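/- For every ε with 0 < ε < 1 there exists t₀(ε) such that for every integer t ≥ t₀(ε), the number of pairs of integers (n,m) with 1 ≤ m < n, exp((log n)^{2/3+ε}) ≤ m ≤ n − exp((log n)^{2/3+ε}), and C(n,m) = t is at most 4. -/

import Mathlib

open Finset

/-- The vector of the first `k` power sums of a finite family of integers. -/
def powerSums (k : ℕ) {ι : Type*} [Fintype ι] (x : ι → ℤ) : Fin k → ℤ :=
  fun r => ∑ i, x i ^ ((r : ℕ) + 1)

theorem prod_X_sub_C_eq_of_psum_eq {R : Type*} [CommRing R] {k : ℕ} (x y : Fin k → R)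
    (hu : ∀ r : ℕ, 1 ≤ r → r ≤ k → IsUnit (r : R))
    (h : ∀ r : ℕ, 1 ≤ r → r ≤ k → ∑ i, x i ^ r = ∑ i, y i ^ r) :
    ∏ i, (Polynomial.X - Polynomial.C (x i)) = ∏ i, (Polynomial.X - Polynomial.C (y i)) := by
  have key : ∀ r : ℕ, r ≤ k → MvPolynomial.aeval x (MvPolynomial.esymm (Fin k) R r) =
      MvPolynomial.aeval y (MvPolynomial.esymm (Fin k) R r) := by
    intro r
    induction r using Nat.strong_induction_on with
    | _ r ih =>
      intro hr
      rcases Nat.eq_zero_or_pos r with rfl | hpos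
      · simp
      · have e := MvPolynomial.mul_esymm_eq_sum (Fin k) R r
        have ex := congrArg (MvPolynomial.aeval x) e
        have ey := congrArg (MvPolynomial.aeval y) e
        simp only [map_mul, map_natCast, map_sum, map_pow, map_neg, map_one] at ex ey
        apply (hu r hpos hr).mul_left_cancel
        rw [ex, ey]
        congr 1
        apply Finset.sum_congr rfl
        intro a ha
        have ha1 := Finset.HasAntidiagonal.mem_antidiagonal.1 (Finset.mem_filter.1 ha).1
        have ha2 := (Finset.mem_filter.1 ha).2
        rw [ih a.1 ha2 (by omega)]
        congr 1
        simp only [MvPolynomial.psum, map_sum, map_pow, MvPolynomial.aeval_X]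
        exact h a.2 (by omega) (by omega)
  have e : ∀ z : Fin k → R, ∏ i, (Polynomial.X - Polynomial.C (z i)) =
      ∑ j ∈ Finset.range (k + 1), (-1) ^ j * (Polynomial.C
        (MvPolynomial.aeval z (MvPolynomial.esymm (Fin k) R j)) * Polynomial.X ^ (k - j)) := by
    intro z
    have := Multiset.prod_X_sub_X_eq_sum_esymm ((Finset.univ : Finset (Fin k)).val.map z)
    simp only [Multiset.map_map, Multiset.card_map, Finset.card_val, Finset.card_univ,
      Fintype.card_fin] at this
    rw [Finset.prod_eq_multiset_prod]
    simp only [Function.comp_def] at this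
    rw [this]
    apply Finset.sum_congr rfl
    intro j _
    rw [MvPolynomial.aeval_esymm_eq_multiset_esymm]
  rw [e, e]
  apply Finset.sum_congr rfl
  intro j hj
  rw [key j (by simp at hj; omega)]

/-- If the power sums of `x` and `y` agree modulo `p ^ k`, and the entries of `y` are distinct
modulo the prime `p > k`, then every entry of `x` is congruent to an entry of `y`. -/
theorem exists_dvd_sub_of_powerSums {p k : ℕ} (hp : p.Prime) (hk : 1 ≤ k) (hkp : k < p)
    (x y : Fin k → ℤ)
    (h : ∀ r : Fin k, ((p : ℤ) ^ k) ∣ powerSums k x r - powerSums k y r)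
    (hy : ∀ i j, i ≠ j → ¬ (p : ℤ) ∣ y i - y j) (i : Fin k) :
    ∃ j, (p : ℤ) ^ k ∣ x i - y j := by
  have hcast : ∀ a : ℤ, ((a : ZMod (p ^ k)) = 0 ↔ (p : ℤ) ^ k ∣ a) := by
    intro a
    rw [ZMod.intCast_zmod_eq_zero_iff_dvd]
    push_cast
    rfl
  have hP := prod_X_sub_C_eq_of_psum_eq (fun i => (x i : ZMod (p ^ k)))
    (fun i => (y i : ZMod (p ^ k)))
    (by
      intro r hr hrk
      rw [ZMod.isUnit_iff_coprime]
      exact Nat.Coprime.pow_right _ (Nat.Coprime.symm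
        ((Nat.Prime.coprime_iff_not_dvd hp).2 (fun hd => by
          have := Nat.le_of_dvd hr hd
          omega))))
    (by
      intro r hr hrk
      have := h ⟨r - 1, by omega⟩
      rw [← hcast] at this
      simp only [powerSums] at this
      rw [Nat.sub_add_cancel hr] at this
      push_cast at this
      exact sub_eq_zero.1 this)
  have hE := congrArg (Polynomial.eval ((x i : ℤ) : ZMod (p ^ k))) hP
  simp only [Polynomial.eval_prod, Polynomial.eval_sub, Polynomial.eval_X,
    Polynomial.eval_C] at hE
  rw [Finset.prod_eq_zero (Finset.mem_univ i) (sub_self _)] at hE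
  have hd : (p : ℤ) ^ k ∣ ∏ j, (x i - y j) := by
    rw [← hcast]
    push_cast
    exact hE.symm
  have hpI : Prime (p : ℤ) := Nat.prime_iff_prime_int.1 hp
  have hd1 : (p : ℤ) ∣ ∏ j, (x i - y j) := (dvd_pow_self _ (by omega)).trans hd
  obtain ⟨j, -, hj⟩ := (hpI.dvd_finsetProd_iff _).1 hd1
  refine ⟨j, ?_⟩
  rw [← Finset.mul_prod_erase _ _ (Finset.mem_univ j)] at hd
  refine IsCoprime.dvd_of_dvd_mul_right ?_ hd
  apply IsCoprime.pow_left
  rw [hpI.coprime_iff_not_dvd, hpI.dvd_finsetProd_iff]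
  rintro ⟨l, hl, hl'⟩
  refine hy j l (fun h => (Finset.ne_of_mem_erase hl) h.symm) ?_
  have := dvd_sub hl' hj
  simpa using this

/-- The number of tuples, distinct modulo `p`, whose translated power sums are prescribed
modulo `p, p ^ 2, …, p ^ k`. -/
theorem card_filter_powerSums_le {p k : ℕ} (hp : p.Prime) (hk : 1 ≤ k) (hkp : k < p)
    (S : Finset ℤ) (hS : ∀ a ∈ S, ∀ b ∈ S, (p : ℤ) ^ k ∣ a - b → a = b) (c : ℤ)
    (y : Fin k → ℤ) :
    ((Fintype.piFinset fun _ : Fin k => S).filter fun x =>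
      (∀ i j, i ≠ j → ¬ (p : ℤ) ∣ x i - x j) ∧
      ∀ r : Fin k, (p : ℤ) ^ ((r : ℕ) + 1) ∣
        powerSums k (fun i => x i - c) r - powerSums k (fun i => y i - c) r).card
      ≤ k ^ k * p ^ (∑ r ∈ Finset.range k, r) := by
  classical
  set A := (Fintype.piFinset fun _ : Fin k => S).filter fun x =>
      (∀ i j, i ≠ j → ¬ (p : ℤ) ∣ x i - x j) ∧
      ∀ r : Fin k, (p : ℤ) ^ ((r : ℕ) + 1) ∣
        powerSums k (fun i => x i - c) r - powerSums k (fun i => y i - c) r with hA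
  let D : (Fin k → ℤ) → Fin k → ℤ := fun x r =>
    powerSums k (fun i => x i - c) r - powerSums k (fun i => y i - c) r
  let g : (Fin k → ℤ) → Fin k → ℤ := fun x r =>
    (D x r / (p : ℤ) ^ ((r : ℕ) + 1)) % (p : ℤ) ^ (k - 1 - (r : ℕ))
  let T : Finset (Fin k → ℤ) :=
    Fintype.piFinset fun r : Fin k => Finset.Ico (0 : ℤ) ((p : ℤ) ^ (k - 1 - (r : ℕ)))
  have hp0 : (0 : ℤ) < p := by exact_mod_cast hp.pos
  have hmaps : ∀ x ∈ A, g x ∈ T := by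
    intro x _
    simp only [T, Fintype.mem_piFinset, Finset.mem_Ico]
    intro r
    exact ⟨Int.emod_nonneg _ (by positivity), Int.emod_lt_of_pos _ (by positivity)⟩
  have hTcard : T.card = p ^ (∑ r ∈ Finset.range k, r) := by
    simp only [T, Fintype.card_piFinset, Int.card_Ico, sub_zero]
    rw [← Finset.prod_pow_eq_pow_sum, ← Finset.prod_range_reflect,
      ← Fin.prod_univ_eq_prod_range (fun r => p ^ (k - 1 - r)) k]
    apply Finset.prod_congr rfl
    intro r _
    rw [show (p : ℤ) ^ (k - 1 - (r : ℕ)) = ((p ^ (k - 1 - (r : ℕ)) : ℕ) : ℤ) by push_cast; rfl]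
    exact Int.toNat_natCast _
  have hfib : ∀ t ∈ T, (A.filter fun x => g x = t).card ≤ k ^ k := by
    intro t _
    rcases (A.filter fun x => g x = t).eq_empty_or_nonempty with he | ⟨x0, hx0⟩
    · rw [he]; simp
    · have hsub : (A.filter fun x => g x = t) ⊆
          (Finset.univ : Finset (Fin k → Fin k)).image (fun σ => x0 ∘ σ) := by
        intro x hx
        rw [Finset.mem_filter] at hx hx0
        have hxA := hx.1
        have hx0A := hx0.1
        rw [hA, Finset.mem_filter] at hxA hx0A
        have hx2 := hxA.2.2
        have hx02 := hx0A.2.2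
        have hcong : ∀ r : Fin k, (p : ℤ) ^ k ∣
            powerSums k (fun i => x i - c) r - powerSums k (fun i => x0 i - c) r := by
          intro r
          obtain ⟨u, hu⟩ := hx2 r
          obtain ⟨v, hv⟩ := hx02 r
          have hg : g x r = g x0 r := by rw [hx.2, hx0.2]
          simp only [g, D] at hg
          have hpr : ((p : ℤ) ^ ((r : ℕ) + 1)) ≠ 0 := by positivity
          rw [hu, hv, Int.mul_ediv_cancel_left _ hpr, Int.mul_ediv_cancel_left _ hpr] at hg
          have hd := Int.ModEq.dvd hg.symm
          have e : powerSums k (fun i => x i - c) r - powerSums k (fun i => x0 i - c) r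
              = (p : ℤ) ^ ((r : ℕ) + 1) * (u - v) := by
            rw [mul_sub, ← hu, ← hv]; ring
          rw [e]
          have hr := r.2
          have e2 : (p : ℤ) ^ k = (p : ℤ) ^ ((r : ℕ) + 1) * (p : ℤ) ^ (k - 1 - (r : ℕ)) := by
            rw [← pow_add]; congr 1; omega
          rw [e2]
          exact mul_dvd_mul_left _ hd
        have hex := exists_dvd_sub_of_powerSums hp hk hkp _ _ hcong (by
          intro i j hij
          have := hx0A.2.1 i j hij
          simpa using this)
        choose σ hσ using hex
        rw [Finset.mem_image]
        refine ⟨σ, Finset.mem_univ _, ?_⟩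
        funext i
        have h1 := hσ i
        have h2 : x i - c - (x0 (σ i) - c) = x i - x0 (σ i) := by ring
        rw [h2] at h1
        exact (hS _ (Fintype.mem_piFinset.1 hxA.1 i) _ (Fintype.mem_piFinset.1 hx0A.1 _) h1).symm
      calc _ ≤ _ := Finset.card_le_card hsub
        _ ≤ _ := Finset.card_image_le
        _ = k ^ k := by simp
  calc A.card ≤ k ^ k * T.card :=
        Finset.card_le_mul_card_image_of_maps_to hmaps _ hfib
    _ = _ := by rw [hTcard]

/-- The number of pairs of elements of `A` with the same image under `φ`. -/
def collisions {ι κ : Type*} [DecidableEq κ] (A : Finset ι) (φ : ι → κ) : ℕ :=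
  ((A ×ˢ A).filter fun z => φ z.1 = φ z.2).card

theorem card_filter_eq_eq_sum {ι ι' κ : Type*} [DecidableEq κ] (A : Finset ι) (B : Finset ι')
    (φ : ι → κ) (ψ : ι' → κ) (I : Finset κ) (hI : ∀ a ∈ A, φ a ∈ I) :
    ((A ×ˢ B).filter fun z => φ z.1 = ψ z.2).card =
      ∑ μ ∈ I, (A.filter fun a => φ a = μ).card * (B.filter fun b => ψ b = μ).card := by
  classical
  rw [Finset.card_eq_sum_card_fiberwise (f := fun z : ι × ι' => φ z.1) (t := I)]
  · apply Finset.sum_congr rfl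
    intro μ _
    rw [← Finset.card_product]
    congr 1
    ext z
    simp only [Finset.mem_filter, Finset.mem_product]
    constructor
    · rintro ⟨⟨⟨h1, h2⟩, h3⟩, h4⟩
      exact ⟨⟨h1, h4⟩, h2, by rw [← h3, h4]⟩
    · rintro ⟨⟨h1, h4⟩, h2, h5⟩
      exact ⟨⟨⟨h1, h2⟩, by rw [h4, h5]⟩, h4⟩
  · intro z hz
    have hz' := Finset.mem_filter.1 (Finset.mem_coe.1 hz)
    exact hI _ (Finset.mem_product.1 hz'.1).1

theorem two_mul_card_filter_eq_le {ι ι' κ : Type*} [DecidableEq κ] (A : Finset ι)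
    (B : Finset ι') (φ : ι → κ) (ψ : ι' → κ) :
    2 * ((A ×ˢ B).filter fun z => φ z.1 = ψ z.2).card ≤ collisions A φ + collisions B ψ := by
  classical
  have hA : ∀ a ∈ A, φ a ∈ A.image φ ∪ B.image ψ := fun a ha =>
    Finset.mem_union_left _ (Finset.mem_image_of_mem _ ha)
  have hB : ∀ a ∈ B, ψ a ∈ A.image φ ∪ B.image ψ := fun a ha =>
    Finset.mem_union_right _ (Finset.mem_image_of_mem _ ha)
  rw [collisions, collisions, card_filter_eq_eq_sum A B φ ψ _ hA,
    card_filter_eq_eq_sum A A φ φ _ hA, card_filter_eq_eq_sum B B ψ ψ _ hB, Finset.mul_sum,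
    ← Finset.sum_add_distrib]
  apply Finset.sum_le_sum
  intro μ _
  have := two_mul_le_add_sq (A.filter fun a => φ a = μ).card (B.filter fun b => ψ b = μ).card
  nlinarith

theorem card_filter_sub_eq_le {ι κ : Type*} [DecidableEq κ] [AddCommGroup κ] (A : Finset ι)
    (φ : ι → κ) (l : κ) :
    ((A ×ˢ A).filter fun z => φ z.1 - φ z.2 = l).card ≤ collisions A φ := by
  have h := two_mul_card_filter_eq_le A A φ (fun a => φ a + l)
  have h2 : collisions A (fun a => φ a + l) = collisions A φ := by
    simp [collisions]
  have h3 : ((A ×ˢ A).filter fun z => φ z.1 - φ z.2 = l) =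
      ((A ×ˢ A).filter fun z => φ z.1 = φ z.2 + l) := by
    apply Finset.filter_congr
    intro z _
    rw [sub_eq_iff_eq_add, add_comm]
  rw [h3]
  omega

theorem collisions_le_two_mul {ι κ : Type*} [DecidableEq ι] [DecidableEq κ] (A : Finset ι)
    (φ : ι → κ) (P : ι → Prop) [DecidablePred P] :
    collisions A φ ≤ 2 * collisions (A.filter P) φ +
      2 * collisions (A.filter fun a => ¬ P a) φ := by
  have h1 := two_mul_card_filter_eq_le (A.filter P) (A.filter fun a => ¬ P a) φ φ
  have h2 := two_mul_card_filter_eq_le (A.filter fun a => ¬ P a) (A.filter P) φ φ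
  have h3 : collisions A φ ≤ collisions (A.filter P) φ + collisions (A.filter fun a => ¬ P a) φ
      + ((A.filter P ×ˢ A.filter fun a => ¬ P a).filter fun z => φ z.1 = φ z.2).card
      + (((A.filter fun a => ¬ P a) ×ˢ A.filter P).filter fun z => φ z.1 = φ z.2).card := by
    unfold collisions
    refine le_trans (Finset.card_le_card ?_) (le_trans (Finset.card_union_le _ _)
      (Nat.add_le_add_right (le_trans (Finset.card_union_le _ _)
      (Nat.add_le_add_right (Finset.card_union_le _ _) _)) _))
    intro z hz
    simp only [Finset.mem_filter, Finset.mem_product, Finset.mem_union] at hz ⊢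
    tauto
  omega

theorem collisions_mono {ι κ : Type*} [DecidableEq κ] {A B : Finset ι} (h : A ⊆ B)
    (φ : ι → κ) : collisions A φ ≤ collisions B φ := by
  unfold collisions
  apply Finset.card_le_card
  intro z hz
  simp only [Finset.mem_filter, Finset.mem_product] at hz ⊢
  exact ⟨⟨h hz.1.1, h hz.1.2⟩, hz.2⟩

theorem collisions_le_of_injOn {ι ι' κ κ' : Type*} [DecidableEq κ] [DecidableEq κ']
    {A : Finset ι} {B : Finset ι'} {φ : ι → κ} {ψ : ι' → κ'} (f : ι → ι')
    (hf : ∀ a ∈ A, f a ∈ B) (hinj : Set.InjOn f A)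
    (h : ∀ a ∈ A, ∀ b ∈ A, φ a = φ b → ψ (f a) = ψ (f b)) :
    collisions A φ ≤ collisions B ψ := by
  unfold collisions
  apply Finset.card_le_card_of_injOn (fun z => (f z.1, f z.2))
  · intro z hz
    have hz := Finset.mem_coe.1 hz
    simp only [Finset.mem_coe, Finset.mem_filter, Finset.mem_product] at hz ⊢
    exact ⟨⟨hf _ hz.1.1, hf _ hz.1.2⟩, h _ hz.1.1 _ hz.1.2 hz.2⟩
  · intro z hz w hw hzw
    have hz := Finset.mem_coe.1 hz
    have hw := Finset.mem_coe.1 hw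
    simp only [Finset.mem_filter, Finset.mem_product] at hz hw
    simp only [Prod.mk.injEq] at hzw
    exact Prod.ext (hinj hz.1.1 hw.1.1 hzw.1) (hinj hz.1.2 hw.1.2 hzw.2)

section Phase

variable {k q : ℕ} [NeZero q]

/-- The additive character of `(ZMod q) ^ k` with frequency `ω`, at an integer vector. -/
noncomputable def phase (ω : Fin k → ZMod q) (l : Fin k → ℤ) : ℂ :=
  ZMod.stdAddChar (∑ r, ω r * (l r : ZMod q))

theorem phase_add (ω : Fin k → ZMod q) (l m : Fin k → ℤ) :
    phase ω (l + m) = phase ω l * phase ω m := by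
  simp only [phase, ← AddChar.map_add_eq_mul, ← Finset.sum_add_distrib, Pi.add_apply,
    Int.cast_add, mul_add]

theorem phase_zero (ω : Fin k → ZMod q) : phase ω 0 = 1 := by
  simp [phase]

theorem phase_neg (ω : Fin k → ZMod q) (l : Fin k → ℤ) :
    phase ω (-l) = (starRingEnd ℂ) (phase ω l) := by
  rw [phase, phase, ← AddChar.map_neg_eq_conj]
  congr 1
  simp

theorem phase_sum {ι : Type*} (ω : Fin k → ZMod q) (s : Finset ι) (l : ι → Fin k → ℤ) :
    phase ω (∑ i ∈ s, l i) = ∏ i ∈ s, phase ω (l i) := by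
  classical
  induction s using Finset.induction_on with
  | empty => simp [phase_zero]
  | insert a s ha ih => rw [Finset.sum_insert ha, Finset.prod_insert ha, phase_add, ih]

theorem sum_phase (l : Fin k → ℤ) :
    ∑ ω : Fin k → ZMod q, phase ω l = if ∀ r, (q : ℤ) ∣ l r then (q : ℂ) ^ k else 0 := by
  have h1 : ∀ ω : Fin k → ZMod q, phase ω l =
      ∏ r, (ZMod.stdAddChar (ω r * (l r : ZMod q)) : ℂ) := by
    intro ω
    exact map_prod (ZMod.stdAddChar (N := q)).toMonoidHom
      (fun r => Multiplicative.ofAdd (ω r * (l r : ZMod q))) _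
  simp only [h1]
  have h2 := Finset.prod_univ_sum (fun _ : Fin k => (Finset.univ : Finset (ZMod q)))
    (fun r a => (ZMod.stdAddChar (a * (l r : ZMod q)) : ℂ))
  rw [Fintype.piFinset_univ] at h2
  rw [← h2]
  have h3 : ∀ r, ∑ a : ZMod q, (ZMod.stdAddChar (a * (l r : ZMod q)) : ℂ) =
      if (q : ℤ) ∣ l r then (q : ℂ) else 0 := by
    intro r
    rw [AddChar.sum_mulShift _ (ZMod.isPrimitive_stdAddChar q)]
    simp [ZMod.intCast_zmod_eq_zero_iff_dvd, ZMod.card]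
  simp only [h3]
  split_ifs with h
  · simp [h]
  · push Not at h
    obtain ⟨r, hr⟩ := h
    exact Finset.prod_eq_zero (Finset.mem_univ r) (by simp [hr])

theorem sum_norm_sq_phase {ι : Type*} (A : Finset ι) (φ : ι → Fin k → ℤ)
    (h : ∀ a ∈ A, ∀ b ∈ A, (∀ r, (q : ℤ) ∣ φ a r - φ b r) → φ a = φ b) :
    ∑ ω : Fin k → ZMod q, ‖∑ a ∈ A, phase ω (φ a)‖ ^ 2 = (q : ℝ) ^ k * collisions A φ := by
  have h1 : ∀ ω : Fin k → ZMod q, ((‖∑ a ∈ A, phase ω (φ a)‖ ^ 2 : ℝ) : ℂ) =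
      ∑ z ∈ A ×ˢ A, phase ω (φ z.1 - φ z.2) := by
    intro ω
    push_cast
    rw [← Complex.mul_conj', map_sum, Finset.sum_mul_sum, ← Finset.sum_product']
    apply Finset.sum_congr rfl
    intro z _
    rw [sub_eq_add_neg, phase_add, phase_neg]
  have h2 : ((∑ ω : Fin k → ZMod q, ‖∑ a ∈ A, phase ω (φ a)‖ ^ 2 : ℝ) : ℂ) =
      (((q : ℝ) ^ k * collisions A φ : ℝ) : ℂ) := by
    rw [Complex.ofReal_sum, Finset.sum_congr rfl (fun ω _ => h1 ω), Finset.sum_comm]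
    simp only [sum_phase]
    rw [← Finset.sum_filter, Finset.sum_const, nsmul_eq_mul, mul_comm]
    push_cast
    congr 2
    unfold collisions
    congr 1
    apply Finset.filter_congr
    intro z hz
    rw [Finset.mem_product] at hz
    constructor
    · exact h _ hz.1 _ hz.2
    · intro e
      simp [e]
  exact_mod_cast h2

end Phase

theorem eventually_eq_of_dvd {ι : Type*} {k : ℕ} (A : Finset ι) (φ : ι → Fin k → ℤ) :
    ∀ᶠ q : ℕ in Filter.atTop, ∀ a ∈ A, ∀ b ∈ A,
      (∀ r, (q : ℤ) ∣ φ a r - φ b r) → φ a = φ b := by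
  rw [Filter.eventually_all_finset]
  intro a _
  rw [Filter.eventually_all_finset]
  intro b _
  have : ∀ᶠ q : ℕ in Filter.atTop, ∀ r, |φ a r - φ b r| < q := by
    rw [Filter.eventually_all]
    intro r
    filter_upwards [Filter.eventually_gt_atTop (φ a r - φ b r).natAbs] with q hq
    rw [Int.abs_eq_natAbs]
    exact_mod_cast hq
  filter_upwards [this] with q hq hd
  funext r
  have := Int.eq_zero_of_abs_lt_dvd (hd r) (hq r)
  linarith

theorem powerSums_eq_sum (k : ℕ) {ι : Type*} [Fintype ι] (x : ι → ℤ) :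
    powerSums k x = ∑ i, fun r : Fin k => x i ^ ((r : ℕ) + 1) := by
  funext r
  simp [powerSums]

theorem sum_piFinset_phase_powerSums {k q : ℕ} [NeZero q] (ω : Fin k → ZMod q) {ι : Type*}
    [Fintype ι] [DecidableEq ι] (S : ι → Finset ℤ) :
    ∑ v ∈ Fintype.piFinset S, phase ω (powerSums k v) =
      ∏ i, ∑ x ∈ S i, phase ω (fun r : Fin k => x ^ ((r : ℕ) + 1)) := by
  rw [Finset.prod_univ_sum]
  apply Finset.sum_congr rfl
  intro v _
  rw [powerSums_eq_sum, phase_sum]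

theorem sum_product_phase {k q : ℕ} [NeZero q] (ω : Fin k → ZMod q) {ι : Type*} (A : Finset ι)
    (φ : ι → Fin k → ℤ) (S : Finset ℤ) (b : ℕ) :
    ∑ z ∈ A ×ˢ (Fintype.piFinset fun _ : Fin b => S), phase ω (φ z.1 + powerSums k z.2) =
      (∑ a ∈ A, phase ω (φ a)) *
        (∑ x ∈ S, phase ω (fun r : Fin k => x ^ ((r : ℕ) + 1))) ^ b := by
  rw [Finset.sum_product]
  simp only [phase_add, ← Finset.mul_sum]
  rw [← Finset.sum_mul, sum_piFinset_phase_powerSums]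
  simp

theorem collisions_add_powerSums_le_of_classes {ι γ : Type*} [DecidableEq γ] {k b M : ℕ}
    (hb : 1 ≤ b) (A : Finset ι) (φ : ι → Fin k → ℤ) (S : Finset ℤ) (C : Finset γ) (cl : ℤ → γ)
    (hcl : ∀ x ∈ S, cl x ∈ C)
    (hM : ∀ c ∈ C, collisions (A ×ˢ (Fintype.piFinset fun _ : Fin b => S.filter fun x => cl x = c))
      (fun z => φ z.1 + powerSums k z.2) ≤ M) :
    collisions (A ×ˢ (Fintype.piFinset fun _ : Fin b => S))
      (fun z => φ z.1 + powerSums k z.2) ≤ C.card ^ (2 * b) * M := by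
  classical
  obtain ⟨q, hq, hqc, hq0⟩ := ((eventually_eq_of_dvd
    (A ×ˢ (Fintype.piFinset fun _ : Fin b => S)) (fun z => φ z.1 + powerSums k z.2)).and
    (((Filter.eventually_all_finset C).2 fun c _ => eventually_eq_of_dvd
      (A ×ˢ (Fintype.piFinset fun _ : Fin b => S.filter fun x => cl x = c))
      (fun z => φ z.1 + powerSums k z.2)).and (Filter.eventually_gt_atTop 0))).exists
  have : NeZero q := ⟨hq0.ne'⟩
  have e := sum_norm_sq_phase _ _ hq
  let f : γ → (Fin k → ZMod q) → ℂ := fun c ω =>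
    ∑ x ∈ S.filter (fun x => cl x = c), phase ω (fun r : Fin k => x ^ ((r : ℕ) + 1))
  have hfsum : ∀ ω, ∑ x ∈ S, phase ω (fun r : Fin k => x ^ ((r : ℕ) + 1)) = ∑ c ∈ C, f c ω := by
    intro ω
    exact (Finset.sum_fiberwise_of_maps_to hcl _).symm
  have hpow : ∀ ω, ‖∑ c ∈ C, f c ω‖ ^ (2 * b) ≤
      (C.card : ℝ) ^ (2 * b - 1) * ∑ c ∈ C, ‖f c ω‖ ^ (2 * b) := by
    intro ω
    have h2 : ‖∑ c ∈ C, f c ω‖ ^ (2 * b) ≤ (∑ c ∈ C, ‖f c ω‖) ^ (2 * b) := by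
      gcongr
      exact norm_sum_le _ _
    refine h2.trans ?_
    obtain ⟨m, hm⟩ : ∃ m, 2 * b = m + 1 := ⟨2 * b - 1, by omega⟩
    rw [hm]
    rw [Nat.add_sub_cancel]
    exact pow_sum_le_card_mul_sum_pow (fun _ _ => norm_nonneg _) m
  have hbound : (q : ℝ) ^ k * (collisions (A ×ˢ (Fintype.piFinset fun _ : Fin b => S))
      (fun z => φ z.1 + powerSums k z.2) : ℝ) ≤
      (q : ℝ) ^ k * ((C.card : ℝ) ^ (2 * b) * M) := by
    rw [← e]
    calc ∑ ω : Fin k → ZMod q, ‖∑ z ∈ A ×ˢ (Fintype.piFinset fun _ : Fin b => S),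
            phase ω (φ z.1 + powerSums k z.2)‖ ^ 2
        ≤ ∑ ω : Fin k → ZMod q, (C.card : ℝ) ^ (2 * b - 1) * ∑ c ∈ C,
            ‖∑ z ∈ A ×ˢ (Fintype.piFinset fun _ : Fin b => S.filter fun x => cl x = c),
              phase ω (φ z.1 + powerSums k z.2)‖ ^ 2 := by
          apply Finset.sum_le_sum
          intro ω _
          simp only [sum_product_phase, norm_mul, norm_pow, mul_pow]
          rw [hfsum, ← pow_mul, mul_comm b 2, ← Finset.mul_sum, mul_left_comm]
          refine mul_le_mul_of_nonneg_left ?_ (by positivity)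
          refine (hpow ω).trans (le_of_eq ?_)
          congr 1
          apply Finset.sum_congr rfl
          intro c _
          rw [← pow_mul, mul_comm b 2]
      _ = (C.card : ℝ) ^ (2 * b - 1) * ∑ c ∈ C, (q : ℝ) ^ k * (collisions
            (A ×ˢ (Fintype.piFinset fun _ : Fin b => S.filter fun x => cl x = c))
            (fun z => φ z.1 + powerSums k z.2) : ℝ) := by
          rw [← Finset.mul_sum, Finset.sum_comm]
          congr 1
          apply Finset.sum_congr rfl
          intro c hc
          exact sum_norm_sq_phase _ _ (hqc c hc)
      _ ≤ (C.card : ℝ) ^ (2 * b - 1) * ∑ c ∈ C, (q : ℝ) ^ k * M := by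
          gcongr with c hc
          exact hM c hc
      _ = (q : ℝ) ^ k * ((C.card : ℝ) ^ (2 * b) * M) := by
          rw [Finset.sum_const, nsmul_eq_mul]
          obtain ⟨m, hm⟩ : ∃ m, 2 * b = m + 1 := ⟨2 * b - 1, by omega⟩
          rw [hm, pow_succ, Nat.add_sub_cancel]
          ring
  have := le_of_mul_le_mul_left hbound (by positivity)
  exact_mod_cast this

/-- Tuples whose classes follow one of few patterns have few power sum collisions. -/
theorem collisions_filter_classes_le {γ : Type*} [DecidableEq γ] {k s M : ℕ}
    (S : Finset ℤ) (C : Finset γ) (cl : ℤ → γ) (P : Finset (Fin s → γ))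
    (hP : ∀ π ∈ P, ∀ i, π i ∈ C)
    (hM : ∀ c ∈ C, collisions (Fintype.piFinset fun _ : Fin s => S.filter fun x => cl x = c)
      (powerSums k) ≤ M) (hs : 1 ≤ s) :
    collisions ((Fintype.piFinset fun _ : Fin s => S).filter fun v => (fun i => cl (v i)) ∈ P)
      (powerSums k) ≤ P.card ^ 2 * (s * M) := by
  classical
  obtain ⟨q, hq, hqc, hq0⟩ := ((eventually_eq_of_dvd
    ((Fintype.piFinset fun _ : Fin s => S).filter fun v => (fun i => cl (v i)) ∈ P)
      (powerSums k)).and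
    (((Filter.eventually_all_finset C).2 fun c _ => eventually_eq_of_dvd
      (Fintype.piFinset fun _ : Fin s => S.filter fun x => cl x = c)
      (powerSums k)).and (Filter.eventually_gt_atTop 0))).exists
  have : NeZero q := ⟨hq0.ne'⟩
  have e := sum_norm_sq_phase _ _ hq
  let f : γ → (Fin k → ZMod q) → ℂ := fun c ω =>
    ∑ x ∈ S.filter (fun x => cl x = c), phase ω (fun r : Fin k => x ^ ((r : ℕ) + 1))
  have hf : ∀ c ∈ C, ∑ ω, ‖f c ω‖ ^ (2 * s) ≤ (q : ℝ) ^ k * M := by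
    intro c hc
    have := sum_norm_sq_phase _ _ (hqc c hc)
    simp only [sum_piFinset_phase_powerSums, Finset.prod_const, Finset.card_univ,
      Fintype.card_fin, norm_pow, ← pow_mul, mul_comm s 2] at this
    refine this.trans_le ?_
    gcongr
    exact hM c hc
  have hsplit : ∀ ω : Fin k → ZMod q,
      ∑ v ∈ (Fintype.piFinset fun _ : Fin s => S).filter (fun v => (fun i => cl (v i)) ∈ P),
        phase ω (powerSums k v) = ∑ π ∈ P, ∏ i, f (π i) ω := by
    intro ω
    rw [← Finset.sum_fiberwise_of_maps_to (g := fun v : Fin s → ℤ => fun i => cl (v i)) (t := P)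
      (fun v hv => (Finset.mem_filter.1 hv).2)]
    apply Finset.sum_congr rfl
    intro π hπ
    simp only [f]
    rw [← sum_piFinset_phase_powerSums]
    apply Finset.sum_congr _ (fun _ _ => rfl)
    ext v
    simp only [Finset.mem_filter, Fintype.mem_piFinset]
    constructor
    · rintro ⟨⟨h1, _⟩, h3⟩ i
      exact ⟨h1 i, by rw [← h3]⟩
    · intro h
      have : (fun i => cl (v i)) = π := funext fun i => (h i).2
      exact ⟨⟨fun i => (h i).1, this ▸ hπ⟩, this⟩
  have hprod : ∀ (π : Fin s → γ) (ω : Fin k → ZMod q),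
      ‖∏ i, f (π i) ω‖ ^ 2 ≤ ∑ i, ‖f (π i) ω‖ ^ (2 * s) := by
    intro π ω
    have : Nonempty (Fin s) := ⟨⟨0, hs⟩⟩
    obtain ⟨i0, _, hi0⟩ := Finset.exists_max_image (Finset.univ : Finset (Fin s))
      (fun i => ‖f (π i) ω‖) Finset.univ_nonempty
    calc ‖∏ i, f (π i) ω‖ ^ 2 ≤ (‖f (π i0) ω‖ ^ s) ^ 2 := by
          gcongr
          rw [norm_prod]
          refine (Finset.prod_le_prod (fun _ _ => norm_nonneg _) hi0).trans ?_
          simp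
      _ = ‖f (π i0) ω‖ ^ (2 * s) := by rw [← pow_mul, mul_comm]
      _ ≤ _ := Finset.single_le_sum (f := fun i => ‖f (π i) ω‖ ^ (2 * s))
          (fun _ _ => by positivity) (Finset.mem_univ i0)
  have hbound : (q : ℝ) ^ k * (collisions ((Fintype.piFinset fun _ : Fin s => S).filter
      fun v => (fun i => cl (v i)) ∈ P) (powerSums k) : ℝ) ≤
      (q : ℝ) ^ k * ((P.card : ℝ) ^ 2 * (s * M)) := by
    rw [← e]
    calc _ ≤ ∑ ω : Fin k → ZMod q, (P.card : ℝ) * ∑ π ∈ P, ∑ i, ‖f (π i) ω‖ ^ (2 * s) := by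
          apply Finset.sum_le_sum
          intro ω _
          rw [hsplit]
          calc ‖∑ π ∈ P, ∏ i, f (π i) ω‖ ^ 2 ≤ (∑ π ∈ P, ‖∏ i, f (π i) ω‖) ^ 2 := by
                gcongr
                exact norm_sum_le _ _
            _ ≤ (P.card : ℝ) * ∑ π ∈ P, ‖∏ i, f (π i) ω‖ ^ 2 := sq_sum_le_card_mul_sum_sq
            _ ≤ _ := by
                gcongr with π _
                exact hprod π ω
      _ = (P.card : ℝ) * ∑ π ∈ P, ∑ i, ∑ ω : Fin k → ZMod q, ‖f (π i) ω‖ ^ (2 * s) := by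
          rw [← Finset.mul_sum, Finset.sum_comm]
          congr 1
          apply Finset.sum_congr rfl
          intro π _
          rw [Finset.sum_comm]
      _ ≤ (P.card : ℝ) * ∑ π ∈ P, ∑ i : Fin s, (q : ℝ) ^ k * M := by
          gcongr with π hπ i _
          exact hf _ (hP π hπ i)
      _ = _ := by
          simp only [Finset.sum_const, nsmul_eq_mul, Finset.card_univ, Fintype.card_fin]
          ring
  have := le_of_mul_le_mul_left hbound (by positivity)
  exact_mod_cast this

/-- The number of solutions in `S` of the Vinogradov system of degree `k` in `2 * b` variables. -/
def meanValue (b k : ℕ) (S : Finset ℤ) : ℕ :=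
  collisions (Fintype.piFinset fun _ : Fin b => S) (powerSums k)

theorem collisions_biUnion_le {ι κ τ : Type*} [DecidableEq ι] [DecidableEq κ] (T : Finset τ)
    (A : τ → Finset ι) (φ : ι → κ) (M : ℕ) (h : ∀ t ∈ T, collisions (A t) φ ≤ M) :
    collisions (T.biUnion A) φ ≤ T.card ^ 2 * M := by
  calc collisions (T.biUnion A) φ
      ≤ ((T ×ˢ T).biUnion fun t => (A t.1 ×ˢ A t.2).filter fun z => φ z.1 = φ z.2).card := by
        apply Finset.card_le_card
        intro z hz
        simp only [Finset.mem_filter, Finset.mem_product, Finset.mem_biUnion] at hz ⊢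
        obtain ⟨⟨⟨t, ht, h1⟩, t', ht', h2⟩, h3⟩ := hz
        exact ⟨(t, t'), ⟨ht, ht'⟩, ⟨h1, h2⟩, h3⟩
    _ ≤ (T ×ˢ T).card * M := by
        apply Finset.card_biUnion_le_card_mul
        intro t ht
        rw [Finset.mem_product] at ht
        have h1 := two_mul_card_filter_eq_le (A t.1) (A t.2) φ φ
        have h2 := h _ ht.1
        have h3 := h _ ht.2
        omega
    _ = _ := by rw [Finset.card_product, sq]

theorem collisions_product_le {ι ι' κ : Type*} [DecidableEq ι] [DecidableEq ι'] [DecidableEq κ]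
    [AddCommGroup κ] (A : Finset ι) (B : Finset ι') (φ : ι → κ) (ψ : ι' → κ)
    (Q : Finset (ι × ι))
    (hQ : ∀ a ∈ A, ∀ a' ∈ A, ∀ b ∈ B, ∀ b' ∈ B, φ a + ψ b = φ a' + ψ b' → (a, a') ∈ Q) :
    collisions (A ×ˢ B) (fun z => φ z.1 + ψ z.2) ≤ Q.card * collisions B ψ := by
  rw [mul_comm]
  refine Finset.card_le_mul_card_image_of_maps_to
    (f := fun z : (ι × ι') × (ι × ι') => (z.1.1, z.2.1)) ?_ _ ?_
  · intro z hz
    simp only [Finset.mem_filter, Finset.mem_product] at hz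
    exact hQ _ hz.1.1.1 _ hz.1.2.1 _ hz.1.1.2 _ hz.1.2.2 hz.2
  · rintro ⟨a, a'⟩ _
    refine le_trans ?_ (card_filter_sub_eq_le B ψ (φ a' - φ a))
    apply Finset.card_le_card_of_injOn (fun z => (z.1.2, z.2.2))
    · intro z hz
      have hz := Finset.mem_coe.1 hz
      simp only [Finset.mem_coe, Finset.mem_filter, Finset.mem_product, Prod.mk.injEq] at hz ⊢
      obtain ⟨⟨⟨⟨h1, h2⟩, h3, h4⟩, h5⟩, rfl, rfl⟩ := hz
      refine ⟨⟨h2, h4⟩, ?_⟩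
      rw [sub_eq_sub_iff_add_eq_add, add_comm, h5, add_comm]
    · intro z hz w hw hzw
      have hz := Finset.mem_coe.1 hz
      have hw := Finset.mem_coe.1 hw
      simp only [Finset.mem_filter, Prod.mk.injEq] at hz hw hzw
      ext
      · simp [hz.2.1, hw.2.1]
      · simp [hzw.1]
      · simp [hz.2.2, hw.2.2]
      · simp [hzw.2]

theorem powerSums_sub_const {k : ℕ} {ι : Type*} [Fintype ι] {x y : ι → ℤ}
    (h : powerSums k x = powerSums k y) (c : ℤ) :
    powerSums k (fun i => x i - c) = powerSums k (fun i => y i - c) := by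
  have h0 : ∀ j ≤ k, ∑ i, x i ^ j = ∑ i, y i ^ j := by
    intro j hj
    rcases Nat.eq_zero_or_pos j with rfl | hpos
    · simp
    · have := congrFun h ⟨j - 1, by omega⟩
      simpa [powerSums, Nat.sub_add_cancel hpos] using this
  funext r
  simp only [powerSums, sub_eq_add_neg, add_pow]
  rw [Finset.sum_comm, Finset.sum_comm (s := Finset.univ)]
  apply Finset.sum_congr rfl
  intro j hj
  rw [← Finset.sum_mul, ← Finset.sum_mul, ← Finset.sum_mul, ← Finset.sum_mul, h0 j]
  have := r.2
  have := Finset.mem_range.1 hj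
  omega

theorem powerSums_elim {k : ℕ} {ι ι' : Type*} [Fintype ι] [Fintype ι'] (x : ι → ℤ)
    (y : ι' → ℤ) : powerSums k (Sum.elim x y) = powerSums k x + powerSums k y := by
  funext r
  simp [powerSums]

theorem powerSums_comp_equiv {k : ℕ} {ι ι' : Type*} [Fintype ι] [Fintype ι'] (e : ι ≃ ι')
    (x : ι' → ℤ) : powerSums k (x ∘ e) = powerSums k x := by
  funext r
  exact Equiv.sum_comp e (fun i => x i ^ ((r : ℕ) + 1))

theorem meanValue_filter_emod_le (b k X p : ℕ) (hp : 0 < p) (c : ℤ) :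
    meanValue b k ((Finset.Icc 1 (X : ℤ)).filter fun x => x % p = c) ≤
      meanValue b k (Finset.Icc 1 ((X / p + 1 : ℕ) : ℤ)) := by
  have hp' : (0 : ℤ) < p := by exact_mod_cast hp
  have hx : ∀ x ∈ Fintype.piFinset (fun _ : Fin b => (Finset.Icc 1 (X : ℤ)).filter
      fun x => x % p = c), ∀ i, x i - c = p * (x i / p) := by
    intro x hx i
    have h1 := (Finset.mem_filter.1 (Fintype.mem_piFinset.1 hx i)).2
    have h2 := Int.emod_add_mul_ediv (x i) p
    linarith
  apply collisions_le_of_injOn (fun x : Fin b → ℤ => fun i => x i / p + 1)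
  · intro x hx
    rw [Fintype.mem_piFinset] at hx ⊢
    intro i
    have h1 := Finset.mem_Icc.1 (Finset.mem_filter.1 (hx i)).1
    have h2 := Int.ediv_nonneg (a := x i) (b := p) (by omega) (by omega)
    have h3 := Int.ediv_le_ediv hp' h1.2
    rw [Finset.mem_Icc]
    push_cast
    omega
  · intro x h y h' hxy
    funext i
    have h1 := hx x h i
    have h2 := hx y h' i
    have h3 := congrFun hxy i
    simp only [add_left_inj] at h3
    rw [h3] at h1
    linarith
  · intro x h y h' hxy
    have h1 := powerSums_sub_const hxy c
    have h2 : powerSums k (fun i => x i / p) = powerSums k (fun i => y i / p) := by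
      funext r
      have h3 := congrFun h1 r
      simp only [powerSums, hx x h, hx y h', mul_pow, ← Finset.mul_sum] at h3
      exact mul_left_cancel₀ (by positivity) h3
    have h3 := powerSums_sub_const h2 (-1)
    simpa using h3

theorem collisions_elim_le {k b s : ℕ} (S : Finset ℤ) (e : Fin k ⊕ Fin b ≃ Fin s)
    (A : Finset (Fin s → ℤ)) (G : Finset (Fin k → ℤ))
    (hA : ∀ x ∈ A, (∀ i, x i ∈ S) ∧ (fun i => x (e (Sum.inl i))) ∈ G) :
    collisions A (powerSums k) ≤ collisions (G ×ˢ (Fintype.piFinset fun _ : Fin b => S))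
      (fun z => powerSums k z.1 + powerSums k z.2) := by
  apply collisions_le_of_injOn
    (fun x : Fin s → ℤ => ((fun i => x (e (Sum.inl i))), (fun i => x (e (Sum.inr i)))))
  · intro x hx
    rw [Finset.mem_product, Fintype.mem_piFinset]
    exact ⟨(hA x hx).2, fun i => (hA x hx).1 _⟩
  · intro x _ y _ hxy
    simp only [Prod.mk.injEq] at hxy
    funext i
    obtain ⟨j, rfl⟩ := e.surjective i
    rcases j with j | j
    · exact congrFun hxy.1 j
    · exact congrFun hxy.2 j
  · have key : ∀ x : Fin s → ℤ, powerSums k (fun i => x (e (Sum.inl i))) +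
        powerSums k (fun i => x (e (Sum.inr i))) = powerSums k x := by
      intro x
      rw [← powerSums_elim, ← powerSums_comp_equiv e x]
      congr 1
      funext i
      rcases i with i | i <;> rfl
    intro x _ y _ hxy
    simp only [key, hxy]

theorem meanValue_add_le (b k : ℕ) (S : Finset ℤ) :
    meanValue (k + b) k S ≤ S.card ^ (2 * k) * meanValue b k S := by
  classical
  refine (collisions_elim_le S finSumFinEquiv _ (Fintype.piFinset fun _ : Fin k => S)
    ?_).trans ?_
  · intro x hx
    rw [Fintype.mem_piFinset] at hx ⊢
    exact ⟨hx, fun i => hx _⟩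
  · refine (collisions_product_le _ _ _ _ ((Fintype.piFinset fun _ : Fin k => S) ×ˢ
      (Fintype.piFinset fun _ : Fin k => S)) ?_).trans ?_
    · intro a ha a' ha' _ _ _ _ _
      exact Finset.mem_product.2 ⟨ha, ha'⟩
    · apply le_of_eq
      simp [meanValue, two_mul, pow_add]

theorem exists_equiv_sum_extending {k b s : ℕ} (hs : k + b = s) (T : Fin k → Fin s)
    (hT : Function.Injective T) : ∃ e : Fin k ⊕ Fin b ≃ Fin s, ∀ i, e (Sum.inl i) = T i := by
  classical
  have hc : Fintype.card (Fin b) = Fintype.card ((Set.range T)ᶜ : Set (Fin s)) := by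
    rw [Fintype.card_compl_set, Set.card_range_of_injective hT]
    simp only [Fintype.card_fin]
    omega
  refine ⟨(Equiv.sumCongr (Equiv.ofInjective T hT) (Fintype.equivOfCardEq hc)).trans
    (Equiv.Set.sumCompl (Set.range T)), fun i => ?_⟩
  simp

theorem collisions_distinct_mod_le {p k b X : ℕ} (hp : p.Prime) (hk : 1 ≤ k) (hkp : k < p)
    (hX : X ≤ p ^ k) (c : ℤ) :
    collisions (((Fintype.piFinset fun _ : Fin k => Finset.Icc 1 (X : ℤ)).filter fun x =>
        ∀ i j, i ≠ j → ¬ (p : ℤ) ∣ x i - x j) ×ˢ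
        (Fintype.piFinset fun _ : Fin b => (Finset.Icc 1 (X : ℤ)).filter fun x => x % p = c))
      (fun z => powerSums k z.1 + powerSums k z.2) ≤
    (X ^ k * (k ^ k * p ^ (∑ r ∈ Finset.range k, r))) *
      meanValue b k ((Finset.Icc 1 (X : ℤ)).filter fun x => x % p = c) := by
  classical
  set S := Finset.Icc 1 (X : ℤ) with hS
  set G := (Fintype.piFinset fun _ : Fin k => S).filter fun x : Fin k → ℤ =>
        ∀ i j, i ≠ j → ¬ (p : ℤ) ∣ x i - x j with hG
  have hSd : ∀ a ∈ S, ∀ b ∈ S, (p : ℤ) ^ k ∣ a - b → a = b := by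
    intro a ha b hb hd
    rw [hS, Finset.mem_Icc] at ha hb
    have hX' : (X : ℤ) ≤ (p : ℤ) ^ k := by exact_mod_cast hX
    have := Int.eq_zero_of_abs_lt_dvd hd (by rw [abs_lt]; constructor <;> linarith)
    linarith
  let Q := (Fintype.piFinset fun _ : Fin k => S).biUnion fun y =>
    (((Fintype.piFinset fun _ : Fin k => S).filter fun x : Fin k → ℤ =>
      (∀ i j, i ≠ j → ¬ (p : ℤ) ∣ x i - x j) ∧
      ∀ r : Fin k, (p : ℤ) ^ ((r : ℕ) + 1) ∣
        powerSums k (fun i => x i - c) r - powerSums k (fun i => y i - c) r).image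
      fun x => (x, y))
  have hQc : Q.card ≤ X ^ k * (k ^ k * p ^ (∑ r ∈ Finset.range k, r)) := by
    have h1 : (Fintype.piFinset fun _ : Fin k => S).card = X ^ k := by
      simp [hS]
    rw [← h1]
    apply Finset.card_biUnion_le_card_mul
    intro y _
    exact Finset.card_image_le.trans (card_filter_powerSums_le hp hk hkp S hSd c y)
  refine (collisions_product_le _ _ _ _ Q ?_).trans (Nat.mul_le_mul_right _ hQc)
  intro x hx y hy v hv w hw he
  rw [hG, Finset.mem_filter] at hx hy
  rw [Finset.mem_biUnion]
  refine ⟨y, hy.1, Finset.mem_image.2 ⟨x, Finset.mem_filter.2 ⟨hx.1, hx.2, ?_⟩, rfl⟩⟩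
  intro r
  rw [← powerSums_elim, ← powerSums_elim] at he
  have h1 := powerSums_sub_const he c
  have h2 : ∀ (x : Fin k → ℤ) (v : Fin b → ℤ), (fun i => Sum.elim x v i - c) =
      Sum.elim (fun i => x i - c) (fun i => v i - c) := by
    intro x v
    funext i
    rcases i with i | i <;> rfl
  rw [h2, h2, powerSums_elim, powerSums_elim] at h1
  have h3 := congrFun h1 r
  simp only [Pi.add_apply] at h3
  have h4 : ∀ v ∈ Fintype.piFinset (fun _ : Fin b => S.filter fun x => x % p = c),
      (p : ℤ) ^ ((r : ℕ) + 1) ∣ powerSums k (fun i => v i - c) r := by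
    intro v hv
    apply Finset.dvd_sum
    intro i _
    apply pow_dvd_pow_of_dvd
    have := (Finset.mem_filter.1 (Fintype.mem_piFinset.1 hv i)).2
    rw [← this]
    exact Int.dvd_self_sub_emod
  have h5 : powerSums k (fun i => x i - c) r - powerSums k (fun i => y i - c) r =
      powerSums k (fun i => w i - c) r - powerSums k (fun i => v i - c) r := by linarith
  rw [h5]
  exact dvd_sub (h4 w hw) (h4 v hv)

theorem meanValue_recursion {p k b X : ℕ} (hp : p.Prime) (hk : 2 ≤ k) (hkp : k < p)
    (hX : X ≤ p ^ k) (hb : 1 ≤ b) :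
    meanValue (k + b) k (Finset.Icc 1 (X : ℤ)) ≤
      2 * (((k + b) ^ k) ^ 2 * (p ^ (2 * b) * (X ^ k * (k ^ k * p ^ (∑ r ∈ Finset.range k, r)) *
        meanValue b k (Finset.Icc 1 ((X / p + 1 : ℕ) : ℤ))))) +
      2 * ((p ^ (k - 1) * (k - 1) ^ (k + b)) ^ 2 * ((k + b) * ((X / p + 1) ^ (2 * k) *
        meanValue b k (Finset.Icc 1 ((X / p + 1 : ℕ) : ℤ))))) := by
  classical
  set S := Finset.Icc 1 (X : ℤ) with hS
  set J := meanValue b k (Finset.Icc 1 ((X / p + 1 : ℕ) : ℤ)) with hJ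
  have hp' : (0 : ℤ) < p := by exact_mod_cast hp.pos
  set C := Finset.Ico (0 : ℤ) p with hC
  have hCc : C.card = p := by simp [hC]
  have hcl : ∀ x ∈ S, x % p ∈ C := fun x _ =>
    Finset.mem_Ico.2 ⟨Int.emod_nonneg _ hp'.ne', Int.emod_lt_of_pos _ hp'⟩
  let Good : (Fin (k + b) → ℤ) → Prop := fun x =>
    ∃ T : Fin k → Fin (k + b), ∀ i j, i ≠ j → ¬ (p : ℤ) ∣ x (T i) - x (T j)
  refine (collisions_le_two_mul _ _ Good).trans (Nat.add_le_add
    (Nat.mul_le_mul_left 2 ?_) (Nat.mul_le_mul_left 2 ?_))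
  · have hcover : (Fintype.piFinset fun _ : Fin (k + b) => S).filter Good ⊆
        (Finset.univ : Finset (Fin k → Fin (k + b))).biUnion fun T =>
          (Fintype.piFinset fun _ : Fin (k + b) => S).filter fun x =>
            ∀ i j, i ≠ j → ¬ (p : ℤ) ∣ x (T i) - x (T j) := by
      intro x hx
      obtain ⟨h1, T, hT⟩ := Finset.mem_filter.1 hx
      exact Finset.mem_biUnion.2 ⟨T, Finset.mem_univ _, Finset.mem_filter.2 ⟨h1, hT⟩⟩
    refine (collisions_mono hcover _).trans ?_
    have hcard : (Finset.univ : Finset (Fin k → Fin (k + b))).card = (k + b) ^ k := by simp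
    rw [← hcard]
    apply collisions_biUnion_le
    intro T _
    by_cases hT : Function.Injective T
    · obtain ⟨e, he⟩ := exists_equiv_sum_extending rfl T hT
      refine (collisions_elim_le S e _ ((Fintype.piFinset fun _ : Fin k => S).filter fun x =>
        ∀ i j, i ≠ j → ¬ (p : ℤ) ∣ x i - x j) ?_).trans ?_
      · intro x hx
        obtain ⟨h1, h2⟩ := Finset.mem_filter.1 hx
        rw [Fintype.mem_piFinset] at h1
        refine ⟨h1, Finset.mem_filter.2 ⟨Fintype.mem_piFinset.2 fun i => h1 _, ?_⟩⟩
        simpa only [he] using h2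
      · have h3 := collisions_add_powerSums_le_of_classes hb
          ((Fintype.piFinset fun _ : Fin k => S).filter fun x : Fin k → ℤ =>
            ∀ i j, i ≠ j → ¬ (p : ℤ) ∣ x i - x j) (powerSums k) S C (fun x => x % p) hcl
          (M := X ^ k * (k ^ k * p ^ (∑ r ∈ Finset.range k, r)) * J) (by
            intro c _
            refine (collisions_distinct_mod_le hp (by omega) hkp hX c).trans ?_
            exact Nat.mul_le_mul_left _ (meanValue_filter_emod_le b k X p hp.pos c))
        rwa [hCc] at h3
    · have hempty : ((Fintype.piFinset fun _ : Fin (k + b) => S).filter fun x =>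
            ∀ i j, i ≠ j → ¬ (p : ℤ) ∣ x (T i) - x (T j)) = ∅ := by
        rw [Finset.filter_eq_empty_iff]
        intro x _ hx
        rw [Function.Injective] at hT
        push Not at hT
        obtain ⟨i, j, hij, hne⟩ := hT
        exact hx i j hne (by simp [hij])
      rw [hempty]
      simp [collisions]
  · let P : Finset (Fin (k + b) → ℤ) :=
      ((Fintype.piFinset fun _ : Fin (k - 1) => C) ×ˢ
        (Finset.univ : Finset (Fin (k + b) → Fin (k - 1)))).image fun z => z.1 ∘ z.2
    have hPc : P.card ≤ p ^ (k - 1) * (k - 1) ^ (k + b) := by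
      refine Finset.card_image_le.trans (le_of_eq ?_)
      simp [hCc]
    have hPC : ∀ π ∈ P, ∀ i, π i ∈ C := by
      intro π hπ i
      obtain ⟨z, hz, rfl⟩ := Finset.mem_image.1 hπ
      exact Fintype.mem_piFinset.1 (Finset.mem_product.1 hz).1 _
    have hcover : ((Fintype.piFinset fun _ : Fin (k + b) => S).filter fun x => ¬ Good x) ⊆
        (Fintype.piFinset fun _ : Fin (k + b) => S).filter fun v =>
          (fun i => v i % (p : ℤ)) ∈ P := by
      intro x hx
      obtain ⟨h1, h2⟩ := Finset.mem_filter.1 hx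
      refine Finset.mem_filter.2 ⟨h1, ?_⟩
      let R := (Finset.univ : Finset (Fin (k + b))).image fun i => x i % (p : ℤ)
      have hR : R.card ≤ k - 1 := by
        by_contra hcon
        have hkR : k ≤ R.card := by omega
        have hpre : ∀ r : R, ∃ i, x i % (p : ℤ) = r := by
          intro r
          obtain ⟨i, _, hi⟩ := Finset.mem_image.1 r.2
          exact ⟨i, hi⟩
        choose f hf using hpre
        refine h2 ⟨fun j => f (R.equivFin.symm (Fin.castLE hkR j)), ?_⟩
        intro i j hij hd
        have h4 : x (f (R.equivFin.symm (Fin.castLE hkR j))) % (p : ℤ) =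
            x (f (R.equivFin.symm (Fin.castLE hkR i))) % (p : ℤ) :=
          (Int.modEq_iff_dvd.2 hd)
        rw [hf, hf] at h4
        have h5 := R.equivFin.symm.injective (Subtype.ext h4)
        exact hij ((Fin.castLE_injective hkR h5).symm)
      have hmem : ∀ i, x i % (p : ℤ) ∈ R := fun i =>
        Finset.mem_image_of_mem _ (Finset.mem_univ i)
      refine Finset.mem_image.2 ⟨(fun j => if h : (j : ℕ) < R.card then
        ((R.equivFin.symm ⟨j, h⟩ : R) : ℤ) else 0,
        fun i => Fin.castLE hR (R.equivFin ⟨_, hmem i⟩)), ?_, ?_⟩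
      · refine Finset.mem_product.2 ⟨Fintype.mem_piFinset.2 fun j => ?_, Finset.mem_univ _⟩
        dsimp only
        split_ifs with h
        · obtain ⟨i, _, hi⟩ := Finset.mem_image.1 (R.equivFin.symm ⟨j, h⟩).2
          rw [← hi]
          exact hcl _ (Fintype.mem_piFinset.1 h1 i)
        · exact Finset.mem_Ico.2 ⟨le_refl _, hp'⟩
      · funext i
        simp
    refine (collisions_mono hcover _).trans ?_
    refine (collisions_filter_classes_le S C (fun x => x % (p : ℤ)) P hPC
      (M := (X / p + 1) ^ (2 * k) * J) ?_ (by omega)).trans ?_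
    · intro c _
      refine (meanValue_filter_emod_le (k + b) k X p hp.pos c).trans ?_
      have hIcc : (Finset.Icc 1 ((X / p + 1 : ℕ) : ℤ)).card = X / p + 1 := by
        rw [Int.card_Icc, add_sub_cancel_right, Int.toNat_natCast]
      have h := meanValue_add_le b k (Finset.Icc 1 ((X / p + 1 : ℕ) : ℤ))
      rw [hIcc] at h
      exact h
    · gcongr

/-- The loss in one step of the iteration for the Vinogradov mean value. -/
def meanValueFactor (k m : ℕ) : ℕ :=
  (2 * (m ^ (2 * k) * k ^ k) + 2 * (k ^ (2 * m) * m * (2 * k + 1) ^ (2 * k))) *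
    (2 * k + 1) ^ (2 * m) * (2 * k) ^ (k ^ 2)

theorem exists_prime_near_root {k X : ℕ} (hk : 2 ≤ k) (hX : 1 ≤ X) :
    ∃ p : ℕ, p.Prime ∧ k < p ∧ X ≤ p ^ k ∧ (p : ℝ) ≤ 2 * k * (X : ℝ) ^ (1 / (k : ℝ)) := by
  set R := (X : ℝ) ^ (1 / (k : ℝ)) with hR
  have hX1 : (1 : ℝ) ≤ X := by exact_mod_cast hX
  have hR1 : 1 ≤ R := Real.one_le_rpow hX1 (by positivity)
  have hk' : (2 : ℝ) ≤ k := by exact_mod_cast hk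
  obtain ⟨p, hp, h1, h2⟩ := Nat.exists_prime_lt_and_le_two_mul (max k ⌈R⌉₊) (by omega)
  have h3 : R ≤ p := (Nat.le_ceil R).trans (by
    exact_mod_cast (le_max_right k ⌈R⌉₊).trans h1.le)
  refine ⟨p, hp, (le_max_left _ _).trans_lt h1, ?_, ?_⟩
  · have h4 : R ^ k = X := by
      rw [hR, ← Real.rpow_natCast, ← Real.rpow_mul (by positivity), one_div,
        inv_mul_cancel₀ (by positivity), Real.rpow_one]
    have h5 : (X : ℝ) ≤ (p : ℝ) ^ k := by
      rw [← h4]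
      gcongr
    exact_mod_cast h5
  · have h4 : (p : ℝ) ≤ 2 * (max k ⌈R⌉₊ : ℕ) := by exact_mod_cast h2
    have h5 : ((max k ⌈R⌉₊ : ℕ) : ℝ) ≤ k * R := by
      rw [Nat.cast_max]
      apply max_le
      · nlinarith
      · have := Nat.ceil_lt_add_one (show 0 ≤ R by linarith)
        nlinarith
    nlinarith

set_option maxHeartbeats 1000000 in
theorem meanValue_step {k b m : ℕ} {D δ : ℝ} (hk : 2 ≤ k) (hb : k ^ 2 ≤ b) (hm : k + b ≤ m)
    (hD : 0 ≤ D) (hδ0 : 0 ≤ δ) (hδ : δ ≤ k * (k + 1) / 2)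
    (h : ∀ X : ℕ, 1 ≤ X → (meanValue b k (Finset.Icc 1 (X : ℤ)) : ℝ) ≤
      D * (X : ℝ) ^ (2 * b - k * (k + 1) / 2 + δ)) (X : ℕ) (hX : 1 ≤ X) :
    (meanValue (k + b) k (Finset.Icc 1 (X : ℤ)) : ℝ) ≤ D * meanValueFactor k m *
      (X : ℝ) ^ (2 * (k + b : ℕ) - k * (k + 1) / 2 + δ * (1 - 1 / k)) := by
  obtain ⟨p, hp, hkp, hXp, hpX⟩ := exists_prime_near_root hk hX
  have hk2 : (2 : ℝ) ≤ k := by exact_mod_cast hk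
  have hX1 : (1 : ℝ) ≤ X := by exact_mod_cast hX
  have hp0 : (0 : ℝ) < p := by exact_mod_cast hp.pos
  have hp1 : (1 : ℝ) ≤ p := by exact_mod_cast hp.one_lt.le
  have hb1 : 1 ≤ b := le_trans (Nat.one_le_pow _ _ (by omega)) hb
  have hbk : ((k : ℝ)) ^ 2 ≤ b := by exact_mod_cast hb
  have hrec := meanValue_recursion hp hk hkp hXp hb1
  set J := meanValue b k (Finset.Icc 1 ((X / p + 1 : ℕ) : ℤ)) with hJ
  have hJb := h (X / p + 1) (Nat.le_add_left 1 _)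
  rw [← hJ] at hJb
  set E : ℝ := 2 * b - k * (k + 1) / 2 + δ with hE
  have hE0 : 0 ≤ E := by nlinarith
  have hEm : E ≤ (2 * m : ℕ) := by
    have : ((k + b : ℕ) : ℝ) ≤ m := by exact_mod_cast hm
    push_cast at this ⊢
    linarith
  have hpX' : (p : ℝ) ≤ 2 * k * X := by
    refine hpX.trans ?_
    gcongr
    calc (X : ℝ) ^ (1 / (k : ℝ)) ≤ (X : ℝ) ^ (1 : ℝ) :=
          Real.rpow_le_rpow_of_exponent_le hX1 (by rw [div_le_one (by linarith)]; linarith)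
      _ = X := Real.rpow_one _
  have hZ : ((X / p + 1 : ℕ) : ℝ) ≤ (2 * k + 1) * (X / p) := by
    have h1 : ((X / p : ℕ) : ℝ) ≤ X / p := Nat.cast_div_le
    have h2 : 1 ≤ 2 * k * (X / p : ℝ) := by
      rw [← mul_div_assoc, le_div_iff₀ hp0]
      linarith
    push_cast
    linarith
  have hZ0 : (0 : ℝ) ≤ ((X / p + 1 : ℕ) : ℝ) := by positivity
  set Z := ((X / p + 1 : ℕ) : ℝ) with hZdef
  clear_value E
  have hJ2 : (J : ℝ) ≤ D * ((2 * k + 1) ^ (2 * m) * (X / p : ℝ) ^ E) := by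
    refine hJb.trans ?_
    gcongr
    calc Z ^ E ≤ ((2 * k + 1) * (X / p : ℝ)) ^ E := Real.rpow_le_rpow hZ0 hZ hE0
      _ = (2 * k + 1 : ℝ) ^ E * (X / p : ℝ) ^ E := Real.mul_rpow (by positivity) (by positivity)
      _ ≤ (2 * k + 1 : ℝ) ^ ((2 * m : ℕ) : ℝ) * (X / p : ℝ) ^ E := by
          gcongr
          linarith
      _ = _ := by rw [Real.rpow_natCast]
  set σ := ∑ r ∈ Finset.range k, r with hσ
  have hσ2 : (σ : ℝ) = k * (k - 1) / 2 := by
    have := Finset.sum_range_id_mul_two k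
    rw [← hσ] at this
    have h2 : ((σ * 2 : ℕ) : ℝ) = ((k * (k - 1) : ℕ) : ℝ) := by exact_mod_cast this
    rw [Nat.cast_mul, Nat.cast_mul, Nat.cast_sub (by omega)] at h2
    push_cast at h2
    linarith
  have hXpk : (X : ℝ) ≤ (p : ℝ) ^ k := by exact_mod_cast hXp
  have hrec' : (meanValue (k + b) k (Finset.Icc 1 (X : ℤ)) : ℝ) ≤
      (2 * ((m : ℝ) ^ (2 * k) * k ^ k) + 2 * (k ^ (2 * m) * m * (2 * k + 1) ^ (2 * k))) *
        (p ^ (2 * b + σ) * X ^ k * J) := by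
    have h1 : (meanValue (k + b) k (Finset.Icc 1 (X : ℤ)) : ℝ) ≤
      2 * ((((k + b : ℕ) : ℝ) ^ k) ^ 2 * (p ^ (2 * b) * (X ^ k * (k ^ k * p ^ σ) * J))) +
      2 * ((p ^ (k - 1) * ((k - 1 : ℕ) : ℝ) ^ (k + b)) ^ 2 * (((k + b : ℕ) : ℝ) * (Z ^ (2 * k) *
        J))) := by
      rw [hZdef]
      exact_mod_cast hrec
    have hkm : ((k + b : ℕ) : ℝ) ≤ m := by exact_mod_cast hm
    have h2 : (((k + b : ℕ) : ℝ) ^ k) ^ 2 * (p ^ (2 * b) * (X ^ k * (k ^ k * p ^ σ) * J)) ≤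
        ((m : ℝ) ^ (2 * k) * k ^ k) * (p ^ (2 * b + σ) * X ^ k * J) := by
      calc _ ≤ ((m : ℝ) ^ k) ^ 2 * (p ^ (2 * b) * (X ^ k * (k ^ k * p ^ σ) * J)) := by gcongr
        _ = _ := by rw [pow_add, ← pow_mul, mul_comm k 2]; ring
    have h3 : (p ^ (k - 1) * ((k - 1 : ℕ) : ℝ) ^ (k + b)) ^ 2 * (((k + b : ℕ) : ℝ) *
        (Z ^ (2 * k) * J)) ≤
        (k ^ (2 * m) * m * (2 * k + 1) ^ (2 * k)) * (p ^ (2 * b + σ) * X ^ k * J) := by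
      have e1 : ((p : ℝ) ^ (k - 1)) ^ 2 * (X / p : ℝ) ^ (2 * k) ≤ p ^ (2 * b + σ) * X ^ k := by
        calc ((p : ℝ) ^ (k - 1)) ^ 2 * (X / p : ℝ) ^ (2 * k)
            ≤ ((p : ℝ) ^ k) ^ 2 * (X / p : ℝ) ^ (2 * k) := by
              gcongr
              omega
          _ = (X : ℝ) ^ k * (X : ℝ) ^ k := by
              rw [div_pow, ← pow_mul, mul_comm k 2]
              field_simp
              ring
          _ ≤ ((p : ℝ) ^ k) ^ k * X ^ k := by gcongr
          _ ≤ p ^ (2 * b + σ) * X ^ k := by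
              rw [← pow_mul]
              gcongr
              nlinarith
      have e2 : ((k - 1 : ℕ) : ℝ) ≤ k := by exact_mod_cast Nat.sub_le _ _
      calc _ ≤ (p ^ (k - 1) * (k : ℝ) ^ m) ^ 2 * (m * (((2 * k + 1) * (X / p : ℝ)) ^ (2 * k) *
              J)) := by
            gcongr
            calc ((k - 1 : ℕ) : ℝ) ^ (k + b) ≤ (k : ℝ) ^ (k + b) := by gcongr
              _ ≤ (k : ℝ) ^ m := by
                gcongr
                linarith
        _ = (k ^ (2 * m) * m * (2 * k + 1) ^ (2 * k)) *
              ((((p : ℝ) ^ (k - 1)) ^ 2 * (X / p : ℝ) ^ (2 * k)) * J) := by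
            rw [mul_pow, mul_pow (2 * (k : ℝ) + 1), mul_comm 2 m, pow_mul]
            ring
        _ ≤ _ := by gcongr
    linarith
  refine hrec'.trans ?_
  have hmain : (p : ℝ) ^ (2 * b + σ) * X ^ k * (X / p : ℝ) ^ E ≤ (2 * k) ^ (k ^ 2) *
      (X : ℝ) ^ (2 * (k + b : ℕ) - k * (k + 1) / 2 + δ * (1 - 1 / k)) := by
    have e1 : (p : ℝ) ^ (2 * b + σ) * X ^ k * (X / p : ℝ) ^ E =
        (p : ℝ) ^ ((k : ℝ) ^ 2 - δ) * (X : ℝ) ^ (k + E) := by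
      rw [Real.div_rpow (by positivity) (by positivity), Real.rpow_add (by linarith),
        Real.rpow_natCast,
        show (k : ℝ) ^ 2 - δ = ((2 * b + σ : ℕ) : ℝ) - E by push_cast; rw [hσ2, hE]; ring,
        Real.rpow_sub hp0, Real.rpow_natCast]
      ring
    have hd : 0 ≤ (k : ℝ) ^ 2 - δ := by nlinarith
    have e2 : (p : ℝ) ^ ((k : ℝ) ^ 2 - δ) ≤
        (2 * k) ^ (k ^ 2) * (X : ℝ) ^ (1 / (k : ℝ) * ((k : ℝ) ^ 2 - δ)) := by
      calc (p : ℝ) ^ ((k : ℝ) ^ 2 - δ) ≤ (2 * k * (X : ℝ) ^ (1 / (k : ℝ))) ^ ((k : ℝ) ^ 2 - δ) :=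
            Real.rpow_le_rpow hp0.le hpX hd
        _ = (2 * k : ℝ) ^ ((k : ℝ) ^ 2 - δ) * (X : ℝ) ^ (1 / (k : ℝ) * ((k : ℝ) ^ 2 - δ)) := by
            rw [Real.mul_rpow (by positivity) (by positivity), Real.rpow_mul (by positivity)]
        _ ≤ _ := by
            gcongr
            rw [← Real.rpow_natCast (2 * (k : ℝ)) (k ^ 2)]
            apply Real.rpow_le_rpow_of_exponent_le (by linarith)
            push_cast
            linarith
    calc _ = (p : ℝ) ^ ((k : ℝ) ^ 2 - δ) * (X : ℝ) ^ (k + E) := e1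
      _ ≤ (2 * k) ^ (k ^ 2) * (X : ℝ) ^ (1 / (k : ℝ) * ((k : ℝ) ^ 2 - δ)) *
          (X : ℝ) ^ (k + E) := by gcongr
      _ = _ := by
          rw [mul_assoc, ← Real.rpow_add (by linarith)]
          congr 2
          rw [hE]
          push_cast
          field_simp
          ring
  obtain ⟨K, hKdef⟩ : ∃ K : ℝ, K = 2 * ((m : ℝ) ^ (2 * k) * k ^ k) +
      2 * (k ^ (2 * m) * m * (2 * k + 1) ^ (2 * k)) := ⟨_, rfl⟩
  have hK : 0 ≤ K := hKdef ▸ (by positivity)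
  have hF : (meanValueFactor k m : ℝ) = K * (2 * k + 1) ^ (2 * m) * (2 * k) ^ (k ^ 2) := by
    rw [hKdef, meanValueFactor]
    push_cast
    rfl
  rw [← hKdef, hF]
  generalize (X : ℝ) ^ (2 * ((k + b : ℕ) : ℝ) - k * (k + 1) / 2 + δ * (1 - 1 / k)) = W at hmain ⊢
  calc K * (p ^ (2 * b + σ) * X ^ k * J)
      ≤ K * (p ^ (2 * b + σ) * X ^ k * (D * ((2 * k + 1) ^ (2 * m) * (X / p : ℝ) ^ E))) :=
        mul_le_mul_of_nonneg_left (mul_le_mul_of_nonneg_left hJ2 (by positivity)) hK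
    _ = D * (K * (2 * k + 1) ^ (2 * m)) * (p ^ (2 * b + σ) * X ^ k * (X / p : ℝ) ^ E) := by ring
    _ ≤ D * (K * (2 * k + 1) ^ (2 * m)) * ((2 * k) ^ (k ^ 2) * W) :=
        mul_le_mul_of_nonneg_left hmain (by positivity)
    _ = _ := by ring

theorem meanValue_iterate {k n : ℕ} (hk : 2 ≤ k) (l : ℕ) (hl : l ≤ n) (X : ℕ) (hX : 1 ≤ X) :
    (meanValue (k ^ 2 + l * k) k (Finset.Icc 1 (X : ℤ)) : ℝ) ≤
      (meanValueFactor k (k ^ 2 + n * k) : ℝ) ^ l * (X : ℝ) ^ (2 * ((k ^ 2 + l * k : ℕ) : ℝ) -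
        k * (k + 1) / 2 + k * (k + 1) / 2 * (1 - 1 / (k : ℝ)) ^ l) := by
  have hk2 : (2 : ℝ) ≤ k := by exact_mod_cast hk
  have hr0 : 0 ≤ 1 - 1 / (k : ℝ) := by
    rw [sub_nonneg, div_le_one (by linarith)]
    linarith
  have hr1 : 1 - 1 / (k : ℝ) ≤ 1 := by
    have : 0 ≤ 1 / (k : ℝ) := by positivity
    linarith
  induction l generalizing X with
  | zero =>
    simp only [zero_mul, add_zero, pow_zero, one_mul, mul_one, sub_add_cancel]
    have h1 : meanValue (k ^ 2) k (Finset.Icc 1 (X : ℤ)) ≤ X ^ (2 * k ^ 2) := by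
      refine (Finset.card_filter_le _ _).trans (le_of_eq ?_)
      simp [two_mul, pow_add]
    rw [show (2 : ℝ) * ((k ^ 2 : ℕ) : ℝ) = ((2 * k ^ 2 : ℕ) : ℝ) by push_cast; rfl,
      Real.rpow_natCast]
    exact_mod_cast h1
  | succ l ih =>
    have hstep := meanValue_step (k := k) (b := k ^ 2 + l * k) (m := k ^ 2 + n * k)
      (D := (meanValueFactor k (k ^ 2 + n * k) : ℝ) ^ l)
      (δ := k * (k + 1) / 2 * (1 - 1 / (k : ℝ)) ^ l) hk (Nat.le_add_right _ _)
      (by nlinarith) (by positivity) (by positivity)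
      (mul_le_of_le_one_right (by positivity) (pow_le_one₀ hr0 hr1))
      (fun X hX => ih (by omega) X hX) X hX
    rw [show k ^ 2 + (l + 1) * k = k + (k ^ 2 + l * k) by ring,
      pow_succ _ l, pow_succ _ l, ← mul_assoc]
    exact hstep

theorem meanValueFactor_le {k L : ℕ} (hk : 2 ≤ k) :
    meanValueFactor k (k ^ 2 + (L * k) * k) ≤ k ^ ((11 * L + 25) * k ^ 2) := by
  have hk0 : 0 < k := by omega
  have hm : k ^ 2 + L * k * k ≤ k ^ (L + 2) := by
    have h1 : L + 1 ≤ k ^ L := (Nat.lt_pow_self (by omega : 1 < k)).succ_le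
    calc k ^ 2 + L * k * k = (L + 1) * k ^ 2 := by ring
      _ ≤ k ^ L * k ^ 2 := Nat.mul_le_mul_right _ h1
      _ = k ^ (L + 2) := by rw [pow_add]
  have h2 : 2 * k + 1 ≤ k ^ 3 := by nlinarith [Nat.mul_le_mul hk hk]
  have h3 : 2 * k ≤ k ^ 2 := by nlinarith
  set m := k ^ 2 + L * k * k with hmdef
  have a1 : m ^ (2 * k) * k ^ k ≤ k ^ ((L + 2) * (2 * k) + k) := by
    rw [pow_add, pow_mul k]
    exact Nat.mul_le_mul_right _ (Nat.pow_le_pow_left hm _)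
  have a2 : k ^ (2 * m) * m * (2 * k + 1) ^ (2 * k) ≤ k ^ (2 * m + (L + 2) + 3 * (2 * k)) := by
    rw [pow_add, pow_add, pow_mul k 3]
    gcongr
  have a3 : 2 * (m ^ (2 * k) * k ^ k) + 2 * (k ^ (2 * m) * m * (2 * k + 1) ^ (2 * k)) ≤
      k ^ ((L + 2) * (2 * k) + k + (2 * m + (L + 2) + 3 * (2 * k)) + 2) := by
    have b1 : m ^ (2 * k) * k ^ k ≤
        k ^ ((L + 2) * (2 * k) + k + (2 * m + (L + 2) + 3 * (2 * k))) :=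
      a1.trans (Nat.pow_le_pow_right hk0 (Nat.le_add_right _ _))
    have b2 : k ^ (2 * m) * m * (2 * k + 1) ^ (2 * k) ≤
        k ^ ((L + 2) * (2 * k) + k + (2 * m + (L + 2) + 3 * (2 * k))) :=
      a2.trans (Nat.pow_le_pow_right hk0 (Nat.le_add_left _ _))
    have b3 : 4 ≤ k ^ 2 := by nlinarith
    rw [pow_add k _ 2]
    generalize k ^ ((L + 2) * (2 * k) + k + (2 * m + (L + 2) + 3 * (2 * k))) = W at b1 b2 ⊢
    nlinarith [Nat.mul_le_mul_left W b3]
  calc meanValueFactor k m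
      ≤ k ^ ((L + 2) * (2 * k) + k + (2 * m + (L + 2) + 3 * (2 * k)) + 2) *
        (k ^ 3) ^ (2 * m) * (k ^ 2) ^ (k ^ 2) := by
        rw [meanValueFactor]
        gcongr
    _ = k ^ ((L + 2) * (2 * k) + k + (2 * m + (L + 2) + 3 * (2 * k)) + 2 + 3 * (2 * m) +
        2 * k ^ 2) := by
        rw [← pow_mul, ← pow_mul, ← pow_add, ← pow_add]
    _ ≤ _ := by
        apply Nat.pow_le_pow_right hk0
        have c1 : k ≤ k ^ 2 := by nlinarith
        have c2 : 1 ≤ k ^ 2 := by nlinarith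
        have c3 : L * k ≤ L * k ^ 2 := Nat.mul_le_mul_left _ c1
        have c4 : L ≤ L * k ^ 2 := Nat.le_mul_of_pos_right _ (by positivity)
        have c5 : m = (L + 1) * k ^ 2 := by rw [hmdef]; ring
        rw [c5]
        nlinarith

/-- **Vinogradov's mean value theorem** in a form with an explicit dependence on the degree. -/
theorem exists_meanValue_le {η : ℝ} (hη : 0 < η) :
    ∃ C : ℕ, ∀ k : ℕ, 2 ≤ k → ∃ b : ℕ, k ^ 2 ≤ b ∧ b ≤ C * k ^ 2 ∧ ∀ X : ℕ, 1 ≤ X →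
      (meanValue b k (Finset.Icc 1 (X : ℤ)) : ℝ) ≤
        (k : ℝ) ^ (C * k ^ 3) * (X : ℝ) ^ (2 * (b : ℝ) - k * (k + 1) / 2 + η * k ^ 2) := by
  obtain ⟨L, hL⟩ : ∃ L : ℕ, Real.exp (-(L : ℝ)) ≤ η := by
    obtain ⟨L, hL⟩ := exists_nat_gt (-Real.log η)
    refine ⟨L, ?_⟩
    rw [← Real.le_log_iff_exp_le hη]
    linarith
  refine ⟨L * (11 * L + 25) + (L + 1), fun k hk => ⟨k ^ 2 + L * k * k, Nat.le_add_right _ _,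
    by nlinarith [Nat.zero_le (L * (11 * L + 25) * k ^ 2)], fun X hX => ?_⟩⟩
  have hk2 : (2 : ℝ) ≤ k := by exact_mod_cast hk
  have hX1 : (1 : ℝ) ≤ X := by exact_mod_cast hX
  refine (meanValue_iterate hk (n := L * k) (L * k) le_rfl X hX).trans ?_
  have h1 : (meanValueFactor k (k ^ 2 + L * k * k) : ℝ) ^ (L * k) ≤
      (k : ℝ) ^ ((L * (11 * L + 25) + (L + 1)) * k ^ 3) := by
    calc (meanValueFactor k (k ^ 2 + L * k * k) : ℝ) ^ (L * k)
        ≤ ((k : ℝ) ^ ((11 * L + 25) * k ^ 2)) ^ (L * k) := by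
          gcongr
          exact_mod_cast meanValueFactor_le hk
      _ = (k : ℝ) ^ (L * (11 * L + 25) * k ^ 3) := by rw [← pow_mul]; congr 1; ring
      _ ≤ _ := by
          apply pow_le_pow_right₀ (by linarith)
          nlinarith [pow_pos (show 0 < k by omega) 3]
  have h2 : (1 - 1 / (k : ℝ)) ^ (L * k) ≤ η := by
    refine le_trans ?_ hL
    have h3 : 0 ≤ 1 - 1 / (k : ℝ) := by
      rw [sub_nonneg, div_le_one (by linarith)]
      linarith
    calc (1 - 1 / (k : ℝ)) ^ (L * k) ≤ (Real.exp (-(1 / (k : ℝ)))) ^ (L * k) := by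
          gcongr
          exact Real.one_sub_le_exp_neg _
      _ = Real.exp (-(L : ℝ)) := by
          rw [← Real.exp_nat_mul]
          congr 1
          push_cast
          field_simp
  have h3 : k * (k + 1) / 2 * (1 - 1 / (k : ℝ)) ^ (L * k) ≤ η * k ^ 2 := by
    calc (k : ℝ) * (k + 1) / 2 * (1 - 1 / (k : ℝ)) ^ (L * k) ≤ k * (k + 1) / 2 * η := by gcongr
      _ ≤ η * k ^ 2 := by nlinarith [mul_pos hη (show (0 : ℝ) < k by linarith)]
  exact mul_le_mul h1 (Real.rpow_le_rpow_of_exponent_le hX1 (by linarith)) (by positivity)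
    (by positivity)

/-- The additive character `x ↦ exp (2 π i x)` of `ℝ`. -/
noncomputable def ef (x : ℝ) : ℂ := Complex.exp (2 * Real.pi * x * Complex.I)

theorem ef_add (x y : ℝ) : ef (x + y) = ef x * ef y := by
  rw [ef, ef, ef, ← Complex.exp_add]
  congr 1
  push_cast
  ring

theorem ef_zero : ef 0 = 1 := by simp [ef]

theorem ef_neg (x : ℝ) : ef (-x) = (starRingEnd ℂ) (ef x) := by
  rw [ef, ef, ← Complex.exp_conj]
  congr 1
  simp [Complex.conj_ofNat]

theorem norm_ef (x : ℝ) : ‖ef x‖ = 1 := by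
  rw [ef, show (2 * Real.pi * x * Complex.I : ℂ) = ((2 * Real.pi * x : ℝ) : ℂ) * Complex.I by
    push_cast; ring]
  exact Complex.norm_exp_ofReal_mul_I _

theorem ef_sum {ι : Type*} (s : Finset ι) (f : ι → ℝ) :
    ef (∑ i ∈ s, f i) = ∏ i ∈ s, ef (f i) := by
  classical
  induction s using Finset.induction_on with
  | empty => simp [ef_zero]
  | insert a s ha ih => rw [Finset.sum_insert ha, Finset.prod_insert ha, ef_add, ih]

theorem ef_intCast (n : ℤ) : ef n = 1 := by
  rw [ef, Complex.exp_eq_one_iff]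
  exact ⟨n, by push_cast; ring⟩

section DoubleHolder

variable {k : ℕ}

/-- The character with frequency vector `β` at an integer vector. -/
noncomputable def vecPhase (β : Fin k → ℝ) (l : Fin k → ℤ) : ℂ := ef (∑ r, β r * l r)

/-- The moment curve. -/
def moment (k : ℕ) (x : ℤ) : Fin k → ℤ := fun r => x ^ ((r : ℕ) + 1)

theorem vecPhase_add (β : Fin k → ℝ) (l m : Fin k → ℤ) :
    vecPhase β (l + m) = vecPhase β l * vecPhase β m := by
  rw [vecPhase, vecPhase, vecPhase, ← ef_add, ← Finset.sum_add_distrib]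
  congr 1
  apply Finset.sum_congr rfl
  intro r _
  simp only [Pi.add_apply, Int.cast_add]
  ring

theorem vecPhase_sum {ι : Type*} (β : Fin k → ℝ) (s : Finset ι) (l : ι → Fin k → ℤ) :
    vecPhase β (∑ i ∈ s, l i) = ∏ i ∈ s, vecPhase β (l i) := by
  classical
  induction s using Finset.induction_on with
  | empty => simp [vecPhase, ef_zero]
  | insert a s ha ih => rw [Finset.sum_insert ha, Finset.prod_insert ha, vecPhase_add, ih]

theorem vecPhase_neg (β : Fin k → ℝ) (l : Fin k → ℤ) :
    vecPhase β (-l) = (starRingEnd ℂ) (vecPhase β l) := by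
  rw [vecPhase, vecPhase, ← ef_neg]
  congr 1
  simp

theorem norm_sum_vecPhase_pow (β : Fin k → ℝ) (S : Finset ℤ) (b : ℕ) :
    ((‖∑ x ∈ S, vecPhase β (moment k x)‖ ^ (2 * b) : ℝ) : ℂ) =
      ∑ z ∈ (Fintype.piFinset fun _ : Fin b => S) ×ˢ (Fintype.piFinset fun _ : Fin b => S),
        vecPhase β (powerSums k z.1 - powerSums k z.2) := by
  have h1 : ∑ v ∈ Fintype.piFinset fun _ : Fin b => S, vecPhase β (powerSums k v) =
      (∑ x ∈ S, vecPhase β (moment k x)) ^ b := by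
    have := Finset.prod_univ_sum (fun _ : Fin b => S) (fun _ x => vecPhase β (moment k x))
    simp only [Finset.prod_const, Finset.card_univ, Fintype.card_fin] at this
    rw [this]
    apply Finset.sum_congr rfl
    intro v _
    rw [powerSums_eq_sum, vecPhase_sum]
    rfl
  rw [pow_mul']
  push_cast
  rw [← Complex.ofReal_pow, ← norm_pow, ← Complex.mul_conj', ← h1, map_sum, Finset.sum_mul_sum,
    ← Finset.sum_product']
  apply Finset.sum_congr rfl
  intro z _
  rw [sub_eq_add_neg, vecPhase_add, vecPhase_neg]

/-- The box containing all differences of power sums. -/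
noncomputable def momentBox (k b U : ℕ) : Finset (Fin k → ℤ) :=
  Fintype.piFinset fun r : Fin k =>
    Finset.Icc (-((b * U ^ ((r : ℕ) + 1) : ℕ) : ℤ)) ((b * U ^ ((r : ℕ) + 1) : ℕ) : ℤ)

theorem sub_powerSums_mem_momentBox {b U : ℕ} {z : (Fin b → ℤ) × (Fin b → ℤ)}
    (hz : z ∈ (Fintype.piFinset fun _ : Fin b => Finset.Icc 1 (U : ℤ)) ×ˢ
      (Fintype.piFinset fun _ : Fin b => Finset.Icc 1 (U : ℤ))) :
    powerSums k z.1 - powerSums k z.2 ∈ momentBox k b U := by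
  have h : ∀ v ∈ (Fintype.piFinset fun _ : Fin b => Finset.Icc 1 (U : ℤ)), ∀ r,
      0 ≤ powerSums k v r ∧ powerSums k v r ≤ ((b * U ^ ((r : ℕ) + 1) : ℕ) : ℤ) := by
    intro v hv r
    have hv' : ∀ i, 1 ≤ v i ∧ v i ≤ U := fun i =>
      Finset.mem_Icc.1 (Fintype.mem_piFinset.1 hv i)
    constructor
    · exact Finset.sum_nonneg fun i _ => pow_nonneg (by linarith [(hv' i).1]) _
    · calc powerSums k v r ≤ ∑ i : Fin b, (U : ℤ) ^ ((r : ℕ) + 1) :=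
            Finset.sum_le_sum fun i _ => pow_le_pow_left₀ (by linarith [(hv' i).1]) (hv' i).2 _
        _ = _ := by simp
  rw [Finset.mem_product] at hz
  refine Fintype.mem_piFinset.2 fun r => ?_
  have h1 := h _ hz.1 r
  have h2 := h _ hz.2 r
  rw [Finset.mem_Icc, Pi.sub_apply]
  constructor <;> linarith [h1.1, h1.2, h2.1, h2.2]

theorem sum_sub_powerSums_le {b U : ℕ} (F : (Fin k → ℤ) → ℝ) (hF : ∀ l, 0 ≤ F l) :
    ∑ z ∈ (Fintype.piFinset fun _ : Fin b => Finset.Icc 1 (U : ℤ)) ×ˢ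
      (Fintype.piFinset fun _ : Fin b => Finset.Icc 1 (U : ℤ)),
        F (powerSums k z.1 - powerSums k z.2) ≤
      meanValue b k (Finset.Icc 1 (U : ℤ)) * ∑ l ∈ momentBox k b U, F l := by
  rw [← Finset.sum_fiberwise_of_maps_to (g := fun z : (Fin b → ℤ) × (Fin b → ℤ) =>
    powerSums k z.1 - powerSums k z.2) (t := momentBox k b U)
    (fun z hz => sub_powerSums_mem_momentBox hz), Finset.mul_sum]
  apply Finset.sum_le_sum
  intro l _
  calc _ = ∑ z ∈ ((Fintype.piFinset fun _ : Fin b => Finset.Icc 1 (U : ℤ)) ×ˢ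
      (Fintype.piFinset fun _ : Fin b => Finset.Icc 1 (U : ℤ))).filter fun z =>
        powerSums k z.1 - powerSums k z.2 = l, F l :=
        Finset.sum_congr rfl fun z hz => by rw [(Finset.mem_filter.1 hz).2]
    _ ≤ _ := by
        rw [Finset.sum_const, nsmul_eq_mul]
        refine mul_le_mul_of_nonneg_right ?_ (hF l)
        exact_mod_cast card_filter_sub_eq_le _ (powerSums k) l

/-- The sum over a box of the absolute values of a bilinear exponential sum. -/
noncomputable def bilinearBoxSum (M : ℕ) (a : ℝ) : ℝ :=
  ∑ μ ∈ Finset.Icc (-(M : ℤ)) M, ‖∑ l ∈ Finset.Icc (-(M : ℤ)) M, ef (a * μ * l)‖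

theorem norm_bilinear_sum_pow_le {b : ℕ} (hb : 1 ≤ b) (U : ℕ) (α : Fin k → ℝ) :
    ‖∑ u ∈ Finset.Icc 1 (U : ℤ), ∑ v ∈ Finset.Icc 1 (U : ℤ),
      ef (∑ r : Fin k, α r * ((u * v : ℤ) : ℝ) ^ ((r : ℕ) + 1))‖ ^ (2 * b * (2 * b)) ≤
      (U : ℝ) ^ ((2 * b - 1) * (4 * b)) * (meanValue b k (Finset.Icc 1 (U : ℤ)) : ℝ) ^ 2 *
        ∏ r : Fin k, bilinearBoxSum (b * U ^ ((r : ℕ) + 1)) (α r) := by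
  obtain ⟨m, hm⟩ : ∃ m, 2 * b = m + 1 := ⟨2 * b - 1, by omega⟩
  set S := Finset.Icc 1 (U : ℤ) with hS
  have hSc : (S.card : ℝ) = U := by simp [hS]
  set Z := (Fintype.piFinset fun _ : Fin b => S) ×ˢ (Fintype.piFinset fun _ : Fin b => S) with hZ
  have hZc : (Z.card : ℝ) = (U : ℝ) ^ (2 * b) := by
    rw [hZ, Finset.card_product, Fintype.card_piFinset]
    push_cast
    rw [hSc]
    simp [two_mul, pow_add]
  let d : (Fin b → ℤ) × (Fin b → ℤ) → Fin k → ℤ := fun z => powerSums k z.1 - powerSums k z.2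
  have hpow : ∀ {ι : Type} (s : Finset ι) (f : ι → ℂ),
      ‖∑ i ∈ s, f i‖ ^ (2 * b) ≤ (s.card : ℝ) ^ m * ∑ i ∈ s, ‖f i‖ ^ (2 * b) := by
    intro ι s f
    rw [hm]
    exact (pow_le_pow_left₀ (norm_nonneg _) (norm_sum_le _ _) _).trans
      (pow_sum_le_card_mul_sum_pow (fun _ _ => norm_nonneg _) m)
  -- expanding a sum of even moments and exchanging the order of summation
  have hexp : ∀ {ι : Type} (s : Finset ι) (β : ι → Fin k → ℝ),
      ∑ i ∈ s, ‖∑ x ∈ S, vecPhase (β i) (moment k x)‖ ^ (2 * b) ≤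
        ∑ z ∈ Z, ‖∑ i ∈ s, vecPhase (β i) (d z)‖ := by
    intro ι s β
    have h1 : ((∑ i ∈ s, ‖∑ x ∈ S, vecPhase (β i) (moment k x)‖ ^ (2 * b) : ℝ) : ℂ) =
        ∑ z ∈ Z, ∑ i ∈ s, vecPhase (β i) (d z) := by
      rw [Complex.ofReal_sum, Finset.sum_comm]
      exact Finset.sum_congr rfl fun i _ => norm_sum_vecPhase_pow _ _ _
    have h2 := congrArg norm h1
    rw [Complex.norm_real, Real.norm_of_nonneg (by positivity)] at h2
    rw [h2]
    exact norm_sum_le _ _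
  have hT : ∀ u v : ℤ, ef (∑ r : Fin k, α r * ((u * v : ℤ) : ℝ) ^ ((r : ℕ) + 1)) =
      vecPhase (fun r => α r * moment k u r) (moment k v) := by
    intro u v
    rw [vecPhase]
    congr 1
    apply Finset.sum_congr rfl
    intro r _
    simp only [moment]
    push_cast
    ring
  have hsymm : ∀ u z, vecPhase (fun r => α r * moment k u r) (d z) =
      vecPhase (fun r => α r * d z r) (moment k u) := by
    intro u z
    rw [vecPhase, vecPhase]
    congr 1
    apply Finset.sum_congr rfl
    intro r _
    ring
  have step1 : ‖∑ u ∈ S, ∑ v ∈ S,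
      ef (∑ r : Fin k, α r * ((u * v : ℤ) : ℝ) ^ ((r : ℕ) + 1))‖ ^ (2 * b) ≤
      (U : ℝ) ^ m * ∑ z ∈ Z, ‖∑ u ∈ S, vecPhase (fun r => α r * d z r) (moment k u)‖ := by
    simp only [hT]
    refine (hpow S _).trans ?_
    rw [hSc]
    refine mul_le_mul_of_nonneg_left ?_ (by positivity)
    refine (hexp S fun u r => α r * moment k u r).trans (le_of_eq ?_)
    apply Finset.sum_congr rfl
    intro z _
    simp only [hsymm]
  have step2 : (∑ z ∈ Z, ‖∑ u ∈ S, vecPhase (fun r => α r * d z r) (moment k u)‖) ^ (2 * b) ≤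
      ((U : ℝ) ^ (2 * b)) ^ m * ∑ z ∈ Z,
        ‖∑ u ∈ S, vecPhase (fun r => α r * d z r) (moment k u)‖ ^ (2 * b) := by
    rw [← hZc, hm]
    exact pow_sum_le_card_mul_sum_pow (fun _ _ => norm_nonneg _) m
  have step3 : ∑ z ∈ Z, ‖∑ u ∈ S, vecPhase (fun r => α r * d z r) (moment k u)‖ ^ (2 * b) ≤
      meanValue b k S * ∑ l ∈ momentBox k b U,
        ‖∑ u ∈ S, vecPhase (fun r => α r * l r) (moment k u)‖ ^ (2 * b) :=
    sum_sub_powerSums_le (fun l => ‖∑ u ∈ S, vecPhase (fun r => α r * l r) (moment k u)‖ ^ (2 * b))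
      (fun _ => by positivity)
  have step4 : ∑ l ∈ momentBox k b U,
        ‖∑ u ∈ S, vecPhase (fun r => α r * l r) (moment k u)‖ ^ (2 * b) ≤
      meanValue b k S * ∑ μ ∈ momentBox k b U,
        ‖∑ l ∈ momentBox k b U, vecPhase (fun r => α r * l r) μ‖ := by
    refine (hexp (momentBox k b U) fun l r => α r * l r).trans ?_
    exact sum_sub_powerSums_le (fun μ =>
      ‖∑ l ∈ momentBox k b U, vecPhase (fun r => α r * l r) μ‖) (fun _ => norm_nonneg _)
  have step5 : ∑ μ ∈ momentBox k b U,
        ‖∑ l ∈ momentBox k b U, vecPhase (fun r => α r * l r) μ‖ =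
      ∏ r : Fin k, bilinearBoxSum (b * U ^ ((r : ℕ) + 1)) (α r) := by
    simp only [bilinearBoxSum]
    rw [Finset.prod_univ_sum]
    apply Finset.sum_congr rfl
    intro μ _
    rw [← norm_prod, Finset.prod_univ_sum]
    congr 1
    apply Finset.sum_congr rfl
    intro l _
    rw [vecPhase, ef_sum]
    apply Finset.prod_congr rfl
    intro r _
    congr 1
    ring
  rw [pow_mul]
  calc _ ≤ ((U : ℝ) ^ m * ∑ z ∈ Z,
        ‖∑ u ∈ S, vecPhase (fun r => α r * d z r) (moment k u)‖) ^ (2 * b) :=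
        pow_le_pow_left₀ (by positivity) step1 _
    _ ≤ ((U : ℝ) ^ m) ^ (2 * b) * (((U : ℝ) ^ (2 * b)) ^ m * (meanValue b k S *
        (meanValue b k S * ∏ r : Fin k, bilinearBoxSum (b * U ^ ((r : ℕ) + 1)) (α r)))) := by
        rw [mul_pow, ← step5]
        refine mul_le_mul_of_nonneg_left (step2.trans ?_) (by positivity)
        refine mul_le_mul_of_nonneg_left (step3.trans ?_) (by positivity)
        exact mul_le_mul_of_nonneg_left step4 (by positivity)
    _ = _ := by
        rw [show 2 * b - 1 = m by omega, ← pow_mul, ← pow_mul,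
          show m * (4 * b) = m * (2 * b) + 2 * b * m by ring, pow_add]
        ring

end DoubleHolder

theorem ef_sub_round (x : ℝ) : ef (x - round x) = ef x := by
  rw [sub_eq_add_neg, ef_add, ef_neg, ef_intCast, map_one, mul_one]

theorem four_mul_abs_sub_round_le (x : ℝ) : 4 * |x - round x| ≤ ‖ef x - 1‖ := by
  rw [← ef_sub_round]
  have h := abs_sub_round x
  set y := x - round x
  have h1 : ef y = Complex.exp (Complex.I * ((2 * Real.pi * y : ℝ) : ℂ)) := by
    rw [ef]; congr 1; push_cast; ring
  rw [h1, Complex.norm_exp_I_mul_ofReal_sub_one, norm_mul, Real.norm_eq_abs, Real.norm_eq_abs,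
    abs_two, show 2 * Real.pi * y / 2 = Real.pi * y by ring]
  have h2 : |Real.pi * y| = Real.pi * |y| := by rw [abs_mul, abs_of_pos Real.pi_pos]
  have h3 := Real.mul_abs_le_abs_sin (x := Real.pi * y) (by
    rw [h2]; nlinarith [Real.pi_pos])
  rw [h2, ← mul_assoc, div_mul_cancel₀ _ Real.pi_ne_zero] at h3
  linarith

theorem ef_natCast_mul (n : ℕ) (x : ℝ) : ef (n * x) = ef x ^ n := by
  induction n with
  | zero => simp [ef_zero]
  | succ n ih => rw [pow_succ, ← ih, ← ef_add]; congr 1; push_cast; ring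

theorem norm_sum_range_ef_mul_le (x y : ℝ) (n : ℕ) :
    ‖∑ l ∈ Finset.range n, ef (y + l * x)‖ * (2 * |x - round x|) ≤ 1 := by
  have h : (∑ l ∈ Finset.range n, ef (y + l * x)) * (ef x - 1) = ef y * (ef x ^ n - 1) := by
    rw [← geom_sum_mul, ← mul_assoc, Finset.mul_sum]
    simp only [ef_add, ef_natCast_mul]
  have h2 : ‖∑ l ∈ Finset.range n, ef (y + l * x)‖ * ‖ef x - 1‖ ≤ 2 := by
    rw [← norm_mul, h, norm_mul, norm_ef, one_mul]
    calc _ ≤ ‖ef x ^ n‖ + ‖(1 : ℂ)‖ := norm_sub_le _ _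
      _ = 2 := by rw [norm_pow, norm_ef]; norm_num
  nlinarith [four_mul_abs_sub_round_le x, norm_nonneg (∑ l ∈ Finset.range n, ef (y + l * x))]

theorem norm_sum_Icc_ef_mul_le (a x : ℝ) (p q : ℤ) :
    ‖∑ l ∈ Finset.Icc p q, ef (a + l * x)‖ * (2 * |x - round x|) ≤ 1 := by
  have h : ∑ l ∈ Finset.Icc p q, ef (a + l * x) =
      ∑ l ∈ Finset.range (q + 1 - p).toNat, ef ((a + p * x) + l * x) := by
    rw [Int.Icc_eq_finset_map, Finset.sum_map]
    apply Finset.sum_congr rfl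
    intro l _
    congr 1
    simp
    ring
  rw [h]
  exact norm_sum_range_ef_mul_le _ _ _

theorem card_Icc_int_real_le (s : Finset ℤ) {x y : ℝ} (hxy : x ≤ y)
    (hs : ∀ n ∈ s, x ≤ n ∧ n ≤ y) : (s.card : ℝ) ≤ y - x + 1 := by
  have h : s ⊆ Finset.Icc ⌈x⌉ ⌊y⌋ := fun n hn =>
    Finset.mem_Icc.2 ⟨Int.ceil_le.2 (hs n hn).1, Int.le_floor.2 (hs n hn).2⟩
  have h1 := Finset.card_le_card h
  rw [Int.card_Icc] at h1
  have h2 : (s.card : ℤ) ≤ max (⌊y⌋ + 1 - ⌈x⌉) 0 := by omega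
  have h3 : (s.card : ℝ) ≤ max ((⌊y⌋ : ℝ) + 1 - ⌈x⌉) 0 := by exact_mod_cast h2
  refine h3.trans (max_le ?_ (by linarith))
  linarith [Int.floor_le y, Int.le_ceil x]

theorem card_filter_near_int_le (M : ℕ) {a : ℝ} (ha : a ≠ 0) {τ : ℝ} (hτ : 0 < τ) :
    (((Finset.Icc (-(M : ℤ)) M).filter fun μ : ℤ => |a * μ - round (a * μ)| < τ).card : ℝ) ≤
      (2 * M * |a| + 2) * (2 * τ / |a| + 1) := by
  have ha' : 0 < |a| := abs_pos.2 ha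
  set s := (Finset.Icc (-(M : ℤ)) M).filter fun μ : ℤ => |a * μ - round (a * μ)| < τ
  have hmem : ∀ μ ∈ s, |(μ : ℝ)| ≤ M := by
    intro μ hμ
    have := Finset.mem_Icc.1 (Finset.mem_filter.1 hμ).1
    rw [abs_le]
    exact_mod_cast this
  have h1 : ((s.image fun μ : ℤ => round (a * μ)).card : ℝ) ≤ 2 * M * |a| + 2 := by
    have := card_Icc_int_real_le (s.image fun μ : ℤ => round (a * μ)) (x := -(M * |a| + 1 / 2))
      (y := M * |a| + 1 / 2) (by have : 0 ≤ M * |a| := by positivity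
                                 linarith) (by
        intro n hn
        obtain ⟨μ, hμ, rfl⟩ := Finset.mem_image.1 hn
        have h2 := abs_le.1 (abs_sub_round (a * μ))
        have h3 : |a * μ| ≤ M * |a| := by
          rw [abs_mul, mul_comm]
          exact mul_le_mul_of_nonneg_right (hmem μ hμ) ha'.le
        rw [abs_le] at h3
        constructor <;> linarith)
    linarith
  have h2 : ∀ j ∈ s.image fun μ : ℤ => round (a * μ),
      ((s.filter fun μ : ℤ => round (a * μ) = j).card : ℝ) ≤ 2 * τ / |a| + 1 := by
    intro j _
    have := card_Icc_int_real_le (s.filter fun μ : ℤ => round (a * μ) = j)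
      (x := j / a - τ / |a|) (y := j / a + τ / |a|)
      (by have : 0 < τ / |a| := by positivity
          linarith) (by
        intro μ hμ
        obtain ⟨hμ1, hμ2⟩ := Finset.mem_filter.1 hμ
        have h3 := (Finset.mem_filter.1 hμ1).2
        rw [hμ2] at h3
        have h4 : |(μ : ℝ) - j / a| ≤ τ / |a| := by
          rw [le_div_iff₀ ha', ← abs_mul, sub_mul, div_mul_cancel₀ _ ha, mul_comm]
          exact h3.le
        rw [abs_le] at h4
        constructor <;> linarith)
    rw [show 2 * τ / |a| = (j / a + τ / |a|) - (j / a - τ / |a|) by ring]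
    linarith
  rw [Finset.card_eq_sum_card_image (fun μ : ℤ => round (a * μ)) s]
  push_cast
  calc _ ≤ ∑ j ∈ s.image fun μ : ℤ => round (a * μ), (2 * τ / |a| + 1) := Finset.sum_le_sum h2
    _ = (s.image fun μ : ℤ => round (a * μ)).card * (2 * τ / |a| + 1) := by
        rw [Finset.sum_const, nsmul_eq_mul]
    _ ≤ _ := mul_le_mul_of_nonneg_right h1 (by positivity)

theorem card_Icc_neg_nat (M : ℕ) : (((Finset.Icc (-(M : ℤ)) M).card : ℕ) : ℝ) = 2 * M + 1 := by
  rw [Int.card_Icc, show ((M : ℤ) + 1 - -(M : ℤ)).toNat = 2 * M + 1 by omega]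
  push_cast
  ring

theorem bilinearBoxSum_le_sq (M : ℕ) (a : ℝ) : bilinearBoxSum M a ≤ (2 * M + 1) ^ 2 := by
  calc bilinearBoxSum M a ≤ ∑ μ ∈ Finset.Icc (-(M : ℤ)) M, ∑ l ∈ Finset.Icc (-(M : ℤ)) M,
        ‖ef (a * μ * l)‖ := Finset.sum_le_sum fun _ _ => norm_sum_le _ _
    _ = _ := by
      simp only [norm_ef, Finset.sum_const, nsmul_eq_mul, card_Icc_neg_nat]
      ring

theorem bilinearBoxSum_nonneg (M : ℕ) (a : ℝ) : 0 ≤ bilinearBoxSum M a :=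
  Finset.sum_nonneg fun _ _ => norm_nonneg _

theorem bilinearBoxSum_le (M : ℕ) {a : ℝ} (ha : a ≠ 0) {τ : ℝ} (hτ : 0 < τ) :
    bilinearBoxSum M a ≤
      (2 * M + 1) * ((2 * M * |a| + 2) * (2 * τ / |a| + 1)) + (2 * M + 1) * (1 / (2 * τ)) := by
  rw [bilinearBoxSum, ← Finset.sum_filter_add_sum_filter_not _
    (fun μ : ℤ => |a * μ - round (a * μ)| < τ)]
  apply add_le_add
  · calc _ ≤ ∑ μ ∈ (Finset.Icc (-(M : ℤ)) M).filter (fun μ : ℤ => |a * μ - round (a * μ)| < τ),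
          ∑ l ∈ Finset.Icc (-(M : ℤ)) M, ‖ef (a * μ * l)‖ :=
          Finset.sum_le_sum fun _ _ => norm_sum_le _ _
      _ ≤ _ := by
        simp only [norm_ef, Finset.sum_const, nsmul_eq_mul, card_Icc_neg_nat, mul_one]
        rw [mul_comm]
        exact mul_le_mul_of_nonneg_left (card_filter_near_int_le M ha hτ) (by positivity)
  · calc _ ≤ ∑ μ ∈ (Finset.Icc (-(M : ℤ)) M).filter
            (fun μ : ℤ => ¬ |a * μ - round (a * μ)| < τ), 1 / (2 * τ) := by
          apply Finset.sum_le_sum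
          intro μ hμ
          have h1 := not_lt.1 (Finset.mem_filter.1 hμ).2
          have h2 := norm_sum_Icc_ef_mul_le 0 (a * μ) (-(M : ℤ)) M
          simp only [zero_add, mul_comm _ (a * (μ : ℝ))] at h2
          rw [le_div_iff₀ (by positivity)]
          refine le_trans (mul_le_mul_of_nonneg_left ?_ (norm_nonneg _)) h2
          linarith
      _ ≤ _ := by
          rw [Finset.sum_const, nsmul_eq_mul, ← card_Icc_neg_nat]
          refine mul_le_mul_of_nonneg_right ?_ (by positivity)
          exact_mod_cast Finset.card_filter_le _ _

theorem negBinomial_partial_sum_rec (j k : ℕ) (t : ℝ) :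
    (1 + t) * ∑ r ∈ Finset.range (k + 1), (-1) ^ r * ((j + 1 + r - 1).choose r : ℝ) * t ^ r =
      ∑ r ∈ Finset.range (k + 1), (-1) ^ r * ((j + r - 1).choose r : ℝ) * t ^ r +
        (-1) ^ k * ((j + k).choose k : ℝ) * t ^ (k + 1) := by
  induction k with
  | zero => simp
  | succ k ih =>
    rw [Finset.sum_range_succ, mul_add, ih, Finset.sum_range_succ _ (k + 1)]
    rw [show j + 1 + (k + 1) - 1 = j + k + 1 by omega, show j + (k + 1) - 1 = j + k by omega,
      show j + (k + 1) = j + k + 1 by omega, Nat.choose_succ_succ (j + k) k]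
    push_cast
    ring

theorem abs_one_add_inv_pow_sub_le (j k : ℕ) {t : ℝ} (ht : 0 ≤ t) :
    |((1 + t) ^ j)⁻¹ - ∑ r ∈ Finset.range (k + 1), (-1) ^ r * ((j + r - 1).choose r : ℝ) * t ^ r| ≤
      ((j + k).choose (k + 1) : ℝ) * t ^ (k + 1) := by
  induction j with
  | zero =>
    rw [Finset.sum_range_succ']
    simp
  | succ j ih =>
    set E := ((1 + t) ^ (j + 1))⁻¹ -
      ∑ r ∈ Finset.range (k + 1), (-1) ^ r * ((j + 1 + r - 1).choose r : ℝ) * t ^ r with hE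
    have h : (1 + t) * E = (((1 + t) ^ j)⁻¹ -
        ∑ r ∈ Finset.range (k + 1), (-1) ^ r * ((j + r - 1).choose r : ℝ) * t ^ r) -
          (-1) ^ k * ((j + k).choose k : ℝ) * t ^ (k + 1) := by
      rw [hE, mul_sub, negBinomial_partial_sum_rec, pow_succ]
      have : (1 + t) ≠ 0 := by positivity
      field_simp
      ring
    have h1 : |(1 + t) * E| ≤ ((j + k).choose (k + 1) : ℝ) * t ^ (k + 1) +
        ((j + k).choose k : ℝ) * t ^ (k + 1) := by
      rw [h]
      refine (abs_sub _ _).trans (add_le_add ih (le_of_eq ?_))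
      rw [abs_mul, abs_mul, abs_pow, abs_neg, abs_one, one_pow, one_mul, abs_of_nonneg
        (by positivity), abs_of_nonneg (by positivity)]
    have h2 : |E| ≤ |(1 + t) * E| := by
      rw [abs_mul, abs_of_nonneg (by positivity : 0 ≤ 1 + t)]
      nlinarith [abs_nonneg E]
    refine h2.trans (h1.trans (le_of_eq ?_))
    rw [show j + 1 + k = j + k + 1 by omega, Nat.choose_succ_succ (j + k) k]
    push_cast
    ring

/-- The Taylor coefficients of `n ↦ Y / (x + n) ^ j`. -/
noncomputable def invPowCoeff (Y x : ℝ) (j k : ℕ) (r : Fin k) : ℝ :=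
  Y / x ^ j * ((-1) ^ ((r : ℕ) + 1) * ((j + r).choose (r + 1) : ℝ) * (x⁻¹) ^ ((r : ℕ) + 1))

theorem abs_div_pow_sub_taylor_le (Y : ℝ) {x n : ℝ} (hx : 0 < x) (hn : 0 ≤ n) (j k : ℕ) :
    |Y / (x + n) ^ j - (Y / x ^ j + ∑ r : Fin k, invPowCoeff Y x j k r * n ^ ((r : ℕ) + 1))| ≤
      |Y| / x ^ j * (((j + k).choose (k + 1) : ℝ) * (n / x) ^ (k + 1)) := by
  have h1 : Y / x ^ j + ∑ r : Fin k, invPowCoeff Y x j k r * n ^ ((r : ℕ) + 1) =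
      Y / x ^ j * ∑ r ∈ Finset.range (k + 1), (-1) ^ r * ((j + r - 1).choose r : ℝ) *
        (n / x) ^ r := by
    rw [Finset.sum_range_succ', mul_add, add_comm, mul_sum, Finset.sum_range]
    congr 1
    · apply Finset.sum_congr rfl
      intro r _
      rw [invPowCoeff, div_eq_mul_inv n x, mul_pow]
      simp only [show j + ((r : ℕ) + 1) - 1 = j + r by omega]
      ring
    · simp
  have h2 : Y / (x + n) ^ j = Y / x ^ j * ((1 + n / x) ^ j)⁻¹ := by
    rw [show x + n = x * (1 + n / x) by field_simp, mul_pow]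
    field_simp
  rw [h1, h2, ← mul_sub, abs_mul, abs_div, abs_of_pos (pow_pos hx j)]
  exact mul_le_mul_of_nonneg_left (abs_one_add_inv_pow_sub_le j k (by positivity)) (by positivity)

theorem norm_ef_sub_ef_le (x y : ℝ) : ‖ef x - ef y‖ ≤ 2 * Real.pi * |x - y| := by
  have h : ef x - ef y = ef y * (ef (x - y) - 1) := by
    rw [mul_sub, ← ef_add]; simp
  have h1 : ef (x - y) = Complex.exp (Complex.I * ((2 * Real.pi * (x - y) : ℝ) : ℂ)) := by
    rw [ef]; congr 1; push_cast; ring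
  rw [h, norm_mul, norm_ef, one_mul, h1]
  refine (Real.norm_exp_I_mul_ofReal_sub_one_le (x := 2 * Real.pi * (x - y))).trans (le_of_eq ?_)
  rw [Real.norm_eq_abs, abs_mul, abs_of_pos (by positivity : (0 : ℝ) < 2 * Real.pi)]

theorem norm_sum_range_sub_shift_le (g : ℤ → ℂ) (hg : ∀ x, ‖g x‖ ≤ 1) (p : ℤ) (n h : ℕ) :
    ‖∑ i ∈ Finset.range n, g (p + i) - ∑ i ∈ Finset.range n, g (p + i + h)‖ ≤ 2 * h := by
  set S := ∑ i ∈ Finset.range n, g (p + i) with hS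
  induction h with
  | zero => simp [hS]
  | succ h ih =>
    have h1 : S - ∑ i ∈ Finset.range n, g (p + i + (h + 1 : ℕ)) =
        (S - ∑ i ∈ Finset.range n, g (p + i + h)) + (g (p + h) - g (p + n + h)) := by
      have e1 := Finset.sum_range_succ (fun i : ℕ => g (p + i + h)) n
      rw [Finset.sum_range_succ'] at e1
      have e2 : ∀ i : ℕ, g (p + (i + 1 : ℕ) + h) = g (p + i + (h + 1 : ℕ)) := fun i => by
        congr 1; push_cast; ring
      simp only [e2, Nat.cast_zero, add_zero] at e1
      linear_combination -e1
    rw [h1]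
    have h2 := norm_add_le (S - ∑ i ∈ Finset.range n, g (p + i + h))
      (g (p + h) - g (p + n + h))
    have h3 := norm_sub_le (g (p + h)) (g (p + n + h))
    have := hg (p + h)
    have := hg (p + n + h)
    push_cast at *
    linarith

theorem norm_sum_range_mul_sq_le (g : ℤ → ℂ) (hg : ∀ x, ‖g x‖ ≤ 1) (p : ℤ) (n U : ℕ) :
    ‖∑ i ∈ Finset.range n, g (p + i)‖ * (U : ℝ) ^ 2 ≤
      ∑ i ∈ Finset.range n, ‖∑ u ∈ Finset.Icc 1 (U : ℤ), ∑ v ∈ Finset.Icc 1 (U : ℤ),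
        g (p + i + u * v)‖ + 2 * (U : ℝ) ^ 4 := by
  set S := ∑ i ∈ Finset.range n, g (p + i) with hS
  have hc : ((Finset.Icc 1 (U : ℤ)).card : ℝ) = U := by simp
  have hdiff := norm_sum_range_sub_shift_le g hg p n
  have hkey : S * (U : ℂ) ^ 2 = ∑ i ∈ Finset.range n, ∑ u ∈ Finset.Icc 1 (U : ℤ),
      ∑ v ∈ Finset.Icc 1 (U : ℤ), g (p + i + u * v) +
      ∑ u ∈ Finset.Icc 1 (U : ℤ), ∑ v ∈ Finset.Icc 1 (U : ℤ),
        (S - ∑ i ∈ Finset.range n, g (p + i + u * v)) := by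
    simp only [Finset.sum_sub_distrib, Finset.sum_const, Int.card_Icc]
    rw [Finset.sum_comm]
    have : ∀ u : ℤ, ∑ i ∈ Finset.range n, ∑ v ∈ Finset.Icc 1 (U : ℤ), g (p + i + u * v) =
        ∑ v ∈ Finset.Icc 1 (U : ℤ), ∑ i ∈ Finset.range n, g (p + i + u * v) :=
      fun u => Finset.sum_comm
    simp only [this, add_sub_cancel]
    simp
    ring
  have hnorm : ‖S‖ * (U : ℝ) ^ 2 = ‖S * (U : ℂ) ^ 2‖ := by simp
  rw [hnorm, hkey]
  refine (norm_add_le _ _).trans (add_le_add (norm_sum_le _ _) ?_)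
  calc _ ≤ ∑ u ∈ Finset.Icc 1 (U : ℤ), ∑ v ∈ Finset.Icc 1 (U : ℤ), 2 * (U : ℝ) ^ 2 := by
        refine (norm_sum_le _ _).trans (Finset.sum_le_sum fun u hu => ?_)
        refine (norm_sum_le _ _).trans (Finset.sum_le_sum fun v hv => ?_)
        rw [Finset.mem_Icc] at hu hv
        have h0 : 0 ≤ u * v := mul_nonneg (by linarith) (by linarith)
        have h1 : ((u * v).toNat : ℤ) = u * v := Int.toNat_of_nonneg h0
        have h2 := hdiff (u * v).toNat
        rw [h1] at h2
        refine h2.trans ?_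
        have h3 : (((u * v).toNat : ℕ) : ℝ) = ((u * v : ℤ) : ℝ) := by exact_mod_cast h1
        rw [h3]
        have h4 : u * v ≤ (U : ℤ) ^ 2 := by nlinarith
        have h5 : ((u * v : ℤ) : ℝ) ≤ (U : ℝ) ^ 2 := by exact_mod_cast h4
        linarith
    _ = _ := by
        simp only [Finset.sum_const, nsmul_eq_mul, hc]
        ring

/-- The saving over the trivial bound in `bilinearBoxSum`. -/
noncomputable def boxRatio (M : ℕ) (a : ℝ) : ℝ := bilinearBoxSum M a / (3 * M) ^ 2

theorem boxRatio_nonneg (M : ℕ) (a : ℝ) : 0 ≤ boxRatio M a :=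
  div_nonneg (bilinearBoxSum_nonneg _ _) (by positivity)

theorem boxRatio_le_one {M : ℕ} (hM : 1 ≤ M) (a : ℝ) : boxRatio M a ≤ 1 := by
  have hM' : (1 : ℝ) ≤ M := by exact_mod_cast hM
  rw [boxRatio, div_le_one (by positivity)]
  exact (bilinearBoxSum_le_sq M a).trans (pow_le_pow_left₀ (by positivity) (by linarith) 2)

theorem boxRatio_le {M : ℕ} (hM : 1 ≤ M) {a : ℝ} (ha : a ≠ 0) {τ : ℝ} (hτ : 0 < τ) :
    boxRatio M a ≤ 2 * τ + |a| + 2 * (τ / (M * |a|)) + 1 / M + 1 / (M * τ) := by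
  have hM' : (1 : ℝ) ≤ M := by exact_mod_cast hM
  have ha' : 0 < |a| := abs_pos.2 ha
  rw [boxRatio, div_le_iff₀ (by positivity)]
  refine (bilinearBoxSum_le M ha hτ).trans ?_
  rw [← mul_add]
  have h1 : (2 * M * |a| + 2) * (2 * τ / |a| + 1) + 1 / (2 * τ) =
      M * (4 * τ + 2 * |a| + 4 * (τ / (M * |a|)) + 2 * (1 / M) + (1 / 2) * (1 / (M * τ))) := by
    field_simp
    ring
  have p1 : 0 < τ / (M * |a|) := by positivity
  have p2 : (0 : ℝ) < 1 / M := by positivity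
  have p3 : 0 < 1 / (M * τ) := by positivity
  rw [h1]
  calc _ ≤ (3 * M : ℝ) * (M * (3 * (2 * τ + |a| + 2 * (τ / (M * |a|)) + 1 / M + 1 / (M * τ)))) := by
        refine mul_le_mul (by linarith) ?_ (by positivity) (by positivity)
        refine mul_le_mul_of_nonneg_left ?_ (by positivity)
        linarith
    _ = _ := by ring

theorem norm_bilinear_sum_pow_le_boxRatio {k b C U : ℕ} {η : ℝ} (hb : 1 ≤ b) (hU : 1 ≤ U)
    (hJ : (meanValue b k (Finset.Icc 1 (U : ℤ)) : ℝ) ≤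
      (k : ℝ) ^ (C * k ^ 3) * (U : ℝ) ^ (2 * (b : ℝ) - k * (k + 1) / 2 + η * k ^ 2))
    (α : Fin k → ℝ) :
    ‖∑ u ∈ Finset.Icc 1 (U : ℤ), ∑ v ∈ Finset.Icc 1 (U : ℤ),
      ef (∑ r : Fin k, α r * ((u * v : ℤ) : ℝ) ^ ((r : ℕ) + 1))‖ ^ (2 * b * (2 * b)) ≤
      ((U : ℝ) ^ 2) ^ (2 * b * (2 * b)) * ((k : ℝ) ^ (2 * (C * k ^ 3)) * (3 * b) ^ (2 * k) *
        (U : ℝ) ^ (2 * η * k ^ 2) *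
        ∏ r : Fin k, boxRatio (b * U ^ ((r : ℕ) + 1)) (α r)) := by
  have hU' : (0 : ℝ) < U := by exact_mod_cast hU
  have hb' : (0 : ℝ) < b := by exact_mod_cast hb
  refine (norm_bilinear_sum_pow_le hb U α).trans ?_
  have hprod : ∏ r : Fin k, bilinearBoxSum (b * U ^ ((r : ℕ) + 1)) (α r) =
      (3 * b) ^ (2 * k) * (U : ℝ) ^ (k * (k + 1)) *
        ∏ r : Fin k, boxRatio (b * U ^ ((r : ℕ) + 1)) (α r) := by
    have e1 : ∀ r : Fin k, bilinearBoxSum (b * U ^ ((r : ℕ) + 1)) (α r) =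
        ((3 * b) ^ 2 * (U : ℝ) ^ (2 * ((r : ℕ) + 1))) *
          boxRatio (b * U ^ ((r : ℕ) + 1)) (α r) := by
      intro r
      rw [boxRatio]
      push_cast
      field_simp
      ring
    rw [Finset.prod_congr rfl fun r _ => e1 r, Finset.prod_mul_distrib, Finset.prod_mul_distrib,
      Finset.prod_const, Finset.card_univ, Fintype.card_fin, ← pow_mul,
      Finset.prod_pow_eq_pow_sum]
    congr 3
    rw [← Finset.mul_sum, Fin.sum_univ_eq_sum_range (fun i => i + 1) k]
    have : ∀ k : ℕ, 2 * ∑ i ∈ Finset.range k, (i + 1) = k * (k + 1) := by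
      intro k
      induction k with
      | zero => simp
      | succ k ih => rw [Finset.sum_range_succ, mul_add, ih]; ring
    exact this k
  rw [hprod]
  have hP : 0 ≤ ∏ r : Fin k, boxRatio (b * U ^ ((r : ℕ) + 1)) (α r) :=
    Finset.prod_nonneg fun _ _ => boxRatio_nonneg _ _
  have hJ2 : (meanValue b k (Finset.Icc 1 (U : ℤ)) : ℝ) ^ 2 ≤
      (k : ℝ) ^ (2 * (C * k ^ 3)) * (U : ℝ) ^ (4 * (b : ℝ) - k * (k + 1) + 2 * η * k ^ 2) := by
    refine (pow_le_pow_left₀ (by positivity) hJ 2).trans (le_of_eq ?_)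
    rw [mul_pow, ← pow_mul, ← Real.rpow_natCast (_ ^ _) 2, ← Real.rpow_mul hU'.le]
    congr 2
    · ring
    · push_cast; ring
  have hexp : (U : ℝ) ^ ((2 * b - 1) * (4 * b)) *
      (U : ℝ) ^ (4 * (b : ℝ) - k * (k + 1) + 2 * η * k ^ 2) * (U : ℝ) ^ (k * (k + 1)) =
      ((U : ℝ) ^ 2) ^ (2 * b * (2 * b)) * (U : ℝ) ^ (2 * η * k ^ 2) := by
    rw [← pow_mul, ← Real.rpow_natCast, ← Real.rpow_natCast _ (k * (k + 1)),
      ← Real.rpow_natCast _ (2 * (2 * b * (2 * b))),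
      ← Real.rpow_add hU', ← Real.rpow_add hU', ← Real.rpow_add hU']
    congr 1
    push_cast [Nat.cast_sub (show 1 ≤ 2 * b by omega)]
    ring
  calc _ ≤ (U : ℝ) ^ ((2 * b - 1) * (4 * b)) * ((k : ℝ) ^ (2 * (C * k ^ 3)) *
        (U : ℝ) ^ (4 * (b : ℝ) - k * (k + 1) + 2 * η * k ^ 2)) *
        ((3 * b) ^ (2 * k) * (U : ℝ) ^ (k * (k + 1)) *
        ∏ r : Fin k, boxRatio (b * U ^ ((r : ℕ) + 1)) (α r)) := by
        gcongr
    _ = ((U : ℝ) ^ ((2 * b - 1) * (4 * b)) *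
      (U : ℝ) ^ (4 * (b : ℝ) - k * (k + 1) + 2 * η * k ^ 2) * (U : ℝ) ^ (k * (k + 1))) *
      ((k : ℝ) ^ (2 * (C * k ^ 3)) * (3 * b) ^ (2 * k) *
        ∏ r : Fin k, boxRatio (b * U ^ ((r : ℕ) + 1)) (α r)) := by ring
    _ = _ := by rw [hexp]; ring

theorem two_le_exp_one : (2 : ℝ) ≤ Real.exp 1 := by
  linarith [Real.add_one_le_exp (1 : ℝ)]

theorem two_pow_le_exp (n : ℕ) : (2 : ℝ) ^ n ≤ Real.exp n := by
  rw [← Real.exp_one_pow]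
  exact pow_le_pow_left₀ (by norm_num) two_le_exp_one n

theorem nine_pow_le_exp (n : ℕ) : (9 : ℝ) ^ n ≤ Real.exp (3 * n) := by
  rw [mul_comm, Real.exp_nat_mul]
  refine pow_le_pow_left₀ (by norm_num) ?_ n
  rw [show (3 : ℝ) = ((3 : ℕ) : ℝ) * 1 by norm_num, Real.exp_nat_mul]
  have h : (2.7 : ℝ) ≤ Real.exp 1 := by linarith [Real.exp_one_gt_d9]
  calc (9 : ℝ) ≤ 2.7 ^ 3 := by norm_num
    _ ≤ _ := pow_le_pow_left₀ (by norm_num) h 3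

theorem choose_le_exp (n m : ℕ) : (n.choose m : ℝ) ≤ Real.exp n := by
  refine le_trans ?_ (two_pow_le_exp n)
  exact_mod_cast Nat.choose_le_two_pow n m

section InvPow

variable {L κ x Y : ℝ} {j k : ℕ}

theorem abs_div_pow_le_exp (hx : Real.exp L ≤ x)
    (hY : |Y| = Real.exp ((j + κ) * L)) : |Y| / x ^ j ≤ Real.exp (κ * L) := by
  have hx0 : 0 < x := (Real.exp_pos L).trans_le hx
  rw [div_le_iff₀ (pow_pos hx0 j), hY]
  calc Real.exp ((j + κ) * L) = Real.exp (κ * L) * (Real.exp L) ^ j := by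
        rw [← Real.exp_nat_mul, ← Real.exp_add]; congr 1; ring
    _ ≤ _ := mul_le_mul_of_nonneg_left (pow_le_pow_left₀ (Real.exp_pos L).le hx j)
        (Real.exp_pos _).le

theorem abs_invPowCoeff_le (hx : Real.exp L ≤ x)
    (hY : |Y| = Real.exp ((j + κ) * L)) (r : Fin k) :
    |invPowCoeff Y x j k r| ≤
      Real.exp ((κ - ((r : ℕ) + 1)) * L + (j + r)) := by
  have hx0 : 0 < x := (Real.exp_pos L).trans_le hx
  rw [invPowCoeff, abs_mul, abs_div, abs_of_pos (pow_pos hx0 j), abs_mul, abs_mul, abs_pow,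
    abs_neg, abs_one, one_pow, one_mul, Nat.abs_cast,
    abs_of_pos (pow_pos (inv_pos.2 hx0) _)]
  have h3 : (x⁻¹) ^ ((r : ℕ) + 1) ≤ Real.exp (-(((r : ℕ) + 1) * L)) := by
    rw [Real.exp_neg, inv_pow]
    refine inv_anti₀ (Real.exp_pos _) ?_
    rw [show (((r : ℕ) : ℝ) + 1) * L = (((r : ℕ) + 1 : ℕ) : ℝ) * L by push_cast; ring,
      Real.exp_nat_mul]
    exact pow_le_pow_left₀ (Real.exp_pos L).le hx _
  calc _ ≤ Real.exp (κ * L) * (Real.exp ((j + r : ℕ) : ℝ) * Real.exp (-(((r : ℕ) + 1) * L))) := by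
        refine mul_le_mul (abs_div_pow_le_exp hx hY) ?_ (by positivity) (by positivity)
        exact mul_le_mul (choose_le_exp _ _) h3 (by positivity) (by positivity)
    _ = _ := by
        rw [← Real.exp_add, ← Real.exp_add]; congr 1; push_cast; ring

theorem le_abs_invPowCoeff (hx : Real.exp L ≤ x) (hx2 : x ≤ 9 * Real.exp L) (hj : 1 ≤ j)
    (hY : |Y| = Real.exp ((j + κ) * L)) (r : Fin k) :
    Real.exp ((κ - ((r : ℕ) + 1)) * L - 3 * (j + (r + 1))) ≤ |invPowCoeff Y x j k r| := by
  have hx0 : 0 < x := (Real.exp_pos L).trans_le hx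
  rw [invPowCoeff, abs_mul, abs_div, abs_of_pos (pow_pos hx0 j), abs_mul, abs_mul, abs_pow,
    abs_neg, abs_one, one_pow, one_mul, Nat.abs_cast,
    abs_of_pos (pow_pos (inv_pos.2 hx0) _), hY]
  have h1 : (1 : ℝ) ≤ ((j + r).choose (r + 1) : ℝ) := by
    exact_mod_cast Nat.choose_pos (show (r : ℕ) + 1 ≤ j + r by omega)
  have h2 : x ^ (j + ((r : ℕ) + 1)) ≤ Real.exp (3 * (j + (r + 1))) *
      Real.exp ((j + (r + 1)) * L) := by
    calc _ ≤ (9 * Real.exp L) ^ (j + ((r : ℕ) + 1)) := pow_le_pow_left₀ hx0.le hx2 _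
      _ = 9 ^ (j + ((r : ℕ) + 1)) * Real.exp ((j + ((r : ℕ) + 1) : ℕ) * L) := by
          rw [mul_pow, Real.exp_nat_mul]
      _ ≤ _ := by
          have := nine_pow_le_exp (j + ((r : ℕ) + 1))
          push_cast at this ⊢
          exact mul_le_mul_of_nonneg_right this (by positivity)
  calc _ = Real.exp ((j + κ) * L) /
      (Real.exp (3 * (j + (r + 1))) * Real.exp ((j + (r + 1)) * L)) := by
        rw [← Real.exp_add, ← Real.exp_sub]; congr 1; ring
    _ ≤ Real.exp ((j + κ) * L) / x ^ (j + ((r : ℕ) + 1)) :=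
        div_le_div_of_nonneg_left (by positivity) (by positivity) h2
    _ = Real.exp ((j + κ) * L) / x ^ j * (1 * (x⁻¹) ^ ((r : ℕ) + 1)) := by
        rw [pow_add, inv_pow]; field_simp
    _ ≤ _ := by gcongr

theorem boxRatio_invPowCoeff_le {c : ℝ} (hc : 0 < c) (hc2 : c ≤ 1 / 2) (hκ : c ≤ κ)
    (hx : Real.exp L ≤ x) (hx2 : x ≤ 9 * Real.exp L) (hj : 1 ≤ j)
    (hY : |Y| = Real.exp ((j + κ) * L)) (hL : 34 * (j + κ) + 20 ≤ c * L / 128)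
    {b U : ℕ} (hb : 1 ≤ b) (hU : Real.exp ((1 / 2 - c / 8) * L) / 2 ≤ U)
    (r : Fin k) (hr : 3 / 2 * κ ≤ r) (hr2 : r ≤ 2 * κ + 1) :
    boxRatio (b * U ^ ((r : ℕ) + 1)) (invPowCoeff Y x j k r) ≤ Real.exp (-(κ * L / 16)) := by
  set a := invPowCoeff Y x j k r
  set R : ℝ := (r : ℕ) + 1 with hR
  have hj0 : (0 : ℝ) ≤ j := by positivity
  have hL0 : 0 < L := by
    by_contra h
    have : c * L ≤ 0 := mul_nonpos_of_nonneg_of_nonpos hc.le (not_lt.1 h)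
    linarith
  have ha1 : |a| ≤ Real.exp ((κ - R) * L + (j + r)) := abs_invPowCoeff_le hx hY r
  have ha2 : Real.exp ((κ - R) * L - 3 * (j + R)) ≤ |a| :=
    le_abs_invPowCoeff hx hx2 hj hY r
  have ha0 : 0 < |a| := (Real.exp_pos _).trans_le ha2
  have hU0 : (0 : ℝ) < U := lt_of_lt_of_le (by positivity) hU
  have hU1 : 1 ≤ U := by exact_mod_cast hU0
  set M := b * U ^ ((r : ℕ) + 1) with hM
  have hM1 : 1 ≤ M := Nat.one_le_iff_ne_zero.2 (by positivity)
  set u := 1 / 2 - c / 8 with hu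
  have hMl : Real.exp (u * R * L - R) ≤ M := by
    have h1 : Real.exp (u * L - 1) ≤ U := by
      refine le_trans ?_ hU
      rw [Real.exp_sub]
      exact div_le_div_of_nonneg_left (by positivity) (by norm_num) two_le_exp_one
    calc _ = Real.exp (u * L - 1) ^ ((r : ℕ) + 1) := by
          rw [← Real.exp_nat_mul]; congr 1; push_cast; ring
      _ ≤ (U : ℝ) ^ ((r : ℕ) + 1) := pow_le_pow_left₀ (by positivity) h1 _
      _ ≤ _ := by
          rw [hM]; push_cast
          exact le_mul_of_one_le_left (by positivity) (by exact_mod_cast hb)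
  have hM0 : (0 : ℝ) < M := by positivity
  set τ := Real.exp ((κ / 8 - u * R) * L) with hτ
  have hτ0 : 0 < τ := Real.exp_pos _
  set E := Real.exp (-(κ * L / 8) + 4 * (j + R)) with hE
  have hκL : 0 < κ * L := mul_pos (hc.trans_le hκ) hL0
  have hR1 : 3 / 2 * κ + 1 ≤ R := by rw [hR]; linarith
  have hR2 : R ≤ 2 * κ + 2 := by rw [hR]; linarith
  have hR0 : 0 < R := by positivity
  have hrR : (r : ℝ) = R - 1 := by rw [hR]; ring
  have huR : κ / 2 ≤ u * R := by
    have : (7 / 16 : ℝ) ≤ u := by rw [hu]; linarith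
    nlinarith
  have huRL : κ / 2 * L ≤ u * R * L := mul_le_mul_of_nonneg_right huR hL0.le
  have t1 : τ ≤ E := by
    refine Real.exp_le_exp.2 ?_
    linarith
  have t2 : |a| ≤ E := by
    refine ha1.trans (Real.exp_le_exp.2 ?_)
    have : (κ - R) * L ≤ -(κ / 2) * L := mul_le_mul_of_nonneg_right (by linarith) hL0.le
    rw [hrR]
    linarith
  have t3 : τ / (M * |a|) ≤ E := by
    rw [div_le_iff₀ (by positivity)]
    calc τ ≤ E * (Real.exp (u * R * L - R) * Real.exp ((κ - R) * L - 3 * (j + R))) := by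
          rw [hE, hτ, ← Real.exp_add, ← Real.exp_add]
          refine Real.exp_le_exp.2 ?_
          have h1 : (2 * u * R + κ - R) ≥ κ / 4 := by
            have : 2 * u * R - R = -(c / 4 * R) := by rw [hu]; ring
            have : c / 4 * R ≤ c / 4 * (2 * κ + 2) := mul_le_mul_of_nonneg_left hR2 (by linarith)
            have : c * κ ≤ 1 / 2 * κ := mul_le_mul_of_nonneg_right hc2 (by linarith)
            linarith
          have h2 := mul_le_mul_of_nonneg_right h1 hL0.le
          linarith
      _ ≤ _ := by gcongr
  have t4 : 1 / (M : ℝ) ≤ E := by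
    rw [div_le_iff₀ hM0]
    calc (1 : ℝ) = Real.exp 0 := Real.exp_zero.symm
      _ ≤ E * Real.exp (u * R * L - R) := by
          rw [hE, ← Real.exp_add]
          refine Real.exp_le_exp.2 ?_
          linarith
      _ ≤ _ := by gcongr
  have t5 : 1 / (M * τ) ≤ E := by
    rw [div_le_iff₀ (by positivity)]
    calc (1 : ℝ) = Real.exp 0 := Real.exp_zero.symm
      _ ≤ E * (Real.exp (u * R * L - R) * τ) := by
          rw [hE, hτ, ← Real.exp_add, ← Real.exp_add]
          refine Real.exp_le_exp.2 ?_
          linarith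
      _ ≤ _ := by gcongr
  calc boxRatio M a ≤ _ := boxRatio_le hM1 (abs_pos.1 ha0) hτ0
    _ ≤ 7 * E := by linarith
    _ ≤ Real.exp 1 ^ 3 * E := by
        refine mul_le_mul_of_nonneg_right ?_ (Real.exp_pos _).le
        calc (7 : ℝ) ≤ 2 ^ 3 := by norm_num
          _ ≤ _ := pow_le_pow_left₀ (by norm_num) two_le_exp_one 3
    _ ≤ _ := by
        rw [← Real.exp_nat_mul, hE, ← Real.exp_add]
        refine Real.exp_le_exp.2 ?_
        have : c * L ≤ κ * L := mul_le_mul_of_nonneg_right hκ hL0.le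
        push_cast
        linarith

theorem prod_boxRatio_invPowCoeff_le {c : ℝ} (hc : 0 < c) (hc2 : c ≤ 1 / 2) (hκ : c ≤ κ)
    (hx : Real.exp L ≤ x) (hx2 : x ≤ 9 * Real.exp L) (hj : 1 ≤ j)
    (hY : |Y| = Real.exp ((j + κ) * L)) (hL : 34 * (j + κ) + 20 ≤ c * L / 128)
    {b U : ℕ} (hb : 1 ≤ b) (hU : Real.exp ((1 / 2 - c / 8) * L) / 2 ≤ U) (hk : 2 * κ + 2 ≤ k) :
    ∏ r : Fin k, boxRatio (b * U ^ ((r : ℕ) + 1)) (invPowCoeff Y x j k r) ≤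
      Real.exp (-(κ ^ 2 * L / 32)) := by
  classical
  have hκ0 : 0 < κ := hc.trans_le hκ
  have hL0 : 0 < L := by
    by_contra h
    have : c * L ≤ 0 := mul_nonpos_of_nonneg_of_nonpos hc.le (not_lt.1 h)
    have : (0 : ℝ) ≤ j := by positivity
    linarith
  have hU0 : (0 : ℝ) < U := lt_of_lt_of_le (by positivity) hU
  have hU1 : 1 ≤ U := by exact_mod_cast hU0
  set E := Real.exp (-(κ * L / 16)) with hE
  have hE1 : E ≤ 1 := Real.exp_le_one_iff.2 (by
    have := mul_pos hκ0 hL0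
    linarith)
  set G : Finset (Fin k) := Finset.univ.filter fun r => 3 / 2 * κ ≤ r ∧ (r : ℝ) ≤ 2 * κ + 1 with hG
  have h1 : ∏ r : Fin k, boxRatio (b * U ^ ((r : ℕ) + 1)) (invPowCoeff Y x j k r) ≤
      E ^ G.card := by
    calc _ ≤ ∏ r : Fin k, (if r ∈ G then E else 1) := by
          apply Finset.prod_le_prod
          · exact fun _ _ => boxRatio_nonneg _ _
          · intro r _
            split_ifs with h
            · obtain ⟨-, h1, h2⟩ := Finset.mem_filter.1 h
              exact boxRatio_invPowCoeff_le hc hc2 hκ hx hx2 hj hY hL hb hU r h1 h2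
            · exact boxRatio_le_one (Nat.one_le_iff_ne_zero.2 (by positivity)) _
      _ = _ := by
          rw [Finset.prod_ite_mem, Finset.univ_inter, Finset.prod_const]
  have h2 : ⌈κ / 2⌉₊ ≤ G.card := by
    have hlt : ∀ i ∈ Finset.range ⌈κ / 2⌉₊, ((⌈3 / 2 * κ⌉₊ + i : ℕ) : ℝ) ≤ 2 * κ + 1 := by
      intro i hi
      have h3 := Nat.lt_ceil.1 (Finset.mem_range.1 hi)
      have h4 := Nat.ceil_lt_add_one (show 0 ≤ 3 / 2 * κ by positivity)
      push_cast
      linarith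
    have hlt2 : ∀ i ∈ Finset.range ⌈κ / 2⌉₊, ⌈3 / 2 * κ⌉₊ + i < k := by
      intro i hi
      have := hlt i hi
      have : ((⌈3 / 2 * κ⌉₊ + i : ℕ) : ℝ) < k := by linarith
      exact_mod_cast this
    have hkpos : 0 < k := by
      have : (0 : ℝ) < k := by linarith
      exact_mod_cast this
    rw [← Finset.card_range ⌈κ / 2⌉₊]
    refine Finset.card_le_card_of_injOn
      (fun i => ⟨(⌈3 / 2 * κ⌉₊ + i) % k, Nat.mod_lt _ hkpos⟩) ?_ ?_
    · intro i hi
      have hm : (⌈3 / 2 * κ⌉₊ + i) % k = ⌈3 / 2 * κ⌉₊ + i := Nat.mod_eq_of_lt (hlt2 i hi)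
      simp only [hG, Finset.coe_filter, Finset.mem_univ, true_and, Set.mem_ofPred_eq, hm]
      refine ⟨?_, hlt i hi⟩
      push_cast
      have := Nat.le_ceil (3 / 2 * κ)
      have : (0 : ℝ) ≤ i := by positivity
      linarith
    · intro i hi i' hi' hii
      have hm : (⌈3 / 2 * κ⌉₊ + i) % k = ⌈3 / 2 * κ⌉₊ + i := Nat.mod_eq_of_lt (hlt2 i hi)
      have hm' : (⌈3 / 2 * κ⌉₊ + i') % k = ⌈3 / 2 * κ⌉₊ + i' := Nat.mod_eq_of_lt (hlt2 i' hi')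
      have := congrArg Fin.val hii
      simp only [hm, hm'] at this
      omega
  refine h1.trans ((pow_le_pow_of_le_one (Real.exp_pos _).le hE1 h2).trans ?_)
  rw [← Real.exp_nat_mul]
  refine Real.exp_le_exp.2 ?_
  have h3 := Nat.le_ceil (κ / 2)
  have h4 := mul_le_mul_of_nonneg_right h3 (show 0 ≤ κ * L / 16 by positivity)
  nlinarith

end InvPow

theorem le_of_pow_le_exp {T R E : ℝ} (hT : 0 ≤ T) (hR : 0 ≤ R) {m : ℕ} (hm : m ≠ 0)
    (h : T ^ m ≤ R ^ m * Real.exp (m * E)) : T ≤ R * Real.exp E := by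
  rw [Real.exp_nat_mul, ← mul_pow] at h
  exact (pow_le_pow_iff_left₀ hT (by positivity) hm).1 h

theorem nat_pow_le_exp {k : ℕ} (hk : 1 ≤ k) (n : ℕ) : (k : ℝ) ^ n ≤ Real.exp (n * k) := by
  rw [Real.exp_nat_mul]
  refine pow_le_pow_left₀ (by positivity) ?_ n
  linarith [Real.add_one_le_exp (k : ℝ)]

set_option maxHeartbeats 400000 in
/-- The saving obtained from the mean value theorem for a single bilinear sum. -/
theorem exists_norm_bilinear_polynomial_sum_le {c : ℝ} (hc : 0 < c) (hc2 : c ≤ 1 / 2) :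
    ∃ C c₁ : ℝ, 0 < c₁ ∧ ∀ (L κ x Y : ℝ) (j U k : ℕ), c ≤ κ → Real.exp L ≤ x →
      x ≤ 9 * Real.exp L → 1 ≤ j → |Y| = Real.exp ((j + κ) * L) →
      34 * (j + κ) + 20 ≤ c * L / 128 →
      Real.exp ((1 / 2 - c / 8) * L) / 2 ≤ U → (U : ℝ) ≤ Real.exp ((1 / 2 - c / 8) * L) →
      2 ≤ k → 2 * κ + 2 ≤ k → (k : ℝ) ≤ 17 * κ / c →
      ‖∑ u ∈ Finset.Icc 1 (U : ℤ), ∑ v ∈ Finset.Icc 1 (U : ℤ),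
        ef (∑ r : Fin k, invPowCoeff Y x j k r * ((u * v : ℤ) : ℝ) ^ ((r : ℕ) + 1))‖ ≤
        (U : ℝ) ^ 2 * Real.exp (C - c₁ * (L / κ ^ 2)) := by
  set η := c ^ 2 / (289 * 64) with hη
  have hη0 : 0 < η := by positivity
  obtain ⟨C, hC⟩ := exists_meanValue_le hη0
  refine ⟨C + 2, c ^ 4 / (256 * (C + 1) ^ 2 * 17 ^ 4), by positivity, ?_⟩
  intro L κ x Y j U k hκ hx hx2 hj hY hL hUl hUu hk2 hkl hku
  have hκ0 : 0 < κ := hc.trans_le hκ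
  have hL0 : 0 < L := by
    by_contra h
    have : c * L ≤ 0 := mul_nonpos_of_nonneg_of_nonpos hc.le (not_lt.1 h)
    have : (0 : ℝ) ≤ j := by positivity
    linarith
  have hU0 : (0 : ℝ) < U := lt_of_lt_of_le (by positivity) hUl
  have hU1 : 1 ≤ U := by exact_mod_cast hU0
  obtain ⟨b, hb1, hb2, hJ⟩ := hC k hk2
  have hk0 : (0 : ℝ) < k := by exact_mod_cast (show 0 < k by omega)
  have hb0 : 1 ≤ b := le_trans (Nat.one_le_pow _ _ (by omega)) hb1
  have hbR : (0 : ℝ) < b := by exact_mod_cast hb0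
  have hbk : (k : ℝ) ^ 2 ≤ b := by exact_mod_cast hb1
  have hbC : (b : ℝ) ≤ (C + 1) * k ^ 2 := by
    have : (b : ℝ) ≤ C * k ^ 2 := by exact_mod_cast hb2
    nlinarith [sq_nonneg (k : ℝ)]
  have hmain := norm_bilinear_sum_pow_le_boxRatio hb0 hU1 (hJ U hU1) (invPowCoeff Y x j k)
  have hprod := prod_boxRatio_invPowCoeff_le hc hc2 hκ hx hx2 hj hY hL hb0 hUl hkl
  refine le_of_pow_le_exp (norm_nonneg _) (by positivity)
    (m := 2 * b * (2 * b)) (by positivity) (hmain.trans ?_)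
  refine mul_le_mul_of_nonneg_left ?_ (by positivity)
  have e1 : (k : ℝ) ^ (2 * (C * k ^ 3)) ≤ Real.exp (2 * C * k ^ 4) := by
    refine (nat_pow_le_exp (by omega) _).trans (le_of_eq ?_)
    congr 1; push_cast; ring
  have e2 : (3 * b : ℝ) ^ (2 * k) ≤ Real.exp (6 * k * b) := by
    have := nat_pow_le_exp (show 1 ≤ 3 * b by omega) (2 * k)
    push_cast at this
    refine this.trans (le_of_eq ?_)
    congr 1; ring
  have e3 : (U : ℝ) ^ (2 * η * k ^ 2) ≤ Real.exp (κ ^ 2 * L / 64) := by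
    calc (U : ℝ) ^ (2 * η * k ^ 2) ≤ (Real.exp (L / 2)) ^ (2 * η * k ^ 2) := by
          refine Real.rpow_le_rpow hU0.le (hUu.trans (Real.exp_le_exp.2 ?_)) (by positivity)
          nlinarith
      _ = Real.exp (η * k ^ 2 * L) := by rw [← Real.exp_mul]; congr 1; ring
      _ ≤ _ := by
          refine Real.exp_le_exp.2 ?_
          have h1 : (k : ℝ) ^ 2 ≤ (17 * κ / c) ^ 2 := pow_le_pow_left₀ hk0.le hku 2
          have h2 : η * (17 * κ / c) ^ 2 = κ ^ 2 / 64 := by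
            rw [hη]; field_simp; norm_num
          have h3 : η * (k : ℝ) ^ 2 ≤ κ ^ 2 / 64 := by
            rw [← h2]; exact mul_le_mul_of_nonneg_left h1 hη0.le
          have := mul_le_mul_of_nonneg_right h3 hL0.le
          linarith
  calc _ ≤ Real.exp (2 * C * k ^ 4) * Real.exp (6 * k * b) * Real.exp (κ ^ 2 * L / 64) *
        Real.exp (-(κ ^ 2 * L / 32)) := by
        refine mul_le_mul (mul_le_mul (mul_le_mul e1 e2 ?_ ?_) e3 ?_ ?_) hprod ?_ ?_
        any_goals positivity
        exact Finset.prod_nonneg fun _ _ => boxRatio_nonneg _ _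
    _ = Real.exp (2 * C * k ^ 4 + 6 * k * b - κ ^ 2 * L / 64) := by
        rw [← Real.exp_add, ← Real.exp_add, ← Real.exp_add]; congr 1; ring
    _ ≤ _ := by
        refine Real.exp_le_exp.2 ?_
        push_cast
        have h1 : (k : ℝ) ^ 4 ≤ b ^ 2 := by
          calc (k : ℝ) ^ 4 = (k ^ 2) ^ 2 := by ring
            _ ≤ _ := pow_le_pow_left₀ (by positivity) hbk 2
        have h2 : (k : ℝ) ≤ b := by
          have : (1 : ℝ) ≤ k := by exact_mod_cast (show 1 ≤ k by omega)
          nlinarith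
        have h3 : (k : ℝ) * b ≤ b ^ 2 := by nlinarith
        have h4 : (b : ℝ) ^ 2 ≤ (C + 1) ^ 2 * (17 * κ / c) ^ 4 := by
          calc (b : ℝ) ^ 2 ≤ ((C + 1) * k ^ 2) ^ 2 := pow_le_pow_left₀ hbR.le hbC 2
            _ = (C + 1) ^ 2 * k ^ 4 := by ring
            _ ≤ _ := mul_le_mul_of_nonneg_left (pow_le_pow_left₀ hk0.le hku 4) (by positivity)
        have h5 : 4 * (b : ℝ) ^ 2 * (c ^ 4 / (256 * (C + 1) ^ 2 * 17 ^ 4) * (L / κ ^ 2)) ≤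
            κ ^ 2 * L / 64 := by
          have h6 : 4 * ((C + 1) ^ 2 * (17 * κ / c) ^ 4) *
              (c ^ 4 / (256 * (C + 1) ^ 2 * 17 ^ 4) * (L / κ ^ 2)) = κ ^ 2 * L / 64 := by
            field_simp
            norm_num
          rw [← h6]
          refine mul_le_mul_of_nonneg_right ?_ (by positivity)
          linarith
        have h7 : (C : ℝ) * k ^ 4 ≤ C * b ^ 2 := mul_le_mul_of_nonneg_left h1 (by positivity)
        have h8 : (0 : ℝ) ≤ C * b ^ 2 := by positivity
        have h9 : (0 : ℝ) ≤ b ^ 2 := by positivity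
        have h10 : (2 * b * (2 * b) : ℝ) *
            (C + 2 - c ^ 4 / (256 * (C + 1) ^ 2 * 17 ^ 4) * (L / κ ^ 2)) = 4 * (C * b ^ 2) +
            8 * b ^ 2 - 4 * (b : ℝ) ^ 2 *
              (c ^ 4 / (256 * (C + 1) ^ 2 * 17 ^ 4) * (L / κ ^ 2)) := by ring
        rw [h10]
        linarith

/-- The bilinear sum attached to a single point. -/
theorem exists_norm_bilinear_inv_pow_sum_le {c : ℝ} (hc : 0 < c) (hc2 : c ≤ 1 / 2) :
    ∃ C c₁ : ℝ, 0 < c₁ ∧ ∀ (L κ x Y : ℝ) (j U : ℕ), c ≤ κ → Real.exp L ≤ x →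
      x ≤ 9 * Real.exp L → 1 ≤ j → |Y| = Real.exp ((j + κ) * L) →
      (34 / c) * (j + κ) + 20 ≤ c * L / 128 →
      Real.exp ((1 / 2 - c / 8) * L) / 2 ≤ U → (U : ℝ) ≤ Real.exp ((1 / 2 - c / 8) * L) →
      ‖∑ u ∈ Finset.Icc 1 (U : ℤ), ∑ v ∈ Finset.Icc 1 (U : ℤ),
        ef (Y / (x + ((u * v : ℤ) : ℝ)) ^ j)‖ ≤
        (U : ℝ) ^ 2 * (Real.exp (C - c₁ * (L / κ ^ 2)) + Real.exp (-(c * L))) := by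
  obtain ⟨C, c₁, hc₁, H⟩ := exists_norm_bilinear_polynomial_sum_le hc hc2
  refine ⟨C, c₁, hc₁, ?_⟩
  intro L κ x Y j U hκ hx hx2 hj hY hL hUl hUu
  have hκ0 : 0 < κ := hc.trans_le hκ
  have hj0 : (0 : ℝ) ≤ j := by positivity
  have hjκ : (j + κ : ℝ) ≤ 1 / c * (j + κ) := by
    refine le_mul_of_one_le_left (by positivity) ?_
    rw [le_div_iff₀ hc]; linarith
  have hL34 : 34 * (j + κ) + 20 ≤ c * L / 128 := by
    have : 34 / c * (j + κ) = 34 * (1 / c * (j + κ)) := by ring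
    linarith
  have hL0 : 0 < L := by
    by_contra h
    have : c * L ≤ 0 := mul_nonpos_of_nonneg_of_nonpos hc.le (not_lt.1 h)
    linarith
  have hx0 : 0 < x := (Real.exp_pos L).trans_le hx
  set k := ⌈16 * κ / c⌉₊ with hk
  have hk1 : 16 * κ / c ≤ k := Nat.le_ceil _
  have hκc : 1 ≤ κ / c := by rw [le_div_iff₀ hc]; linarith
  have hκc2 : 2 * κ ≤ κ / c := by rw [le_div_iff₀ hc]; nlinarith
  have hk2 : (k : ℝ) ≤ 17 * κ / c := by
    have := Nat.ceil_lt_add_one (show 0 ≤ 16 * κ / c by positivity)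
    have e : 17 * κ / c = 16 * κ / c + κ / c := by ring
    rw [← hk] at this
    linarith
  have e16 : 16 * κ / c = 16 * (κ / c) := by ring
  have hk3 : 2 ≤ k := by
    have : (2 : ℝ) ≤ k := by linarith
    exact_mod_cast this
  have hT := H L κ x Y j U k hκ hx hx2 hj hY hL34 hUl hUu hk3 (by linarith) hk2
  set T : ℤ → ℤ → ℝ := fun u v =>
    ∑ r : Fin k, invPowCoeff Y x j k r * ((u * v : ℤ) : ℝ) ^ ((r : ℕ) + 1) with hTdef
  have herr : ∀ u ∈ Finset.Icc 1 (U : ℤ), ∀ v ∈ Finset.Icc 1 (U : ℤ),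
      ‖ef (Y / (x + ((u * v : ℤ) : ℝ)) ^ j) - ef (Y / x ^ j) * ef (T u v)‖ ≤
        Real.exp (-(c * L)) := by
    intro u hu v hv
    rw [Finset.mem_Icc] at hu hv
    have h0 : 0 ≤ u * v := mul_nonneg (by linarith) (by linarith)
    have h0' : (0 : ℝ) ≤ ((u * v : ℤ) : ℝ) := by exact_mod_cast h0
    have h4 : u * v ≤ (U : ℤ) ^ 2 := by nlinarith
    have h5 : ((u * v : ℤ) : ℝ) ≤ (U : ℝ) ^ 2 := by exact_mod_cast h4
    rw [← ef_add]
    refine (norm_ef_sub_ef_le _ _).trans ?_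
    have h6 := abs_div_pow_sub_taylor_le Y hx0 h0' j k
    have h7 : ((u * v : ℤ) : ℝ) / x ≤ Real.exp (-(c / 4) * L) := by
      rw [div_le_iff₀ hx0]
      calc _ ≤ (U : ℝ) ^ 2 := h5
        _ ≤ (Real.exp ((1 / 2 - c / 8) * L)) ^ 2 := pow_le_pow_left₀ (by positivity) hUu 2
        _ = Real.exp (-(c / 4) * L) * Real.exp L := by
            rw [← Real.exp_nat_mul, ← Real.exp_add]; congr 1; push_cast; ring
        _ ≤ _ := mul_le_mul_of_nonneg_left hx (Real.exp_pos _).le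
    have h8 : (((u * v : ℤ) : ℝ) / x) ^ (k + 1) ≤ Real.exp (-(4 * κ * L)) := by
      refine (pow_le_pow_left₀ (by positivity) h7 _).trans ?_
      rw [← Real.exp_nat_mul]
      refine Real.exp_le_exp.2 ?_
      have h9 : 4 * κ ≤ (k + 1) * (c / 4) := by
        have : 16 * κ ≤ k * c := by rwa [div_le_iff₀ hc] at hk1
        linarith
      have := mul_le_mul_of_nonneg_right h9 hL0.le
      push_cast
      linarith
    calc 2 * Real.pi * |Y / (x + ((u * v : ℤ) : ℝ)) ^ j - (Y / x ^ j + T u v)| ≤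
        Real.exp 3 * (Real.exp (κ * L) * (Real.exp ((j + k : ℕ) : ℝ) *
          Real.exp (-(4 * κ * L)))) := by
          refine mul_le_mul ?_ (h6.trans ?_) (abs_nonneg _) (Real.exp_pos _).le
          · have h10 : (2 : ℝ) ^ 3 ≤ Real.exp 3 := by exact_mod_cast two_pow_le_exp 3
            linarith [Real.pi_lt_four]
          · refine mul_le_mul (abs_div_pow_le_exp hx hY) ?_ (by positivity) (Real.exp_pos _).le
            exact mul_le_mul (choose_le_exp _ _) h8 (by positivity) (Real.exp_pos _).le
      _ = Real.exp (3 + κ * L + (j + k) - 4 * κ * L) := by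
          rw [← Real.exp_add, ← Real.exp_add, ← Real.exp_add]; congr 1; push_cast; ring
      _ ≤ _ := by
          refine Real.exp_le_exp.2 ?_
          have h9 : c * L ≤ κ * L := mul_le_mul_of_nonneg_right hκ hL0.le
          have h10 : 34 / c * (j + κ) = 34 * (1 / c * (j + κ)) := by ring
          have h11 : 17 * κ / c ≤ 17 * (1 / c * (j + κ)) := by
            have : (0 : ℝ) ≤ 17 * (1 / c * j) := by positivity
            have e : 17 * κ / c = 17 * (1 / c * (j + κ)) - 17 * (1 / c * j) := by ring
            linarith
          nlinarith
  have hcard : ((Finset.Icc 1 (U : ℤ)).card : ℝ) = U := by simp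
  have hsplit : ∑ u ∈ Finset.Icc 1 (U : ℤ), ∑ v ∈ Finset.Icc 1 (U : ℤ),
        ef (Y / (x + ((u * v : ℤ) : ℝ)) ^ j) =
      ef (Y / x ^ j) * (∑ u ∈ Finset.Icc 1 (U : ℤ), ∑ v ∈ Finset.Icc 1 (U : ℤ), ef (T u v)) +
      ∑ u ∈ Finset.Icc 1 (U : ℤ), ∑ v ∈ Finset.Icc 1 (U : ℤ),
        (ef (Y / (x + ((u * v : ℤ) : ℝ)) ^ j) - ef (Y / x ^ j) * ef (T u v)) := by
    simp only [Finset.sum_sub_distrib, Finset.mul_sum]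
    ring
  rw [hsplit, mul_add]
  refine (norm_add_le _ _).trans (add_le_add ?_ ?_)
  · rw [norm_mul, norm_ef, one_mul]
    exact hT
  · calc _ ≤ ∑ u ∈ Finset.Icc 1 (U : ℤ), ∑ v ∈ Finset.Icc 1 (U : ℤ), Real.exp (-(c * L)) := by
          refine (norm_sum_le _ _).trans (Finset.sum_le_sum fun u hu => ?_)
          exact (norm_sum_le _ _).trans (Finset.sum_le_sum fun v hv => herr u hu v hv)
      _ = _ := by
          simp only [Finset.sum_const, nsmul_eq_mul, hcard]
          ring

theorem eventually_mul_exp_neg_mul_rpow_le {a s : ℝ} (ha : 0 < a) (hs : 0 < s) (A K : ℝ) :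
    ∀ᶠ L : ℝ in Filter.atTop, K * Real.exp (-(a * L ^ s)) ≤ L ^ (-A) := by
  have h1 := tendsto_rpow_mul_exp_neg_mul_atTop_nhds_zero (A / s) a ha
  have h2 := (h1.comp (tendsto_rpow_atTop hs)).const_mul K
  rw [mul_zero] at h2
  filter_upwards [h2.eventually (gt_mem_nhds one_pos), Filter.eventually_gt_atTop 0] with L hL hL0
  have h3 : (L ^ s) ^ (A / s) = L ^ A := by
    rw [← Real.rpow_mul hL0.le]; congr 1; field_simp
  simp only [Function.comp_apply, h3] at hL
  rw [Real.rpow_neg hL0.le, ← one_div, le_div_iff₀ (Real.rpow_pos_of_pos hL0 A)]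
  rw [← neg_mul]
  nlinarith

theorem half_le_natFloor {x : ℝ} (hx : 1 ≤ x) : x / 2 ≤ ⌊x⌋₊ := by
  have h1 := Nat.lt_floor_add_one x
  have h2 : (1 : ℝ) ≤ ⌊x⌋₊ := by
    exact_mod_cast Nat.le_floor (by simpa using hx)
  linarith

/-- Vinogradov's estimate for the exponential sums with phase `Y / x ^ j`. -/
theorem exists_norm_sum_inv_pow_le {c η : ℝ} (hc : 0 < c) (hc2 : c ≤ 1 / 2) (hη : 0 < η)
    (A : ℝ) : ∃ N₀ : ℕ, ∀ N : ℕ, N₀ ≤ N → ∀ j : ℕ, 1 ≤ j → ∀ Y : ℝ,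
      (N : ℝ) ^ (j + c) ≤ |Y| → |Y| ≤ Real.exp (Real.log N ^ (3 / 2 - η)) →
      ∀ p n : ℕ, N ≤ p → p + n ≤ 9 * N →
        ‖∑ i ∈ Finset.range n, ef (Y / ((p : ℝ) + i) ^ j)‖ ≤ N * Real.log N ^ (-A) := by
  obtain ⟨C, c₁, hc₁, H⟩ := exists_norm_bilinear_inv_pow_sum_le hc hc2
  have ev1 := eventually_mul_exp_neg_mul_rpow_le hc₁ (show 0 < 2 * η by linarith) A
    (27 * Real.exp C)
  have ev2 := eventually_mul_exp_neg_mul_rpow_le hc one_pos A 27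
  have ev3 := eventually_mul_exp_neg_mul_rpow_le (show 0 < c / 4 by linarith) one_pos A 6
  have ev4 : ∀ᶠ L : ℝ in Filter.atTop, 34 / c * L ^ (1 / 2 : ℝ) + 20 ≤ c * L / 128 := by
    have h1 := (tendsto_rpow_atTop (show (0 : ℝ) < 1 / 2 by norm_num)).eventually
      (Filter.eventually_ge_atTop (34 * 256 / c ^ 2))
    filter_upwards [h1, Filter.eventually_ge_atTop (20 * 256 / c),
      Filter.eventually_gt_atTop 0] with L hL hL2 hL0
    rw [div_le_iff₀ hc] at hL2
    rw [div_le_iff₀ (by positivity)] at hL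
    have hsq : L ^ (1 / 2 : ℝ) * L ^ (1 / 2 : ℝ) = L := by
      rw [← Real.rpow_add hL0]; norm_num
    have hs0 : 0 ≤ L ^ (1 / 2 : ℝ) := by positivity
    have h2 : 34 / c * L ^ (1 / 2 : ℝ) ≤ 34 / c * (c ^ 2 / (34 * 256) * L) := by
      refine mul_le_mul_of_nonneg_left ?_ (by positivity)
      have := mul_le_mul_of_nonneg_right hL hs0
      nlinarith
    have h3 : 34 / c * (c ^ 2 / (34 * 256) * L) = c * L / 256 := by
      field_simp
    linarith
  have hlog : Filter.Tendsto (fun N : ℕ => Real.log N) Filter.atTop Filter.atTop :=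
    Real.tendsto_log_atTop.comp tendsto_natCast_atTop_atTop
  obtain ⟨N₀, hN₀⟩ := Filter.eventually_atTop.1 (((((hlog.eventually ev1).and
    (hlog.eventually ev2)).and (hlog.eventually ev3)).and (hlog.eventually ev4)).and
    ((hlog.eventually (Filter.eventually_ge_atTop 1)).and (Filter.eventually_ge_atTop 1)))
  refine ⟨N₀, ?_⟩
  intro N hN j hj Y hY1 hY2 p n hp hpn
  obtain ⟨⟨⟨⟨h1, h2⟩, h3⟩, h4⟩, h5, h6⟩ := hN₀ N hN
  set L := Real.log N with hL
  have hN0 : (0 : ℝ) < N := by exact_mod_cast h6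
  have hNe : Real.exp L = N := Real.exp_log hN0
  have hL0 : 0 < L := by linarith
  have hY0 : 0 < |Y| := (Real.rpow_pos_of_pos hN0 _).trans_le hY1
  set κ := Real.log |Y| / L - j with hκ
  have hYe : |Y| = Real.exp ((j + κ) * L) := by
    rw [hκ, add_sub_cancel, div_mul_cancel₀ _ hL0.ne', Real.exp_log hY0]
  have hκc : c ≤ κ := by
    rw [← hNe, ← Real.exp_mul, hYe, Real.exp_le_exp] at hY1
    have : (j + c) * L ≤ (j + κ) * L := by linarith
    linarith [le_of_mul_le_mul_right this hL0]
  have hκ0 : 0 < κ := hc.trans_le hκc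
  have hj0 : (0 : ℝ) ≤ j := by positivity
  have hjκ : j + κ ≤ L ^ (1 / 2 - η) := by
    rw [hYe, Real.exp_le_exp] at hY2
    have : L ^ (3 / 2 - η) = L ^ (1 / 2 - η) * L := by
      rw [← Real.rpow_add_one hL0.ne']; congr 1; ring
    rw [this] at hY2
    exact le_of_mul_le_mul_right hY2 hL0
  have hjκ2 : j + κ ≤ L ^ (1 / 2 : ℝ) :=
    hjκ.trans (Real.rpow_le_rpow_of_exponent_le h5 (by linarith))
  have hcond : 34 / c * (j + κ) + 20 ≤ c * L / 128 := by
    have := mul_le_mul_of_nonneg_left hjκ2 (show 0 ≤ 34 / c by positivity)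
    linarith
  set u := 1 / 2 - c / 8 with hu
  set U := ⌊Real.exp (u * L)⌋₊ with hU
  have hUu : (U : ℝ) ≤ Real.exp (u * L) := Nat.floor_le (Real.exp_pos _).le
  have hu1 : 1 ≤ Real.exp (u * L) := Real.one_le_exp (by
    have : 0 ≤ u := by rw [hu]; linarith
    positivity)
  have hUl : Real.exp (u * L) / 2 ≤ U := half_le_natFloor hu1
  have hU0 : (0 : ℝ) < U := lt_of_lt_of_le (by positivity) hUl
  have hκ2 : L ^ (2 * η) ≤ L / κ ^ 2 := by
    rw [le_div_iff₀ (by positivity)]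
    have e1 : κ ^ 2 ≤ L ^ (1 - 2 * η) := by
      calc κ ^ 2 ≤ (L ^ (1 / 2 - η)) ^ 2 := pow_le_pow_left₀ hκ0.le (by linarith) 2
        _ = _ := by rw [← Real.rpow_natCast, ← Real.rpow_mul hL0.le]; congr 1; push_cast; ring
    calc _ ≤ L ^ (2 * η) * L ^ (1 - 2 * η) := by gcongr
      _ = L := by rw [← Real.rpow_add hL0]; simp
  have hn : n ≤ 8 * N := by omega
  have hsum := norm_sum_range_mul_sq_le (fun x : ℤ => ef (Y / (x : ℝ) ^ j))
    (fun _ => (norm_ef _).le) p n U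
  have hinner : ∀ i ∈ Finset.range n, ‖∑ u ∈ Finset.Icc 1 (U : ℤ), ∑ v ∈ Finset.Icc 1 (U : ℤ),
      ef (Y / (((p : ℤ) + i + u * v : ℤ) : ℝ) ^ j)‖ ≤
      (U : ℝ) ^ 2 * (Real.exp (C - c₁ * L ^ (2 * η)) + Real.exp (-(c * L))) := by
    intro i hi
    have hi' := Finset.mem_range.1 hi
    have hx1 : Real.exp L ≤ (p : ℝ) + i := by
      rw [hNe]
      exact_mod_cast (show N ≤ p + i by omega)
    have hx2 : (p : ℝ) + i ≤ 9 * Real.exp L := by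
      rw [hNe]
      exact_mod_cast (show p + i ≤ 9 * N by omega)
    have := H L κ (p + i) Y j U hκc hx1 hx2 hj hYe hcond hUl hUu
    push_cast at this ⊢
    refine this.trans ?_
    gcongr
  have hfin : ‖∑ i ∈ Finset.range n, ef (Y / ((p : ℝ) + i) ^ j)‖ ≤
      n * (Real.exp (C - c₁ * L ^ (2 * η)) + Real.exp (-(c * L))) + 2 * (U : ℝ) ^ 2 := by
    have h7 := hsum.trans (add_le_add_left (Finset.sum_le_sum hinner) _)
    rw [Finset.sum_const, Finset.card_range, nsmul_eq_mul] at h7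
    push_cast at h7
    refine le_of_mul_le_mul_right (h7.trans (le_of_eq ?_)) (pow_pos hU0 2)
    ring
  have hU2 : (U : ℝ) ^ 2 ≤ N * Real.exp (-(c / 4 * L)) := by
    calc (U : ℝ) ^ 2 ≤ (Real.exp (u * L)) ^ 2 := pow_le_pow_left₀ hU0.le hUu 2
      _ = _ := by rw [← hNe, ← Real.exp_nat_mul, ← Real.exp_add]; congr 1; push_cast; ring
  rw [Real.rpow_one] at h2 h3
  have e1 : Real.exp (C - c₁ * L ^ (2 * η)) = Real.exp C * Real.exp (-(c₁ * L ^ (2 * η))) := by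
    rw [← Real.exp_add]; rfl
  have hn' : (n : ℝ) ≤ 8 * N := by exact_mod_cast hn
  have e2 : 0 ≤ Real.exp (C - c₁ * L ^ (2 * η)) + Real.exp (-(c * L)) := by positivity
  have e3 := mul_le_mul_of_nonneg_right hn' e2
  have e4 : 8 * (Real.exp (C - c₁ * L ^ (2 * η)) + Real.exp (-(c * L))) +
      2 * Real.exp (-(c / 4 * L)) ≤ L ^ (-A) := by
    have : 0 ≤ L ^ (-A) := by positivity
    rw [e1]
    linarith
  have e5 := mul_le_mul_of_nonneg_left e4 hN0.le
  linarith

theorem sum_Ioc_eq_sum_range' {M : Type*} [AddCommMonoid M] (f : ℕ → M) (p q : ℕ) :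
    ∑ x ∈ Finset.Ioc p q, f x = ∑ i ∈ Finset.range (q - p), f (p + 1 + i) := by
  rw [← Finset.Ico_add_one_add_one_eq_Ioc, Finset.sum_Ico_eq_sum_range]
  congr 2
  omega

theorem tendsto_log_natCast_atTop :
    Filter.Tendsto (fun N : ℕ => Real.log N) Filter.atTop Filter.atTop :=
  Real.tendsto_log_atTop.comp tendsto_natCast_atTop_atTop

theorem exists_norm_sum_Ioc_inv_pow_le {c η γ : ℝ} (hc : 0 < c) (hc2 : c ≤ 1 / 2) (hη : 0 < η)
    (hγ : 0 < γ) {A : ℝ} (hA : 0 ≤ A) : ∃ P₀ : ℕ, ∀ P : ℕ, P₀ ≤ P → ∀ N : ℕ,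
      (P : ℝ) ^ γ ≤ N → ∀ j : ℕ, 1 ≤ j → ∀ Y : ℝ,
      (N : ℝ) ^ (j + c) ≤ |Y| → |Y| ≤ Real.exp (Real.log P ^ (3 / 2 - η)) →
      ∀ p q : ℕ, N ≤ p → q ≤ 8 * N →
        ‖∑ x ∈ Finset.Ioc p q, ef (Y / (x : ℝ) ^ j)‖ ≤ N * Real.log P ^ (-A) := by
  set η' := min η 1 with hη'
  have hη'0 : 0 < η' := lt_min hη one_pos
  have hη'1 : η' ≤ 1 := min_le_right _ _
  have hη'2 : η' ≤ η := min_le_left _ _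
  obtain ⟨N₀, hN₀⟩ := exists_norm_sum_inv_pow_le hc hc2 (show 0 < η' / 2 by linarith) (A + 1)
  have ev1 : ∀ᶠ L : ℝ in Filter.atTop, L ^ (3 / 2 - η) ≤ (γ * L) ^ (3 / 2 - η' / 2) := by
    have h1 := (tendsto_rpow_atTop (show 0 < η' / 2 by linarith)).eventually
      (Filter.eventually_ge_atTop (γ ^ (-(3 / 2 - η' / 2))))
    filter_upwards [h1, Filter.eventually_ge_atTop 1] with L hL hL1
    have hL0 : 0 < L := by linarith
    rw [Real.rpow_neg hγ.le, ← one_div, div_le_iff₀ (Real.rpow_pos_of_pos hγ _)] at hL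
    calc L ^ (3 / 2 - η) ≤ L ^ (3 / 2 - η') :=
          Real.rpow_le_rpow_of_exponent_le hL1 (by linarith)
      _ ≤ L ^ (3 / 2 - η') * (L ^ (η' / 2) * γ ^ (3 / 2 - η' / 2)) :=
          le_mul_of_one_le_right (by positivity) hL
      _ = _ := by
          rw [Real.mul_rpow hγ.le hL0.le, ← mul_assoc, ← Real.rpow_add hL0, mul_comm]
          congr 2
          ring
  have ev2 : ∀ᶠ L : ℝ in Filter.atTop, (γ * L) ^ (-(A + 1)) ≤ L ^ (-A) := by
    filter_upwards [Filter.eventually_ge_atTop (γ ^ (-(A + 1))), Filter.eventually_gt_atTop 0]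
      with L hL hL0
    rw [Real.mul_rpow hγ.le hL0.le, neg_add, Real.rpow_add hL0, Real.rpow_neg_one, ← neg_add]
    calc _ ≤ L * (L ^ (-A) * L⁻¹) := by gcongr
      _ = _ := by field_simp
  have ev3 := (tendsto_rpow_atTop hγ).eventually (Filter.eventually_ge_atTop (N₀ : ℝ))
  obtain ⟨P₀, hP₀⟩ := Filter.eventually_atTop.1 (((tendsto_log_natCast_atTop.eventually ev1).and
    (tendsto_log_natCast_atTop.eventually ev2)).and
    (((tendsto_natCast_atTop_atTop (R := ℝ)).eventually ev3).and
    ((tendsto_log_natCast_atTop.eventually (Filter.eventually_gt_atTop 0)).and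
      (Filter.eventually_ge_atTop 1))))
  refine ⟨P₀, ?_⟩
  intro P hP N hN j hj Y hY1 hY2 p q hp hq
  obtain ⟨⟨h1, h2⟩, h3, h4, h5⟩ := hP₀ P hP
  have hP0 : (0 : ℝ) < P := by exact_mod_cast h5
  have hN0 : N₀ ≤ N := by exact_mod_cast h3.trans hN
  have hNpos : (0 : ℝ) < N := (Real.rpow_pos_of_pos hP0 γ).trans_le hN
  have hlogN : γ * Real.log P ≤ Real.log N := by
    rw [← Real.log_rpow hP0]
    exact Real.log_le_log (Real.rpow_pos_of_pos hP0 γ) hN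
  have hγL : 0 < γ * Real.log P := mul_pos hγ h4
  rcases Nat.lt_or_ge q p with hqp | hqp
  · rw [Finset.Ioc_eq_empty (by omega)]
    simp only [Finset.sum_empty, norm_zero]
    positivity
  have hN1 : 1 ≤ N := by exact_mod_cast hNpos
  have h := hN₀ N hN0 j hj Y hY1 (hY2.trans (Real.exp_le_exp.2 (h1.trans
    (Real.rpow_le_rpow hγL.le hlogN (by linarith))))) (p + 1) (q - p) (by omega) (by omega)
  rw [sum_Ioc_eq_sum_range' (fun x : ℕ => ef (Y / (x : ℝ) ^ j))]
  push_cast at h ⊢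
  refine h.trans (mul_le_mul_of_nonneg_left ?_ hNpos.le)
  refine le_trans ?_ h2
  exact Real.rpow_le_rpow_of_nonpos hγL hlogN (by linarith)

theorem sum_Ioc_sum_divisorsAntidiagonal {M : Type*} [AddCommMonoid M] (F : ℕ → ℕ → M)
    (P Q : ℕ) :
    ∑ n ∈ Finset.Ioc P Q, ∑ x ∈ n.divisorsAntidiagonal, F x.1 x.2 =
      ∑ a ∈ Finset.Icc 1 Q, ∑ l ∈ Finset.Ioc (P / a) (Q / a), F a l := by
  rw [Finset.sum_sigma', Finset.sum_sigma']
  refine Finset.sum_nbij' (fun x => ⟨x.2.1, x.2.2⟩) (fun x => ⟨x.1 * x.2, (x.1, x.2)⟩)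
    ?_ ?_ ?_ ?_ ?_
  · rintro ⟨n, a, l⟩ h
    simp only [Finset.mem_sigma, Finset.mem_Ioc, Nat.mem_divisorsAntidiagonal] at h
    obtain ⟨⟨h1, h2⟩, rfl, h3⟩ := h
    have ha : 0 < a := Nat.pos_of_ne_zero fun h => h3 (by simp [h])
    have hl : 0 < l := Nat.pos_of_ne_zero fun h => h3 (by simp [h])
    simp only [Finset.mem_sigma, Finset.mem_Icc, Finset.mem_Ioc]
    refine ⟨⟨ha, ?_⟩, ?_, ?_⟩
    · nlinarith
    · rw [Nat.div_lt_iff_lt_mul ha]; linarith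
    · rw [Nat.le_div_iff_mul_le ha]; linarith
  · rintro ⟨a, l⟩ h
    simp only [Finset.mem_sigma, Finset.mem_Icc, Finset.mem_Ioc] at h
    obtain ⟨⟨ha, -⟩, h1, h2⟩ := h
    rw [Nat.div_lt_iff_lt_mul ha] at h1
    rw [Nat.le_div_iff_mul_le ha] at h2
    simp only [Finset.mem_sigma, Finset.mem_Ioc, Nat.mem_divisorsAntidiagonal]
    refine ⟨⟨by linarith, by linarith⟩, by trivial, ?_⟩
    intro h0
    rw [mul_comm] at h0
    omega
  · rintro ⟨n, a, l⟩ h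
    simp only [Finset.mem_sigma, Finset.mem_Ioc, Nat.mem_divisorsAntidiagonal] at h
    obtain ⟨-, rfl, -⟩ := h
    rfl
  · intro _ _; rfl
  · intro _ _; rfl

theorem norm_sum_range_mul_le_of_monotone {f : ℕ → ℝ} (hf : Monotone f) (hf0 : ∀ i, 0 ≤ f i)
    (g : ℕ → ℂ) {K : ℝ} (n : ℕ)
    (hg : ∀ m ≤ n, ‖∑ i ∈ Finset.range m, g i‖ ≤ K) :
    ‖∑ i ∈ Finset.range n, (f i : ℂ) * g i‖ ≤ 2 * f n * K := by
  have hK : 0 ≤ K := (norm_nonneg _).trans (hg 0 (by omega))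
  have key : ∀ m ≤ n, ∑ i ∈ Finset.range m, (f i : ℂ) * g i =
      f m * ∑ i ∈ Finset.range m, g i - ∑ i ∈ Finset.range m,
        ((f (i + 1) - f i : ℝ) : ℂ) * ∑ l ∈ Finset.range (i + 1), g l := by
    intro m
    induction m with
    | zero => intro _; simp
    | succ m ih =>
      intro hm
      rw [Finset.sum_range_succ, ih (by omega),
        Finset.sum_range_succ (fun i => ((f (i + 1) - f i : ℝ) : ℂ) * _), Finset.sum_range_succ g]
      push_cast
      ring
  rw [key n le_rfl]
  refine (norm_sub_le _ _).trans ?_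
  have h1 : ‖(f n : ℂ) * ∑ i ∈ Finset.range n, g i‖ ≤ f n * K := by
    rw [norm_mul, Complex.norm_real, Real.norm_of_nonneg (hf0 n)]
    exact mul_le_mul_of_nonneg_left (hg n le_rfl) (hf0 n)
  have h2 : ‖∑ i ∈ Finset.range n, ((f (i + 1) - f i : ℝ) : ℂ) *
      ∑ l ∈ Finset.range (i + 1), g l‖ ≤ (f n - f 0) * K := by
    rw [← Finset.sum_range_sub, Finset.sum_mul]
    refine (norm_sum_le _ _).trans (Finset.sum_le_sum fun i hi => ?_)
    have hd : 0 ≤ f (i + 1) - f i := sub_nonneg.2 (hf (Nat.le_succ i))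
    rw [norm_mul, Complex.norm_real, Real.norm_of_nonneg hd]
    exact mul_le_mul_of_nonneg_left (hg _ (Finset.mem_range.1 hi)) hd
  have h3 : 0 ≤ f 0 * K := mul_nonneg (hf0 0) hK
  linarith

theorem norm_bilinear_sq_le {ι κ : Type*} (s : Finset ι) (t : Finset κ) (a : ι → ℂ) (β : κ → ℂ)
    (k : ι → κ → ℂ) (ha : ∀ i ∈ s, ‖a i‖ ≤ 1) {R : ℝ} (hβ : ∀ m ∈ t, ‖β m‖ ≤ R) :
    ‖∑ i ∈ s, a i * ∑ m ∈ t, β m * k i m‖ ^ 2 ≤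
      s.card * (R ^ 2 * ∑ m₁ ∈ t, ∑ m₂ ∈ t,
        ‖∑ i ∈ s, k i m₁ * (starRingEnd ℂ) (k i m₂)‖) := by
  have h1 : ‖∑ i ∈ s, a i * ∑ m ∈ t, β m * k i m‖ ≤ ∑ i ∈ s, ‖∑ m ∈ t, β m * k i m‖ := by
    refine (norm_sum_le _ _).trans (Finset.sum_le_sum fun i hi => ?_)
    rw [norm_mul]
    exact mul_le_of_le_one_left (norm_nonneg _) (ha i hi)
  have h2 : ((∑ i ∈ s, ‖∑ m ∈ t, β m * k i m‖ ^ 2 : ℝ) : ℂ) = ∑ m₁ ∈ t, ∑ m₂ ∈ t,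
      β m₁ * (starRingEnd ℂ) (β m₂) * ∑ i ∈ s, k i m₁ * (starRingEnd ℂ) (k i m₂) := by
    push_cast
    simp only [← Complex.mul_conj', map_sum, map_mul, Finset.sum_mul_sum]
    rw [Finset.sum_comm]
    refine Finset.sum_congr rfl fun m₁ _ => ?_
    rw [Finset.sum_comm]
    refine Finset.sum_congr rfl fun m₂ _ => ?_
    rw [Finset.mul_sum]
    refine Finset.sum_congr rfl fun i _ => ?_
    ring
  have h3 : ∑ i ∈ s, ‖∑ m ∈ t, β m * k i m‖ ^ 2 ≤ R ^ 2 * ∑ m₁ ∈ t, ∑ m₂ ∈ t,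
        ‖∑ i ∈ s, k i m₁ * (starRingEnd ℂ) (k i m₂)‖ := by
    have h4 := congrArg norm h2
    rw [Complex.norm_real, Real.norm_of_nonneg (by positivity)] at h4
    rw [h4, Finset.mul_sum]
    refine (norm_sum_le _ _).trans (Finset.sum_le_sum fun m₁ hm₁ => ?_)
    rw [Finset.mul_sum]
    refine (norm_sum_le _ _).trans (Finset.sum_le_sum fun m₂ hm₂ => ?_)
    rw [norm_mul, norm_mul, RCLike.norm_conj, sq]
    refine mul_le_mul_of_nonneg_right ?_ (norm_nonneg _)
    exact mul_le_mul (hβ _ hm₁) (hβ _ hm₂) (norm_nonneg _) ((norm_nonneg _).trans (hβ _ hm₁))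
  calc _ ≤ (∑ i ∈ s, ‖∑ m ∈ t, β m * k i m‖) ^ 2 := pow_le_pow_left₀ (norm_nonneg _) h1 2
    _ ≤ s.card * ∑ i ∈ s, ‖∑ m ∈ t, β m * k i m‖ ^ 2 := sq_sum_le_card_mul_sum_sq
    _ ≤ _ := mul_le_mul_of_nonneg_left h3 (by positivity)

section Vaughan

open ArithmeticFunction

/-- The restriction of an arithmetic function to `[1, z]`. -/
def arithTrunc (z : ℕ) (f : ArithmeticFunction ℝ) : ArithmeticFunction ℝ :=
  ⟨fun n => if n ≤ z then f n else 0, by simp⟩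

theorem arithTrunc_apply (z : ℕ) (f : ArithmeticFunction ℝ) (n : ℕ) :
    arithTrunc z f n = if n ≤ z then f n else 0 := rfl

theorem sub_arithTrunc_apply (z : ℕ) (f : ArithmeticFunction ℝ) (n : ℕ) :
    (f - arithTrunc z f) n = if n ≤ z then 0 else f n := by
  rw [sub_eq_add_neg, ArithmeticFunction.add_apply, ArithmeticFunction.neg_apply,
    arithTrunc_apply]
  split_ifs <;> simp

theorem vonMangoldt_eq_vaughan (z : ℕ) :
    (vonMangoldt : ArithmeticFunction ℝ) = arithTrunc z vonMangoldt +
      arithTrunc z (moebius : ArithmeticFunction ℝ) * log -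
      (arithTrunc z (moebius : ArithmeticFunction ℝ) * arithTrunc z vonMangoldt) *
        (zeta : ArithmeticFunction ℝ) +
      ((moebius : ArithmeticFunction ℝ) - arithTrunc z (moebius : ArithmeticFunction ℝ)) *
        ((vonMangoldt - arithTrunc z vonMangoldt) * (zeta : ArithmeticFunction ℝ)) := by
  have h1 : (vonMangoldt : ArithmeticFunction ℝ) * (zeta : ArithmeticFunction ℝ) = log :=
    vonMangoldt_mul_zeta
  have h2 : (moebius : ArithmeticFunction ℝ) * (zeta : ArithmeticFunction ℝ) = 1 :=
    coe_moebius_mul_coe_zeta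
  set M := (moebius : ArithmeticFunction ℝ)
  set Z := (zeta : ArithmeticFunction ℝ)
  set M₁ := arithTrunc z M
  set V₁ := arithTrunc z vonMangoldt
  rw [← h1]
  linear_combination (V₁ - vonMangoldt) * h2

theorem abs_arithTrunc_mul_le (z a : ℕ) :
    |(arithTrunc z (moebius : ArithmeticFunction ℝ) * arithTrunc z vonMangoldt) a| ≤
      Real.log a := by
  rw [mul_apply]
  refine (Finset.abs_sum_le_sum_abs _ _).trans ?_
  calc _ ≤ ∑ x ∈ a.divisorsAntidiagonal, vonMangoldt x.2 := by
        refine Finset.sum_le_sum fun x _ => ?_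
        have hv : |arithTrunc z vonMangoldt x.2| ≤ vonMangoldt x.2 := by
          rw [arithTrunc_apply]
          split_ifs
          · exact (abs_of_nonneg vonMangoldt_nonneg).le
          · simp
        have hm : |arithTrunc z (moebius : ArithmeticFunction ℝ) x.1| ≤ 1 := by
          rw [arithTrunc_apply]
          split_ifs
          · rw [intCoe_apply]
            exact_mod_cast abs_moebius_le_one
          · simp
        rw [abs_mul]
        calc _ ≤ 1 * vonMangoldt x.2 := mul_le_mul hm hv (abs_nonneg _) zero_le_one
          _ = _ := one_mul _
    _ = ∑ d ∈ a.divisors, vonMangoldt d :=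
        Nat.sum_divisorsAntidiagonal' (fun _ d => vonMangoldt d)
    _ = _ := vonMangoldt_sum

theorem arithTrunc_mul_eq_zero {z a : ℕ} (h : z * z < a) :
    (arithTrunc z (moebius : ArithmeticFunction ℝ) * arithTrunc z vonMangoldt) a = 0 := by
  rw [mul_apply]
  refine Finset.sum_eq_zero fun x hx => ?_
  rw [arithTrunc_apply, arithTrunc_apply]
  have h1 := (Nat.mem_divisorsAntidiagonal.1 hx).1
  split_ifs with h2 h3
  · exact absurd (Nat.mul_le_mul h2 h3) (by omega)
  all_goals simp

/-- The coefficients `m ↦ ∑_{b ∣ m, b > z} Λ(b)`. -/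
noncomputable def vaughanCoeff (z m : ℕ) : ℝ :=
  ((vonMangoldt - arithTrunc z vonMangoldt) * (zeta : ArithmeticFunction ℝ)) m

theorem vaughanCoeff_eq (z m : ℕ) :
    vaughanCoeff z m = ∑ b ∈ m.divisors, if b ≤ z then 0 else vonMangoldt b := by
  rw [vaughanCoeff, coe_mul_zeta_apply]
  exact Finset.sum_congr rfl fun b _ => sub_arithTrunc_apply _ _ _

theorem abs_vaughanCoeff_le (z m : ℕ) : |vaughanCoeff z m| ≤ Real.log m := by
  rw [vaughanCoeff_eq, abs_of_nonneg, ← vonMangoldt_sum]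
  · refine Finset.sum_le_sum fun b _ => ?_
    split_ifs
    · exact vonMangoldt_nonneg
    · exact le_rfl
  · refine Finset.sum_nonneg fun b _ => ?_
    split_ifs
    · exact le_rfl
    · exact vonMangoldt_nonneg

theorem vaughanCoeff_eq_zero {z m : ℕ} (h : m ≤ z) : vaughanCoeff z m = 0 := by
  rw [vaughanCoeff_eq]
  refine Finset.sum_eq_zero fun b hb => if_pos ?_
  exact (Nat.divisor_le hb).trans h

theorem sum_vonMangoldt_mul_eq (z P Q : ℕ) (hz : z ≤ P) (w : ℕ → ℂ) :
    ∑ n ∈ Finset.Ioc P Q, (vonMangoldt n : ℂ) * w n =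
      ∑ a ∈ Finset.Icc 1 Q, (arithTrunc z (moebius : ArithmeticFunction ℝ) a : ℂ) *
        ∑ l ∈ Finset.Ioc (P / a) (Q / a), (Real.log l : ℂ) * w (a * l) -
      ∑ a ∈ Finset.Icc 1 Q, ((arithTrunc z (moebius : ArithmeticFunction ℝ) *
        arithTrunc z vonMangoldt) a : ℂ) * ∑ l ∈ Finset.Ioc (P / a) (Q / a), w (a * l) +
      ∑ a ∈ Finset.Icc 1 Q, (((moebius : ArithmeticFunction ℝ) -
        arithTrunc z (moebius : ArithmeticFunction ℝ)) a : ℂ) *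
        ∑ l ∈ Finset.Ioc (P / a) (Q / a), (vaughanCoeff z l : ℂ) * w (a * l) := by
  have hconv : ∀ f g : ArithmeticFunction ℝ, ∑ n ∈ Finset.Ioc P Q, ((f * g) n : ℂ) * w n =
      ∑ a ∈ Finset.Icc 1 Q, (f a : ℂ) * ∑ l ∈ Finset.Ioc (P / a) (Q / a),
        (g l : ℂ) * w (a * l) := by
    intro f g
    simp only [Finset.mul_sum]
    rw [← sum_Ioc_sum_divisorsAntidiagonal (fun a l => (f a : ℂ) * ((g l : ℂ) * w (a * l)))]
    refine Finset.sum_congr rfl fun n _ => ?_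
    rw [mul_apply]
    push_cast
    rw [Finset.sum_mul]
    refine Finset.sum_congr rfl fun x hx => ?_
    rw [(Nat.mem_divisorsAntidiagonal.1 hx).1]
    ring
  have h1 : ∑ n ∈ Finset.Ioc P Q, (vonMangoldt n : ℂ) * w n =
      ∑ n ∈ Finset.Ioc P Q, ((arithTrunc z (moebius : ArithmeticFunction ℝ) * log) n : ℂ) * w n -
      ∑ n ∈ Finset.Ioc P Q, (((arithTrunc z (moebius : ArithmeticFunction ℝ) *
        arithTrunc z vonMangoldt) * (zeta : ArithmeticFunction ℝ)) n : ℂ) * w n +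
      ∑ n ∈ Finset.Ioc P Q, ((((moebius : ArithmeticFunction ℝ) -
        arithTrunc z (moebius : ArithmeticFunction ℝ)) *
        ((vonMangoldt - arithTrunc z vonMangoldt) * (zeta : ArithmeticFunction ℝ))) n : ℂ) *
          w n := by
    rw [← Finset.sum_sub_distrib, ← Finset.sum_add_distrib]
    refine Finset.sum_congr rfl fun n hn => ?_
    have hn' := Finset.mem_Ioc.1 hn
    have h2 := congrArg (fun f : ArithmeticFunction ℝ => f n) (vonMangoldt_eq_vaughan z)
    simp only [sub_eq_add_neg, ArithmeticFunction.add_apply, ArithmeticFunction.neg_apply]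
      at h2 ⊢
    rw [arithTrunc_apply, if_neg (by omega), zero_add] at h2
    rw [h2]
    push_cast
    ring
  rw [h1, hconv, hconv, hconv]
  congr 2
  refine Finset.sum_congr rfl fun a _ => ?_
  congr 1
  refine Finset.sum_congr rfl fun l hl => ?_
  have hl0 : l ≠ 0 := 
    Nat.ne_of_gt (lt_of_le_of_lt (Nat.zero_le _) (Finset.mem_Ioc.1 hl).1)
  rw [natCoe_apply, zeta_apply_ne hl0]
  simp

theorem norm_sum_vonMangoldt_mul_le {z P Q : ℕ} (hz : z ≤ P) (w : ℕ → ℂ) :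
    ‖∑ n ∈ Finset.Ioc P Q, (vonMangoldt n : ℂ) * w n‖ ≤
      ∑ a ∈ Finset.Icc 1 z, ‖∑ l ∈ Finset.Ioc (P / a) (Q / a), (Real.log l : ℂ) * w (a * l)‖ +
      ∑ a ∈ Finset.Icc 1 (z * z), Real.log a * ‖∑ l ∈ Finset.Ioc (P / a) (Q / a), w (a * l)‖ +
      ‖∑ d ∈ Finset.Ioc z Q, (((moebius d : ℤ) : ℝ) : ℂ) * ∑ m ∈ Finset.Ioc z Q,
        (vaughanCoeff z m : ℂ) * if P < d * m ∧ d * m ≤ Q then w (d * m) else 0‖ := by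
  rw [sum_vonMangoldt_mul_eq z P Q hz w]
  refine (norm_add_le _ _).trans (add_le_add ((norm_sub_le _ _).trans (add_le_add ?_ ?_)) ?_)
  · refine (norm_sum_le _ _).trans ?_
    have h0 : ∀ a ∈ Finset.Icc 1 Q, ‖(arithTrunc z (moebius : ArithmeticFunction ℝ) a : ℂ) *
        ∑ l ∈ Finset.Ioc (P / a) (Q / a), (Real.log l : ℂ) * w (a * l)‖ ≤
        if a ∈ Finset.Icc 1 z then
          ‖∑ l ∈ Finset.Ioc (P / a) (Q / a), (Real.log l : ℂ) * w (a * l)‖ else 0 := by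
      intro a ha
      rw [norm_mul, Complex.norm_real, Real.norm_eq_abs, arithTrunc_apply]
      by_cases h1 : a ≤ z
      · rw [if_pos h1, if_pos (Finset.mem_Icc.2 ⟨(Finset.mem_Icc.1 ha).1, h1⟩)]
        refine mul_le_of_le_one_left (norm_nonneg _) ?_
        rw [intCoe_apply]
        exact_mod_cast abs_moebius_le_one
      · rw [if_neg h1, if_neg fun h => h1 (Finset.mem_Icc.1 h).2]
        simp
    refine (Finset.sum_le_sum h0).trans ?_
    rw [Finset.sum_ite_mem]
    exact Finset.sum_le_sum_of_subset_of_nonneg Finset.inter_subset_right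
      fun _ _ _ => norm_nonneg _
  · refine (norm_sum_le _ _).trans ?_
    have h0 : ∀ a ∈ Finset.Icc 1 Q, ‖((arithTrunc z (moebius : ArithmeticFunction ℝ) *
        arithTrunc z vonMangoldt) a : ℂ) * ∑ l ∈ Finset.Ioc (P / a) (Q / a), w (a * l)‖ ≤
        if a ∈ Finset.Icc 1 (z * z) then
          Real.log a * ‖∑ l ∈ Finset.Ioc (P / a) (Q / a), w (a * l)‖ else 0 := by
      intro a ha
      rw [norm_mul, Complex.norm_real, Real.norm_eq_abs]
      split_ifs with h1
      · exact mul_le_mul_of_nonneg_right (abs_arithTrunc_mul_le z a) (norm_nonneg _)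
      · rw [arithTrunc_mul_eq_zero]
        · simp
        · rw [Finset.mem_Icc] at h1 ha; omega
    refine (Finset.sum_le_sum h0).trans ?_
    rw [Finset.sum_ite_mem]
    exact Finset.sum_le_sum_of_subset_of_nonneg Finset.inter_subset_right
      fun _ _ _ => mul_nonneg (Real.log_natCast_nonneg _) (norm_nonneg _)
  · refine le_of_eq (congrArg norm ?_)
    rw [← Finset.sum_subset (s₁ := Finset.Ioc z Q) (s₂ := Finset.Icc 1 Q)]
    · refine Finset.sum_congr rfl fun d hd => ?_
      have hd' := Finset.mem_Ioc.1 hd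
      have hd0 : 0 < d := by omega
      rw [sub_arithTrunc_apply, if_neg (by omega), intCoe_apply]
      congr 1
      have h1 : ∀ m, (vaughanCoeff z m : ℂ) * (if P < d * m ∧ d * m ≤ Q then w (d * m) else 0) =
          if P < d * m ∧ d * m ≤ Q then (vaughanCoeff z m : ℂ) * w (d * m) else 0 := by
        intro m; split_ifs <;> simp
      simp only [h1]
      rw [← Finset.sum_filter]
      symm
      refine Finset.sum_subset ?_ ?_
      · intro m hm
        obtain ⟨-, h2, h3⟩ := Finset.mem_filter.1 hm
        rw [Finset.mem_Ioc, Nat.div_lt_iff_lt_mul hd0, Nat.le_div_iff_mul_le hd0, mul_comm m]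
        exact ⟨h2, h3⟩
      · intro m hm hm2
        rw [Finset.mem_Ioc, Nat.div_lt_iff_lt_mul hd0, Nat.le_div_iff_mul_le hd0, mul_comm m] at hm
        rw [vaughanCoeff_eq_zero]
        · simp
        · by_contra hmz
          refine hm2 (Finset.mem_filter.2 ⟨Finset.mem_Ioc.2 ⟨by omega, ?_⟩, hm⟩)
          exact le_trans (Nat.le_mul_of_pos_left m hd0) hm.2
    · intro d hd
      have := Finset.mem_Ioc.1 hd
      exact Finset.mem_Icc.2 ⟨by omega, this.2⟩
    · intro d hd hd2
      rw [sub_arithTrunc_apply, if_pos]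
      · simp
      · rw [Finset.mem_Icc] at hd
        rw [Finset.mem_Ioc] at hd2
        omega

end Vaughan

section TypeTwo

theorem ef_mul_conj_ef (x y : ℝ) : ef x * (starRingEnd ℂ) (ef y) = ef (x - y) := by
  rw [← ef_neg, ← ef_add, sub_eq_add_neg]

/-- The product of two kernels of a dyadic bilinear sum is again an exponential sum. -/
theorem sum_hyperbola_mul_conj_eq {P Q D m₁ m₂ : ℕ} (h₁ : 0 < m₁) (h₂ : 0 < m₂) (B : ℝ) :
    ∑ d ∈ Finset.Ioc D (2 * D),
      (if P < d * m₁ ∧ d * m₁ ≤ Q then ef (B / ((d * m₁ : ℕ) : ℝ)) else 0) *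
      (starRingEnd ℂ) (if P < d * m₂ ∧ d * m₂ ≤ Q then ef (B / ((d * m₂ : ℕ) : ℝ)) else 0) =
    ∑ d ∈ Finset.Ioc (max D (max (P / m₁) (P / m₂))) (min (2 * D) (min (Q / m₁) (Q / m₂))),
      ef (B * (1 / m₁ - 1 / m₂) / (d : ℝ) ^ 1) := by
  symm
  have hm : ∀ d, d ∈ Finset.Ioc (max D (max (P / m₁) (P / m₂)))
      (min (2 * D) (min (Q / m₁) (Q / m₂))) ↔ d ∈ Finset.Ioc D (2 * D) ∧
      (P < d * m₁ ∧ d * m₁ ≤ Q) ∧ (P < d * m₂ ∧ d * m₂ ≤ Q) := by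
    intro d
    simp only [Finset.mem_Ioc, max_lt_iff, le_min_iff, Nat.div_lt_iff_lt_mul h₁,
      Nat.div_lt_iff_lt_mul h₂, Nat.le_div_iff_mul_le h₁, Nat.le_div_iff_mul_le h₂]
    tauto
  rw [← Finset.sum_subset (s₁ := Finset.Ioc (max D (max (P / m₁) (P / m₂)))
    (min (2 * D) (min (Q / m₁) (Q / m₂)))) (s₂ := Finset.Ioc D (2 * D))]
  · refine Finset.sum_congr rfl fun d hd => ?_
    obtain ⟨-, h3, h4⟩ := (hm d).1 hd
    rw [if_pos h3, if_pos h4, ef_mul_conj_ef]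
    congr 1
    have hm1 : (m₁ : ℝ) ≠ 0 := by positivity
    have hm2 : (m₂ : ℝ) ≠ 0 := by positivity
    have hd0 : (d : ℝ) ≠ 0 := by
      rintro h
      have : d = 0 := by exact_mod_cast h
      subst this
      simp at h3
    push_cast
    field_simp
  · exact fun d hd => ((hm d).1 hd).1
  · intro d hd hd2
    by_cases h3 : P < d * m₁ ∧ d * m₁ ≤ Q
    · rw [if_neg fun h4 => hd2 ((hm d).2 ⟨hd, h3, h4⟩)]
      simp
    · rw [if_neg h3, zero_mul]

theorem card_filter_abs_sub_lt_le (t : Finset ℕ) (m : ℕ) {δ : ℝ} (hδ : 0 ≤ δ) :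
    ((t.filter fun m' : ℕ => |(m : ℝ) - m'| < δ).card : ℝ) ≤ 2 * δ + 1 := by
  have h := card_Icc_int_real_le ((t.filter fun m' : ℕ => |(m : ℝ) - m'| < δ).image
    ((↑) : ℕ → ℤ)) (x := m - δ) (y := m + δ) (by linarith) ?_
  · rw [Finset.card_image_of_injective _ Nat.cast_injective] at h
    linarith
  · intro n hn
    obtain ⟨m', hm', rfl⟩ := Finset.mem_image.1 hn
    have := abs_lt.1 (Finset.mem_filter.1 hm').2
    push_cast
    constructor <;> linarith

theorem norm_hyperbola_block_sq_le {P Q D : ℕ} {t : Finset ℕ} {B R V δ M : ℝ} (hδ : 0 ≤ δ)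
    (hV : 0 ≤ V) (ht : ∀ m ∈ t, 0 < m) (htM : (t.card : ℝ) ≤ M) (a β : ℕ → ℂ)
    (ha : ∀ d, ‖a d‖ ≤ 1) (hβ : ∀ m ∈ t, ‖β m‖ ≤ R)
    (hfar : ∀ m₁ ∈ t, ∀ m₂ ∈ t, δ ≤ |(m₁ : ℝ) - m₂| → ∀ p q : ℕ, D ≤ p → q ≤ 2 * D →
      ‖∑ d ∈ Finset.Ioc p q, ef (B * (1 / m₁ - 1 / m₂) / (d : ℝ) ^ 1)‖ ≤ V) :
    ‖∑ d ∈ Finset.Ioc D (2 * D), a d * ∑ m ∈ t,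
      β m * if P < d * m ∧ d * m ≤ Q then ef (B / ((d * m : ℕ) : ℝ)) else 0‖ ^ 2 ≤
      D * (R ^ 2 * (M * (M * V + (2 * δ + 1) * D))) := by
  have hM : 0 ≤ M := (Nat.cast_nonneg _).trans htM
  refine (norm_bilinear_sq_le _ t a β _ (fun d _ => ha d) hβ).trans ?_
  rw [Nat.card_Ioc, show 2 * D - D = D by omega]
  refine mul_le_mul_of_nonneg_left (mul_le_mul_of_nonneg_left ?_ (sq_nonneg R))
    (Nat.cast_nonneg _)
  have hin : ∀ m₁ ∈ t, ∑ m₂ ∈ t, ‖∑ d ∈ Finset.Ioc D (2 * D),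
      (if P < d * m₁ ∧ d * m₁ ≤ Q then ef (B / ((d * m₁ : ℕ) : ℝ)) else 0) *
      (starRingEnd ℂ) (if P < d * m₂ ∧ d * m₂ ≤ Q then ef (B / ((d * m₂ : ℕ) : ℝ)) else 0)‖ ≤
      M * V + (2 * δ + 1) * D := by
    intro m₁ h₁
    calc _ ≤ ∑ m₂ ∈ t, (V + if |(m₁ : ℝ) - m₂| < δ then (D : ℝ) else 0) := by
          refine Finset.sum_le_sum fun m₂ h₂ => ?_
          rw [sum_hyperbola_mul_conj_eq (ht _ h₁) (ht _ h₂)]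
          split_ifs with h
          · refine le_trans ?_ (le_add_of_nonneg_left hV)
            refine (norm_sum_le _ _).trans ?_
            simp only [norm_ef, Finset.sum_const, nsmul_eq_mul, mul_one, Nat.card_Ioc]
            exact_mod_cast (by omega : min (2 * D) (min (Q / m₁) (Q / m₂)) -
              max D (max (P / m₁) (P / m₂)) ≤ D)
          · rw [add_zero]
            exact hfar _ h₁ _ h₂ (not_lt.1 h) _ _ (le_max_left _ _) (min_le_left _ _)
      _ = t.card * V + ((t.filter fun m' : ℕ => |(m₁ : ℝ) - m'| < δ).card : ℝ) * D := by
          rw [Finset.sum_add_distrib, ← Finset.sum_filter]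
          simp
      _ ≤ _ := by
          gcongr
          exact card_filter_abs_sub_lt_le t m₁ hδ
  refine (Finset.sum_le_sum hin).trans ?_
  rw [Finset.sum_const, nsmul_eq_mul]
  refine mul_le_mul_of_nonneg_right htM (by positivity)

end TypeTwo

theorem eventually_mul_rpow_neg_le_log_rpow {a : ℝ} (ha : 0 < a) (A K : ℝ) :
    ∀ᶠ P : ℕ in Filter.atTop, K * (P : ℝ) ^ (-a) ≤ Real.log P ^ (-A) := by
  filter_upwards [tendsto_log_natCast_atTop.eventually
    (eventually_mul_exp_neg_mul_rpow_le ha one_pos A K), Filter.eventually_gt_atTop 0] with P h hP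
  have hP0 : (0 : ℝ) < P := by exact_mod_cast hP
  refine le_trans (le_of_eq ?_) h
  rw [Real.rpow_one, Real.rpow_def_of_pos hP0]
  congr 2
  ring

theorem norm_sum_Ioc_le_of_dyadic {G : ℕ → ℂ} {z Q I : ℕ} {K : ℝ} (h0 : ∀ d, Q < d → G d = 0)
    (hQ : Q ≤ z * 2 ^ I)
    (hK : ∀ D, z ≤ D → ‖∑ d ∈ Finset.Ioc D (2 * D), G d‖ ≤ K) :
    ‖∑ d ∈ Finset.Ioc z Q, G d‖ ≤ I * K := by
  have h1 : ∑ d ∈ Finset.Ioc z Q, G d = ∑ d ∈ Finset.Ioc z (z * 2 ^ I), G d := by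
    refine Finset.sum_subset (Finset.Ioc_subset_Ioc_right hQ) fun d hd hd2 => h0 d ?_
    rw [Finset.mem_Ioc] at hd hd2
    omega
  have h2 : ∀ J : ℕ, ‖∑ d ∈ Finset.Ioc z (z * 2 ^ J), G d‖ ≤ J * K := by
    intro J
    induction J with
    | zero => simp
    | succ J ih =>
      have hz : z ≤ z * 2 ^ J := Nat.le_mul_of_pos_right _ (by positivity)
      rw [← Finset.sum_Ioc_consecutive G hz
        (show z * 2 ^ J ≤ z * 2 ^ (J + 1) by rw [pow_succ]; nlinarith)]
      have h3 := hK (z * 2 ^ J) hz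
      rw [show 2 * (z * 2 ^ J) = z * 2 ^ (J + 1) by ring] at h3
      refine (norm_add_le _ _).trans ?_
      push_cast
      linarith
  rw [h1]
  exact h2 I

set_option maxHeartbeats 1000000 in
theorem exists_norm_hyperbola_block_le {c η A : ℝ} (hc : 0 < c) (hc2 : c ≤ 1 / 2) (hη : 0 < η)
    (hA : 0 ≤ A) : ∃ P₀ : ℕ, ∀ P : ℕ, P₀ ≤ P → ∀ B : ℝ, (P : ℝ) ^ (1 + c) ≤ |B| →
      |B| ≤ Real.exp (Real.log P ^ (3 / 2 - η)) → ∀ z D : ℕ, (P : ℝ) ^ (1 / 4 : ℝ) ≤ z → z ≤ D →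
      ∀ a β : ℕ → ℂ, (∀ d, ‖a d‖ ≤ 1) → (∀ m, ‖β m‖ ≤ Real.log m) →
      ‖∑ d ∈ Finset.Ioc D (2 * D), a d * ∑ m ∈ Finset.Ioc z (4 * P),
        β m * if P < d * m ∧ d * m ≤ 4 * P then ef (B / ((d * m : ℕ) : ℝ)) else 0‖ ≤
      P * Real.log P ^ (-A) := by
  obtain ⟨P₁, hP₁⟩ := exists_norm_sum_Ioc_inv_pow_le (c := c / 4) (γ := 1 / 4) (by linarith)
    (by linarith) hη (by norm_num) (A := 2 * A + 3) (by linarith)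
  have ev1 := eventually_mul_rpow_neg_le_log_rpow (show 0 < c / 2 by linarith) (2 * A + 3) 24
  have ev2 := (tendsto_rpow_atTop (show 0 < c / 4 by linarith)).comp
    (tendsto_natCast_atTop_atTop (R := ℝ)) |>.eventually (Filter.eventually_ge_atTop 16)
  obtain ⟨P₀, hP₀⟩ := Filter.eventually_atTop.1 ((ev1.and ev2).and
    ((tendsto_log_natCast_atTop.eventually (Filter.eventually_ge_atTop 68)).and
      (Filter.eventually_ge_atTop 256)))
  refine ⟨max P₀ P₁, ?_⟩
  intro P hP B hB1 hB2 z D hz hzD a β ha hβ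
  obtain ⟨⟨h1, h2⟩, h3, h4⟩ := hP₀ P ((le_max_left _ _).trans hP)
  have hmain := hP₁ P ((le_max_right _ _).trans hP)
  simp only [Function.comp] at h2
  have hPge : (256 : ℝ) ≤ P := by exact_mod_cast h4
  have hP0 : (0 : ℝ) < P := by linarith
  set L := Real.log P with hL
  have hL0 : 0 < L := by linarith
  have hzpos : (0 : ℝ) < z := (Real.rpow_pos_of_pos hP0 _).trans_le hz
  have hz1 : 0 < z := by exact_mod_cast hzpos
  have hDpos : (0 : ℝ) < D := by exact_mod_cast hz1.trans_le hzD
  have hD1 : 0 < D := by exact_mod_cast hDpos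
  have hzD' : (z : ℝ) ≤ D := by exact_mod_cast hzD
  set t := (Finset.Ioc z (4 * P)).filter fun m => D * m ≤ 4 * P with ht
  have hred : ∀ d ∈ Finset.Ioc D (2 * D), a d * ∑ m ∈ Finset.Ioc z (4 * P),
        (β m * if P < d * m ∧ d * m ≤ 4 * P then ef (B / ((d * m : ℕ) : ℝ)) else 0) =
      a d * ∑ m ∈ t, β m * if P < d * m ∧ d * m ≤ 4 * P then ef (B / ((d * m : ℕ) : ℝ)) else 0 := by
    intro d hd
    congr 1
    symm
    refine Finset.sum_subset (Finset.filter_subset _ _) fun m hm hm2 => ?_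
    rw [if_neg, mul_zero]
    rintro ⟨-, h5⟩
    refine hm2 (Finset.mem_filter.2 ⟨hm, ?_⟩)
    exact (Nat.mul_le_mul_right m (Finset.mem_Ioc.1 hd).1.le).trans h5
  rw [Finset.sum_congr rfl hred]
  rcases t.eq_empty_or_nonempty with hte | ⟨m₀, hm₀⟩
  · rw [hte]
    simp only [Finset.sum_empty, mul_zero, Finset.sum_const_zero, norm_zero]
    positivity
  have hDz : (D : ℝ) * z ≤ 4 * P := by
    have h5 := Finset.mem_filter.1 hm₀
    have h6 : D * z ≤ 4 * P := (Nat.mul_le_mul_left D (Finset.mem_Ioc.1 h5.1).1.le).trans h5.2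
    exact_mod_cast h6
  have hq : (P : ℝ) ^ (1 / 4 : ℝ) * (P : ℝ) ^ (3 / 4 : ℝ) = P := by
    rw [← Real.rpow_add hP0]; norm_num
  have hq4 : (4 : ℝ) ≤ (P : ℝ) ^ (1 / 4 : ℝ) := by
    calc (4 : ℝ) = (4 ^ (4 : ℝ)) ^ (1 / 4 : ℝ) := by
          rw [← Real.rpow_mul (by norm_num)]; norm_num
      _ ≤ _ := Real.rpow_le_rpow (by positivity) (by norm_num; linarith) (by norm_num)
  have hD34 : (D : ℝ) ≤ 4 * (P : ℝ) ^ (3 / 4 : ℝ) := by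
    have h5 : (D : ℝ) * (P : ℝ) ^ (1 / 4 : ℝ) ≤ (4 * (P : ℝ) ^ (3 / 4 : ℝ)) *
        (P : ℝ) ^ (1 / 4 : ℝ) := by nlinarith
    exact le_of_mul_le_mul_right h5 (by positivity)
  have hDP : (D : ℝ) ≤ P := by
    nlinarith [Real.rpow_pos_of_pos hP0 (3 / 4 : ℝ)]
  have hDle : (D : ℝ) ≤ 4 * (P : ℝ) ^ (1 - c / 2) := by
    refine hD34.trans ?_
    gcongr
    · linarith
    · linarith
  set V := L ^ (-(2 * A + 3)) with hV
  have hV0 : 0 < V := Real.rpow_pos_of_pos hL0 _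
  have htm : ∀ m ∈ t, 0 < m ∧ (D : ℝ) * m ≤ 4 * P ∧ m ≤ 4 * P := by
    intro m hm
    have h5 := Finset.mem_filter.1 hm
    have h6 := Finset.mem_Ioc.1 h5.1
    exact ⟨by omega, by exact_mod_cast h5.2, h6.2⟩
  have htcard : (t.card : ℝ) ≤ 4 * P / D := by
    have h5 : t ⊆ Finset.Ioc 0 (4 * P / D) := by
      intro m hm
      refine Finset.mem_Ioc.2 ⟨(htm m hm).1, (Nat.le_div_iff_mul_le hD1).2 ?_⟩
      rw [mul_comm]
      exact (Finset.mem_filter.1 hm).2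
    have h6 := Finset.card_le_card h5
    rw [Nat.card_Ioc, Nat.sub_zero] at h6
    calc (t.card : ℝ) ≤ ((4 * P / D : ℕ) : ℝ) := by exact_mod_cast h6
      _ ≤ ((4 * P : ℕ) : ℝ) / D := Nat.cast_div_le
      _ = _ := by push_cast; ring
  have hR : ∀ m ∈ t, ‖β m‖ ≤ 2 * L := by
    intro m hm
    obtain ⟨h5, -, h6⟩ := htm m hm
    refine (hβ m).trans ?_
    have h7 : (m : ℝ) ≤ (P : ℝ) ^ 2 := by
      have : (m : ℝ) ≤ 4 * P := by exact_mod_cast h6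
      nlinarith
    have h8 := Real.log_le_log (by exact_mod_cast h5) h7
    rwa [Real.log_pow] at h8
  have hblock := norm_hyperbola_block_sq_le (P := P) (Q := 4 * P) (D := D) (t := t) (B := B)
    (R := 2 * L) (V := D * V) (δ := (P : ℝ) ^ (1 - c / 2) / D) (M := 4 * P / D) (by positivity)
    (by positivity) (fun m hm => (htm m hm).1) htcard a β ha hR ?_
  · have hsq : (D : ℝ) * ((2 * L) ^ 2 * (4 * P / D * (4 * P / D * (D * V) +
        (2 * ((P : ℝ) ^ (1 - c / 2) / D) + 1) * D))) =
        4 * L ^ 2 * (16 * P ^ 2 * V + 4 * P * (2 * (P : ℝ) ^ (1 - c / 2) + D)) := by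
      field_simp
      ring
    rw [hsq] at hblock
    have h5 : 24 * (P : ℝ) ^ (1 - c / 2) ≤ P * V := by
      rw [sub_eq_add_neg, Real.rpow_add hP0, Real.rpow_one]
      nlinarith
    have h6 : 16 * (P : ℝ) ^ 2 * V + 4 * P * (2 * (P : ℝ) ^ (1 - c / 2) + D) ≤
        17 * P ^ 2 * V := by nlinarith
    have h7 : 68 * (L ^ 2 * V) ≤ (L ^ (-A)) ^ 2 := by
      have h8 : L ^ 3 * V = (L ^ (-A)) ^ 2 := by
        rw [hV, ← Real.rpow_natCast, ← Real.rpow_natCast, ← Real.rpow_add hL0,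
          ← Real.rpow_mul hL0.le]
        congr 1
        push_cast
        ring
      rw [← h8]
      have : 0 < L ^ 2 * V := by positivity
      rw [show L ^ 3 * V = L * (L ^ 2 * V) by ring]
      exact mul_le_mul_of_nonneg_right h3 this.le
    refine abs_le_of_sq_le_sq' ?_ (by positivity) |>.2
    calc _ ≤ _ := hblock
      _ ≤ 4 * L ^ 2 * (17 * P ^ 2 * V) := by gcongr
      _ = P ^ 2 * (68 * (L ^ 2 * V)) := by ring
      _ ≤ P ^ 2 * (L ^ (-A)) ^ 2 := by gcongr
      _ = _ := by ring
  · intro m₁ hm₁ m₂ hm₂ hδ p q hp hq'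
    obtain ⟨h5, h6, -⟩ := htm _ hm₁
    obtain ⟨h7, h8, -⟩ := htm _ hm₂
    have hm1 : (1 : ℝ) ≤ m₁ := by exact_mod_cast h5
    have hm2 : (1 : ℝ) ≤ m₂ := by exact_mod_cast h7
    have hY : |B * (1 / m₁ - 1 / m₂)| = |B| * (|(m₁ : ℝ) - m₂| / (m₁ * m₂)) := by
      rw [abs_mul, div_sub_div _ _ (by positivity) (by positivity), abs_div, abs_sub_comm,
        abs_of_pos (show (0 : ℝ) < m₁ * m₂ by positivity)]
      ring_nf
    refine hmain D (hz.trans hzD') 1 le_rfl _ ?_ ?_ p q hp (by omega)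
    · rw [hY]
      have h9 : (D : ℝ) ^ 2 * (m₁ * m₂) ≤ 16 * P ^ 2 := by
        have := mul_le_mul h6 h8 (by positivity) (by positivity)
        nlinarith
      have h10 : (D : ℝ) ^ (c / 4) ≤ (P : ℝ) ^ (c / 4) :=
        Real.rpow_le_rpow hDpos.le hDP (by linarith)
      have h11 : (P : ℝ) ^ (c / 4) * (P : ℝ) ^ (c / 4) = (P : ℝ) ^ (c / 2) := by
        rw [← Real.rpow_add hP0]; ring_nf
      have h12 : (P : ℝ) ^ (1 + c) * (P : ℝ) ^ (1 - c / 2) = P ^ 2 * (P : ℝ) ^ (c / 2) := by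
        rw [← Real.rpow_natCast, ← Real.rpow_add hP0, ← Real.rpow_add hP0]
        congr 1
        push_cast
        ring
      rw [Nat.cast_one, Real.rpow_add hDpos, Real.rpow_one, ← mul_div_assoc,
        le_div_iff₀ (by positivity)]
      rw [div_le_iff₀ hDpos] at hδ
      have h13 : (P : ℝ) ^ 2 * (P : ℝ) ^ (c / 2) ≤ |B| * |(m₁ : ℝ) - m₂| * D := by
        rw [← h12, mul_assoc]
        exact mul_le_mul hB1 hδ (by positivity) (abs_nonneg _)
      have h14 : 16 * (D : ℝ) ^ (c / 4) ≤ (P : ℝ) ^ (c / 2) := by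
        rw [← h11]
        exact mul_le_mul h2 h10 (by positivity) (by positivity)
      refine le_of_mul_le_mul_right ?_ hDpos
      calc (D : ℝ) * (D : ℝ) ^ (c / 4) * (m₁ * m₂) * D =
            (D : ℝ) ^ (c / 4) * ((D : ℝ) ^ 2 * (m₁ * m₂)) := by ring
        _ ≤ (D : ℝ) ^ (c / 4) * (16 * P ^ 2) := by gcongr
        _ = P ^ 2 * (16 * (D : ℝ) ^ (c / 4)) := by ring
        _ ≤ P ^ 2 * (P : ℝ) ^ (c / 2) := by gcongr
        _ ≤ _ := h13
    · refine le_trans ?_ hB2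
      rw [abs_mul]
      refine mul_le_of_le_one_right (abs_nonneg _) ?_
      have h9 : 1 / (m₁ : ℝ) ≤ 1 := by rw [div_le_one (by linarith)]; exact hm1
      have h10 : 1 / (m₂ : ℝ) ≤ 1 := by rw [div_le_one (by linarith)]; exact hm2
      have h11 : 0 < 1 / (m₁ : ℝ) := by positivity
      have h12 : 0 < 1 / (m₂ : ℝ) := by positivity
      rw [abs_le]
      constructor <;> linarith

theorem exists_norm_sum_Ioc_div_mul_le {c η A : ℝ} (hc : 0 < c) (hc2 : c ≤ 1 / 2) (hη : 0 < η)
    (hA : 0 ≤ A) : ∃ P₀ : ℕ, ∀ P : ℕ, P₀ ≤ P → ∀ B : ℝ, (P : ℝ) ^ (1 + c) ≤ |B| →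
      |B| ≤ Real.exp (Real.log P ^ (3 / 2 - η)) → ∀ a : ℕ, 1 ≤ a → (a : ℝ) ≤ P ^ (2 / 3 : ℝ) →
      ∀ q : ℕ, q ≤ 4 * P / a → ‖∑ l ∈ Finset.Ioc (P / a) q, ef (B / ((a * l : ℕ) : ℝ))‖ ≤
        (P : ℝ) / a * Real.log P ^ (-A) := by
  obtain ⟨P₁, hP₁⟩ := exists_norm_sum_Ioc_inv_pow_le (γ := 1 / 4) hc hc2 hη (by norm_num) hA
  have ev := (tendsto_rpow_atTop (show (0 : ℝ) < 1 / 12 by norm_num)).comp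
    (tendsto_natCast_atTop_atTop (R := ℝ)) |>.eventually (Filter.eventually_ge_atTop 2)
  obtain ⟨P₀, hP₀⟩ := Filter.eventually_atTop.1 (ev.and (Filter.eventually_ge_atTop 3))
  refine ⟨max P₀ P₁, ?_⟩
  intro P hP B hB1 hB2 a ha haP q hq
  obtain ⟨h1, h2⟩ := hP₀ P ((le_max_left _ _).trans hP)
  simp only [Function.comp] at h1
  have hP3 : (3 : ℝ) ≤ P := by exact_mod_cast h2
  have hP0 : (0 : ℝ) < P := by linarith
  have ha1 : (1 : ℝ) ≤ a := by exact_mod_cast ha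
  have ha0 : (0 : ℝ) < a := by linarith
  have hL0 : 0 < Real.log P := Real.log_pos (by linarith)
  have hPa : (P : ℝ) ^ (1 / 3 : ℝ) ≤ P / a := by
    rw [le_div_iff₀ ha0]
    calc (P : ℝ) ^ (1 / 3 : ℝ) * a ≤ (P : ℝ) ^ (1 / 3 : ℝ) * (P : ℝ) ^ (2 / 3 : ℝ) := by gcongr
      _ = P := by rw [← Real.rpow_add hP0]; norm_num
  have hN1 : (P : ℝ) / a < (P / a : ℕ) + 1 := by
    rw [div_lt_iff₀ ha0]
    have h3 : P < (P / a + 1) * a := by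
      rw [← Nat.div_lt_iff_lt_mul (by omega)]; omega
    exact_mod_cast h3
  have hN2 : ((P / a : ℕ) : ℝ) ≤ P / a := Nat.cast_div_le
  have h13 : (P : ℝ) ^ (1 / 3 : ℝ) = (P : ℝ) ^ (1 / 12 : ℝ) * (P : ℝ) ^ (1 / 4 : ℝ) := by
    rw [← Real.rpow_add hP0]; norm_num
  have h14 : (1 : ℝ) ≤ (P : ℝ) ^ (1 / 4 : ℝ) := Real.one_le_rpow (by linarith) (by norm_num)
  have hN : (P : ℝ) ^ (1 / 4 : ℝ) ≤ (P / a : ℕ) := by nlinarith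
  have hNone : 1 ≤ P / a := by exact_mod_cast h14.trans hN
  have hform : ∀ l : ℕ, ef (B / ((a * l : ℕ) : ℝ)) = ef (B / a / (l : ℝ) ^ 1) := by
    intro l
    rw [pow_one, div_div]
    push_cast
    rfl
  simp only [hform]
  have hq8 : q ≤ 8 * (P / a) := by
    have h3 : P < (P / a + 1) * a := by
      rw [← Nat.div_lt_iff_lt_mul (by omega)]; omega
    have h4 : 4 * P / a < 4 * (P / a) + 4 := by
      rw [Nat.div_lt_iff_lt_mul (by omega)]
      nlinarith
    omega
  refine (hP₁ P ((le_max_right _ _).trans hP) (P / a) hN 1 le_rfl (B / a) ?_ ?_ _ q le_rfl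
    hq8).trans ?_
  · rw [abs_div, abs_of_pos ha0, le_div_iff₀ ha0, Nat.cast_one]
    refine le_trans ?_ hB1
    calc ((P / a : ℕ) : ℝ) ^ (1 + c) * a ≤ (P / a : ℝ) ^ (1 + c) * (a : ℝ) ^ (1 + c) := by
          gcongr
          exact Real.self_le_rpow_of_one_le ha1 (by linarith)
      _ = _ := by
          rw [← Real.mul_rpow (by positivity) ha0.le, div_mul_cancel₀ _ ha0.ne']
  · refine le_trans ?_ hB2
    rw [abs_div, abs_of_pos ha0]
    exact div_le_self (abs_nonneg _) ha1
  · gcongr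

theorem norm_sum_Ioc_log_mul_le {p q : ℕ} {g : ℕ → ℂ} {K : ℝ} (hpq : p ≤ q)
    (hK : ∀ q' ≤ q, ‖∑ l ∈ Finset.Ioc p q', g l‖ ≤ K) :
    ‖∑ l ∈ Finset.Ioc p q, (Real.log l : ℂ) * g l‖ ≤ 2 * Real.log (q + 1) * K := by
  rw [sum_Ioc_eq_sum_range' (fun l => (Real.log l : ℂ) * g l)]
  have hmono : Monotone fun i : ℕ => Real.log ((p + 1 + i : ℕ) : ℝ) := by
    intro i j hij
    refine Real.log_le_log (by positivity) ?_
    exact_mod_cast (by omega)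
  have h := norm_sum_range_mul_le_of_monotone hmono (fun i => Real.log_natCast_nonneg _)
    (fun i => g (p + 1 + i)) (K := K) (q - p) ?_
  · refine h.trans (le_of_eq ?_)
    rw [show p + 1 + (q - p) = q + 1 by omega]
    push_cast
    rfl
  · intro m hm
    have h1 := hK (p + m) (by omega)
    rw [sum_Ioc_eq_sum_range' g, Nat.add_sub_cancel_left] at h1
    exact h1

theorem sum_Icc_inv_le_one_add_log (n : ℕ) :
    ∑ a ∈ Finset.Icc 1 n, (1 : ℝ) / a ≤ 1 + Real.log n := by
  have h := harmonic_le_one_add_log n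
  rw [harmonic_eq_sum_Icc] at h
  push_cast at h
  simpa [one_div] using h

/-- Cancellation in the exponential sum `∑ Λ(d) e(B / d)` in the Vinogradov–Korobov range. -/
theorem exists_norm_sum_vonMangoldt_ef_le {c η A : ℝ} (hc : 0 < c) (hc2 : c ≤ 1 / 2) (hη : 0 < η)
    (hA : 0 ≤ A) : ∃ P₀ : ℕ, ∀ P : ℕ, P₀ ≤ P → ∀ B : ℝ, (P : ℝ) ^ (1 + c) ≤ |B| →
      |B| ≤ Real.exp (Real.log P ^ (3 / 2 - η)) →
      ‖∑ d ∈ Finset.Ioc P (4 * P), (ArithmeticFunction.vonMangoldt d : ℂ) * ef (B / d)‖ ≤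
        P * Real.log P ^ (-A) := by
  obtain ⟨P₁, hP₁⟩ := exists_norm_sum_Ioc_div_mul_le hc hc2 hη (A := A + 3) (by linarith)
  obtain ⟨P₂, hP₂⟩ := exists_norm_hyperbola_block_le hc hc2 hη (A := A + 2) (by linarith)
  have ev := (tendsto_rpow_atTop (show (0 : ℝ) < 1 / 12 by norm_num)).comp
    (tendsto_natCast_atTop_atTop (R := ℝ)) |>.eventually (Filter.eventually_ge_atTop 2)
  obtain ⟨P₀, hP₀⟩ := Filter.eventually_atTop.1 (ev.and ((Filter.eventually_ge_atTop 100).and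
    (tendsto_log_natCast_atTop.eventually (Filter.eventually_ge_atTop 100))))
  refine ⟨max P₀ (max P₁ P₂), ?_⟩
  intro P hP B hB1 hB2
  obtain ⟨h1, h2, h3⟩ := hP₀ P ((le_max_left _ _).trans hP)
  have hI := hP₁ P (((le_max_left _ _).trans (le_max_right _ _)).trans hP) B hB1 hB2
  have hII := hP₂ P (((le_max_right _ _).trans (le_max_right _ _)).trans hP) B hB1 hB2
  simp only [Function.comp] at h1
  have hP100 : (100 : ℝ) ≤ P := by exact_mod_cast h2
  have hP0 : (0 : ℝ) < P := by linarith
  have hP1 : (1 : ℝ) ≤ P := by linarith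
  set L := Real.log P with hL
  have hL0 : 0 < L := by linarith
  set z := ⌊(P : ℝ) ^ (1 / 3 : ℝ)⌋₊ with hz
  have hz1 : (z : ℝ) ≤ (P : ℝ) ^ (1 / 3 : ℝ) := Nat.floor_le (by positivity)
  have hz2 : (P : ℝ) ^ (1 / 3 : ℝ) / 2 ≤ z :=
    half_le_natFloor (Real.one_le_rpow hP1 (by norm_num))
  have hz4 : (P : ℝ) ^ (1 / 4 : ℝ) ≤ z := by
    have h13 : (P : ℝ) ^ (1 / 3 : ℝ) = (P : ℝ) ^ (1 / 12 : ℝ) * (P : ℝ) ^ (1 / 4 : ℝ) := by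
      rw [← Real.rpow_add hP0]; norm_num
    have h14 : (1 : ℝ) ≤ (P : ℝ) ^ (1 / 4 : ℝ) := Real.one_le_rpow hP1 (by norm_num)
    nlinarith
  have hzz : ((z * z : ℕ) : ℝ) ≤ (P : ℝ) ^ (2 / 3 : ℝ) := by
    push_cast
    calc (z : ℝ) * z ≤ (P : ℝ) ^ (1 / 3 : ℝ) * (P : ℝ) ^ (1 / 3 : ℝ) := by gcongr
      _ = _ := by rw [← Real.rpow_add hP0]; norm_num
  have hzpos : 0 < z := by
    have : (0 : ℝ) < z := (Real.rpow_pos_of_pos hP0 _).trans_le hz4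
    exact_mod_cast this
  have hP23 : (P : ℝ) ^ (2 / 3 : ℝ) ≤ P := by
    conv_rhs => rw [← Real.rpow_one (P : ℝ)]
    exact Real.rpow_le_rpow_of_exponent_le hP1 (by norm_num)
  have hzzP : z * z ≤ P := by exact_mod_cast hzz.trans hP23
  have hzzz : z ≤ z * z := Nat.le_mul_of_pos_left z hzpos
  have hzP : z ≤ P := hzzz.trans hzzP
  have hlog5 : Real.log (4 * P + 1) ≤ 2 * L := by
    have h5 : (4 * P + 1 : ℝ) ≤ (P : ℝ) ^ 2 := by nlinarith
    have h6 := Real.log_le_log (by positivity) h5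
    rwa [Real.log_pow] at h6
  have hsum : ∀ n : ℕ, 1 ≤ n → n ≤ P → ∑ a ∈ Finset.Icc 1 n, (1 : ℝ) / a ≤ 2 * L := by
    intro n hn hnP
    have h5 : Real.log n ≤ L :=
      Real.log_le_log (by exact_mod_cast hn) (by exact_mod_cast hnP)
    linarith [sum_Icc_inv_le_one_add_log n]
  set V := L ^ (-(A + 3)) with hV
  have hV0 : 0 < V := Real.rpow_pos_of_pos hL0 _
  have hVA : L ^ 3 * V = L ^ (-A) := by
    rw [hV, ← Real.rpow_natCast, ← Real.rpow_add hL0]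
    congr 1
    push_cast
    ring
  have hVA2 : L * V = L ^ (-(A + 2)) := by
    rw [hV]
    nth_rewrite 1 [← Real.rpow_one L]
    rw [← Real.rpow_add hL0]
    congr 1
    ring
  refine (norm_sum_vonMangoldt_mul_le hzP (fun d : ℕ => ef (B / (d : ℝ)))).trans ?_
  have b1 : ∑ a ∈ Finset.Icc 1 z, ‖∑ l ∈ Finset.Ioc (P / a) (4 * P / a),
      (Real.log l : ℂ) * ef (B / ((a * l : ℕ) : ℝ))‖ ≤ 8 * L ^ 2 * (P * V) := by
    calc _ ≤ ∑ a ∈ Finset.Icc 1 z, 4 * L * (P * V) * (1 / a : ℝ) := by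
          refine Finset.sum_le_sum fun a ha => ?_
          obtain ⟨ha1, ha2⟩ := Finset.mem_Icc.1 ha
          have ha0 : (0 : ℝ) < a := by exact_mod_cast ha1
          have haP : (a : ℝ) ≤ (P : ℝ) ^ (2 / 3 : ℝ) := by
            refine le_trans ?_ hzz
            exact_mod_cast ha2.trans hzzz
          refine (norm_sum_Ioc_log_mul_le (Nat.div_le_div_right (by omega))
            (fun q hq => hI a ha1 haP q hq)).trans ?_
          have h5 : Real.log ((4 * P / a : ℕ) + 1) ≤ 2 * L := by
            refine le_trans (Real.log_le_log (by positivity) ?_) hlog5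
            have : 4 * P / a ≤ 4 * P := Nat.div_le_self _ _
            exact_mod_cast Nat.succ_le_succ this
          calc _ ≤ 2 * (2 * L) * ((P : ℝ) / a * V) := by gcongr
            _ = _ := by ring
      _ ≤ 4 * L * (P * V) * (2 * L) := by
          rw [← Finset.mul_sum]
          exact mul_le_mul_of_nonneg_left (hsum z hzpos hzP) (by positivity)
      _ = _ := by ring
  have b2 : ∑ a ∈ Finset.Icc 1 (z * z), Real.log a * ‖∑ l ∈ Finset.Ioc (P / a) (4 * P / a),
      ef (B / ((a * l : ℕ) : ℝ))‖ ≤ 2 * L ^ 2 * (P * V) := by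
    calc _ ≤ ∑ a ∈ Finset.Icc 1 (z * z), L * (P * V) * (1 / a : ℝ) := by
          refine Finset.sum_le_sum fun a ha => ?_
          obtain ⟨ha1, ha2⟩ := Finset.mem_Icc.1 ha
          have ha0 : (0 : ℝ) < a := by exact_mod_cast ha1
          have haP : (a : ℝ) ≤ (P : ℝ) ^ (2 / 3 : ℝ) := by
            refine le_trans ?_ hzz
            exact_mod_cast ha2
          have h5 : Real.log a ≤ L := Real.log_le_log ha0 (haP.trans hP23)
          calc _ ≤ L * ((P : ℝ) / a * V) := by
                refine mul_le_mul h5 (hI a ha1 haP _ le_rfl) (norm_nonneg _) hL0.le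
            _ = _ := by ring
      _ ≤ L * (P * V) * (2 * L) := by
          rw [← Finset.mul_sum]
          exact mul_le_mul_of_nonneg_left (hsum _ (by omega) hzzP) (by positivity)
      _ = _ := by ring
  have b3 : ‖∑ d ∈ Finset.Ioc z (4 * P), (((ArithmeticFunction.moebius d : ℤ) : ℝ) : ℂ) *
      ∑ m ∈ Finset.Ioc z (4 * P), (vaughanCoeff z m : ℂ) *
        if P < d * m ∧ d * m ≤ 4 * P then ef (B / ((d * m : ℕ) : ℝ)) else 0‖ ≤
      4 * L * (P * (L * V)) := by
    set I := Nat.log 2 (4 * P) + 1 with hIdef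
    have hIL : (I : ℝ) ≤ 4 * L := by
      have h5 : (2 : ℝ) ^ Nat.log 2 (4 * P) ≤ 4 * P + 1 := by
        have := Nat.pow_log_le_self 2 (x := 4 * P) (by omega)
        have h6 : ((2 ^ Nat.log 2 (4 * P) : ℕ) : ℝ) ≤ ((4 * P : ℕ) : ℝ) := by exact_mod_cast this
        push_cast at h6
        linarith
      have h6 := (Real.log_le_log (by positivity) h5).trans hlog5
      rw [Real.log_pow] at h6
      have h7 := Real.log_two_gt_d9
      have h8 : (0 : ℝ) ≤ Nat.log 2 (4 * P) := Nat.cast_nonneg _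
      rw [hIdef]
      push_cast
      nlinarith
    have h5 := norm_sum_Ioc_le_of_dyadic (z := z) (Q := 4 * P) (I := I) (K := P * (L * V))
      (G := fun d => (((ArithmeticFunction.moebius d : ℤ) : ℝ) : ℂ) *
      ∑ m ∈ Finset.Ioc z (4 * P), (vaughanCoeff z m : ℂ) *
        if P < d * m ∧ d * m ≤ 4 * P then ef (B / ((d * m : ℕ) : ℝ)) else 0) ?_ ?_ ?_
    · refine h5.trans ?_
      gcongr
    · intro d hd
      rw [Finset.sum_eq_zero, mul_zero]
      intro m hm
      have hm0 : 0 < m := lt_of_le_of_lt (Nat.zero_le _) (Finset.mem_Ioc.1 hm).1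
      rw [if_neg, mul_zero]
      rintro ⟨-, h6⟩
      have : d ≤ d * m := Nat.le_mul_of_pos_right d hm0
      omega
    · have h6 : 4 * P < 2 ^ I := Nat.lt_pow_succ_log_self (by norm_num) _
      exact h6.le.trans (Nat.le_mul_of_pos_left _ hzpos)
    · intro D hD
      rw [hVA2]
      refine hII z D hz4 hD _ _ ?_ ?_
      · intro d
        rw [Complex.norm_real, Real.norm_eq_abs]
        exact_mod_cast ArithmeticFunction.abs_moebius_le_one
      · intro m
        rw [Complex.norm_real, Real.norm_eq_abs]
        exact abs_vaughanCoeff_le z m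
  refine (add_le_add (add_le_add b1 b2) b3).trans ?_
  rw [← hVA]
  have h5 : 0 < P * (L ^ 2 * V) := by positivity
  nlinarith

theorem card_near_int_sq_le {s S : Finset ℕ} (hS : S ⊆ s) (f : ℕ → ℝ) {H : ℕ} {δ V : ℝ}
    (hH : 4 * Real.pi * H * δ ≤ 1) (hf : ∀ d ∈ S, |f d - round (f d)| ≤ δ)
    (hV : ∀ h : ℤ, h ≠ 0 → |h| ≤ H → ‖∑ d ∈ s, ef (h * f d)‖ ≤ V) :
    ((S.card : ℝ) * H) ^ 2 ≤ 4 * (s.card * (H * s.card + H ^ 2 * V)) := by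
  classical
  have h1 := norm_bilinear_sq_le s (Finset.range H) (fun d => if d ∈ S then (1 : ℂ) else 0)
    (fun _ => 1) (fun d h => ef (h * f d)) (fun d _ => by split_ifs <;> simp) (R := 1)
    (fun _ _ => by simp)
  have hV0 : 0 ≤ V ∨ H = 0 := by
    rcases Nat.eq_zero_or_pos H with h | h
    · exact Or.inr h
    · exact Or.inl ((norm_nonneg _).trans (hV 1 one_ne_zero (by rw [abs_one]; exact_mod_cast h)))
  have hlow : (S.card : ℝ) * H / 2 ≤ ‖∑ d ∈ s, (if d ∈ S then (1 : ℂ) else 0) *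
      ∑ h ∈ Finset.range H, 1 * ef (h * f d)‖ := by
    simp only [ite_mul, one_mul, zero_mul]
    rw [Finset.sum_ite_mem, Finset.inter_eq_right.2 hS]
    have h2 : ‖∑ d ∈ S, ∑ h ∈ Finset.range H, ef (h * f d) -
        ∑ d ∈ S, ∑ h ∈ Finset.range H, (1 : ℂ)‖ ≤ S.card * H / 2 := by
      rw [← Finset.sum_sub_distrib]
      calc _ ≤ ∑ d ∈ S, (H : ℝ) / 2 := by
            refine (norm_sum_le _ _).trans (Finset.sum_le_sum fun d hd => ?_)
            rw [← Finset.sum_sub_distrib]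
            calc _ ≤ ∑ h ∈ Finset.range H, (1 / 2 : ℝ) := by
                  refine (norm_sum_le _ _).trans (Finset.sum_le_sum fun h hh => ?_)
                  have h3 := norm_ef_sub_ef_le (h * f d) ((h * round (f d) : ℤ) : ℝ)
                  rw [ef_intCast] at h3
                  refine h3.trans ?_
                  have h4 : (h : ℝ) ≤ H := by exact_mod_cast (Finset.mem_range.1 hh).le
                  have h5 := hf d hd
                  push_cast
                  rw [← mul_sub, abs_mul, abs_of_nonneg (Nat.cast_nonneg (α := ℝ) h)]
                  have h6 : (h : ℝ) * |f d - round (f d)| ≤ H * δ :=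
                    mul_le_mul h4 h5 (abs_nonneg _) (Nat.cast_nonneg _)
                  nlinarith [Real.pi_pos]
              _ = _ := by simp; ring
        _ = _ := by simp; ring
    have h3 : ∑ d ∈ S, ∑ h ∈ Finset.range H, (1 : ℂ) = ((S.card * H : ℕ) : ℂ) := by simp
    have h4 := norm_sub_norm_le (∑ d ∈ S, ∑ h ∈ Finset.range H, (1 : ℂ))
      (∑ d ∈ S, ∑ h ∈ Finset.range H, ef (h * f d))
    rw [norm_sub_rev] at h4
    rw [h3, Complex.norm_natCast] at h4
    rw [h3] at h2
    push_cast at h4 h2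
    linarith
  have hup : ∑ h₁ ∈ Finset.range H, ∑ h₂ ∈ Finset.range H,
      ‖∑ d ∈ s, ef (h₁ * f d) * (starRingEnd ℂ) (ef (h₂ * f d))‖ ≤ H * s.card + H ^ 2 * V := by
    calc _ ≤ ∑ h₁ ∈ Finset.range H, ∑ h₂ ∈ Finset.range H,
          ((if h₁ = h₂ then (s.card : ℝ) else 0) + V) := by
          refine Finset.sum_le_sum fun h₁ hh₁ => Finset.sum_le_sum fun h₂ hh₂ => ?_
          rw [Finset.mem_range] at hh₁ hh₂
          simp only [ef_mul_conj_ef, ← sub_mul]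
          have hV1 : 0 ≤ V := hV0.resolve_right (by omega)
          split_ifs with h
          · refine (norm_sum_le _ _).trans ?_
            simp only [norm_ef, Finset.sum_const, nsmul_eq_mul, mul_one]
            linarith
          · rw [zero_add]
            have h5 := hV ((h₁ : ℤ) - h₂) (by omega) (by rw [abs_le]; constructor <;> omega)
            push_cast at h5
            exact h5
      _ = _ := by
          simp only [Finset.sum_add_distrib, Finset.sum_ite_eq, Finset.sum_const, nsmul_eq_mul,
            Finset.card_range, Finset.mem_range]
          rw [Finset.sum_congr rfl fun x hx => if_pos (Finset.mem_range.1 hx)]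
          simp only [Finset.sum_const, nsmul_eq_mul, Finset.card_range]
          ring
  rw [one_pow, one_mul] at h1
  have h5 : ((S.card : ℝ) * H / 2) ^ 2 ≤ s.card * (H * s.card + H ^ 2 * V) := by
    refine (pow_le_pow_left₀ (by positivity) hlow 2).trans (h1.trans ?_)
    exact mul_le_mul_of_nonneg_left hup (Nat.cast_nonneg _)
  linarith [h5, show ((S.card : ℝ) * H / 2) ^ 2 = ((S.card : ℝ) * H) ^ 2 / 4 by ring]

/-- Points `d` in a dyadic range for which `y / d ^ j` lies in a fixed interval `[i - δ, i)`. -/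
theorem card_fract_fiber_le {P y i j : ℕ} {δ : ℝ} (hj : 1 ≤ j) (hδ0 : 0 ≤ δ) (hδ : δ ≤ 1 / 2)
    {S : Finset ℕ} (hS : S ⊆ Finset.Ioc P (4 * P))
    (h1 : ∀ d ∈ S, (i : ℝ) + 1 - δ ≤ (y : ℝ) / (d : ℝ) ^ j)
    (h2 : ∀ d ∈ S, (y : ℝ) / (d : ℝ) ^ j < (i : ℝ) + 1) :
    (S.card : ℝ) ≤ 8 * P * δ + 1 := by
  rcases S.eq_empty_or_nonempty with rfl | hne
  · simp; positivity
  set d₀ := S.min' hne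
  have hd₀ : d₀ ∈ S := S.min'_mem hne
  have hpos : ∀ d ∈ S, (0 : ℝ) < d := fun d hd => by
    exact_mod_cast lt_of_le_of_lt (Nat.zero_le _) (Finset.mem_Ioc.1 (hS hd)).1
  have hdiff : ∀ d ∈ S, (d : ℝ) ≤ d₀ + 8 * P * δ := by
    intro d hd
    have hle : (d₀ : ℝ) ≤ d := by exact_mod_cast S.min'_le d hd
    have hd0p := hpos _ hd₀
    have hdp := hpos _ hd
    have h3 := h1 d hd
    have h4 := h2 _ hd₀
    rw [le_div_iff₀ (by positivity)] at h3
    rw [div_lt_iff₀ (by positivity)] at h4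
    have hi : (0 : ℝ) ≤ i := Nat.cast_nonneg _
    have h5 : (1 - δ) * (d : ℝ) ^ j ≤ (d₀ : ℝ) ^ j := by
      have h6 : ((i : ℝ) + 1) * ((1 - δ) * (d : ℝ) ^ j) ≤ ((i : ℝ) + 1) * (d₀ : ℝ) ^ j := by
        have : 0 ≤ (i : ℝ) * δ * (d : ℝ) ^ j := by positivity
        nlinarith
      exact le_of_mul_le_mul_left h6 (by positivity)
    have h6 : (1 - δ) * d ≤ d₀ := by
      by_contra hcon
      rw [not_le] at hcon
      have h7 : (d₀ : ℝ) ^ j < ((1 - δ) * d) ^ j := pow_lt_pow_left₀ hcon hd0p.le (by omega)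
      rw [mul_pow] at h7
      have h8 : (1 - δ) ^ j ≤ 1 - δ := by
        calc (1 - δ) ^ j ≤ (1 - δ) ^ 1 :=
              pow_le_pow_of_le_one (by linarith) (by linarith) hj
          _ = _ := pow_one _
      have h9 : (1 - δ) ^ j * (d : ℝ) ^ j ≤ (1 - δ) * (d : ℝ) ^ j := by gcongr
      linarith
    have h7 : (d : ℝ) ≤ 4 * P := by exact_mod_cast (Finset.mem_Ioc.1 (hS hd)).2
    nlinarith
  have h := card_Icc_int_real_le (S.image ((↑) : ℕ → ℤ)) (x := d₀) (y := d₀ + 8 * P * δ)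
    (by linarith [show 0 ≤ 8 * P * δ by positivity]) ?_
  · rw [Finset.card_image_of_injective _ Nat.cast_injective] at h
    linarith
  · intro n hn
    obtain ⟨d, hd, rfl⟩ := Finset.mem_image.1 hn
    refine ⟨?_, ?_⟩
    · exact_mod_cast S.min'_le d hd
    · exact_mod_cast hdiff d hd

theorem card_fract_of_small_le {P y j : ℕ} {δ X : ℝ} (hj : 1 ≤ j) (hδ0 : 0 ≤ δ) (hδ : δ ≤ 1 / 2)
    (hP : 0 < P) (hX0 : 0 ≤ X) (hy : (y : ℝ) ≤ X * (P : ℝ) ^ j) :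
    (((Finset.Ioc P (4 * P)).filter fun d : ℕ =>
      1 - δ ≤ Int.fract ((y : ℝ) / (d : ℝ) ^ j)).card : ℝ) ≤ (8 * P * δ + 1) * (X + 1) := by
  set S := (Finset.Ioc P (4 * P)).filter fun d : ℕ => 1 - δ ≤ Int.fract ((y : ℝ) / (d : ℝ) ^ j)
  have hfl : ∀ d : ℕ, (⌊(y : ℝ) / (d : ℝ) ^ j⌋ : ℝ) = (⌊(y : ℝ) / (d : ℝ) ^ j⌋₊ : ℝ) := by
    intro d
    exact (natCast_floor_eq_intCast_floor (by positivity)).symm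
  have hmaps : ∀ d ∈ S, ⌊(y : ℝ) / (d : ℝ) ^ j⌋₊ ∈ Finset.range (⌊X⌋₊ + 1) := by
    intro d hd
    have hd1 : (P : ℝ) ≤ d := by exact_mod_cast (Finset.mem_Ioc.1 (Finset.mem_filter.1 hd).1).1.le
    have hP0 : (0 : ℝ) < P := by exact_mod_cast hP
    have hd0 : (0 : ℝ) < d := by linarith
    rw [Finset.mem_range, Nat.lt_succ_iff]
    refine Nat.floor_le_floor ?_
    rw [div_le_iff₀ (by positivity)]
    exact hy.trans (by gcongr)
  have hfib : ∀ i ∈ Finset.range (⌊X⌋₊ + 1),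
      (S.filter fun d : ℕ => ⌊(y : ℝ) / (d : ℝ) ^ j⌋₊ = i).card ≤ ⌊8 * P * δ + 1⌋₊ := by
    intro i _
    refine Nat.le_floor ?_
    refine card_fract_fiber_le (y := y) (i := i) hj hδ0 hδ
      ((Finset.filter_subset _ _).trans (Finset.filter_subset _ _)) ?_ ?_
    · intro d hd
      obtain ⟨h1, h2⟩ := Finset.mem_filter.1 hd
      have h3 := (Finset.mem_filter.1 h1).2
      rw [← Int.self_sub_floor, hfl, h2] at h3
      linarith
    · intro d hd
      obtain ⟨h1, h2⟩ := Finset.mem_filter.1 hd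
      rw [← h2]
      exact Nat.lt_floor_add_one _
  have h := Finset.card_le_mul_card_image_of_maps_to hmaps _ hfib
  rw [Finset.card_range] at h
  calc (S.card : ℝ) ≤ ((⌊8 * P * δ + 1⌋₊ * (⌊X⌋₊ + 1) : ℕ) : ℝ) := by exact_mod_cast h
    _ = (⌊8 * P * δ + 1⌋₊ : ℝ) * (⌊X⌋₊ + 1) := by push_cast; ring
    _ ≤ _ := by
      gcongr
      · exact Nat.floor_le (by positivity)
      · exact Nat.floor_le hX0

theorem eventually_rpow_mul_exp_rpow_le {s r : ℝ} (hs : 1 / 2 ≤ s) (hsr : s < r) (A : ℝ) :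
    ∀ᶠ L : ℝ in Filter.atTop, L ^ A * Real.exp (L ^ s) ≤ Real.exp (L ^ r) := by
  filter_upwards [eventually_mul_exp_neg_mul_rpow_le one_pos (show 0 < s by linarith) A 1,
    (tendsto_rpow_atTop (sub_pos.2 hsr)).eventually (Filter.eventually_ge_atTop 2),
    Filter.eventually_gt_atTop 0] with L h1 h2 hL
  have h3 : L ^ A ≤ Real.exp (L ^ s) := by
    rw [one_mul, one_mul, Real.rpow_neg hL.le, Real.exp_neg] at h1
    exact (inv_le_inv₀ (Real.exp_pos _) (by positivity)).1 h1
  have h4 : L ^ s + L ^ s ≤ L ^ r := by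
    have h5 : L ^ r = L ^ s * L ^ (r - s) := by
      rw [← Real.rpow_add hL]; ring_nf
    rw [h5]
    nlinarith [Real.rpow_pos_of_pos hL s]
  calc _ ≤ Real.exp (L ^ s) * Real.exp (L ^ s) := by gcongr
    _ = Real.exp (L ^ s + L ^ s) := (Real.exp_add _ _).symm
    _ ≤ _ := Real.exp_le_exp.2 h4

theorem exists_card_fract_le {c η A : ℝ} (hc : 0 < c) (hc2 : c ≤ 1 / 2) (hη : 0 < η)
    (hη1 : η ≤ 1) (hA : 0 ≤ A) : ∃ P₀ : ℕ, ∀ P : ℕ, P₀ ≤ P → ∀ y : ℕ,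
      (y : ℝ) ≤ Real.exp (Real.log P ^ (3 / 2 - η)) → ∀ j : ℕ, 1 ≤ j →
      (((Finset.Ioc P (4 * P)).filter fun d : ℕ =>
        1 - (P : ℝ) ^ (-(2 * c)) ≤ Int.fract ((y : ℝ) / (d : ℝ) ^ j)).card : ℝ) ≤
          P * Real.log P ^ (-A) := by
  obtain ⟨P₁, hP₁⟩ := exists_norm_sum_Ioc_inv_pow_le hc hc2 (show 0 < η / 2 by linarith)
    one_pos (A := 2 * A + 3) (by linarith)
  have ev1 := tendsto_log_natCast_atTop.eventually (eventually_rpow_mul_exp_rpow_le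
    (s := 3 / 2 - η) (r := 3 / 2 - η / 2) (by linarith) (by linarith) (2 * A + 3))
  have ev2 := eventually_mul_rpow_neg_le_log_rpow (show 0 < 2 * c by linarith) (2 * A + 3) 16
  have ev3 := eventually_mul_rpow_neg_le_log_rpow (show 0 < c by linarith) A 18
  obtain ⟨P₀, hP₀⟩ := Filter.eventually_atTop.1 ((ev1.and ev2).and (ev3.and
    ((tendsto_log_natCast_atTop.eventually (Filter.eventually_ge_atTop 84)).and
      (Filter.eventually_ge_atTop 1))))
  refine ⟨max P₀ P₁, ?_⟩
  intro P hP y hy j hj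
  obtain ⟨⟨h1, h2⟩, h3, h4, h5⟩ := hP₀ P ((le_max_left _ _).trans hP)
  have hW := hP₁ P ((le_max_right _ _).trans hP) P (by rw [Real.rpow_one]) j hj
  set L := Real.log P with hL
  have hP1 : (1 : ℝ) ≤ P := by exact_mod_cast h5
  have hP0 : (0 : ℝ) < P := by linarith
  have hL0 : 0 < L := by linarith
  set δ := (P : ℝ) ^ (-(2 * c)) with hδ
  have hδ0 : 0 < δ := Real.rpow_pos_of_pos hP0 _
  have hV1 : L ^ (-(2 * A + 3)) ≤ 1 :=
    Real.rpow_le_one_of_one_le_of_nonpos (by linarith) (by linarith)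
  have hδ1 : δ ≤ 1 / 2 := by linarith
  rcases le_or_gt ((y : ℝ)) ((P : ℝ) ^ (j + c)) with hsm | hbig
  · rw [add_comm, Real.rpow_add hP0, Real.rpow_natCast] at hsm
    refine (card_fract_of_small_le hj hδ0.le hδ1 (by omega) (by positivity) hsm).trans ?_
    have hX : (1 : ℝ) ≤ (P : ℝ) ^ c := Real.one_le_rpow hP1 hc.le
    have h6 : (1 : ℝ) ≤ P * δ := by
      rw [hδ]
      nth_rewrite 1 [← Real.rpow_one (P : ℝ)]
      rw [← Real.rpow_add hP0]
      exact Real.one_le_rpow hP1 (by linarith)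
    calc (8 * P * δ + 1) * ((P : ℝ) ^ c + 1) ≤ (9 * (P * δ)) * (2 * (P : ℝ) ^ c) := by
          apply mul_le_mul <;> linarith
      _ = P * (18 * (δ * (P : ℝ) ^ c)) := by ring
      _ = P * (18 * (P : ℝ) ^ (-c)) := by
          rw [hδ, ← Real.rpow_add hP0]; ring_nf
      _ ≤ _ := by gcongr
  · set S := (Finset.Ioc P (4 * P)).filter fun d : ℕ =>
        1 - δ ≤ Int.fract ((y : ℝ) / (d : ℝ) ^ j) with hS
    set U := L ^ (2 * A + 3) with hU
    have hU1 : 1 ≤ U := Real.one_le_rpow (by linarith) (by linarith)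
    set H := ⌊U⌋₊ with hH
    have hHU : (H : ℝ) ≤ U := Nat.floor_le (by linarith)
    have hUH : U / 2 ≤ H := half_le_natFloor hU1
    have hVU : L ^ (-(2 * A + 3)) = U⁻¹ := Real.rpow_neg hL0.le _
    rw [hVU] at hW h2
    have hUδ : 16 * (U * δ) ≤ 1 := by
      rw [le_inv_comm₀ (by positivity) (by linarith)] at h2
      rw [← one_div, le_div_iff₀ (by positivity)] at h2
      linarith
    have hkey := card_near_int_sq_le (s := Finset.Ioc P (4 * P)) (S := S)
      (Finset.filter_subset _ _) (fun d : ℕ => (y : ℝ) / (d : ℝ) ^ j) (H := H) (δ := δ)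
      (V := P * U⁻¹) ?_ ?_ ?_
    · rw [Nat.card_Ioc, show 4 * P - P = 3 * P by omega] at hkey
      push_cast at hkey
      have hH0 : (0 : ℝ) < H := by linarith
      have h6 : (S.card : ℝ) ^ 2 ≤ 84 * P ^ 2 * U⁻¹ := by
        have h7 : (U : ℝ) * U⁻¹ = 1 := mul_inv_cancel₀ (by linarith)
        have hUi : 0 < U⁻¹ := by positivity
        have h8 : (1 : ℝ) ≤ H * (2 * U⁻¹) := by nlinarith
        refine le_of_mul_le_mul_right ?_ (show (0 : ℝ) < H ^ 2 by positivity)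
        calc (S.card : ℝ) ^ 2 * H ^ 2 = (S.card * H) ^ 2 := by ring
          _ ≤ _ := hkey
          _ = 36 * P ^ 2 * H * 1 + 12 * P ^ 2 * U⁻¹ * H ^ 2 := by ring
          _ ≤ 36 * P ^ 2 * H * (H * (2 * U⁻¹)) + 12 * P ^ 2 * U⁻¹ * H ^ 2 := by gcongr
          _ = _ := by ring
      refine abs_le_of_sq_le_sq' ?_ (by positivity) |>.2
      refine h6.trans ?_
      have h7 : U⁻¹ * L ^ 3 = (L ^ (-A)) ^ 2 := by
        rw [← hVU, ← Real.rpow_natCast, ← Real.rpow_natCast, ← Real.rpow_add hL0,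
          ← Real.rpow_mul hL0.le]
        congr 1
        push_cast
        ring
      rw [mul_pow, ← h7]
      have h8 : 84 ≤ L ^ 3 := by nlinarith [sq_nonneg L]
      have h9 : 0 < P ^ 2 * U⁻¹ := by positivity
      nlinarith
    · have h6 : (H : ℝ) * δ ≤ U * δ := by gcongr
      have h7 : 0 ≤ (H : ℝ) * δ := by positivity
      nlinarith [Real.pi_lt_four]
    · intro d hd
      have h6 := (Finset.mem_filter.1 hd).2
      have h7 := round_le ((y : ℝ) / (d : ℝ) ^ j) (⌊(y : ℝ) / (d : ℝ) ^ j⌋ + 1)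
      refine h7.trans ?_
      push_cast
      have h8 := Int.self_sub_floor ((y : ℝ) / (d : ℝ) ^ j)
      have h9 := Int.fract_lt_one ((y : ℝ) / (d : ℝ) ^ j)
      rw [abs_le]
      constructor <;> linarith
    · intro h hh0 hhH
      have hform : ∀ d : ℕ, (h : ℝ) * ((y : ℝ) / (d : ℝ) ^ j) = (h * y : ℝ) / (d : ℝ) ^ j :=
        fun d => by ring
      simp only [hform]
      have habs1 : (1 : ℝ) ≤ |(h : ℝ)| := by exact_mod_cast Int.one_le_abs hh0
      have habs2 : |(h : ℝ)| ≤ U := by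
        refine le_trans ?_ hHU
        exact_mod_cast hhH
      have hy0 : (0 : ℝ) ≤ y := Nat.cast_nonneg _
      refine hW _ ?_ ?_ P (4 * P) le_rfl (by omega)
      · rw [abs_mul, abs_of_nonneg hy0]
        nlinarith
      · rw [abs_mul, abs_of_nonneg hy0]
        refine le_trans ?_ h1
        exact mul_le_mul habs2 hy hy0 (by linarith)

theorem exists_card_div_pow_ne_le {c η A : ℝ} (hc : 0 < c) (hc2 : c ≤ 1 / 2) (hη : 0 < η)
    (hη1 : η ≤ 1) (hA : 0 ≤ A) : ∃ P₀ : ℕ, ∀ P : ℕ, P₀ ≤ P → ∀ y₁ y₂ : ℕ, y₁ ≤ y₂ →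
      (y₂ : ℝ) ≤ y₁ + (P : ℝ) ^ (2 - 2 * c) →
      (y₁ : ℝ) ≤ Real.exp (Real.log P ^ (3 / 2 - η)) → ∀ j : ℕ, 2 ≤ j →
      (((Finset.Ioc P (4 * P)).filter fun d : ℕ => y₁ / d ^ j ≠ y₂ / d ^ j).card : ℝ) ≤
          P * Real.log P ^ (-A) := by
  obtain ⟨P₀, hP₀⟩ := exists_card_fract_le hc hc2 hη hη1 hA
  refine ⟨max P₀ 1, ?_⟩
  intro P hP y₁ y₂ h12 hy hy1 j hj
  refine le_trans ?_ (hP₀ P ((le_max_left _ _).trans hP) y₁ hy1 j (by omega))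
  have hP1 : (1 : ℝ) ≤ P := by exact_mod_cast (le_max_right _ _).trans hP
  have hP0 : (0 : ℝ) < P := by linarith
  norm_cast
  refine Finset.card_le_card fun d hd => ?_
  obtain ⟨hd1, hd2⟩ := Finset.mem_filter.1 hd
  refine Finset.mem_filter.2 ⟨hd1, ?_⟩
  by_contra hcon
  rw [not_le] at hcon
  push_cast at hcon
  apply hd2
  have hdP : (P : ℝ) ≤ d := by exact_mod_cast (Finset.mem_Ioc.1 hd1).1.le
  have hd0 : (0 : ℝ) < d := by linarith
  have hdj : (0 : ℝ) < (d : ℝ) ^ j := by positivity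
  have hstep : (y₂ : ℝ) / (d : ℝ) ^ j ≤ (y₁ : ℝ) / (d : ℝ) ^ j + (P : ℝ) ^ (-(2 * c)) := by
    rw [div_le_iff₀ hdj, add_mul, div_mul_cancel₀ _ hdj.ne']
    refine hy.trans ?_
    have h1 : (P : ℝ) ^ (2 - 2 * c) = (P : ℝ) ^ (-(2 * c)) * (P : ℝ) ^ 2 := by
      rw [← Real.rpow_natCast, ← Real.rpow_add hP0]
      congr 1
      push_cast
      ring
    have h2 : (P : ℝ) ^ 2 ≤ (d : ℝ) ^ j :=
      (pow_le_pow_left₀ hP0.le hdP 2).trans (pow_le_pow_right₀ (by linarith) hj)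
    rw [h1]
    gcongr
  have hf1 : (y₁ / d ^ j : ℕ) = ⌊(y₁ : ℝ) / (d : ℝ) ^ j⌋₊ := by
    have := Nat.floor_div_eq_div (K := ℝ) y₁ (d ^ j)
    push_cast at this
    exact this.symm
  have hf2 : (y₂ / d ^ j : ℕ) = ⌊(y₂ : ℝ) / (d : ℝ) ^ j⌋₊ := by
    have := Nat.floor_div_eq_div (K := ℝ) y₂ (d ^ j)
    push_cast at this
    exact this.symm
  refine le_antisymm (Nat.div_le_div_right h12) ?_
  rw [hf1, hf2, ← Nat.lt_succ_iff, Nat.floor_lt (by positivity)]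
  have h3 := Int.self_sub_floor ((y₁ : ℝ) / (d : ℝ) ^ j)
  have h4 : (⌊(y₁ : ℝ) / (d : ℝ) ^ j⌋ : ℝ) = (⌊(y₁ : ℝ) / (d : ℝ) ^ j⌋₊ : ℝ) :=
    (natCast_floor_eq_intCast_floor (by positivity)).symm
  push_cast
  linarith

/-- A smoothed version of the sawtooth function `x ↦ Int.fract x - 1 / 2 + δ / 2`. -/
noncomputable def smoothSaw (δ x : ℝ) : ℝ :=
  (bernoulliFun 2 (Int.fract (x + δ)) - bernoulliFun 2 (Int.fract x)) / (2 * δ)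

/-- The Fourier coefficients of `smoothSaw δ`. -/
noncomputable def sawCoeff (δ : ℝ) (h : ℤ) : ℂ :=
  (ef (h * δ) - 1) / (4 * Real.pi ^ 2 * δ * h ^ 2)

theorem ef_intCast_mul_fract (n : ℤ) (x : ℝ) : ef (n * Int.fract x) = ef (n * x) := by
  have h : (n : ℝ) * x = n * Int.fract x + ((n * ⌊x⌋ : ℤ) : ℝ) := by
    push_cast
    linear_combination -(n : ℝ) * (Int.fract_add_floor x)
  rw [h, ef_add, ef_intCast, mul_one]

theorem hasSum_bernoulliFun_two_fract (x : ℝ) :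
    HasSum (fun h : ℤ => 1 / (h : ℂ) ^ 2 * ef (h * x))
      (2 * Real.pi ^ 2 * (bernoulliFun 2 (Int.fract x) : ℂ)) := by
  have h := hasSum_one_div_pow_mul_fourier_mul_bernoulliFun (k := 2) le_rfl
    (x := Int.fract x) ⟨Int.fract_nonneg x, (Int.fract_lt_one x).le⟩
  convert h using 1
  · funext n
    rw [fourier_coe_apply, ← ef_intCast_mul_fract]
    unfold ef
    push_cast
    congr 2
    ring
  · rw [mul_pow, Complex.I_sq, Nat.factorial_two]
    push_cast
    ring

theorem hasSum_sawCoeff {δ : ℝ} (hδ : 0 < δ) (x : ℝ) :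
    HasSum (fun h : ℤ => sawCoeff δ h * ef (h * x)) (smoothSaw δ x : ℂ) := by
  have h := ((hasSum_bernoulliFun_two_fract (x + δ)).sub
    (hasSum_bernoulliFun_two_fract x)).div_const (4 * Real.pi ^ 2 * δ : ℂ)
  have hδ' : (δ : ℂ) ≠ 0 := by exact_mod_cast hδ.ne'
  have hpi : (Real.pi : ℂ) ≠ 0 := by exact_mod_cast Real.pi_ne_zero
  have h0 : (fun h : ℤ => sawCoeff δ h * ef (h * x)) = fun h : ℤ =>
      (1 / (h : ℂ) ^ 2 * ef (h * (x + δ)) - 1 / (h : ℂ) ^ 2 * ef (h * x)) /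
        (4 * Real.pi ^ 2 * δ : ℂ) := by
    funext n
    rw [mul_add, ef_add]
    unfold sawCoeff
    rcases eq_or_ne n 0 with rfl | hn
    · simp
    have hn' : (n : ℂ) ≠ 0 := by exact_mod_cast hn
    field_simp
  have h1 : (smoothSaw δ x : ℂ) = (2 * Real.pi ^ 2 * (bernoulliFun 2 (Int.fract (x + δ)) : ℂ) -
      2 * Real.pi ^ 2 * (bernoulliFun 2 (Int.fract x) : ℂ)) / (4 * Real.pi ^ 2 * δ : ℂ) := by
    unfold smoothSaw
    push_cast
    field_simp
    ring
  rw [h0, h1]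
  exact h

theorem norm_sawCoeff_le_inv_sq {δ : ℝ} (hδ : 0 < δ) (h : ℤ) :
    ‖sawCoeff δ h‖ ≤ 1 / (2 * Real.pi ^ 2 * δ) / (h : ℝ) ^ 2 := by
  have h1 : ‖ef (h * δ) - 1‖ ≤ 2 := (norm_sub_le _ _).trans (by
    rw [norm_ef, norm_one]; norm_num)
  have h2 : ‖(4 * Real.pi ^ 2 * δ * h ^ 2 : ℂ)‖ = 4 * Real.pi ^ 2 * δ * (h : ℝ) ^ 2 := by
    simp [abs_of_pos hδ, abs_of_pos Real.pi_pos]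
  unfold sawCoeff
  rw [norm_div, h2]
  rcases eq_or_ne h 0 with rfl | hh
  · simp
  have : (h : ℝ) ≠ 0 := by exact_mod_cast hh
  calc _ ≤ 2 / (4 * Real.pi ^ 2 * δ * (h : ℝ) ^ 2) := by gcongr
    _ = _ := by field_simp; norm_num

theorem norm_sawCoeff_le_inv {δ : ℝ} (hδ : 0 < δ) (h : ℤ) :
    ‖sawCoeff δ h‖ ≤ 1 / (2 * Real.pi) / |(h : ℝ)| := by
  have h1 : ‖ef (h * δ) - 1‖ ≤ 2 * Real.pi * (|(h : ℝ)| * δ) := by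
    have := norm_ef_sub_ef_le (h * δ) 0
    rwa [ef_zero, sub_zero, abs_mul, abs_of_pos hδ] at this
  have h2 : ‖(4 * Real.pi ^ 2 * δ * h ^ 2 : ℂ)‖ = 4 * Real.pi ^ 2 * δ * |(h : ℝ)| ^ 2 := by
    simp [abs_of_pos hδ, abs_of_pos Real.pi_pos]
  unfold sawCoeff
  rw [norm_div, h2]
  rcases eq_or_ne h 0 with rfl | hh
  · simp
  have : 0 < |(h : ℝ)| := abs_pos.2 (by exact_mod_cast hh)
  calc _ ≤ 2 * Real.pi * (|(h : ℝ)| * δ) / (4 * Real.pi ^ 2 * δ * |(h : ℝ)| ^ 2) := by gcongr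
    _ = _ := by field_simp; norm_num

theorem le_norm_sawCoeff_one {δ : ℝ} (hδ : 0 < δ) (hδ1 : δ ≤ 1 / 20) :
    99 / 100 / (2 * Real.pi) ≤ ‖sawCoeff δ 1‖ := by
  have hpi := Real.pi_pos
  have h1 : ‖ef δ - 1‖ = 2 * |Real.sin (Real.pi * δ)| := by
    have := Complex.norm_exp_I_mul_ofReal_sub_one (2 * Real.pi * δ)
    rw [norm_mul, Real.norm_eq_abs, Real.norm_eq_abs, abs_two] at this
    unfold ef
    rw [show (2 * Real.pi * δ / 2 : ℝ) = Real.pi * δ by ring] at this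
    rw [← this]
    congr 3
    push_cast
    ring
  have h2 := Real.sin_gt_sub_cube (x := Real.pi * δ) (by positivity)
  have h3 : 99 / 100 * (Real.pi * δ) ≤ Real.sin (Real.pi * δ) := by
    have h4 : (Real.pi * δ) ^ 2 ≤ 6 / 100 := by
      have : Real.pi * δ ≤ 3.15 * (1 / 20) := by
        gcongr
        exact Real.pi_lt_d2.le
      nlinarith [mul_pos hpi hδ]
    nlinarith [mul_pos hpi hδ]
  have h5 : ‖(4 * Real.pi ^ 2 * δ * (1 : ℤ) ^ 2 : ℂ)‖ = 4 * Real.pi ^ 2 * δ := by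
    simp [abs_of_pos hδ, abs_of_pos Real.pi_pos]
  unfold sawCoeff
  rw [norm_div, h5, Int.cast_one, one_mul, h1, div_le_div_iff₀ (by positivity) (by positivity)]
  have := h3.trans (le_abs_self _)
  nlinarith [mul_pos hpi hδ]

theorem smoothSaw_eq {δ x : ℝ} (hδ : 0 < δ) (hx : Int.fract x < 1 - δ) :
    smoothSaw δ x = Int.fract x - 1 / 2 + δ / 2 := by
  have h : Int.fract (x + δ) = Int.fract x + δ := by
    rw [Int.fract_eq_iff]
    refine ⟨by linarith [Int.fract_nonneg x], by linarith, ⌊x⌋, ?_⟩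
    linarith [Int.fract_add_floor x]
  unfold smoothSaw
  rw [h, bernoulliFun_two, bernoulliFun_two]
  field_simp
  ring

theorem abs_sub_smoothSaw_le {δ : ℝ} (hδ : 0 < δ) (hδ1 : δ ≤ 1 / 2) (x : ℝ) :
    |Int.fract x - 1 / 2 + δ / 2 - smoothSaw δ x| ≤ 2 := by
  rcases lt_or_ge (Int.fract x) (1 - δ) with hx | hx
  · rw [smoothSaw_eq hδ hx]; simp
  have hx0 := Int.fract_nonneg x
  have hx1 := Int.fract_lt_one x
  have h : Int.fract (x + δ) = Int.fract x + δ - 1 := by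
    rw [Int.fract_eq_iff]
    refine ⟨by linarith, by linarith, ⌊x⌋ + 1, ?_⟩
    push_cast
    linarith [Int.fract_add_floor x]
  have h1 : smoothSaw δ x = (1 - δ) * ((2 - δ - 2 * Int.fract x) / (2 * δ)) := by
    unfold smoothSaw
    rw [h, bernoulliFun_two, bernoulliFun_two]
    field_simp
    ring
  have h2 : |(2 - δ - 2 * Int.fract x) / (2 * δ)| ≤ 1 / 2 := by
    rw [abs_div, abs_of_pos (show 0 < 2 * δ by linarith), div_le_iff₀ (by linarith), abs_le]
    constructor <;> linarith
  have h3 : |smoothSaw δ x| ≤ 1 / 2 := by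
    rw [h1, abs_mul, abs_of_nonneg (show 0 ≤ 1 - δ by linarith)]
    nlinarith [abs_nonneg ((2 - δ - 2 * Int.fract x) / (2 * δ))]
  rw [abs_le] at h3 ⊢
  constructor <;> linarith

theorem sum_Icc_neg_inv_abs_le {H : ℝ} (hH : 1 ≤ H) :
    ∑ h ∈ Finset.Icc (-(⌊H⌋₊ : ℤ)) ⌊H⌋₊, 1 / |(h : ℝ)| ≤ 2 * (1 + Real.log H) := by
  have h0 := Finset.sum_Icc_of_even_eq_range (f := fun h : ℤ => 1 / |(h : ℝ)|)
    (fun h => by simp) ⌊H⌋₊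
  have h1 : ∑ m ∈ Finset.range (⌊H⌋₊ + 1), 1 / |((m : ℤ) : ℝ)| =
      ∑ a ∈ Finset.Icc 1 ⌊H⌋₊, (1 : ℝ) / a := by
    rw [Finset.range_eq_Ico, Finset.sum_eq_sum_Ico_succ_bot (by omega)]
    simp only [Nat.cast_zero, Int.cast_zero, abs_zero, div_zero, zero_add]
    exact Finset.sum_congr rfl fun a _ => by simp
  rw [h0, h1]
  have h2 := sum_Icc_inv_le_one_add_log ⌊H⌋₊
  have h3 : Real.log ⌊H⌋₊ ≤ Real.log H := by
    refine Real.log_le_log ?_ (Nat.floor_le (by linarith))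
    exact_mod_cast Nat.floor_pos.2 hH
  simp only [nsmul_eq_mul, Nat.cast_ofNat, Int.cast_zero, abs_zero, div_zero,
    sub_zero]
  linarith

/-- Truncation of a series over the integers, outside a finite set of exceptional terms. -/
theorem norm_sub_sum_le_of_hasSum {f : ℤ → ℂ} {s : ℂ} (hf : HasSum f s) (R : Finset ℤ)
    {V₁ V₂ H : ℝ} (hV₁ : 0 ≤ V₁) (hV₂ : 0 ≤ V₂) (hH : 1 ≤ H)
    (h₁ : ∀ h ∉ R, |(h : ℝ)| ≤ H → ‖f h‖ ≤ V₁ * (1 / |(h : ℝ)|))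
    (h₂ : ∀ h ∉ R, H < |(h : ℝ)| → ‖f h‖ ≤ V₂ / (h : ℝ) ^ 2) :
    ‖s - ∑ h ∈ R, f h‖ ≤
      2 * V₁ * (1 + Real.log H) +
        V₂ * H ^ (-(1 / 2) : ℝ) * ∑' h : ℤ, |(h : ℝ)| ^ (-(3 / 2) : ℝ) := by
  classical
  have hR : HasSum (fun h => if h ∈ R then f h else 0) (∑ h ∈ R, f h) := by
    have := hasSum_sum_of_ne_finset_zero (f := fun h => if h ∈ R then f h else 0) (s := R)
      (L := SummationFilter.unconditional ℤ) (fun h hh => if_neg hh)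
    rwa [Finset.sum_congr rfl fun h hh => if_pos hh] at this
  set J := Finset.Icc (-(⌊H⌋₊ : ℤ)) ⌊H⌋₊ with hJ
  have hmem : ∀ h : ℤ, h ∈ J ↔ |(h : ℝ)| ≤ H := by
    intro h
    rw [hJ, Finset.mem_Icc, ← abs_le, ← Int.cast_abs, Int.abs_eq_natAbs,
      Nat.cast_le, Nat.le_floor_iff (by linarith), Int.cast_natCast]
  have hG₁ : HasSum (fun h => if h ∈ J then V₁ * (1 / |(h : ℝ)|) else 0)
      (∑ h ∈ J, V₁ * (1 / |(h : ℝ)|)) := by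
    have := hasSum_sum_of_ne_finset_zero
      (f := fun h => if h ∈ J then V₁ * (1 / |(h : ℝ)|) else 0) (s := J)
      (L := SummationFilter.unconditional ℤ) (fun h hh => if_neg hh)
    rwa [Finset.sum_congr rfl fun h hh => if_pos hh] at this
  have hG₂ := ((Real.summable_abs_int_rpow (b := 3 / 2) (by norm_num)).hasSum).mul_left
    (V₂ * H ^ (-(1 / 2) : ℝ))
  have key := HasSum.norm_le_of_bounded (hf.sub hR) (hG₁.add hG₂) fun h => by
    have hpos : 0 ≤ V₂ * H ^ (-(1 / 2) : ℝ) * |(h : ℝ)| ^ (-(3 / 2) : ℝ) := by positivity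
    by_cases hhR : h ∈ R
    · rw [if_pos hhR, sub_self, norm_zero]
      refine add_nonneg ?_ hpos
      split_ifs <;> positivity
    rw [if_neg hhR, sub_zero]
    by_cases hhJ : h ∈ J
    · rw [if_pos hhJ]
      linarith [h₁ h hhR ((hmem h).1 hhJ)]
    rw [if_neg hhJ, zero_add]
    have hlt : H < |(h : ℝ)| := not_le.1 fun hh => hhJ ((hmem h).2 hh)
    refine (h₂ h hhR hlt).trans ?_
    rw [div_eq_mul_inv, mul_assoc]
    refine mul_le_mul_of_nonneg_left ?_ hV₂
    have hh0 : 0 < |(h : ℝ)| := by linarith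
    rw [← sq_abs, ← Real.rpow_natCast, ← Real.rpow_neg hh0.le,
      show (-((2 : ℕ) : ℝ)) = -(1 / 2) + -(3 / 2) by norm_num, Real.rpow_add hh0]
    refine mul_le_mul_of_nonneg_right ?_ (by positivity)
    exact Real.rpow_le_rpow_of_nonpos (by linarith) hlt.le (by norm_num)
  refine key.trans ?_
  rw [← Finset.mul_sum]
  have := mul_le_mul_of_nonneg_left (sum_Icc_neg_inv_abs_le hH) hV₁
  linarith

theorem sum_Ioc_vonMangoldt_eq (P : ℕ) : ∑ d ∈ Finset.Ioc P (4 * P),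
    ArithmeticFunction.vonMangoldt d = Chebyshev.psi ((4 * P : ℕ) : ℝ) - Chebyshev.psi (P : ℝ) := by
  unfold Chebyshev.psi
  rw [Nat.floor_natCast, Nat.floor_natCast, eq_sub_iff_add_eq, add_comm]
  exact Finset.sum_Ioc_consecutive _ (Nat.zero_le _) (by omega)

theorem eventually_sqrt_mul_log_le {κ : ℝ} (hκ : 0 < κ) : ∀ᶠ P : ℕ in Filter.atTop,
    2 * Real.sqrt ((4 * P : ℕ) : ℝ) * Real.log ((4 * P : ℕ) : ℝ) ≤ κ * P := by
  filter_upwards [eventually_mul_rpow_neg_le_log_rpow (show (0 : ℝ) < 1 / 2 by norm_num) 2 1,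
    tendsto_log_natCast_atTop.eventually (Filter.eventually_ge_atTop (8 / κ)),
    Filter.eventually_ge_atTop 4] with P h1 h2 h3
  have hP : (4 : ℝ) ≤ P := by exact_mod_cast h3
  have hL : 0 < Real.log P := Real.log_pos (by linarith)
  have h4 : Real.log ((4 * P : ℕ) : ℝ) ≤ 2 * Real.log P := by
    push_cast
    rw [Real.log_mul (by norm_num) (by linarith)]
    linarith [Real.log_le_log (by norm_num) hP]
  have h5 : Real.sqrt ((4 * P : ℕ) : ℝ) = 2 * (P * (P : ℝ) ^ (-(1 / 2) : ℝ)) := by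
    push_cast
    rw [Real.sqrt_mul (by norm_num), show (4 : ℝ) = 2 ^ 2 by norm_num,
      Real.sqrt_sq (by norm_num), Real.sqrt_eq_rpow]
    congr 1
    nth_rewrite 2 [← Real.rpow_one (P : ℝ)]
    rw [← Real.rpow_add (by linarith)]
    norm_num
  rw [one_mul] at h1
  calc 2 * Real.sqrt ((4 * P : ℕ) : ℝ) * Real.log ((4 * P : ℕ) : ℝ)
      ≤ 2 * (2 * (P * Real.log P ^ (-2 : ℝ))) * (2 * Real.log P) := by
        rw [h5]; gcongr
    _ = 8 / Real.log P * P := by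
        rw [Real.rpow_neg hL.le, Real.rpow_two]; field_simp; norm_num
    _ ≤ κ * P := by
        gcongr
        rw [div_le_iff₀ hL]
        rwa [div_le_iff₀ hκ, mul_comm] at h2

theorem eventually_le_sum_vonMangoldt : ∀ᶠ P : ℕ in Filter.atTop,
    (P : ℝ) ≤ ∑ d ∈ Finset.Ioc P (4 * P), ArithmeticFunction.vonMangoldt d := by
  filter_upwards [eventually_sqrt_mul_log_le (show (0 : ℝ) < 1 / 20 by norm_num),
    Filter.eventually_ge_atTop 100] with P h1 h3
  have hP : (100 : ℝ) ≤ P := by exact_mod_cast h3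
  rw [sum_Ioc_vonMangoldt_eq]
  have h4 := Chebyshev.theta_ge' (x := ((4 * P : ℕ) : ℝ)) (by push_cast; linarith)
  have h5 := Chebyshev.theta_le_psi ((4 * P : ℕ) : ℝ)
  have h6 := Chebyshev.psi_le (x := (P : ℝ)) (by linarith)
  have h7 : 2 * Real.sqrt P * Real.log P ≤
      2 * Real.sqrt ((4 * P : ℕ) : ℝ) * Real.log ((4 * P : ℕ) : ℝ) := by
    have : (P : ℝ) ≤ ((4 * P : ℕ) : ℝ) := by push_cast; linarith
    have := Real.log_nonneg (show (1 : ℝ) ≤ P by linarith)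
    gcongr
  have h8 : Real.log (((4 * P : ℕ) : ℝ) + 2) ≤ 2 * Real.sqrt ((4 * P : ℕ) : ℝ) *
      Real.log ((4 * P : ℕ) : ℝ) := by
    have h9 : (4 : ℝ) ≤ ((4 * P : ℕ) : ℝ) := by push_cast; linarith
    have h10 : 1 ≤ Real.sqrt ((4 * P : ℕ) : ℝ) := Real.one_le_sqrt.2 (by linarith)
    have h11 : Real.log (((4 * P : ℕ) : ℝ) + 2) ≤ 2 * Real.log ((4 * P : ℕ) : ℝ) := by
      rw [← Real.log_rpow (by linarith), Real.rpow_two]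
      exact Real.log_le_log (by linarith) (by nlinarith)
    nlinarith [Real.log_nonneg (show (1 : ℝ) ≤ ((4 * P : ℕ) : ℝ) by linarith)]
  have h12 : Real.log 4 = 2 * Real.log 2 := by
    rw [show (4 : ℝ) = 2 ^ 2 by norm_num, Real.log_pow]; norm_num
  have h13 := Real.log_two_gt_d9
  have h14 := Real.log_two_lt_d9
  rw [h12] at h6
  push_cast at *
  nlinarith

theorem sum_vonMangoldt_le (P : ℕ) :
    ∑ d ∈ Finset.Ioc P (4 * P), ArithmeticFunction.vonMangoldt d ≤ 22 * P := by
  rw [sum_Ioc_vonMangoldt_eq]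
  have h1 := Chebyshev.psi_le_const_mul_self (x := ((4 * P : ℕ) : ℝ)) (by positivity)
  have h2 : 0 ≤ Chebyshev.psi (P : ℝ) := Chebyshev.psi_nonneg _
  have h12 : Real.log 4 = 2 * Real.log 2 := by
    rw [show (4 : ℝ) = 2 ^ 2 by norm_num, Real.log_pow]; norm_num
  have h14 := Real.log_two_lt_d9
  rw [h12] at h1
  push_cast at *
  nlinarith [Nat.cast_nonneg (α := ℝ) P]

/-- A weight in `[0, 1]` that vanishes at almost all primes has small average against `Λ`. -/
theorem eventually_sum_vonMangoldt_mul_le {κ : ℝ} (hκ : 0 < κ) : ∀ᶠ P : ℕ in Filter.atTop,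
    ∀ g : ℕ → ℝ, (∀ d, 0 ≤ g d) → (∀ d, g d ≤ 1) →
      (((Finset.Ioc P (4 * P)).filter fun p => p.Prime ∧ g p ≠ 0).card : ℝ) ≤
        P * Real.log P ^ (-2 : ℝ) →
      ∑ d ∈ Finset.Ioc P (4 * P), ArithmeticFunction.vonMangoldt d * g d ≤ κ * P := by
  filter_upwards [eventually_sqrt_mul_log_le (show 0 < κ / 2 by linarith),
    tendsto_log_natCast_atTop.eventually (Filter.eventually_ge_atTop (4 / κ)),
    Filter.eventually_ge_atTop 4] with P h1 h2 h3 g hg0 hg1 hcard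
  have hP : (4 : ℝ) ≤ P := by exact_mod_cast h3
  have hL : 0 < Real.log P := Real.log_pos (by linarith)
  have h4 : Real.log ((4 * P : ℕ) : ℝ) ≤ 2 * Real.log P := by
    push_cast
    rw [Real.log_mul (by norm_num) (by linarith)]
    linarith [Real.log_le_log (by norm_num) hP]
  set E := (Finset.Ioc P (4 * P)).filter fun p => p.Prime ∧ g p ≠ 0 with hE
  set Q := (Finset.Ioc P (4 * P)).filter fun p => ¬ p.Prime with hQ
  have hpt : ∀ d ∈ Finset.Ioc P (4 * P), ArithmeticFunction.vonMangoldt d * g d ≤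
      (if d.Prime ∧ g d ≠ 0 then Real.log ((4 * P : ℕ) : ℝ) else 0) +
      (if ¬ d.Prime then ArithmeticFunction.vonMangoldt d else 0) := by
    intro d hd
    rw [Finset.mem_Ioc] at hd
    have hΛ : 0 ≤ ArithmeticFunction.vonMangoldt d := ArithmeticFunction.vonMangoldt_nonneg
    have hmul : ArithmeticFunction.vonMangoldt d * g d ≤ ArithmeticFunction.vonMangoldt d :=
      mul_le_of_le_one_right hΛ (hg1 d)
    by_cases hdp : d.Prime
    · by_cases hgd : g d = 0
      · simp [hgd, hdp]
      · rw [if_pos ⟨hdp, hgd⟩, if_neg (not_not.2 hdp), add_zero]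
        refine hmul.trans (ArithmeticFunction.vonMangoldt_le_log.trans ?_)
        exact Real.log_le_log (by exact_mod_cast hdp.pos) (by exact_mod_cast hd.2)
    · rw [if_neg fun h => hdp h.1, if_pos hdp, zero_add]
      exact hmul
  have h5 : ∑ d ∈ Q, ArithmeticFunction.vonMangoldt d ≤ κ / 2 * P := by
    refine le_trans ?_ h1
    refine le_trans ?_ (Chebyshev.psi_sub_theta_le (x := ((4 * P : ℕ) : ℝ))
      (by push_cast; linarith))
    rw [Chebyshev.psi_sub_theta_eq_sum_not_prime, Nat.floor_natCast]
    refine Finset.sum_le_sum_of_subset_of_nonneg ?_ fun _ _ _ =>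
      ArithmeticFunction.vonMangoldt_nonneg
    exact Finset.filter_subset_filter _ (Finset.Ioc_subset_Ioc_left (Nat.zero_le _))
  have h6 : (E.card : ℝ) * Real.log ((4 * P : ℕ) : ℝ) ≤ κ / 2 * P := by
    calc (E.card : ℝ) * Real.log ((4 * P : ℕ) : ℝ)
        ≤ (P * Real.log P ^ (-2 : ℝ)) * (2 * Real.log P) := by gcongr
      _ = 2 / Real.log P * P := by
          rw [Real.rpow_neg hL.le, Real.rpow_two]; field_simp
      _ ≤ κ / 2 * P := by
          refine mul_le_mul_of_nonneg_right ?_ (by linarith)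
          rw [div_le_iff₀ hL]
          rw [div_le_iff₀ hκ] at h2
          linarith
  calc _ ≤ _ := Finset.sum_le_sum hpt
    _ = E.card * Real.log ((4 * P : ℕ) : ℝ) + ∑ d ∈ Q, ArithmeticFunction.vonMangoldt d := by
        rw [Finset.sum_add_distrib, ← Finset.sum_filter, ← Finset.sum_filter, Finset.sum_const,
          nsmul_eq_mul]
    _ ≤ κ * P := by linarith

theorem eventually_two_mul_exp_mul_exp_rpow_le {s r : ℝ} (hsr : s < r) (hr : 1 < r) :
    ∀ᶠ L : ℝ in Filter.atTop, 2 * Real.exp L * Real.exp (L ^ s) ≤ Real.exp (L ^ r) := by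
  filter_upwards [(tendsto_rpow_atTop (sub_pos.2 hsr)).eventually (Filter.eventually_ge_atTop 2),
    (tendsto_rpow_atTop (sub_pos.2 hr)).eventually (Filter.eventually_ge_atTop 4),
    Filter.eventually_ge_atTop 1] with L h1 h2 hL
  have hL0 : 0 < L := by linarith
  have h3 : L ^ r = L ^ s * L ^ (r - s) := by rw [← Real.rpow_add hL0]; ring_nf
  have h4 : L ^ r = L * L ^ (r - 1) := by
    nth_rewrite 2 [← Real.rpow_one L]
    rw [← Real.rpow_add hL0]; ring_nf
  have h5 : 0 < L ^ s := Real.rpow_pos_of_pos hL0 s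
  have h6 : (2 : ℝ) ≤ Real.exp L := two_le_exp_one.trans (Real.exp_le_exp.2 hL)
  calc _ ≤ Real.exp L * Real.exp L * Real.exp (L ^ s) := by gcongr
    _ = Real.exp (L + L + L ^ s) := by rw [Real.exp_add, Real.exp_add]
    _ ≤ _ := Real.exp_le_exp.2 (by nlinarith)

/-- The exponential sum `∑ Λ(d) e(B / d)` over `P < d ≤ 4 P`. -/
noncomputable def primeSum (P : ℕ) (B : ℝ) : ℂ :=
  ∑ d ∈ Finset.Ioc P (4 * P), (ArithmeticFunction.vonMangoldt d : ℂ) * ef (B / d)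

theorem norm_primeSum_le_sum (P : ℕ) (B : ℝ) :
    ‖primeSum P B‖ ≤ ∑ d ∈ Finset.Ioc P (4 * P), ArithmeticFunction.vonMangoldt d := by
  refine (norm_sum_le _ _).trans (Finset.sum_le_sum fun d _ => ?_)
  rw [norm_mul, norm_ef, mul_one, Complex.norm_of_nonneg ArithmeticFunction.vonMangoldt_nonneg]

theorem hasSum_sawCoeff_mul_primeSum {δ : ℝ} (hδ : 0 < δ) (P : ℕ) (y θ : ℝ) :
    HasSum (fun h : ℤ => sawCoeff δ h * primeSum P (h * y - θ))
      (∑ d ∈ Finset.Ioc P (4 * P), (ArithmeticFunction.vonMangoldt d : ℂ) *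
        (smoothSaw δ (y / d) : ℂ) * ef (-θ / d)) := by
  have h := hasSum_sum (s := Finset.Ioc P (4 * P)) (fun d _ =>
    ((hasSum_sawCoeff hδ (y / d)).mul_left (ArithmeticFunction.vonMangoldt d : ℂ)).mul_right
      (ef (-θ / d)))
  refine h.congr_fun ?_
  intro n
  unfold primeSum
  rw [Finset.mul_sum]
  refine Finset.sum_congr rfl fun d _ => ?_
  rw [show (n * y - θ) / (d : ℝ) = n * (y / d) + -θ / d by ring, ef_add]
  ring

theorem eventually_norm_sub_sum_sawCoeff_le {c η κ : ℝ} (hc : 0 < c) (hc2 : c ≤ 1 / 8)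
    (hη : 0 < η) (hη1 : η < 1) (hκ : 0 < κ) : ∀ᶠ P : ℕ in Filter.atTop, ∀ y θ : ℝ,
      |y| ≤ Real.exp (Real.log P ^ (3 / 2 - η)) → |θ| ≤ Real.exp (Real.log P ^ (3 / 2 - η)) →
      ∀ R : Finset ℤ, (∀ h : ℤ, h ∉ R → h ≠ 0 → (P : ℝ) ^ (1 + c) ≤ |h * y - θ|) →
      ‖∑ d ∈ Finset.Ioc P (4 * P), (ArithmeticFunction.vonMangoldt d : ℂ) *
        (smoothSaw ((P : ℝ) ^ (-(2 * c))) (y / d) : ℂ) * ef (-θ / d) -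
        ∑ h ∈ R, sawCoeff ((P : ℝ) ^ (-(2 * c))) h * primeSum P (h * y - θ)‖ ≤ κ * P := by
  obtain ⟨P₁, hP₁⟩ := exists_norm_sum_vonMangoldt_ef_le hc (show c ≤ 1 / 2 by linarith)
    (show 0 < η / 2 by linarith) (A := 2) (by norm_num)
  set K := ∑' h : ℤ, |(h : ℝ)| ^ (-(3 / 2) : ℝ) with hK
  have hK0 : 0 ≤ K := tsum_nonneg fun _ => by positivity
  filter_upwards [eventually_mul_rpow_neg_le_log_rpow (show 0 < 2 * c by linarith) 1 (22 * K),
    tendsto_log_natCast_atTop.eventually (eventually_two_mul_exp_mul_exp_rpow_le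
      (s := 3 / 2 - η) (r := 3 / 2 - η / 2) (by linarith) (by linarith)),
    tendsto_log_natCast_atTop.eventually (Filter.eventually_ge_atTop (5 / κ)),
    tendsto_log_natCast_atTop.eventually (Filter.eventually_ge_atTop 1),
    Filter.eventually_ge_atTop P₁, Filter.eventually_ge_atTop 2]
    with P h1 h2 h3 h4 h5 h6 y θ hy hθ R hR
  have hP : (2 : ℝ) ≤ P := by exact_mod_cast h6
  have hP0 : (0 : ℝ) < P := by linarith
  have hL : 0 < Real.log P := by linarith
  have hpi := Real.pi_gt_three
  set δ := (P : ℝ) ^ (-(2 * c)) with hδd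
  have hδ : 0 < δ := Real.rpow_pos_of_pos hP0 _
  set H := (P : ℝ) ^ (8 * c) with hHd
  have hH1 : 1 ≤ H := Real.one_le_rpow (by linarith) (by linarith)
  have hHP : H ≤ P := by
    calc H ≤ (P : ℝ) ^ (1 : ℝ) := Real.rpow_le_rpow_of_exponent_le (by linarith) (by linarith)
      _ = P := Real.rpow_one _
  set E := Real.exp (Real.log P ^ (3 / 2 - η)) with hE
  have hE0 : 0 < E := Real.exp_pos _
  rw [Real.exp_log hP0] at h2
  have key := norm_sub_sum_le_of_hasSum (hasSum_sawCoeff_mul_primeSum hδ P y θ) R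
    (V₁ := P * Real.log P ^ (-2 : ℝ)) (V₂ := 22 * P / δ) (H := H) (by positivity)
    (by positivity) hH1 (fun h hh hhH => ?_) (fun h hh hhH => ?_)
  · refine key.trans ?_
    have e1 : 22 * P / δ * H ^ (-(1 / 2) : ℝ) * K = 22 * K * (P : ℝ) ^ (-(2 * c)) * P := by
      rw [hHd, ← Real.rpow_mul hP0.le, hδd, div_eq_mul_inv, ← Real.rpow_neg hP0.le,
        mul_assoc (22 * (P : ℝ)), ← Real.rpow_add hP0]
      ring_nf
    have e2 : Real.log H ≤ Real.log P := Real.log_le_log (by linarith) hHP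
    rw [e1]
    calc _ ≤ 2 * (P * Real.log P ^ (-2 : ℝ)) * (Real.log P + Real.log P) +
          Real.log P ^ (-1 : ℝ) * P := by gcongr
      _ = 5 / Real.log P * P := by
        rw [Real.rpow_neg hL.le, Real.rpow_two, Real.rpow_neg_one]; field_simp; norm_num
      _ ≤ κ * P := by
        refine mul_le_mul_of_nonneg_right ?_ hP0.le
        rw [div_le_iff₀ hκ] at h3
        rw [div_le_iff₀ hL]; linarith
  · rcases eq_or_ne h 0 with rfl | h0
    · simp [sawCoeff]
    have hup : |h * y - θ| ≤ Real.exp (Real.log P ^ (3 / 2 - η / 2)) := by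
      calc |h * y - θ| ≤ |(h : ℝ)| * |y| + |θ| := by
            rw [← abs_mul]; exact abs_sub _ _
        _ ≤ P * E + P * E := by
            have : |(h : ℝ)| * |y| ≤ P * E := by
              gcongr; exact hhH.trans hHP
            nlinarith
        _ = 2 * P * E := by ring
        _ ≤ _ := h2
    have hS := hP₁ P h5 _ (hR h hh h0) hup
    rw [norm_mul, mul_comm]
    refine mul_le_mul hS ((norm_sawCoeff_le_inv hδ h).trans ?_) (norm_nonneg _) (by positivity)
    gcongr
    rw [div_le_one (by positivity)]
    linarith
  · rw [norm_mul]
    have hS := (norm_primeSum_le_sum P (h * y - θ)).trans (sum_vonMangoldt_le P)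
    calc _ ≤ 1 / (2 * Real.pi ^ 2 * δ) / (h : ℝ) ^ 2 * (22 * P) :=
          mul_le_mul (norm_sawCoeff_le_inv_sq hδ h) hS (norm_nonneg _) (by positivity)
      _ ≤ 1 / (1 * δ) / (h : ℝ) ^ 2 * (22 * P) := by
          gcongr
          nlinarith
      _ = _ := by rw [one_mul]; ring

theorem eventually_sum_abs_sub_smoothSaw_le {c η κ : ℝ} (hc : 0 < c) (hc2 : c ≤ 1 / 8)
    (hη : 0 < η) (hη1 : η < 1) (hκ : 0 < κ) : ∀ᶠ P : ℕ in Filter.atTop, ∀ y : ℕ,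
      (y : ℝ) ≤ Real.exp (Real.log P ^ (3 / 2 - η)) →
      ∑ d ∈ Finset.Ioc P (4 * P), ArithmeticFunction.vonMangoldt d *
        |Int.fract ((y : ℝ) / d) - 1 / 2 + (P : ℝ) ^ (-(2 * c)) / 2 -
          smoothSaw ((P : ℝ) ^ (-(2 * c))) ((y : ℝ) / d)| ≤ κ * P := by
  obtain ⟨P₁, hP₁⟩ := exists_card_fract_le hc (show c ≤ 1 / 2 by linarith) hη hη1.le
    (A := 2) (by norm_num)
  filter_upwards [eventually_sum_vonMangoldt_mul_le (show 0 < κ / 2 by linarith),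
    eventually_mul_rpow_neg_le_log_rpow (show 0 < 2 * c by linarith) 0 2,
    Filter.eventually_ge_atTop P₁, Filter.eventually_ge_atTop 1] with P h1 h2 h3 h4 y hy
  have hP0 : (0 : ℝ) < P := by exact_mod_cast h4
  have hδ : 0 < (P : ℝ) ^ (-(2 * c)) := Real.rpow_pos_of_pos hP0 _
  set δ := (P : ℝ) ^ (-(2 * c)) with hδd
  have hδ1 : δ ≤ 1 / 2 := by
    rw [neg_zero, Real.rpow_zero] at h2; linarith
  set g : ℕ → ℝ := fun d =>
    |Int.fract ((y : ℝ) / d) - 1 / 2 + δ / 2 - smoothSaw δ ((y : ℝ) / d)| / 2 with hg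
  have h := h1 g (fun d => by positivity)
    (fun d => by have := abs_sub_smoothSaw_le hδ hδ1 ((y : ℝ) / d); simp only [hg]; linarith) (by
      refine le_trans ?_ (hP₁ P h3 y hy 1 le_rfl)
      refine Nat.cast_le.2 (Finset.card_le_card fun d hd => ?_)
      rw [Finset.mem_filter] at hd ⊢
      refine ⟨hd.1, ?_⟩
      by_contra hlt
      rw [pow_one, not_le] at hlt
      refine hd.2.2 ?_
      simp only [hg]
      rw [smoothSaw_eq hδ hlt]
      simp)
  have e : ∀ d : ℕ, ArithmeticFunction.vonMangoldt d *
      |Int.fract ((y : ℝ) / d) - 1 / 2 + δ / 2 - smoothSaw δ ((y : ℝ) / d)| =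
      2 * (ArithmeticFunction.vonMangoldt d * g d) := fun d => by simp only [hg]; ring
  rw [Finset.sum_congr rfl fun d _ => e d, ← Finset.mul_sum]
  linarith

/-- If a balanced combination of six fractional parts `{y i / p}` vanishes at almost all primes
`p`, then so does the contribution of the resonant frequencies of its Fourier expansion. -/
theorem eventually_norm_sum_resonant_le {c η κ : ℝ} (hc : 0 < c) (hc2 : c ≤ 1 / 8)
    (hη : 0 < η) (hη1 : η < 1) (hκ : 0 < κ) : ∀ᶠ P : ℕ in Filter.atTop,
      ∀ (y : Fin 6 → ℕ) (σ : Fin 6 → ℝ) (θ : ℝ), (∀ i, |σ i| ≤ 1) → ∑ i, σ i = 0 →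
      (∀ i, (y i : ℝ) ≤ Real.exp (Real.log P ^ (3 / 2 - η))) →
      |θ| ≤ Real.exp (Real.log P ^ (3 / 2 - η)) →
      (((Finset.Ioc P (4 * P)).filter fun p : ℕ => p.Prime ∧
        ∑ i, σ i * Int.fract ((y i : ℝ) / p) ≠ 0).card : ℝ) ≤ P * Real.log P ^ (-2 : ℝ) →
      ∀ R : Fin 6 → Finset ℤ,
      (∀ i, ∀ h : ℤ, h ∉ R i → h ≠ 0 → (P : ℝ) ^ (1 + c) ≤ |h * (y i : ℝ) - θ|) →
      ‖∑ i, (σ i : ℂ) * ∑ h ∈ R i,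
        sawCoeff ((P : ℝ) ^ (-(2 * c))) h * primeSum P (h * (y i : ℝ) - θ)‖ ≤ κ * P := by
  filter_upwards [eventually_norm_sub_sum_sawCoeff_le hc hc2 hη hη1 (show 0 < κ / 18 by linarith),
    eventually_sum_abs_sub_smoothSaw_le hc hc2 hη hη1 (show 0 < κ / 18 by linarith),
    eventually_sum_vonMangoldt_mul_le (show 0 < κ / 18 by linarith)]
    with P h1 h2 h3 y σ θ hσ hσ0 hy hθ hcard R hR
  set δ := (P : ℝ) ^ (-(2 * c)) with hδ
  set Λ : ℕ → ℝ := fun d => ArithmeticFunction.vonMangoldt d with hΛ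
  have hΛ0 : ∀ d, 0 ≤ Λ d := fun d => ArithmeticFunction.vonMangoldt_nonneg
  set s : Fin 6 → ℂ := fun i => ∑ d ∈ Finset.Ioc P (4 * P), (Λ d : ℂ) *
        (smoothSaw δ ((y i : ℝ) / d) : ℂ) * ef (-θ / d) with hs
  set F : Fin 6 → ℂ := fun i => ∑ h ∈ R i, sawCoeff δ h * primeSum P (h * (y i : ℝ) - θ) with hF
  set f : ℕ → ℝ := fun d => ∑ i, σ i * Int.fract ((y i : ℝ) / d) with hf
  set E : Fin 6 → ℕ → ℝ := fun i d =>
    Int.fract ((y i : ℝ) / d) - 1 / 2 + δ / 2 - smoothSaw δ ((y i : ℝ) / d) with hE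
  have htail : ∀ i, ‖s i - F i‖ ≤ κ / 18 * P := fun i =>
    h1 (y i) θ (by rw [Nat.abs_cast]; exact hy i) hθ (R i) (hR i)
  have hEsum : ∀ i, ∑ d ∈ Finset.Ioc P (4 * P), Λ d * |E i d| ≤ κ / 18 * P := fun i =>
    h2 (y i) (hy i)
  have hf6 : ∀ d, |f d| ≤ 6 := by
    intro d
    calc |f d| ≤ ∑ i, |σ i * Int.fract ((y i : ℝ) / d)| := Finset.abs_sum_le_sum_abs _ _
      _ ≤ ∑ _i : Fin 6, (1 : ℝ) := by
          refine Finset.sum_le_sum fun i _ => ?_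
          rw [abs_mul, Int.abs_fract]
          exact mul_le_one₀ (hσ i) (Int.fract_nonneg _) (Int.fract_lt_one _).le
      _ = 6 := by simp
  have hfsum : ∑ d ∈ Finset.Ioc P (4 * P), Λ d * |f d| ≤ 6 * (κ / 18 * P) := by
    have := h3 (fun d => |f d| / 6) (fun d => by positivity)
      (fun d => by have := hf6 d; linarith) (by
        refine le_trans (Nat.cast_le.2 (Finset.card_le_card fun d hd => ?_)) hcard
        rw [Finset.mem_filter] at hd ⊢
        refine ⟨hd.1, hd.2.1, fun h0 => hd.2.2 ?_⟩
        have : f d = 0 := h0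
        rw [this]; simp)
    have e : ∀ d, Λ d * |f d| = 6 * (Λ d * (|f d| / 6)) := fun d => by ring
    rw [Finset.sum_congr rfl fun d _ => e d, ← Finset.mul_sum]
    linarith
  have hcomb : ∀ d : ℕ, ∑ i, σ i * smoothSaw δ ((y i : ℝ) / d) = f d - ∑ i, σ i * E i d := by
    intro d
    have e : ∀ i, σ i * smoothSaw δ ((y i : ℝ) / d) =
        σ i * Int.fract ((y i : ℝ) / d) - σ i * E i d + σ i * (δ / 2 - 1 / 2) := fun i => by
      simp only [hE]; ring
    rw [Finset.sum_congr rfl fun i _ => e i, Finset.sum_add_distrib, Finset.sum_sub_distrib,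
      ← Finset.sum_mul, hσ0, zero_mul, add_zero]
  have hmain : ‖∑ i, (σ i : ℂ) * s i‖ ≤ 12 * (κ / 18 * P) := by
    have e : ∑ i, (σ i : ℂ) * s i = ∑ d ∈ Finset.Ioc P (4 * P),
        ((Λ d * (f d - ∑ i, σ i * E i d) : ℝ) : ℂ) * ef (-θ / d) := by
      simp only [hs, Finset.mul_sum]
      rw [Finset.sum_comm]
      refine Finset.sum_congr rfl fun d _ => ?_
      rw [← hcomb, Finset.mul_sum]
      push_cast
      rw [Finset.sum_mul]
      exact Finset.sum_congr rfl fun i _ => by ring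
    rw [e]
    calc _ ≤ ∑ d ∈ Finset.Ioc P (4 * P), (Λ d * |f d| + ∑ i, Λ d * |E i d|) := by
          refine (norm_sum_le _ _).trans (Finset.sum_le_sum fun d _ => ?_)
          rw [norm_mul, norm_ef, mul_one, Complex.norm_real, Real.norm_eq_abs, abs_mul,
            abs_of_nonneg (hΛ0 d), ← Finset.mul_sum, ← mul_add]
          refine mul_le_mul_of_nonneg_left ((abs_sub _ _).trans ?_) (hΛ0 d)
          gcongr
          refine (Finset.abs_sum_le_sum_abs _ _).trans (Finset.sum_le_sum fun i _ => ?_)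
          rw [abs_mul]
          exact mul_le_of_le_one_left (abs_nonneg _) (hσ i)
      _ = ∑ d ∈ Finset.Ioc P (4 * P), Λ d * |f d| +
            ∑ i, ∑ d ∈ Finset.Ioc P (4 * P), Λ d * |E i d| := by
          rw [Finset.sum_add_distrib, Finset.sum_comm (s := Finset.Ioc P (4 * P))]
      _ ≤ 6 * (κ / 18 * P) + ∑ _i : Fin 6, κ / 18 * P := by
          gcongr with i
          exact hEsum i
      _ = _ := by simp; ring
  have hdiff : ‖∑ i, (σ i : ℂ) * s i - ∑ i, (σ i : ℂ) * F i‖ ≤ 6 * (κ / 18 * P) := by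
    rw [← Finset.sum_sub_distrib]
    calc _ ≤ ∑ _i : Fin 6, κ / 18 * P := by
          refine (norm_sum_le _ _).trans (Finset.sum_le_sum fun i _ => ?_)
          rw [← mul_sub, norm_mul, Complex.norm_real, Real.norm_eq_abs]
          exact (mul_le_of_le_one_left (norm_nonneg _) (hσ i)).trans (htail i)
      _ = _ := by simp
  have := norm_sub_norm_le (∑ i, (σ i : ℂ) * F i) (∑ i, (σ i : ℂ) * s i)
  rw [norm_sub_rev] at this
  linarith

/-- The integers `h` with `|h y - x| < W` (provided that `W ≤ x`). -/
noncomputable def resonantSet (y : ℕ) (x W : ℝ) : Finset ℤ :=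
  (Finset.Icc (-⌈x + W⌉) ⌈x + W⌉).filter fun h => |h * (y : ℝ) - x| < W

section resonantSet

variable {y : ℕ} {x W : ℝ} {h : ℤ}

theorem mem_resonantSet (hW : W ≤ x) : h ∈ resonantSet y x W ↔ |h * (y : ℝ) - x| < W := by
  rw [resonantSet, Finset.mem_filter, and_iff_right_iff_imp, Finset.mem_Icc, ← abs_le]
  intro hh
  rcases Nat.eq_zero_or_pos y with rfl | hy
  · rw [Nat.cast_zero, mul_zero, zero_sub, abs_neg] at hh
    linarith [le_abs_self x]
  have hy1 : (1 : ℝ) ≤ y := by exact_mod_cast hy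
  have h1 : |(h : ℝ)| ≤ x + W := by
    have h2 : |(h : ℝ)| ≤ |h * (y : ℝ)| := by
      rw [abs_mul, abs_of_nonneg (by linarith : (0 : ℝ) ≤ y)]
      exact le_mul_of_one_le_right (abs_nonneg _) hy1
    refine h2.trans (abs_le.2 ?_)
    rw [abs_lt] at hh
    constructor <;> linarith [hh.1, hh.2]
  have : ((|h| : ℤ) : ℝ) ≤ ⌈x + W⌉ := by
    rw [Int.cast_abs]; exact h1.trans (Int.le_ceil _)
  exact_mod_cast this

theorem lt_of_mem_resonantSet (hW : W ≤ x) (hh : h ∈ resonantSet y x W) {j : ℕ}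
    (hj : j * (y : ℝ) + W ≤ x) : (j : ℤ) + 1 ≤ h := by
  by_contra hlt
  have h1 : (h : ℝ) ≤ j := by exact_mod_cast show h ≤ j by omega
  rw [mem_resonantSet hW, abs_lt] at hh
  nlinarith [mul_le_mul_of_nonneg_right h1 (Nat.cast_nonneg (α := ℝ) y)]

theorem resonantSet_eq_empty (hW : W ≤ x) {j : ℕ} (hj : j * (y : ℝ) + W ≤ x)
    (hj' : x + W ≤ (j + 1) * (y : ℝ)) : resonantSet y x W = ∅ := by
  refine Finset.eq_empty_of_forall_notMem fun h hh => ?_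
  have h1 : (j : ℝ) + 1 ≤ h := by exact_mod_cast lt_of_mem_resonantSet hW hh hj
  rw [mem_resonantSet hW, abs_lt] at hh
  nlinarith [mul_le_mul_of_nonneg_right h1 (Nat.cast_nonneg (α := ℝ) y)]

theorem resonantSet_eq_singleton (hW : W ≤ x) (hx : |(y : ℝ) - x| < W)
    (hy : x + W ≤ 2 * (y : ℝ)) : resonantSet y x W = {1} := by
  refine Finset.eq_singleton_iff_unique_mem.2 ⟨(mem_resonantSet hW).2 (by simpa using hx), ?_⟩
  intro h hh
  have h1 : 1 ≤ h := by
    have := lt_of_mem_resonantSet hW hh (j := 0) (by simpa using hW)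
    omega
  by_contra hne
  have h2 : (2 : ℝ) ≤ h := by exact_mod_cast show 2 ≤ h by omega
  rw [mem_resonantSet hW, abs_lt] at hh
  nlinarith [mul_le_mul_of_nonneg_right h2 (Nat.cast_nonneg (α := ℝ) y)]

theorem sum_resonantSet_le (hW0 : 0 < W) (hW : 1000 * W ≤ x) {k : ℝ} (hk : 1 ≤ k)
    (hR : ∀ h ∈ resonantSet y x W, k ≤ h) :
    ∑ h ∈ resonantSet y x W, 1 / |(h : ℝ)| ≤ 1003 / 1000 / k + 3 / 1000 := by
  rcases Finset.eq_empty_or_nonempty (resonantSet y x W) with he | ⟨h₀, hh₀⟩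
  · rw [he, Finset.sum_empty]; positivity
  have hWx : W ≤ x := by linarith
  have hb : ∀ h ∈ resonantSet y x W, k ≤ h ∧ x - W ≤ h * (y : ℝ) ∧ h * (y : ℝ) ≤ x + W := by
    intro h hh
    refine ⟨hR h hh, ?_⟩
    rw [mem_resonantSet hWx, abs_lt] at hh
    constructor <;> linarith [hh.1, hh.2]
  obtain ⟨b1, b2, b3⟩ := hb h₀ hh₀
  have hy0 : (0 : ℝ) < y := by
    by_contra hy
    have : (y : ℝ) = 0 := le_antisymm (not_lt.1 hy) (Nat.cast_nonneg _)
    rw [this, mul_zero] at b2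
    linarith
  have hyk : k * y ≤ x + W := (mul_le_mul_of_nonneg_right b1 hy0.le).trans b3
  have hcard := card_Icc_int_real_le (resonantSet y x W) (x := (x - W) / y) (y := (x + W) / y)
    (by gcongr; linarith) fun h hh => by
      obtain ⟨-, c1, c2⟩ := hb h hh
      rw [div_le_iff₀ hy0, le_div_iff₀ hy0]
      exact ⟨c1, c2⟩
  have hterm : ∀ h ∈ resonantSet y x W, 1 / |(h : ℝ)| ≤ y / (x - W) := by
    intro h hh
    obtain ⟨c0, c1, c2⟩ := hb h hh
    rw [abs_of_pos (by linarith), div_le_div_iff₀ (by linarith) (by linarith)]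
    linarith
  have hxW : 0 < x - W := by linarith
  calc _ ≤ ((resonantSet y x W).card : ℝ) * (y / (x - W)) := by
        rw [← nsmul_eq_mul, ← Finset.sum_const]; exact Finset.sum_le_sum hterm
    _ ≤ ((x + W) / y - (x - W) / y + 1) * (y / (x - W)) := by gcongr
    _ = (2 * W + y) / (x - W) := by field_simp; ring
    _ ≤ (3 / 1000 * (x - W) + 1003 / 1000 / k * (x - W)) / (x - W) := by
        have h1 : (y : ℝ) ≤ 1003 / 1000 / k * (x - W) := by
          rw [div_mul_eq_mul_div, le_div_iff₀ (by linarith)]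
          linarith
        exact div_le_div_of_nonneg_right (by linarith) hxW.le
    _ = _ := by field_simp; ring

end resonantSet

theorem norm_sum_resonantSet_le {y : ℕ} {x W δ : ℝ} (hδ : 0 < δ) (P : ℕ) (hW0 : 0 < W)
    (hW : 1000 * W ≤ x) {k : ℝ} (hk : 1 ≤ k) (hR : ∀ h ∈ resonantSet y x W, k ≤ h) :
    ‖∑ h ∈ resonantSet y x W, sawCoeff δ h * primeSum P (h * (y : ℝ) - x)‖ ≤
      (∑ d ∈ Finset.Ioc P (4 * P), ArithmeticFunction.vonMangoldt d) / (2 * Real.pi) *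
        (1003 / 1000 / k + 3 / 1000) := by
  refine le_trans ?_ (mul_le_mul_of_nonneg_left (sum_resonantSet_le hW0 hW hk hR) ?_)
  · rw [Finset.mul_sum]
    refine (norm_sum_le _ _).trans (Finset.sum_le_sum fun h _ => ?_)
    rw [norm_mul]
    calc _ ≤ 1 / (2 * Real.pi) / |(h : ℝ)| *
          ∑ d ∈ Finset.Ioc P (4 * P), ArithmeticFunction.vonMangoldt d :=
          mul_le_mul (norm_sawCoeff_le_inv hδ h) (norm_primeSum_le_sum P _) (norm_nonneg _)
            (by have := Real.pi_pos; positivity)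
      _ = _ := by ring
  · have := Real.pi_pos
    have : 0 ≤ ∑ d ∈ Finset.Ioc P (4 * P), ArithmeticFunction.vonMangoldt d :=
      Finset.sum_nonneg fun _ _ => ArithmeticFunction.vonMangoldt_nonneg
    positivity

theorem primeSum_zero (P : ℕ) : primeSum P 0 =
    ((∑ d ∈ Finset.Ioc P (4 * P), ArithmeticFunction.vonMangoldt d : ℝ) : ℂ) := by
  unfold primeSum
  push_cast
  exact Finset.sum_congr rfl fun d _ => by rw [zero_div, ef_zero, mul_one]

theorem re_primeSum_nonneg {P : ℕ} {B : ℝ} (hB : 0 ≤ B) (hBP : B ≤ P / 1000) :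
    0 ≤ (primeSum P B).re := by
  unfold primeSum
  rw [Complex.re_sum]
  refine Finset.sum_nonneg fun d hd => ?_
  rw [Complex.re_ofReal_mul]
  refine mul_nonneg ArithmeticFunction.vonMangoldt_nonneg ?_
  have hd1 : (P : ℝ) < d := by exact_mod_cast (Finset.mem_Ioc.1 hd).1
  have hP0 : (0 : ℝ) ≤ P := Nat.cast_nonneg P
  have h1 : B / d ≤ 1 / 1000 := by
    rw [div_le_iff₀ (by linarith)]; linarith
  have h0 : 0 ≤ B / d := by positivity
  rw [ef, show (2 * Real.pi * ((B / d : ℝ) : ℂ) * Complex.I : ℂ) =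
    ((2 * Real.pi * (B / d) : ℝ) : ℂ) * Complex.I by push_cast; ring,
    Complex.exp_ofReal_mul_I_re]
  have := Real.pi_pos
  refine Real.cos_nonneg_of_mem_Icc ⟨?_, ?_⟩ <;> nlinarith

/-- The contribution of the divisor `d` to the valuation of `n.choose m`. -/
def carry (n m d : ℕ) : ℤ :=
  ((n / d : ℕ) : ℤ) - ((m / d : ℕ) : ℤ) - (((n - m) / d : ℕ) : ℤ)

theorem natCast_div_eq_sub_fract (y d : ℕ) :
    ((y / d : ℕ) : ℝ) = (y : ℝ) / d - Int.fract ((y : ℝ) / d) := by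
  rw [← Nat.floor_div_eq_div (K := ℝ), natCast_floor_eq_intCast_floor (by positivity)]
  exact (Int.self_sub_fract _).symm

theorem carry_eq_fract {n m : ℕ} (hmn : m ≤ n) (d : ℕ) : (carry n m d : ℝ) =
    Int.fract ((m : ℝ) / d) + Int.fract (((n - m : ℕ) : ℝ) / d) - Int.fract ((n : ℝ) / d) := by
  unfold carry
  simp only [Int.cast_sub, Int.cast_natCast]
  rw [natCast_div_eq_sub_fract, natCast_div_eq_sub_fract, natCast_div_eq_sub_fract,
    Nat.cast_sub hmn, sub_div]
  ring

/-- Specialization of `eventually_norm_sum_resonant_le` to a difference of two carries. -/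
theorem eventually_norm_carry_resonant_le {c η κ : ℝ} (hc : 0 < c) (hc2 : c ≤ 1 / 8)
    (hη : 0 < η) (hη1 : η < 1) (hκ : 0 < κ) : ∀ᶠ P : ℕ in Filter.atTop,
      ∀ (n m n' m' : ℕ) (x : ℝ), m < m' → 2 * m' ≤ n' → n' < n →
      (n : ℝ) ≤ Real.exp (Real.log P ^ (3 / 2 - η)) → 0 ≤ x → x ≤ n → (P : ℝ) ^ (1 + c) ≤ x →
      (((Finset.Ioc P (4 * P)).filter fun p : ℕ => p.Prime ∧
        carry n m p ≠ carry n' m' p).card : ℝ) ≤ P * Real.log P ^ (-2 : ℝ) →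
      ∀ F : ℕ → ℂ, (∀ y, F y = ∑ h ∈ resonantSet y x ((P : ℝ) ^ (1 + c)),
        sawCoeff ((P : ℝ) ^ (-(2 * c))) h * primeSum P (h * (y : ℝ) - x)) →
      ‖-F n + F m + F (n - m) + F n' - F m' - F (n' - m')‖ ≤ κ * P := by
  filter_upwards [eventually_norm_sum_resonant_le hc hc2 hη hη1 hκ]
    with P hP n m n' m' x hm hmn' hn hnE hx0 hxn hWx hcard F hF
  have hy : ∀ i, ((![n, m, n - m, n', m', n' - m'] : Fin 6 → ℕ) i) ≤ n := by
    intro i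
    fin_cases i <;> simp <;> omega
  have h := hP ![n, m, n - m, n', m', n' - m'] ![-1, 1, 1, 1, -1, -1] x
    (fun i => by fin_cases i <;> simp) (by simp [Fin.sum_univ_six])
    (fun i => le_trans (by exact_mod_cast hy i) hnE)
    (by rw [abs_of_nonneg hx0]; exact hxn.trans hnE)
    (by
      refine le_trans (Nat.cast_le.2 (Finset.card_le_card fun p hp => ?_)) hcard
      rw [Finset.mem_filter] at hp ⊢
      refine ⟨hp.1, hp.2.1, fun he => hp.2.2 ?_⟩
      have e1 := carry_eq_fract (n := n) (m := m) (by omega) p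
      have e2 := carry_eq_fract (n := n') (m := m') (by omega) p
      rw [he, e2] at e1
      simp [Fin.sum_univ_six]
      linarith)
    (fun i => resonantSet ((![n, m, n - m, n', m', n' - m'] : Fin 6 → ℕ) i) x ((P : ℝ) ^ (1 + c)))
    (fun i h hh _ => not_lt.1 fun hlt => hh ((mem_resonantSet hWx).2 hlt))
  refine le_trans (le_of_eq ?_) h
  congr 1
  simp only [← hF, Fin.sum_univ_six]
  simp
  ring

/-- If the carries of `(n, m)` and `(n', m')` agree at almost all primes in `(P, 4 P]`, then
`m` and `m'` are close, unless `n'` is close to `2 m'`. -/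
theorem eventually_lower_close_of_carry_eq {c η : ℝ} (hc : 0 < c) (hc2 : c ≤ 1 / 8)
    (hη : 0 < η) (hη1 : η < 1) : ∀ᶠ P : ℕ in Filter.atTop,
      ∀ n m n' m' : ℕ, m < m' → 2 * m' ≤ n' → n' < n →
      (n : ℝ) ≤ Real.exp (Real.log P ^ (3 / 2 - η)) → 1000 * (P : ℝ) ^ (1 + c) ≤ m' →
      ((n' : ℝ) - 2 * m' ≤ P / 1000 ∨ (P : ℝ) ^ (1 + c) ≤ (n' : ℝ) - 2 * m') →
      (((Finset.Ioc P (4 * P)).filter fun p : ℕ => p.Prime ∧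
        carry n m p ≠ carry n' m' p).card : ℝ) ≤ P * Real.log P ^ (-2 : ℝ) →
      (m' : ℝ) - m < (P : ℝ) ^ (1 + c) := by
  filter_upwards [eventually_norm_carry_resonant_le hc hc2 hη hη1
      (show (0 : ℝ) < 1 / 100 by norm_num), eventually_le_sum_vonMangoldt,
    eventually_mul_rpow_neg_le_log_rpow (show 0 < 2 * c by linarith) 0 20,
    Filter.eventually_ge_atTop 1] with P h1 hT h2 h3 n m n' m' hm hmn' hn hnE hmW hr hcard
  by_contra! hgap
  have hP0 : (0 : ℝ) < P := by exact_mod_cast h3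
  have hδ : 0 < (P : ℝ) ^ (-(2 * c)) := Real.rpow_pos_of_pos hP0 _
  have hW0 : 0 < (P : ℝ) ^ (1 + c) := Real.rpow_pos_of_pos hP0 _
  have hmW' : (P : ℝ) ^ (1 + c) ≤ m' := by linarith
  rw [neg_zero, Real.rpow_zero] at h2
  have h := h1 n m n' m' m' hm hmn' hn hnE (by positivity)
    (by exact_mod_cast (by omega : m' ≤ n)) hmW' hcard _ fun y => rfl
  beta_reduce at h
  set δ := (P : ℝ) ^ (-(2 * c))
  set W := (P : ℝ) ^ (1 + c)
  set T := ∑ d ∈ Finset.Ioc P (4 * P), ArithmeticFunction.vonMangoldt d with hTd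
  have hm1 : (m : ℝ) < m' := by exact_mod_cast hm
  have hmn1 : (2 : ℝ) * m' ≤ n' := by exact_mod_cast hmn'
  have hn1 : (n' : ℝ) < n := by exact_mod_cast hn
  have c1 : ((n - m : ℕ) : ℝ) = n - m := Nat.cast_sub (by omega)
  have c2 : ((n' - m' : ℕ) : ℝ) = n' - m' := Nat.cast_sub (by omega)
  rw [resonantSet_eq_empty (y := n) hmW' (j := 0) (by simpa using hmW')
      (by push_cast; linarith),
    resonantSet_eq_empty (y := n - m) hmW' (j := 0) (by simpa using hmW')
      (by rw [c1]; push_cast; linarith),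
    resonantSet_eq_empty (y := n') hmW' (j := 0) (by simpa using hmW')
      (by push_cast; linarith),
    resonantSet_eq_singleton (y := m') hmW' (by simpa using hW0) (by linarith)] at h
  have hz : ∃ z : ℂ, 0 ≤ z.re ∧ ∑ h ∈ resonantSet (n' - m') m' W,
      sawCoeff δ h * primeSum P (h * ((n' - m' : ℕ) : ℝ) - m') = sawCoeff δ 1 * z := by
    rcases lt_or_ge ((n' : ℝ) - 2 * m') W with hlt | hge
    · have hr' : (n' : ℝ) - 2 * m' ≤ P / 1000 := hr.resolve_right (not_le.2 hlt)
      refine ⟨primeSum P ((n' : ℝ) - 2 * m'), re_primeSum_nonneg (by linarith) hr', ?_⟩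
      rw [resonantSet_eq_singleton hmW' (by rw [c2, abs_of_nonneg] <;> linarith)
        (by rw [c2]; linarith), Finset.sum_singleton, c2]
      congr 2
      push_cast
      ring
    · refine ⟨0, le_rfl, ?_⟩
      rw [resonantSet_eq_empty hmW' (j := 0) (by simpa using hmW')
        (by rw [c2]; push_cast; linarith), Finset.sum_empty, mul_zero]
  obtain ⟨z, hz0, hz⟩ := hz
  have hres := norm_sum_resonantSet_le (y := m) (x := m') (W := W) (k := 2) hδ P hW0 hmW
    (by norm_num) (fun h hh => by
      have := lt_of_mem_resonantSet hmW' hh (j := 1) (by push_cast; linarith)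
      exact_mod_cast this)
  rw [hz, Finset.sum_empty, Finset.sum_empty, Finset.sum_empty, Finset.sum_singleton,
    Int.cast_one, one_mul, sub_self, primeSum_zero, ← hTd] at h
  set G := ∑ h ∈ resonantSet m m' W, sawCoeff δ h * primeSum P (h * (m : ℝ) - m')
  have hT0 : 0 < T := by linarith
  have h4 : T ≤ ‖(T : ℂ) + z‖ := by
    refine le_trans ?_ (Complex.re_le_norm _)
    rw [Complex.add_re, Complex.ofReal_re]; linarith
  have h5 : ‖sawCoeff δ 1 * ((T : ℂ) + z)‖ ≤ 1 / 100 * P + ‖G‖ := by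
    have e : sawCoeff δ 1 * ((T : ℂ) + z) =
        G - (-0 + G + 0 + 0 - sawCoeff δ 1 * (T : ℂ) - sawCoeff δ 1 * z) := by ring
    rw [e]
    refine (norm_sub_le _ _).trans ?_
    linarith
  have h6 := le_norm_sawCoeff_one hδ (by linarith)
  rw [norm_mul] at h5
  have h7 : 99 / 100 / (2 * Real.pi) * T ≤ ‖sawCoeff δ 1‖ * ‖(T : ℂ) + z‖ := by gcongr
  have h8 : 99 / 100 / (2 * Real.pi) * T ≤ 1 / 100 * T +
      T / (2 * Real.pi) * (1003 / 1000 / 2 + 3 / 1000) := by linarith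
  have hpi := Real.pi_pos
  have h9 := Real.pi_lt_d2
  rw [div_mul_eq_mul_div, div_mul_eq_mul_div T, ← sub_le_iff_le_add, ← sub_div,
    div_le_iff₀ (by positivity)] at h8
  nlinarith

/-- If the carries of `(n, m)` and `(n', m')` agree at almost all primes in `(P, 4 P]`, then
`n` and `n'` are close, provided that `n` is sufficiently large in terms of `m'`. -/
theorem eventually_upper_close_of_carry_eq {c η : ℝ} (hc : 0 < c) (hc2 : c ≤ 1 / 8)
    (hη : 0 < η) (hη1 : η < 1) : ∀ᶠ P : ℕ in Filter.atTop,
      ∀ n m n' m' : ℕ, m < m' → 2 * m' ≤ n' → n' < n →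
      (n : ℝ) ≤ Real.exp (Real.log P ^ (3 / 2 - η)) → 1000 * (P : ℝ) ^ (1 + c) ≤ m →
      20 * m' ≤ n →
      (((Finset.Ioc P (4 * P)).filter fun p : ℕ => p.Prime ∧
        carry n m p ≠ carry n' m' p).card : ℝ) ≤ P * Real.log P ^ (-2 : ℝ) →
      (n : ℝ) - n' < (P : ℝ) ^ (1 + c) := by
  filter_upwards [eventually_norm_carry_resonant_le hc hc2 hη hη1
      (show (0 : ℝ) < 1 / 1000 by norm_num), eventually_le_sum_vonMangoldt,
    eventually_mul_rpow_neg_le_log_rpow (show 0 < 2 * c by linarith) 0 20,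
    Filter.eventually_ge_atTop 1] with P h1 hT h2 h3 n m n' m' hm hmn' hn hnE hmW hnm hcard
  by_contra! hgap
  have hP0 : (0 : ℝ) < P := by exact_mod_cast h3
  have hδ : 0 < (P : ℝ) ^ (-(2 * c)) := Real.rpow_pos_of_pos hP0 _
  have hW0 : 0 < (P : ℝ) ^ (1 + c) := Real.rpow_pos_of_pos hP0 _
  have hm1 : (m : ℝ) < m' := by exact_mod_cast hm
  have hmn1 : (2 : ℝ) * m' ≤ n' := by exact_mod_cast hmn'
  have hn1 : (n' : ℝ) < n := by exact_mod_cast hn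
  have hnm1 : (20 : ℝ) * m' ≤ n := by exact_mod_cast hnm
  rw [neg_zero, Real.rpow_zero] at h2
  have hnW' : (P : ℝ) ^ (1 + c) ≤ n := by linarith
  have h := h1 n m n' m' n hm hmn' hn hnE (by positivity) le_rfl hnW' hcard _ fun y => rfl
  beta_reduce at h
  set δ := (P : ℝ) ^ (-(2 * c))
  set W := (P : ℝ) ^ (1 + c)
  set T := ∑ d ∈ Finset.Ioc P (4 * P), ArithmeticFunction.vonMangoldt d with hTd
  have c1 : ((n - m : ℕ) : ℝ) = n - m := Nat.cast_sub (by omega)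
  have c2 : ((n' - m' : ℕ) : ℝ) = n' - m' := Nat.cast_sub (by omega)
  have hnW : 1000 * W ≤ n := by linarith
  rw [resonantSet_eq_singleton (y := n) hnW' (by simpa using hW0) (by linarith),
    resonantSet_eq_empty (y := n - m) hnW' (j := 1) (by rw [c1]; push_cast; linarith)
      (by rw [c1]; push_cast; linarith)] at h
  have hres : ∀ y k : ℕ, (k : ℝ) * y + W ≤ n →
      ‖∑ h ∈ resonantSet y n W, sawCoeff δ h * primeSum P (h * (y : ℝ) - n)‖ ≤
        T / (2 * Real.pi) * (1003 / 1000 / ((k : ℝ) + 1) + 3 / 1000) := by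
    intro y k hk
    refine norm_sum_resonantSet_le hδ P hW0 hnW (by linarith [Nat.cast_nonneg (α := ℝ) k])
      fun h hh => ?_
    have := lt_of_mem_resonantSet hnW' hh hk
    exact_mod_cast this
  have r1 := hres m 19 (by push_cast; linarith)
  have r2 := hres m' 19 (by push_cast; linarith)
  have r3 : ‖∑ h ∈ resonantSet n' n W, sawCoeff δ h * primeSum P (h * (n' : ℝ) - n)‖ +
      ‖∑ h ∈ resonantSet (n' - m') n W,
        sawCoeff δ h * primeSum P (h * ((n' - m' : ℕ) : ℝ) - n)‖ ≤
      T / (2 * Real.pi) * (1003 / 1000 / 2 + 1003 / 1000 / 3 + 6 / 1000) := by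
    have hpi := Real.pi_pos
    have hT0 : 0 ≤ T / (2 * Real.pi) := div_nonneg (by linarith) (by positivity)
    have a2 := hres n' 1 (by push_cast; linarith)
    have b2 := hres (n' - m') 1 (by rw [c2]; push_cast; linarith)
    norm_num at a2 b2
    rcases le_total (2 * (n' : ℝ) + W) n with ha | ha
    · have a3 := hres n' 2 (by push_cast; linarith)
      norm_num at a3
      linarith
    rcases le_total (2 * (n' : ℝ)) (n + W) with hb | hb
    · have b3 := hres (n' - m') 2 (by rw [c2]; push_cast; linarith)
      norm_num at b3
      linarith
    · rw [resonantSet_eq_empty (y := n') hnW' (j := 1) (by push_cast; linarith)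
        (by push_cast; linarith), Finset.sum_empty, norm_zero]
      linarith
  norm_num at r1 r2
  rw [Finset.sum_empty, Finset.sum_singleton, Int.cast_one, one_mul, sub_self, primeSum_zero,
    ← hTd] at h
  set G₁ := ∑ h ∈ resonantSet m n W, sawCoeff δ h * primeSum P (h * (m : ℝ) - n)
  set G₂ := ∑ h ∈ resonantSet m' n W, sawCoeff δ h * primeSum P (h * (m' : ℝ) - n)
  set G₃ := ∑ h ∈ resonantSet n' n W, sawCoeff δ h * primeSum P (h * (n' : ℝ) - n)
  set G₄ := ∑ h ∈ resonantSet (n' - m') n W,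
    sawCoeff δ h * primeSum P (h * ((n' - m' : ℕ) : ℝ) - n)
  have hT0 : 0 < T := by linarith
  have h5 : ‖sawCoeff δ 1 * (T : ℂ)‖ ≤ 1 / 1000 * P + (‖G₁‖ + ‖G₂‖ + (‖G₃‖ + ‖G₄‖)) := by
    have e : sawCoeff δ 1 * (T : ℂ) =
        G₁ - G₂ + (G₃ - G₄) - (-(sawCoeff δ 1 * (T : ℂ)) + G₁ + 0 + G₃ - G₂ - G₄) := by ring
    rw [e]
    refine (norm_sub_le _ _).trans ?_
    have := (norm_add_le (G₁ - G₂) (G₃ - G₄)).trans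
      (add_le_add (norm_sub_le _ _) (norm_sub_le _ _))
    linarith
  have h6 := le_norm_sawCoeff_one hδ (by linarith)
  rw [norm_mul, Complex.norm_of_nonneg hT0.le] at h5
  have h7 : 99 / 100 / (2 * Real.pi) * T ≤ ‖sawCoeff δ 1‖ * T := by gcongr
  have hpi := Real.pi_pos
  have h9 := Real.pi_lt_d2
  have e : 99 / 100 / (2 * Real.pi) * T = T / (2 * Real.pi) * (99 / 100) := by ring
  have h8 : T / (2 * Real.pi) * (1 / 50) ≤ 1 / 1000 * T := by linarith
  rw [div_mul_eq_mul_div, div_le_iff₀ (by positivity)] at h8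
  nlinarith

theorem log_choose_succ_sub {n m : ℕ} (h : m ≤ n) :
    Real.log ((n + 1).choose m) - Real.log (n.choose m) =
      Real.log (((n : ℝ) + 1) / ((n : ℝ) + 1 - m)) := by
  have h0 : (0 : ℝ) < n.choose m := by exact_mod_cast Nat.choose_pos h
  have h1 : (0 : ℝ) < (n + 1).choose m := by exact_mod_cast Nat.choose_pos (by omega)
  have hmn : (m : ℝ) ≤ n := by exact_mod_cast h
  have key := Nat.choose_mul_succ_eq n m
  have key' : (n.choose m : ℝ) * (n + 1) = (n + 1).choose m * (n + 1 - m) := by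
    have := congrArg (Nat.cast (R := ℝ)) key
    push_cast [Nat.cast_sub (show m ≤ n + 1 by omega)] at this
    exact this
  rw [← Real.log_div h1.ne' h0.ne']
  congr 1
  rw [div_eq_div_iff h0.ne' (by linarith)]
  linarith

theorem log_choose_succ_right_sub {n m : ℕ} (h : m < n) :
    Real.log (n.choose (m + 1)) - Real.log (n.choose m) =
      Real.log (((n : ℝ) - m) / ((m : ℝ) + 1)) := by
  have h0 : (0 : ℝ) < n.choose m := by exact_mod_cast Nat.choose_pos h.le
  have h1 : (0 : ℝ) < n.choose (m + 1) := by exact_mod_cast Nat.choose_pos h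
  have key := Nat.choose_succ_right_eq n m
  have key' : (n.choose (m + 1) : ℝ) * (m + 1) = n.choose m * (n - m) := by
    have := congrArg (Nat.cast (R := ℝ)) key
    push_cast [Nat.cast_sub h.le] at this
    exact this
  rw [← Real.log_div h1.ne' h0.ne']
  congr 1
  rw [div_eq_div_iff h0.ne' (by positivity)]
  linarith

theorem div_sub_le_div_sub {x y z : ℝ} (hz : 0 ≤ z) (hzx : z < x) (hxy : x ≤ y) :
    y / (y - z) ≤ x / (x - z) := by
  rw [div_le_div_iff₀ (by linarith) (by linarith)]
  nlinarith

theorem log_choose_sub_le {n n' m : ℕ} (hm : m < n') (hn : n' ≤ n) :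
    Real.log (n.choose m) - Real.log (n'.choose m) ≤
      ((n : ℝ) - n') * Real.log ((n' : ℝ) / ((n' : ℝ) - m)) := by
  induction n, hn using Nat.le_induction with
  | base => simp
  | succ k hk ih =>
    have hstep := log_choose_succ_sub (show m ≤ k by omega)
    have hmn : (m : ℝ) < n' := by exact_mod_cast hm
    have hkn : (n' : ℝ) ≤ k := by exact_mod_cast hk
    have := Real.log_le_log (div_pos (by positivity) (by linarith))
      (div_sub_le_div_sub (Nat.cast_nonneg m) hmn (show (n' : ℝ) ≤ (k : ℝ) + 1 by linarith))
    push_cast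
    nlinarith

theorem le_log_choose_sub {n n' m : ℕ} (hm : m < n') (hn : n' ≤ n) :
    ((n : ℝ) - n') * Real.log ((n : ℝ) / ((n : ℝ) - m)) ≤
      Real.log (n.choose m) - Real.log (n'.choose m) := by
  suffices H : ∀ k : ℕ, n' ≤ k → k ≤ n →
      ((k : ℝ) - n') * Real.log ((n : ℝ) / ((n : ℝ) - m)) ≤
        Real.log (k.choose m) - Real.log (n'.choose m) from H n hn le_rfl
  intro k hk
  induction k, hk using Nat.le_induction with
  | base => simp
  | succ k hk ih =>
    intro hkn
    have ih := ih (by omega)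
    have hstep := log_choose_succ_sub (show m ≤ k by omega)
    have hmk : (m : ℝ) < (k : ℝ) + 1 := by exact_mod_cast (show m < k + 1 by omega)
    have hkn' : (k : ℝ) + 1 ≤ n := by exact_mod_cast hkn
    have := Real.log_le_log (div_pos (by linarith [Nat.cast_nonneg (α := ℝ) k]) (by linarith))
      (div_sub_le_div_sub (Nat.cast_nonneg m) hmk hkn')
    push_cast
    nlinarith

theorem log_choose_sub_right_le {n m m' : ℕ} (hm : 0 < m) (hmm : m ≤ m') (hn : m' ≤ n) :
    Real.log (n.choose m') - Real.log (n.choose m) ≤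
      ((m' : ℝ) - m) * Real.log (((n : ℝ) - m) / m) := by
  induction m', hmm using Nat.le_induction with
  | base => simp
  | succ k hk ih =>
    have ih := ih (by omega)
    have hstep := log_choose_succ_right_sub (show k < n by omega)
    have hm0 : (0 : ℝ) < m := by exact_mod_cast hm
    have hkn : (k : ℝ) < n := by exact_mod_cast (show k < n by omega)
    have hmk : (m : ℝ) ≤ k := by exact_mod_cast hk
    have := Real.log_le_log (div_pos (by linarith) (by linarith))
      (div_le_div₀ (show 0 ≤ (n : ℝ) - m by linarith) (show (n : ℝ) - k ≤ n - m by linarith) hm0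
        (show (m : ℝ) ≤ k + 1 by linarith))
    push_cast
    nlinarith

theorem le_log_choose_sub_right {n m m' : ℕ} (hmm : m ≤ m') (hn : m' < n) :
    ((m' : ℝ) - m) * Real.log (((n : ℝ) - m') / m') ≤
      Real.log (n.choose m') - Real.log (n.choose m) := by
  suffices H : ∀ k : ℕ, m ≤ k → k ≤ m' →
      ((k : ℝ) - m) * Real.log (((n : ℝ) - m') / m') ≤
        Real.log (n.choose k) - Real.log (n.choose m) from H m' hmm le_rfl
  intro k hk
  induction k, hk using Nat.le_induction with
  | base => simp
  | succ k hk ih =>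
    intro hkn
    have ih := ih (by omega)
    have hstep := log_choose_succ_right_sub (show k < n by omega)
    have hn' : (m' : ℝ) < n := by exact_mod_cast hn
    have hk0 : (0 : ℝ) ≤ k := Nat.cast_nonneg k
    have hkm : (k : ℝ) + 1 ≤ m' := by exact_mod_cast hkn
    have := Real.log_le_log (div_pos (by linarith) (by linarith))
      (div_le_div₀ (show 0 ≤ (n : ℝ) - k by linarith) (show (n : ℝ) - m' ≤ n - k by linarith)
        (by linarith) hkm)
    push_cast
    nlinarith

theorem div_le_log_div_sub {x y : ℝ} (hy : 0 ≤ y) (hyx : y < x) :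
    y / x ≤ Real.log (x / (x - y)) := by
  have hx : 0 < x := by linarith
  have h := Real.one_sub_inv_le_log_of_pos (show 0 < x / (x - y) from div_pos hx (by linarith))
  refine le_trans (le_of_eq ?_) h
  field_simp
  ring

/-- If `C(n, m) = C(n', m')` then `n - n'` is controlled by `m' - m`. -/
theorem sub_mul_div_le_of_choose_eq {n m n' m' : ℕ} (hm0 : 0 < m) (hm : m < m')
    (hmn : 2 * m' ≤ n') (hn : n' < n) (h : n.choose m = n'.choose m') :
    ((n : ℝ) - n') * (m / n) ≤ ((m' : ℝ) - m) * Real.log n := by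
  have h1 := le_log_choose_sub (show m < n' by omega) hn.le
  have h2 := log_choose_sub_right_le hm0 hm.le (show m' ≤ n' by omega)
  rw [h] at h1
  have hm0' : (1 : ℝ) ≤ m := by exact_mod_cast hm0
  have hmm : (m : ℝ) < m' := by exact_mod_cast hm
  have hmn' : 2 * (m' : ℝ) ≤ n' := by exact_mod_cast hmn
  have hn' : (n' : ℝ) < n := by exact_mod_cast hn
  have h3 := div_le_log_div_sub (show 0 ≤ (m : ℝ) by linarith) (show (m : ℝ) < n by linarith)
  have h4 : Real.log (((n' : ℝ) - m) / m) ≤ Real.log n := by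
    refine Real.log_le_log (div_pos (by linarith) (by linarith)) ?_
    rw [div_le_iff₀ (by linarith)]
    nlinarith
  nlinarith [mul_le_mul_of_nonneg_left h3 (show 0 ≤ (n : ℝ) - n' by linarith),
    mul_le_mul_of_nonneg_left h4 (show 0 ≤ (m' : ℝ) - m by linarith)]

/-- Discrete convexity of the level curves of the binomial coefficient. -/
theorem mul_lt_mul_of_choose_eq {n₁ n₂ n₃ m₁ m₂ m₃ : ℕ} (hm0 : 0 < m₁) (hm12 : m₁ < m₂)
    (hm23 : m₂ < m₃) (hmn : 2 * m₃ ≤ n₃) (hn23 : n₃ < n₂) (hn12 : n₂ < n₁)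
    (h12 : n₁.choose m₁ = n₂.choose m₂) (h23 : n₂.choose m₂ = n₃.choose m₃) :
    ((n₂ : ℝ) - n₃) * (m₂ - m₁) < ((n₁ : ℝ) - n₂) * (m₃ - m₂) := by
  have e1 := log_choose_sub_le (show m₁ < n₂ by omega) hn12.le
  have e2 := le_log_choose_sub_right hm12.le (show m₂ < n₂ by omega)
  have e3 := le_log_choose_sub (show m₂ < n₃ by omega) hn23.le
  have e4 := log_choose_sub_right_le (show 0 < m₂ by omega) hm23.le (show m₃ ≤ n₃ by omega)
  rw [h12] at e1
  rw [h23] at e3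
  have hm0' : (1 : ℝ) ≤ m₁ := by exact_mod_cast hm0
  have hm12' : (m₁ : ℝ) < m₂ := by exact_mod_cast hm12
  have hm23' : (m₂ : ℝ) < m₃ := by exact_mod_cast hm23
  have hmn' : 2 * (m₃ : ℝ) ≤ n₃ := by exact_mod_cast hmn
  have hn23' : (n₃ : ℝ) < n₂ := by exact_mod_cast hn23
  have hn12' : (n₂ : ℝ) < n₁ := by exact_mod_cast hn12
  have hA1 : 0 < Real.log ((n₂ : ℝ) / (n₂ - m₁)) := by
    apply Real.log_pos
    rw [lt_div_iff₀ (by linarith)]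
    linarith
  have hA : Real.log ((n₂ : ℝ) / (n₂ - m₁)) < Real.log ((n₂ : ℝ) / (n₂ - m₂)) := by
    apply Real.log_lt_log (div_pos (by linarith) (by linarith))
    exact div_lt_div_of_pos_left (by linarith) (by linarith) (by linarith)
  have hb0 : 0 ≤ Real.log (((n₃ : ℝ) - m₂) / m₂) := by
    apply Real.log_nonneg
    rw [le_div_iff₀ (by linarith)]
    linarith
  have hb : Real.log (((n₃ : ℝ) - m₂) / m₂) < Real.log (((n₂ : ℝ) - m₂) / m₂) := by
    apply Real.log_lt_log (div_pos (by linarith) (by linarith))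
    exact div_lt_div_of_pos_right (by linarith) (by linarith)
  set A := Real.log ((n₂ : ℝ) / (n₂ - m₁))
  set A' := Real.log ((n₂ : ℝ) / (n₂ - m₂))
  set b := Real.log (((n₂ : ℝ) - m₂) / m₂)
  set b' := Real.log (((n₃ : ℝ) - m₂) / m₂)
  have f1 : ((m₂ : ℝ) - m₁) * b ≤ (n₁ - n₂) * A := by linarith
  have f2 : ((n₂ : ℝ) - n₃) * A' ≤ (m₃ - m₂) * b' := by linarith
  by_contra! hcon
  have g1 : ((n₂ : ℝ) - n₃) * (m₂ - m₁) * A' ≤ (m₃ - m₂) * (m₂ - m₁) * b' := by nlinarith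
  have g2 : ((m₂ : ℝ) - m₁) * (m₃ - m₂) * b ≤ (n₁ - n₂) * (m₃ - m₂) * A := by nlinarith
  have g3 : ((m₃ : ℝ) - m₂) * (m₂ - m₁) * b' < (m₃ - m₂) * (m₂ - m₁) * b :=
    mul_lt_mul_of_pos_left hb (mul_pos (by linarith) (by linarith))
  have g4 : ((n₂ : ℝ) - n₃) * (m₂ - m₁) * A < (n₂ - n₃) * (m₂ - m₁) * A' :=
    mul_lt_mul_of_pos_left hA (mul_pos (by linarith) (by linarith))
  nlinarith

theorem sub_mul_le_of_choose_eq {n₁ n₂ m₁ m₂ : ℕ} {L : ℝ} (hm0 : 0 < m₁) (hm12 : m₁ < m₂)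
    (hmn : 2 * m₂ ≤ n₂) (hn12 : n₂ < n₁) (h12 : n₁.choose m₁ = n₂.choose m₂)
    (hL : L ≤ m₁) (hd : (m₂ : ℝ) - m₁ ≤ L) (ha : (n₁ : ℝ) - n₂ ≤ L) :
    ((m₂ : ℝ) - m₁) * n₁ ≤ 12 * L * m₁ := by
  have hm0' : (1 : ℝ) ≤ m₁ := by exact_mod_cast hm0
  have hm12' : (m₁ : ℝ) < m₂ := by exact_mod_cast hm12
  have hmn' : 2 * (m₂ : ℝ) ≤ n₂ := by exact_mod_cast hmn
  have hn12' : (n₂ : ℝ) < n₁ := by exact_mod_cast hn12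
  by_cases hbig : (n₁ : ℝ) ≤ 12 * m₁
  · nlinarith
  push Not at hbig
  have e1 := log_choose_sub_le (show m₁ < n₂ by omega) hn12.le
  have e2 := le_log_choose_sub_right hm12.le (show m₂ < n₂ by omega)
  rw [h12] at e1
  have hA : Real.log ((n₂ : ℝ) / (n₂ - m₁)) ≤ 2 * m₁ / n₂ := by
    refine (Real.log_le_sub_one_of_pos (div_pos (by linarith) (by linarith))).trans ?_
    rw [div_sub_one (by linarith), div_le_div_iff₀ (by linarith) (by linarith)]
    nlinarith
  have hb : (1 : ℝ) / 2 ≤ Real.log (((n₂ : ℝ) - m₂) / m₂) := by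
    have h2 : (2 : ℝ) ≤ ((n₂ : ℝ) - m₂) / m₂ := by
      rw [le_div_iff₀ (by linarith)]
      linarith
    have := Real.log_le_log (by norm_num) h2
    have := Real.log_two_gt_d9
    linarith
  have h3 : ((m₂ : ℝ) - m₁) * (1 / 2) ≤ (n₁ - n₂) * (2 * m₁ / n₂) :=
    (mul_le_mul_of_nonneg_left hb (by linarith)).trans
      ((e2.trans e1).trans (mul_le_mul_of_nonneg_left hA (by linarith)))
  rw [← mul_div_assoc ((n₁ : ℝ) - n₂), le_div_iff₀ (by linarith)] at h3
  nlinarith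

theorem log_div_sub_sub_le {x y u v L : ℝ} (hu : 0 < u) (huv : u ≤ v) (hvx : 2 * v ≤ x)
    (hxy : x ≤ y) (hv : v - u ≤ L) (hy : y - x ≤ 2 * L) :
    Real.log (x / (x - v)) - Real.log (y / (y - u)) ≤ 3 * L / u := by
  have hx0 : 0 < x := by linarith
  have hy0 : 0 < y := by linarith
  have hxv : 0 < x - v := by linarith
  have hyu : 0 < y - u := by linarith
  rw [← Real.log_div (by positivity) (by positivity)]
  refine (Real.log_le_sub_one_of_pos (by positivity)).trans ?_
  rw [div_div_div_eq, div_sub_one (by positivity)]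
  calc _ = ((v - u) * y + u * (y - x)) / ((x - v) * y) := by congr 1; ring
    _ ≤ (3 * L * y) / (u * y) := by
      have h1 : (v - u) * y ≤ L * y := by gcongr
      have h2 : u * (y - x) ≤ y * (2 * L) := by
        gcongr
        linarith
      exact div_le_div₀ (mul_nonneg (by linarith) hy0.le) (by linarith) (by positivity)
        (mul_le_mul_of_nonneg_right (by linarith) hy0.le)
    _ = 3 * L / u := by rw [mul_div_mul_right _ _ hy0.ne']

theorem log_sub_div_sub_le {x y u v L : ℝ} (hu : 0 < u) (huv : u ≤ v) (hvx : 2 * v ≤ x)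
    (hxy : x ≤ y) (hv : v - u ≤ 2 * L) (hy : y - x ≤ L) :
    Real.log ((y - u) / u) - Real.log ((x - v) / v) ≤ 5 * L / u := by
  have hxv : 0 < x - v := by linarith
  have hyu : 0 < y - u := by linarith
  have hv0 : 0 < v := by linarith
  rw [Real.log_div hyu.ne' hu.ne', Real.log_div hxv.ne' hv0.ne']
  have g1 : Real.log (y - u) - Real.log (x - v) ≤ 3 * L / u := by
    rw [← Real.log_div hyu.ne' hxv.ne']
    refine (Real.log_le_sub_one_of_pos (by positivity)).trans ?_
    rw [div_sub_one hxv.ne']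
    exact div_le_div₀ (by linarith) (by linarith) (by linarith) (by linarith)
  have g2 : Real.log v - Real.log u ≤ 2 * L / u := by
    rw [← Real.log_div hv0.ne' hu.ne']
    refine (Real.log_le_sub_one_of_pos (by positivity)).trans ?_
    rw [div_sub_one hu.ne']
    gcongr
  have : 5 * L / u = 3 * L / u + 2 * L / u := by ring
  linarith

/-- Three solutions on the left half that are close together cannot exist. -/
theorem le_of_three_choose_eq {n₁ n₂ n₃ m₁ m₂ m₃ : ℕ} {L : ℝ} (hm0 : 0 < m₁) (hm12 : m₁ < m₂)
    (hm23 : m₂ < m₃) (hmn : 2 * m₃ ≤ n₃) (hn23 : n₃ < n₂) (hn12 : n₂ < n₁)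
    (h12 : n₁.choose m₁ = n₂.choose m₂) (h23 : n₂.choose m₂ = n₃.choose m₃)
    (hL : L ≤ m₁) (hd1 : (m₂ : ℝ) - m₁ ≤ L) (hd2 : (m₃ : ℝ) - m₂ ≤ L)
    (ha1 : (n₁ : ℝ) - n₂ ≤ L) (ha2 : (n₂ : ℝ) - n₃ ≤ L) : (m₁ : ℝ) ≤ 96 * L ^ 3 := by
  have hD := mul_lt_mul_of_choose_eq hm0 hm12 hm23 hmn hn23 hn12 h12 h23
  have hdn := sub_mul_le_of_choose_eq hm0 hm12 (show 2 * m₂ ≤ n₂ by omega) hn12 h12 hL hd1 ha1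
  have e1 := le_log_choose_sub (show m₁ < n₂ by omega) hn12.le
  have e2 := log_choose_sub_right_le hm0 hm12.le (show m₂ ≤ n₂ by omega)
  have e3 := log_choose_sub_le (show m₂ < n₃ by omega) hn23.le
  have e4 := le_log_choose_sub_right hm23.le (show m₃ < n₃ by omega)
  rw [h12] at e1
  rw [h23] at e3
  have hD1 : ((n₂ : ℝ) - n₃) * (m₂ - m₁) + 1 ≤ ((n₁ : ℝ) - n₂) * (m₃ - m₂) := by
    have : ((n₂ : ℤ) - n₃) * (m₂ - m₁) < ((n₁ : ℤ) - n₂) * (m₃ - m₂) := by exact_mod_cast hD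
    exact_mod_cast Int.add_one_le_of_lt this
  have hm0' : (1 : ℝ) ≤ m₁ := by exact_mod_cast hm0
  have hm12' : (m₁ : ℝ) < m₂ := by exact_mod_cast hm12
  have hm23' : (m₂ : ℝ) < m₃ := by exact_mod_cast hm23
  have hmn' : 2 * (m₃ : ℝ) ≤ n₃ := by exact_mod_cast hmn
  have hn23' : (n₃ : ℝ) < n₂ := by exact_mod_cast hn23
  have hn12' : (n₂ : ℝ) < n₁ := by exact_mod_cast hn12
  have hL0 : 0 < L := by linarith
  have hA1 := div_le_log_div_sub (show 0 ≤ (m₁ : ℝ) by linarith) (show (m₁ : ℝ) < n₁ by linarith)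
  have hA := log_div_sub_sub_le (L := L) (x := n₃) (y := n₁) (u := m₁) (v := m₂)
    (by linarith) (by linarith) (by linarith) (by linarith) (by linarith) (by linarith)
  have hB := log_sub_div_sub_le (L := L) (x := n₃) (y := n₂) (u := m₁) (v := m₃)
    (by linarith) (by linarith) (by linarith) (by linarith) (by linarith) (by linarith)
  set A1 := Real.log ((n₁ : ℝ) / (n₁ - m₁))
  set A2 := Real.log ((n₃ : ℝ) / (n₃ - m₂))
  set B1 := Real.log (((n₂ : ℝ) - m₁) / m₁)
  set B2 := Real.log (((n₃ : ℝ) - m₃) / m₃)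
  have f1 : ((n₁ : ℝ) - n₂) * A1 ≤ (m₂ - m₁) * B1 := by linarith
  have f2 : ((m₃ : ℝ) - m₂) * B2 ≤ (n₂ - n₃) * A2 := by linarith
  set d1 := (m₂ : ℝ) - m₁ with hd1'
  set d2 := (m₃ : ℝ) - m₂
  set a1 := (n₁ : ℝ) - n₂
  set a2 := (n₂ : ℝ) - n₃
  have hd1p : 0 < d1 := by simp only [d1]; linarith
  have hd2p : 0 < d2 := by simp only [d2]; linarith
  have ha2p : 0 < a2 := by simp only [a2]; linarith
  have hA1p : 0 ≤ A1 := le_trans (by positivity) hA1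
  have g1 : A1 ≤ d1 * d2 * (B1 - B2) + d1 * a2 * (A2 - A1) := by
    have q1 := mul_le_mul_of_nonneg_right f1 hd2p.le
    have q2 := mul_le_mul_of_nonneg_right f2 hd1p.le
    have q3 := mul_le_mul_of_nonneg_right hD1 hA1p
    linarith
  have g2 : d1 * d2 * (B1 - B2) ≤ d1 * L * (5 * L / m₁) := by
    refine (mul_le_mul_of_nonneg_left hB (by positivity)).trans ?_
    gcongr
  have g3 : d1 * a2 * (A2 - A1) ≤ d1 * L * (3 * L / m₁) := by
    refine (mul_le_mul_of_nonneg_left hA (by positivity)).trans ?_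
    gcongr
  have g4 : (m₁ : ℝ) / n₁ ≤ 8 * L ^ 2 * d1 / m₁ := by
    refine (hA1.trans g1).trans ((add_le_add g2 g3).trans (le_of_eq (by ring)))
  rw [div_le_div_iff₀ (by linarith) (by linarith)] at g4
  have g5 : (m₁ : ℝ) * m₁ ≤ 96 * L ^ 3 * m₁ := by
    nlinarith [mul_le_mul_of_nonneg_left hdn (show 0 ≤ 8 * L ^ 2 by positivity)]
  exact le_of_mul_le_mul_right g5 (by linarith)

theorem factorization_choose_eq_sum_carry {p n m b : ℕ} (hp : p.Prime) (hmn : m ≤ n)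
    (hb0 : 0 < b) (hb : n < p ^ b) :
    ((n.choose m).factorization p : ℤ) = ∑ j ∈ Ico 1 b, carry n m (p ^ j) := by
  have hlog : ∀ k, k ≤ n → Nat.log p k < b := fun k hk => by
    rcases Nat.eq_zero_or_pos k with rfl | hk0
    · rwa [Nat.log_zero_right]
    · exact Nat.log_lt_of_lt_pow hk0.ne' (hk.trans_lt hb)
  have h := congrArg (fun f => f p) (congrArg Nat.factorization
    (Nat.choose_mul_factorial_mul_factorial hmn))
  rw [Nat.factorization_mul (mul_ne_zero (Nat.choose_pos hmn).ne' (Nat.factorial_ne_zero _))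
    (Nat.factorial_ne_zero _), Nat.factorization_mul (Nat.choose_pos hmn).ne'
    (Nat.factorial_ne_zero _)] at h
  simp only [Finsupp.add_apply, Nat.factorization_factorial hp (hlog n le_rfl),
    Nat.factorization_factorial hp (hlog m hmn),
    Nat.factorization_factorial hp (hlog (n - m) (Nat.sub_le _ _))] at h
  simp only [carry, sum_sub_distrib]
  have h' := congrArg (Nat.cast (R := ℤ)) h
  push_cast at h' ⊢
  linarith

/-- Equal binomial coefficients have equal carries at almost all primes, provided that the
carries at higher prime powers agree almost always. -/
theorem card_carry_ne_le_of_choose_eq {P n m n' m' b : ℕ} {K : ℝ} (hmn : m ≤ n) (hmn' : m' ≤ n')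
    (hn : n' ≤ n) (hb : n < P ^ b) (h : n.choose m = n'.choose m')
    (hK : ∀ j ∈ Ico 2 b, (((Ioc P (4 * P)).filter fun d : ℕ =>
      carry n m (d ^ j) ≠ carry n' m' (d ^ j)).card : ℝ) ≤ K) :
    (((Ioc P (4 * P)).filter fun p : ℕ => p.Prime ∧ carry n m p ≠ carry n' m' p).card : ℝ) ≤
      (b - 2 : ℕ) * K := by
  have hsub : ((Ioc P (4 * P)).filter fun p : ℕ => p.Prime ∧ carry n m p ≠ carry n' m' p) ⊆
      (Ico 2 b).biUnion fun j => (Ioc P (4 * P)).filter fun d : ℕ =>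
        carry n m (d ^ j) ≠ carry n' m' (d ^ j) := by
    intro p hp
    rw [mem_filter] at hp
    obtain ⟨hpP, hp, hne⟩ := hp
    by_contra hcon
    simp only [mem_biUnion, mem_filter, not_exists, not_and, not_not] at hcon
    have hPp : P ≤ p := (mem_Ioc.mp hpP).1.le
    have hb0 : 0 < b := by
      rcases Nat.eq_zero_or_pos b with rfl | hb0
      · exfalso
        have : n = 0 := by simpa using hb
        obtain ⟨rfl, rfl, rfl, rfl⟩ : n = 0 ∧ m = 0 ∧ n' = 0 ∧ m' = 0 := by omega
        exact hne rfl
      · exact hb0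
    have hnp : n < p ^ b := hb.trans_le (Nat.pow_le_pow_left hPp b)
    have e := factorization_choose_eq_sum_carry hp hmn hb0 hnp
    rw [h, factorization_choose_eq_sum_carry hp hmn' hb0 (hn.trans_lt hnp)] at e
    rcases Nat.lt_or_ge 1 b with hb1 | hb1
    · rw [sum_eq_sum_Ico_succ_bot hb1, sum_eq_sum_Ico_succ_bot hb1,
        sum_congr rfl fun j hj => hcon j hj hpP] at e
      simp only [pow_one] at e
      exact hne (by linarith)
    · have hsmall : ∀ k, k ≤ n → k / p = 0 := fun k hk =>
        Nat.div_eq_of_lt (hk.trans_lt (hnp.trans_le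
          (by simpa using Nat.pow_le_pow_right hp.pos hb1)))
      apply hne
      simp only [carry]
      rw [hsmall n le_rfl, hsmall m hmn, hsmall (n - m) (Nat.sub_le _ _), hsmall n' hn,
        hsmall m' (by omega), hsmall (n' - m') (by omega)]
  calc _ ≤ ((((Ico 2 b).biUnion fun j => (Ioc P (4 * P)).filter fun d : ℕ =>
        carry n m (d ^ j) ≠ carry n' m' (d ^ j)).card : ℕ) : ℝ) := by
        exact_mod_cast card_le_card hsub
    _ ≤ ∑ j ∈ Ico 2 b, (((Ioc P (4 * P)).filter fun d : ℕ =>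
        carry n m (d ^ j) ≠ carry n' m' (d ^ j)).card : ℝ) := by
        exact_mod_cast card_biUnion_le
    _ ≤ ∑ j ∈ Ico 2 b, K := sum_le_sum hK
    _ = (b - 2 : ℕ) * K := by simp

/-- Eventual form of `card_carry_ne_le_of_choose_eq`. -/
theorem eventually_card_carry_ne_le {η : ℝ} (hη : 0 < η) : ∀ᶠ P : ℕ in Filter.atTop,
    ∀ n m n' m' : ℕ, m ≤ n → m' ≤ n' → n' ≤ n →
      (n : ℝ) ≤ Real.exp (Real.log P ^ (3 / 2 - η)) → n.choose m = n'.choose m' →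
      (∀ j : ℕ, 2 ≤ j → (((Ioc P (4 * P)).filter fun d : ℕ =>
        carry n m (d ^ j) ≠ carry n' m' (d ^ j)).card : ℝ) ≤ 3 * (P * Real.log P ^ (-5 : ℝ))) →
      (((Ioc P (4 * P)).filter fun p : ℕ => p.Prime ∧ carry n m p ≠ carry n' m' p).card : ℝ) ≤
        P * Real.log P ^ (-2 : ℝ) := by
  filter_upwards [tendsto_log_natCast_atTop.eventually_ge_atTop 9,
    Filter.eventually_ge_atTop 1] with P hlog hP1 n m n' m' hmn hmn' hn hnE h hcar
  have hP0 : (0 : ℝ) < P := by exact_mod_cast hP1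
  set l := Real.log P with hl
  set b := ⌊l⌋₊ + 1 + 1
  have hb : n < P ^ b := by
    have h1 : (n : ℝ) < (P : ℝ) ^ b := by
      refine hnE.trans_lt ?_
      rw [← Real.rpow_natCast, Real.rpow_def_of_pos hP0]
      apply Real.exp_lt_exp.mpr
      have h2 : l ^ (3 / 2 - η) ≤ l ^ (2 : ℝ) :=
        Real.rpow_le_rpow_of_exponent_le (by linarith) (by linarith)
      have h3 := Nat.lt_floor_add_one l
      rw [Real.rpow_two] at h2
      push_cast [b]
      rw [← hl]
      nlinarith
    exact_mod_cast h1
  refine (card_carry_ne_le_of_choose_eq hmn hmn' hn hb h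
    fun j hj => hcar j (mem_Ico.mp hj).1).trans ?_
  have h3 : ((b - 2 : ℕ) : ℝ) ≤ l := by
    have : b - 2 = ⌊l⌋₊ := by omega
    rw [this]
    exact Nat.floor_le (by linarith)
  have h4 : l ^ (-2 : ℝ) = l ^ (3 : ℝ) * l ^ (-5 : ℝ) := by
    rw [← Real.rpow_add (by linarith)]
    norm_num
  have h5 : 0 ≤ P * l ^ (-5 : ℝ) := mul_nonneg hP0.le (Real.rpow_nonneg (by linarith) _)
  rw [h4]
  calc _ ≤ l * (3 * (P * l ^ (-5 : ℝ))) := by gcongr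
    _ = (3 * l) * (P * l ^ (-5 : ℝ)) := by ring
    _ ≤ l ^ (3 : ℝ) * (P * l ^ (-5 : ℝ)) := by
      gcongr
      rw [show (3 : ℝ) = ((3 : ℕ) : ℝ) by norm_num, Real.rpow_natCast]
      push_cast
      nlinarith [sq_nonneg l, mul_nonneg (show 0 ≤ l by linarith) (show 0 ≤ l - 9 by linarith)]
    _ = _ := by ring

theorem eventually_close_of_card_le {c η : ℝ} (hc : 0 < c) (hc2 : c ≤ 1 / 8) (hη : 0 < η)
    (hη1 : η < 1) : ∀ᶠ P : ℕ in Filter.atTop, ∀ n m n' m' : ℕ, m < m' → 2 * m' ≤ n' → n' < n →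
      (n : ℝ) ≤ Real.exp (Real.log P ^ (3 / 2 - η)) → 2000 * (P : ℝ) ^ (1 + c) ≤ m' →
      ((n' : ℝ) - 2 * m' ≤ P / 1000 ∨ (P : ℝ) ^ (1 + c) ≤ (n' : ℝ) - 2 * m') →
      n.choose m = n'.choose m' →
      (∀ j : ℕ, 2 ≤ j → (((Ioc P (4 * P)).filter fun d : ℕ =>
        carry n m (d ^ j) ≠ carry n' m' (d ^ j)).card : ℝ) ≤ 3 * (P * Real.log P ^ (-5 : ℝ))) →
      (m' : ℝ) - m < (P : ℝ) ^ (1 + c) ∧ (20 * m' ≤ n → (n : ℝ) - n' < (P : ℝ) ^ (1 + c)) := by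
  filter_upwards [eventually_card_carry_ne_le hη,
    eventually_lower_close_of_carry_eq hc hc2 hη hη1,
    eventually_upper_close_of_carry_eq hc hc2 hη hη1] with P h1 h2 h3
    n m n' m' hm hmn' hn hnE hmW hzone h hcar
  have hcard := h1 n m n' m' (by omega) (by omega) hn.le hnE h hcar
  have hW : (0 : ℝ) ≤ (P : ℝ) ^ (1 + c) := by positivity
  have hlow := h2 n m n' m' hm hmn' hn hnE (by linarith) hzone hcard
  exact ⟨hlow, fun h20 => h3 n m n' m' hm hmn' hn hnE (by linarith) h20 hcard⟩

/-- Small `m'`: the carries at higher powers vanish almost always. -/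
theorem eventually_close_of_le_rpow {c η : ℝ} (hc : 0 < c) (hc2 : c ≤ 1 / 8) (hη : 0 < η)
    (hη1 : η < 1) : ∀ᶠ P : ℕ in Filter.atTop, ∀ n m n' m' : ℕ, m < m' → 2 * m' ≤ n' → n' < n →
      (n : ℝ) ≤ Real.exp (Real.log P ^ (3 / 2 - η)) → 2000 * (P : ℝ) ^ (1 + c) ≤ m' →
      (m' : ℝ) ≤ (P : ℝ) ^ (2 - 2 * c) →
      ((n' : ℝ) - 2 * m' ≤ P / 1000 ∨ (P : ℝ) ^ (1 + c) ≤ (n' : ℝ) - 2 * m') →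
      n.choose m = n'.choose m' →
      (m' : ℝ) - m < (P : ℝ) ^ (1 + c) ∧ (20 * m' ≤ n → (n : ℝ) - n' < (P : ℝ) ^ (1 + c)) := by
  obtain ⟨P₀, hP₀⟩ := exists_card_div_pow_ne_le hc (show c ≤ 1 / 2 by linarith) hη hη1.le
    (show (0 : ℝ) ≤ 5 by norm_num)
  filter_upwards [eventually_close_of_card_le hc hc2 hη hη1, Filter.eventually_ge_atTop P₀,
    Filter.eventually_ge_atTop 2] with P h1 hP hP2 n m n' m' hm hmn' hn hnE hmW hmP hzone h
  refine h1 n m n' m' hm hmn' hn hnE hmW hzone h fun j hj => ?_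
  have hP1 : (1 : ℝ) ≤ P := by exact_mod_cast (by omega : 1 ≤ P)
  have hmm : (m : ℝ) ≤ m' := by exact_mod_cast hm.le
  have hnn : (n' : ℝ) ≤ n := by exact_mod_cast hn.le
  have b1 := hP₀ P hP (n - m) n (Nat.sub_le _ _) (by
    rw [Nat.cast_sub (by omega)]
    linarith) (le_trans (by exact_mod_cast Nat.sub_le _ _) hnE) j hj
  have b2 := hP₀ P hP (n' - m') n' (Nat.sub_le _ _) (by
    rw [Nat.cast_sub (by omega)]
    linarith) (le_trans (by exact_mod_cast (Nat.sub_le n' m').trans hn.le) hnE) j hj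
  have hmP2 : m' ≤ P ^ 2 := by
    have : (m' : ℝ) ≤ (P : ℝ) ^ (2 : ℝ) :=
      hmP.trans (Real.rpow_le_rpow_of_exponent_le hP1 (by linarith))
    rw [Real.rpow_two] at this
    exact_mod_cast this
  have hsub : ((Ioc P (4 * P)).filter fun d : ℕ => carry n m (d ^ j) ≠ carry n' m' (d ^ j)) ⊆
      ((Ioc P (4 * P)).filter fun d : ℕ => (n - m) / d ^ j ≠ n / d ^ j) ∪
      ((Ioc P (4 * P)).filter fun d : ℕ => (n' - m') / d ^ j ≠ n' / d ^ j) := by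
    intro d hd
    rw [mem_filter] at hd
    obtain ⟨hd, hne⟩ := hd
    by_contra hcon
    simp only [mem_union, mem_filter, hd, true_and, not_or, not_not] at hcon
    have hPd : P < d := (mem_Ioc.mp hd).1
    have hdj : m' < d ^ j := calc
      m' ≤ P ^ 2 := hmP2
      _ < d ^ 2 := Nat.pow_lt_pow_left hPd (by norm_num)
      _ ≤ d ^ j := Nat.pow_le_pow_right (by omega) hj
    apply hne
    simp only [carry]
    rw [hcon.1, hcon.2, Nat.div_eq_of_lt hdj, Nat.div_eq_of_lt (hm.trans hdj)]
    simp
  have hc3 : (((Ioc P (4 * P)).filter fun d : ℕ =>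
      carry n m (d ^ j) ≠ carry n' m' (d ^ j)).card : ℝ) ≤
      (((Ioc P (4 * P)).filter fun d : ℕ => (n - m) / d ^ j ≠ n / d ^ j).card : ℝ) +
      (((Ioc P (4 * P)).filter fun d : ℕ => (n' - m') / d ^ j ≠ n' / d ^ j).card : ℝ) := by
    exact_mod_cast (card_le_card hsub).trans (card_union_le _ _)
  have : 0 ≤ P * Real.log P ^ (-5 : ℝ) :=
    mul_nonneg (by linarith) (Real.rpow_nonneg (Real.log_nonneg hP1) _)
  linarith

/-- Close pairs: the carries at higher powers agree almost always. -/
theorem eventually_close_of_gap_le_rpow {c η : ℝ} (hc : 0 < c) (hc2 : c ≤ 1 / 8) (hη : 0 < η)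
    (hη1 : η < 1) : ∀ᶠ P : ℕ in Filter.atTop, ∀ n m n' m' : ℕ, m < m' → 2 * m' ≤ n' → n' < n →
      (n : ℝ) ≤ Real.exp (Real.log P ^ (3 / 2 - η)) → 2000 * (P : ℝ) ^ (1 + c) ≤ m' →
      ((n : ℝ) - n') + ((m' : ℝ) - m) ≤ (P : ℝ) ^ (2 - 2 * c) →
      ((n' : ℝ) - 2 * m' ≤ P / 1000 ∨ (P : ℝ) ^ (1 + c) ≤ (n' : ℝ) - 2 * m') →
      n.choose m = n'.choose m' →
      (m' : ℝ) - m < (P : ℝ) ^ (1 + c) ∧ (20 * m' ≤ n → (n : ℝ) - n' < (P : ℝ) ^ (1 + c)) := by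
  obtain ⟨P₀, hP₀⟩ := exists_card_div_pow_ne_le hc (show c ≤ 1 / 2 by linarith) hη hη1.le
    (show (0 : ℝ) ≤ 5 by norm_num)
  filter_upwards [eventually_close_of_card_le hc hc2 hη hη1, Filter.eventually_ge_atTop P₀] with
    P h1 hP n m n' m' hm hmn' hn hnE hmW hgap hzone h
  refine h1 n m n' m' hm hmn' hn hnE hmW hzone h fun j hj => ?_
  have hmm : (m : ℝ) < m' := by exact_mod_cast hm
  have hnn : (n' : ℝ) < n := by exact_mod_cast hn
  have hmn'' : (m' : ℝ) ≤ n' := by exact_mod_cast (by omega : m' ≤ n')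
  have b1 := hP₀ P hP n' n hn.le (by linarith) (by linarith) j hj
  have b2 := hP₀ P hP m m' hm.le (by linarith) (by linarith) j hj
  have b3 := hP₀ P hP (n' - m') (n - m) (by omega) (by
    rw [Nat.cast_sub (by omega), Nat.cast_sub (by omega)]
    linarith) (le_trans (by exact_mod_cast (Nat.sub_le n' m').trans hn.le) hnE) j hj
  have hsub : ((Ioc P (4 * P)).filter fun d : ℕ => carry n m (d ^ j) ≠ carry n' m' (d ^ j)) ⊆
      ((Ioc P (4 * P)).filter fun d : ℕ => n' / d ^ j ≠ n / d ^ j) ∪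
      ((Ioc P (4 * P)).filter fun d : ℕ => m / d ^ j ≠ m' / d ^ j) ∪
      ((Ioc P (4 * P)).filter fun d : ℕ => (n' - m') / d ^ j ≠ (n - m) / d ^ j) := by
    intro d hd
    rw [mem_filter] at hd
    obtain ⟨hd, hne⟩ := hd
    by_contra hcon
    simp only [mem_union, mem_filter, hd, true_and, not_or, not_not] at hcon
    apply hne
    simp only [carry]
    rw [hcon.1.1, hcon.1.2, hcon.2]
  have hc3 : (((Ioc P (4 * P)).filter fun d : ℕ =>
      carry n m (d ^ j) ≠ carry n' m' (d ^ j)).card : ℝ) ≤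
      (((Ioc P (4 * P)).filter fun d : ℕ => n' / d ^ j ≠ n / d ^ j).card : ℝ) +
      (((Ioc P (4 * P)).filter fun d : ℕ => m / d ^ j ≠ m' / d ^ j).card : ℝ) +
      (((Ioc P (4 * P)).filter fun d : ℕ => (n' - m') / d ^ j ≠ (n - m) / d ^ j).card : ℝ) := by
    exact_mod_cast (card_le_card hsub).trans
      ((card_union_le _ _).trans (Nat.add_le_add_right (card_union_le _ _) _))
  linarith

theorem eventually_mul_rpow_le_rpow {x y : ℝ} (hxy : x < y) (K : ℝ) :
    ∀ᶠ L : ℝ in Filter.atTop, K * L ^ x ≤ L ^ y := by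
  filter_upwards [(tendsto_rpow_atTop (sub_pos.mpr hxy)).eventually_ge_atTop K,
    Filter.eventually_gt_atTop 0] with L h hL
  calc K * L ^ x ≤ L ^ (y - x) * L ^ x := by gcongr
    _ = L ^ y := by rw [← Real.rpow_add hL, sub_add_cancel]

theorem eventually_natCast_mul_rpow_le_rpow {x y : ℝ} (hxy : x < y) (K : ℝ) :
    ∀ᶠ M : ℕ in Filter.atTop, K * (M : ℝ) ^ x ≤ (M : ℝ) ^ y :=
  tendsto_natCast_atTop_atTop.eventually (eventually_mul_rpow_le_rpow hxy K)

theorem tendsto_natFloor_rpow_atTop {a : ℝ} (ha : 0 < a) :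
    Filter.Tendsto (fun M : ℕ => ⌊(M : ℝ) ^ a⌋₊) Filter.atTop Filter.atTop :=
  tendsto_nat_floor_atTop.comp ((tendsto_rpow_atTop ha).comp tendsto_natCast_atTop_atTop)

theorem eventually_half_rpow_le_natFloor {a : ℝ} (ha : 0 < a) :
    ∀ᶠ M : ℕ in Filter.atTop, (M : ℝ) ^ a / 2 ≤ ⌊(M : ℝ) ^ a⌋₊ := by
  filter_upwards [((tendsto_rpow_atTop ha).comp
    tendsto_natCast_atTop_atTop).eventually_ge_atTop 2] with M hM
  have h1 := Nat.lt_floor_add_one ((M : ℝ) ^ a)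
  have h2 : (2 : ℝ) ≤ (M : ℝ) ^ a := hM
  linarith

theorem eventually_exp_log_rpow_le {a η η' : ℝ} (ha : 0 < a) (hη : η' < η)
    (hη' : 0 ≤ 3 / 2 - η') :
    ∀ᶠ M : ℕ in Filter.atTop, Real.exp (Real.log M ^ (3 / 2 - η)) ≤
      Real.exp (Real.log (⌊(M : ℝ) ^ a⌋₊ : ℝ) ^ (3 / 2 - η')) := by
  have ev := tendsto_log_natCast_atTop.eventually (eventually_mul_rpow_le_rpow
    (show 3 / 2 - η < 3 / 2 - η' by linarith) ((a / 2) ^ (3 / 2 - η'))⁻¹)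
  filter_upwards [ev, eventually_half_rpow_le_natFloor ha,
    tendsto_log_natCast_atTop.eventually_ge_atTop (2 / a), Filter.eventually_ge_atTop 1]
    with M h1 h2 h3 h4
  have hM0 : (0 : ℝ) < M := by exact_mod_cast h4
  rw [div_le_iff₀ ha] at h3
  have hl0 : 0 < Real.log M := by nlinarith
  apply Real.exp_le_exp.mpr
  rw [inv_mul_le_iff₀ (by positivity), ← Real.mul_rpow (by positivity) hl0.le] at h1
  refine h1.trans (Real.rpow_le_rpow (by positivity) ?_ hη')
  have h5 := Real.log_le_log (by positivity) h2
  rw [Real.log_div (by positivity) (by norm_num), Real.log_rpow hM0] at h5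
  have := Real.log_two_lt_d9
  linarith

/-- Transfer of closeness from a scale `P` to a power of `m'`; the scale is chosen among two
candidates so as to avoid the exceptional zone for `n' - 2 * m'`. -/
theorem eventually_close_of_forall_scale {c η a b e u : ℝ} {X : ℕ → ℕ → ℕ → ℕ → ℝ}
    (hc : 0 < c) (hc2 : c ≤ 1 / 8) (hη : 0 < η) (hη1 : η < 1) (ha : 0 < a)
    (hab : (1 + c) * a < b) (hbe : (1 + c) * b < e) (he : e ≤ 1) (hu : u < (2 - 2 * c) * a)
    (hX : ∀ η' : ℝ, 0 < η' → η' < η → ∀ᶠ P : ℕ in Filter.atTop, ∀ n m n' m' : ℕ, m < m' →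
      2 * m' ≤ n' → n' < n → (n : ℝ) ≤ Real.exp (Real.log P ^ (3 / 2 - η')) →
      2000 * (P : ℝ) ^ (1 + c) ≤ m' → X n m n' m' ≤ (P : ℝ) ^ (2 - 2 * c) →
      ((n' : ℝ) - 2 * m' ≤ P / 1000 ∨ (P : ℝ) ^ (1 + c) ≤ (n' : ℝ) - 2 * m') →
      n.choose m = n'.choose m' →
      (m' : ℝ) - m < (P : ℝ) ^ (1 + c) ∧ (20 * m' ≤ n → (n : ℝ) - n' < (P : ℝ) ^ (1 + c))) :
    ∀ᶠ M : ℕ in Filter.atTop, ∀ n m n' : ℕ, 0 < m → m < M → 2 * M ≤ n' → n' < n →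
      (n : ℝ) ≤ Real.exp (Real.log M ^ (3 / 2 - η)) → X n m n' M ≤ (M : ℝ) ^ u →
      n.choose m = n'.choose M → (M : ℝ) - m ≤ (M : ℝ) ^ e ∧ (n : ℝ) - n' ≤ (M : ℝ) ^ e := by
  have hb : 0 < b := lt_trans (by positivity) hab
  have hab' : a < b := by nlinarith
  have hX' := hX (η / 2) (by linarith) (by linarith)
  filter_upwards [(tendsto_natFloor_rpow_atTop ha).eventually hX',
    (tendsto_natFloor_rpow_atTop hb).eventually hX',
    eventually_half_rpow_le_natFloor ha, eventually_half_rpow_le_natFloor hb,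
    eventually_exp_log_rpow_le ha (show η / 2 < η by linarith) (by linarith),
    eventually_exp_log_rpow_le hb (show η / 2 < η by linarith) (by linarith),
    eventually_natCast_mul_rpow_le_rpow hab 2000,
    eventually_natCast_mul_rpow_le_rpow (show (1 + c) * b < 1 by linarith) 2000,
    eventually_natCast_mul_rpow_le_rpow hu 4,
    eventually_mul_rpow_neg_le_log_rpow (show 0 < e - (1 + c) * b by linarith) 1 80,
    Filter.eventually_ge_atTop 20] with M hXa hXb hfa hfb hEa hEb hzone hsmall hMu hlog hM20
    n m n' hm0 hm hmn' hn hnE hXu h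
  have hM0 : (20 : ℝ) ≤ M := by exact_mod_cast hM20
  set Pa := ⌊(M : ℝ) ^ a⌋₊
  set Pb := ⌊(M : ℝ) ^ b⌋₊
  have hPa : (Pa : ℝ) ≤ (M : ℝ) ^ a := Nat.floor_le (by positivity)
  have hPb : (Pb : ℝ) ≤ (M : ℝ) ^ b := Nat.floor_le (by positivity)
  have hPac : (Pa : ℝ) ^ (1 + c) ≤ (M : ℝ) ^ ((1 + c) * a) := by
    rw [mul_comm, Real.rpow_mul (by positivity)]
    gcongr
  have hPbc : (Pb : ℝ) ^ (1 + c) ≤ (M : ℝ) ^ ((1 + c) * b) := by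
    rw [mul_comm, Real.rpow_mul (by positivity)]
    gcongr
  have habM : (M : ℝ) ^ ((1 + c) * a) ≤ (M : ℝ) ^ ((1 + c) * b) :=
    Real.rpow_le_rpow_of_exponent_le (by linarith) (by nlinarith)
  rw [Real.rpow_one] at hsmall
  have hXPa : X n m n' M ≤ (Pa : ℝ) ^ (2 - 2 * c) := by
    refine hXu.trans ?_
    have h1 : ((M : ℝ) ^ a / 2) ^ (2 - 2 * c) ≤ (Pa : ℝ) ^ (2 - 2 * c) :=
      Real.rpow_le_rpow (by positivity) hfa (by linarith)
    have h2 : (2 : ℝ) ^ (2 - 2 * c) ≤ 4 := by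
      calc (2 : ℝ) ^ (2 - 2 * c) ≤ (2 : ℝ) ^ (2 : ℝ) :=
            Real.rpow_le_rpow_of_exponent_le (by norm_num) (by linarith)
        _ = 4 := by norm_num
    rw [Real.div_rpow (by positivity) (by norm_num), ← Real.rpow_mul (by positivity),
      div_le_iff₀ (by positivity), mul_comm a] at h1
    have h3 : (0 : ℝ) ≤ (Pa : ℝ) ^ (2 - 2 * c) := by positivity
    nlinarith [mul_le_mul_of_nonneg_left h2 h3]
  have hPab : (Pa : ℝ) ≤ Pb := by
    exact_mod_cast Nat.floor_le_floor (Real.rpow_le_rpow_of_exponent_le (by linarith) hab'.le)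
  have hXPb : X n m n' M ≤ (Pb : ℝ) ^ (2 - 2 * c) :=
    hXPa.trans (Real.rpow_le_rpow (by positivity) hPab (by linarith))
  have hmain : (M : ℝ) - m ≤ (M : ℝ) ^ ((1 + c) * b) ∧
      (20 * M ≤ n → (n : ℝ) - n' ≤ (M : ℝ) ^ ((1 + c) * b)) := by
    rcases le_or_gt ((n' : ℝ) - 2 * M) ((Pb : ℝ) / 1000) with hr | hr
    · have := hXb n m n' M hm hmn' hn (hnE.trans hEb) (by linarith) hXPb (Or.inl hr) h
      exact ⟨this.1.le.trans hPbc, fun h20 => (this.2 h20).le.trans hPbc⟩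
    · have := hXa n m n' M hm hmn' hn (hnE.trans hEa) (by linarith) hXPa
        (Or.inr (by linarith)) h
      exact ⟨this.1.le.trans (hPac.trans habM),
        fun h20 => (this.2 h20).le.trans (hPac.trans habM)⟩
  have hMe : (M : ℝ) ^ ((1 + c) * b) ≤ (M : ℝ) ^ e :=
    Real.rpow_le_rpow_of_exponent_le (by linarith) hbe.le
  refine ⟨hmain.1.trans hMe, ?_⟩
  rcases le_or_gt (20 * M) n with h20 | h20
  · exact (hmain.2 h20).trans hMe
  have hbd := sub_mul_div_le_of_choose_eq hm0 hm hmn' hn h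
  have hnM : (n : ℝ) < 20 * M := by exact_mod_cast h20
  have hnn : (n' : ℝ) < n := by exact_mod_cast hn
  have hn0 : (0 : ℝ) < n := by
    have : (0 : ℝ) ≤ n' := Nat.cast_nonneg _
    linarith
  have hm2 : (M : ℝ) ≤ 2 * m := by linarith [hmain.1]
  have hlogM : 0 < Real.log M := Real.log_pos (by linarith)
  have hlogn : Real.log n ≤ 2 * Real.log M := by
    rw [← Real.log_rpow (by linarith), Real.rpow_two]
    exact Real.log_le_log hn0 (by nlinarith)
  have hquot : (1 : ℝ) / 40 ≤ m / n := by
    rw [div_le_div_iff₀ (by norm_num) hn0]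
    linarith
  have h1 : (n : ℝ) - n' ≤ 80 * (M : ℝ) ^ ((1 + c) * b) * Real.log M := by
    have q1 := mul_le_mul_of_nonneg_left hquot (sub_nonneg.mpr hnn.le)
    have q2 : ((M : ℝ) - m) * Real.log n ≤ (M : ℝ) ^ ((1 + c) * b) * (2 * Real.log M) :=
      mul_le_mul hmain.1 hlogn (Real.log_nonneg (by
        exact_mod_cast (show 1 ≤ n by omega))) (by positivity)
    linarith
  refine h1.trans ?_
  have h2 : (M : ℝ) ^ ((1 + c) * b) = (M : ℝ) ^ e * (M : ℝ) ^ (-(e - (1 + c) * b)) := by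
    rw [← Real.rpow_add (by linarith)]
    congr 1
    ring
  rw [Real.rpow_neg_one, ← one_div, le_div_iff₀ hlogM] at hlog
  rw [h2]
  calc _ = (M : ℝ) ^ e * (80 * (M : ℝ) ^ (-(e - (1 + c) * b)) * Real.log M) := by ring
    _ ≤ (M : ℝ) ^ e * 1 := by gcongr
    _ = _ := mul_one _

theorem eventually_close {η : ℝ} (hη : 0 < η) (hη1 : η < 1) : ∀ᶠ M : ℕ in Filter.atTop,
    ∀ n m n' : ℕ, 0 < m → m < M → 2 * M ≤ n' → n' < n →
      (n : ℝ) ≤ Real.exp (Real.log M ^ (3 / 2 - η)) → n.choose m = n'.choose M →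
      (M : ℝ) - m ≤ (M : ℝ) ^ (29 / 100 : ℝ) ∧ (n : ℝ) - n' ≤ (M : ℝ) ^ (29 / 100 : ℝ) := by
  have first := eventually_close_of_forall_scale (c := 1 / 100) (η := η) (a := 51 / 100)
    (b := 53 / 100) (e := 54 / 100) (u := 1) (X := fun _ _ _ m' => (m' : ℝ))
    (by norm_num) (by norm_num) hη hη1 (by norm_num) (by norm_num) (by norm_num) (by norm_num)
    (by norm_num) fun η' h0 h1 =>
      eventually_close_of_le_rpow (by norm_num) (by norm_num) h0 (by linarith)
  have second := eventually_close_of_forall_scale (c := 1 / 100) (η := η) (a := 28 / 100)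
    (b := 285 / 1000) (e := 29 / 100) (u := 55 / 100)
    (X := fun n m n' m' => ((n : ℝ) - n') + ((m' : ℝ) - m))
    (by norm_num) (by norm_num) hη hη1 (by norm_num) (by norm_num) (by norm_num) (by norm_num)
    (by norm_num) fun η' h0 h1 =>
      eventually_close_of_gap_le_rpow (by norm_num) (by norm_num) h0 (by linarith)
  filter_upwards [first, second, eventually_natCast_mul_rpow_le_rpow
    (show (54 / 100 : ℝ) < 55 / 100 by norm_num) 2] with M h1 h2 h3 n m n' hm0 hm hmn hn hnE h
  have g := h1 n m n' hm0 hm hmn hn hnE (by rw [Real.rpow_one]) h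
  exact h2 n m n' hm0 hm hmn hn hnE (by linarith [g.1, g.2]) h

theorem exists_forall_not_three_choose_eq {η : ℝ} (hη : 0 < η) (hη1 : η < 1) :
    ∃ M₀ : ℕ, ∀ n₁ n₂ n₃ m₁ m₂ m₃ : ℕ, M₀ ≤ m₁ → m₁ < m₂ → m₂ < m₃ → 2 * m₃ ≤ n₃ → n₃ < n₂ →
      n₂ < n₁ → (n₁ : ℝ) ≤ Real.exp (Real.log m₁ ^ (3 / 2 - η)) →
      (n₂ : ℝ) ≤ Real.exp (Real.log m₂ ^ (3 / 2 - η)) →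
      n₁.choose m₁ = n₂.choose m₂ → n₂.choose m₂ ≠ n₃.choose m₃ := by
  obtain ⟨M₀, hM₀⟩ := Filter.eventually_atTop.mp ((eventually_close hη hη1).and
    (eventually_natCast_mul_rpow_le_rpow (show (87 / 100 : ℝ) < 1 by norm_num) 100))
  refine ⟨M₀ + 1, fun n₁ n₂ n₃ m₁ m₂ m₃ hM hm12 hm23 hmn hn23 hn12 hE1 hE2 h12 h23 => ?_⟩
  have hE : ∀ m m' : ℕ, 0 < m → m < m' → Real.exp (Real.log m ^ (3 / 2 - η)) ≤
      Real.exp (Real.log m' ^ (3 / 2 - η)) := fun m m' h0 h => by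
    apply Real.exp_le_exp.mpr
    have h1 : (1 : ℝ) ≤ m := by exact_mod_cast h0
    refine Real.rpow_le_rpow (Real.log_nonneg h1) ?_ (by linarith)
    exact Real.log_le_log (by linarith) (by exact_mod_cast h.le)
  have c1 := (hM₀ m₂ (by omega)).1 n₁ m₁ n₂ (by omega) hm12 (by omega) hn12
    (hE1.trans (hE _ _ (by omega) hm12)) h12
  have c2 := (hM₀ m₃ (by omega)).1 n₂ m₂ n₃ (by omega) hm23 hmn hn23
    (hE2.trans (hE _ _ (by omega) hm23)) h23
  have hbig := (hM₀ m₃ (by omega)).2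
  have hm3 : (1 : ℝ) ≤ m₃ := by exact_mod_cast (by omega : 1 ≤ m₃)
  have hL23 : (m₂ : ℝ) ^ (29 / 100 : ℝ) ≤ (m₃ : ℝ) ^ (29 / 100 : ℝ) := by gcongr
  have hL1 : 1 ≤ (m₃ : ℝ) ^ (29 / 100 : ℝ) := Real.one_le_rpow hm3 (by norm_num)
  have hL3 : (m₃ : ℝ) ^ (87 / 100 : ℝ) = ((m₃ : ℝ) ^ (29 / 100 : ℝ)) ^ 3 := by
    rw [← Real.rpow_mul_natCast (by positivity)]
    norm_num
  rw [Real.rpow_one, hL3] at hbig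
  set L := (m₃ : ℝ) ^ (29 / 100 : ℝ)
  have hLL : L ≤ L ^ 3 := le_self_pow₀ hL1 (by norm_num)
  have := le_of_three_choose_eq (L := L) (by omega) hm12 hm23 hmn hn23 hn12 h12 h23
    (by linarith [c1.1, c2.1]) (by linarith [c1.1]) c2.1 (by linarith [c1.2]) c2.2
  linarith [c1.1, c2.1]

theorem choose_lt_choose_of_lt_left {n n' m : ℕ} (hm : 0 < m) (hmn : m ≤ n) (h : n < n') :
    n.choose m < n'.choose m := by
  obtain ⟨k, rfl⟩ := Nat.exists_eq_succ_of_ne_zero hm.ne'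
  refine lt_of_lt_of_le ?_ (Nat.choose_le_choose (k + 1) (Nat.succ_le_of_lt h))
  rw [Nat.succ_eq_add_one, Nat.succ_eq_add_one, Nat.choose_succ_succ' n k]
  exact Nat.lt_add_of_pos_left (Nat.choose_pos (by omega))

theorem choose_lt_choose_of_two_mul_le {n m m' : ℕ} (h : m < m') (hn : 2 * m' ≤ n) :
    n.choose m < n.choose m' := by
  have step : ∀ k, 2 * (k + 1) ≤ n → n.choose k < n.choose (k + 1) := fun k hk => by
    have h1 := Nat.choose_succ_right_eq n k
    have h2 := Nat.choose_pos (show k ≤ n by omega)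
    refine lt_of_mul_lt_mul_right (a := k + 1) ?_ (Nat.zero_le _)
    rw [h1]
    exact Nat.mul_lt_mul_of_pos_left (by omega) h2
  induction m', h using Nat.le_induction with
  | base => exact step m hn
  | succ k hk ih => exact (ih (by omega)).trans (step k hn)

theorem lt_of_choose_eq_of_lt {n m n' m' : ℕ} (hm : m < m') (hn : 2 * m' ≤ n')
    (h : n.choose m = n'.choose m') : n' < n := by
  by_contra! hcon
  exact absurd h ((Nat.choose_le_choose m hcon).trans_lt
    (choose_lt_choose_of_two_mul_le hm hn)).ne

theorem encard_le_two_of_forall_not_lt_lt {α : Type*} {s : Set α} {f : α → ℕ}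
    (hf : Set.InjOn f s)
    (H : ∀ x ∈ s, ∀ y ∈ s, ∀ z ∈ s, f x < f y → f y < f z → False) : s.encard ≤ 2 := by
  by_contra! hcon
  obtain ⟨u, hus, hu⟩ := Set.exists_subset_encard_eq (s := s) (k := 3) (Order.add_one_le_of_lt hcon)
  obtain ⟨x, y, z, hxy, hxz, hyz, rfl⟩ := Set.encard_eq_three.mp hu
  have hx : x ∈ s := hus (by simp)
  have hy : y ∈ s := hus (by simp)
  have hz : z ∈ s := hus (by simp)
  rcases lt_or_gt_of_ne (hf.ne hx hy hxy) with h1 | h1 <;>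
    rcases lt_or_gt_of_ne (hf.ne hx hz hxz) with h2 | h2 <;>
    rcases lt_or_gt_of_ne (hf.ne hy hz hyz) with h3 | h3
  · exact H x hx y hy z hz h1 h3
  · exact H x hx z hz y hy h2 h3
  · exact H z hz x hx y hy h2 h1
  · exact H z hz x hx y hy h2 h1
  · exact H y hy x hx z hz h1 h2
  · exact H y hy x hx z hz h1 h2
  · exact H y hy z hz x hx h3 h2
  · exact H z hz y hy x hx h3 h1

/-- On the left half of Pascal's triangle, and away from its edge, large integers appear at
most twice. -/
theorem exists_encard_left_le_two {η : ℝ} (hη : 0 < η) (hη1 : η < 1) :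
    ∃ M₀ : ℕ, ∀ t : ℕ, {p : ℕ × ℕ | M₀ ≤ p.2 ∧ 0 < p.2 ∧ 2 * p.2 ≤ p.1 ∧
      (p.1 : ℝ) ≤ Real.exp (Real.log p.2 ^ (3 / 2 - η)) ∧ p.1.choose p.2 = t}.encard ≤ 2 := by
  obtain ⟨M₀, hM₀⟩ := exists_forall_not_three_choose_eq hη hη1
  refine ⟨M₀, fun t => encard_le_two_of_forall_not_lt_lt (f := Prod.snd) ?_ ?_⟩
  · rintro ⟨n, m⟩ ⟨-, hm0, hmn, -, ht⟩ ⟨n', m'⟩ ⟨-, -, hmn', -, ht'⟩ h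
    simp only at h hm0 hmn hmn' ht ht'
    subst h
    rcases lt_trichotomy n n' with hlt | rfl | hlt
    · exact absurd (ht.trans ht'.symm) (choose_lt_choose_of_lt_left hm0 (by omega) hlt).ne
    · rfl
    · exact absurd (ht'.trans ht.symm) (choose_lt_choose_of_lt_left hm0 (by omega) hlt).ne
  · rintro ⟨n₁, m₁⟩ ⟨h1, -, -, hE1, t1⟩ ⟨n₂, m₂⟩ ⟨-, -, h2, hE2, t2⟩ ⟨n₃, m₃⟩
      ⟨-, -, h3, -, t3⟩ h12 h23
    simp only at h1 h2 h3 hE1 hE2 t1 t2 t3 h12 h23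
    exact hM₀ n₁ n₂ n₃ m₁ m₂ m₃ h1 h12 h23 h3
      (lt_of_choose_eq_of_lt h23 h3 (t2.trans t3.symm))
      (lt_of_choose_eq_of_lt h12 h2 (t1.trans t2.symm)) hE1 hE2 (t1.trans t2.symm)
      (t2.trans t3.symm)

theorem encard_le_four_of_forall_min_mem {s u : Set (ℕ × ℕ)} (hu : u.encard ≤ 2)
    (h : ∀ p ∈ s, p.2 ≤ p.1 ∧ (p.1, min p.2 (p.1 - p.2)) ∈ u) : s.encard ≤ 4 := by
  have hsub : s ⊆ u ∪ (fun p : ℕ × ℕ => (p.1, p.1 - p.2)) '' u := by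
    rintro ⟨n, m⟩ hp
    obtain ⟨hmn, hmem⟩ := h _ hp
    simp only at hmn hmem
    rcases le_total m (n - m) with hle | hle
    · rw [min_eq_left hle] at hmem
      exact Or.inl hmem
    · rw [min_eq_right hle] at hmem
      exact Or.inr ⟨_, hmem, by simp only [Nat.sub_sub_self hmn]⟩
  calc s.encard ≤ (u ∪ (fun p : ℕ × ℕ => (p.1, p.1 - p.2)) '' u).encard := Set.encard_le_encard hsub
    _ ≤ u.encard + ((fun p : ℕ × ℕ => (p.1, p.1 - p.2)) '' u).encard := Set.encard_union_le _ _
    _ ≤ 2 + 2 := add_le_add hu ((Set.encard_image_le _ _).trans hu)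
    _ = 4 := by norm_num

/-- For every `0 < ε < 1` there is `t₀` such that for all integers `t ≥ t₀`, the number
of pairs `(n, m)` with `1 ≤ m < n`, `exp((log n)^(2/3+ε)) ≤ m ≤ n - exp((log n)^(2/3+ε))`
and `C(n,m) = t` is at most `4`. -/
theorem stmt_1 (ε : ℝ) (hε0 : 0 < ε) (hε1 : ε < 1) :
    ∃ t₀ : ℕ, ∀ t : ℕ, t₀ ≤ t →
      {p : ℕ × ℕ | 1 ≤ p.2 ∧ p.2 < p.1 ∧
        Real.exp ((Real.log p.1) ^ ((2 : ℝ) / 3 + ε)) ≤ (p.2 : ℝ) ∧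
        (p.2 : ℝ) ≤ (p.1 : ℝ) - Real.exp ((Real.log p.1) ^ ((2 : ℝ) / 3 + ε)) ∧
        Nat.choose p.1 p.2 = t}.encard ≤ 4 := by
  have hθ : (2 : ℝ) / 3 < 2 / 3 + ε := by linarith
  have hθ0 : (0 : ℝ) < 2 / 3 + ε := by linarith
  set θ := (2 : ℝ) / 3 + ε
  have hinv : θ⁻¹ < 3 / 2 := by
    rw [inv_lt_comm₀ hθ0 (by norm_num)]
    linarith
  have hinv' : (1 : ℝ) / 2 < θ⁻¹ := by
    rw [lt_inv_comm₀ (by norm_num) hθ0]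
    simp only [θ]
    linarith
  obtain ⟨M₀, hM₀⟩ := exists_encard_left_le_two (show 0 < 3 / 2 - θ⁻¹ by linarith)
    (show 3 / 2 - θ⁻¹ < 1 by linarith)
  obtain ⟨N, hN⟩ := Filter.eventually_atTop.mp ((Real.tendsto_exp_atTop.comp
    ((tendsto_rpow_atTop hθ0).comp tendsto_log_natCast_atTop)).eventually_ge_atTop (M₀ : ℝ))
  refine ⟨2 ^ N, fun t ht => encard_le_four_of_forall_min_mem (hM₀ t) ?_⟩
  rintro ⟨n, m⟩ ⟨hm1, hmn, hlow, hupp, hc⟩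
  simp only at hm1 hmn hlow hupp hc
  refine ⟨hmn.le, ?_⟩
  simp only [Set.mem_ofPred_eq]
  set k := min m (n - m) with hk
  have hNn : N ≤ n := by
    rw [← Nat.pow_le_pow_iff_right (a := 2) (by norm_num)]
    exact ht.trans (hc ▸ Nat.choose_le_two_pow n m)
  have hkE : Real.exp (Real.log n ^ θ) ≤ k := by
    rw [hk, Nat.cast_min, Nat.cast_sub hmn.le]
    exact le_min hlow (by linarith)
  have hn1 : (1 : ℝ) ≤ n := by exact_mod_cast (by omega : 1 ≤ n)
  have hk0 : 0 < k := by omega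
  refine ⟨?_, hk0, by omega, ?_, ?_⟩
  · exact_mod_cast (hN n hNn).trans hkE
  · have h1 := Real.log_le_log (Real.exp_pos _) hkE
    rw [Real.log_exp] at h1
    have hl := Real.log_nonneg hn1
    rw [sub_sub_cancel, ← Real.log_le_iff_le_exp (by linarith)]
    calc Real.log n = (Real.log n ^ θ) ^ θ⁻¹ := (Real.rpow_rpow_inv hl hθ0.ne').symm
      _ ≤ Real.log k ^ θ⁻¹ := Real.rpow_le_rpow (by positivity) h1 (by linarith)
  · rcases min_choice m (n - m) with h | h
    · rw [hk, h, hc]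
    · rw [hk, h, Nat.choose_symm hmn.le, hc]
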